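/- Let D ⊂ ℂⁿ be a bounded B-regular domain and φ ∈ N(D, fb φ) with finite total residual Monge–Ampère mass (i.e. (dd^c φ)ⁿ(L'(φ)) < ∞), and suppose g_φ is idempotent (for instance, fb φ ∈ PSH_s(D)). Then g_φ = P(g_φ^o, g_φ^b). -/

import Mathlib

open MeasureTheory Filter Topology
open scoped ENNReal

noncomputable section

/-- Complex Euclidean space `ℂⁿ`. -/
abbrev Cn (n : ℕ) : Type := Fin n → ℂ

section Defs

variable {E : Type*} [NormedAddCommGroup E] [NormedSpace ℂ E]

/-- `u` is plurisubharmonic on `Ω`: it is upper semicontinuous on `Ω` (with values in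
`EReal`) and on every closed disc of every complex line contained in `Ω` it satisfies the
maximum principle with respect to real parts of complex polynomials (an equivalent form of
the sub-mean value property on complex lines). -/
def PlurisubharmonicOn (u : E → EReal) (Ω : Set E) : Prop :=
  UpperSemicontinuousOn u Ω ∧
  ∀ a b : E, ∀ r : ℝ, 0 < r →
    (∀ ζ : ℂ, ‖ζ‖ ≤ r → a + ζ • b ∈ Ω) →
    ∀ p : Polynomial ℂ,
      (∀ ζ : ℂ, ‖ζ‖ = r → u (a + ζ • b) ≤ ((Polynomial.eval ζ p).re : EReal)) →
      ∀ ζ : ℂ, ‖ζ‖ ≤ r → u (a + ζ • b) ≤ ((Polynomial.eval ζ p).re : EReal)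

/-- Negative plurisubharmonic functions on `Ω` : the class `PSH⁻(Ω)`. -/
def PSHNeg (u : E → EReal) (Ω : Set E) : Prop :=
  PlurisubharmonicOn u Ω ∧ ∀ z ∈ Ω, u z ≤ 0

/-- A set is pluripolar if it is contained in `{u = -∞}` for some psh `u ≢ -∞`
defined on a neighborhood of the set. -/
def Pluripolar (S : Set E) : Prop :=
  ∃ Ω : Set E, IsOpen Ω ∧ S ⊆ Ω ∧
    ∃ u : E → EReal, PlurisubharmonicOn u Ω ∧ (∃ z ∈ Ω, u z ≠ ⊥) ∧ ∀ z ∈ S, u z = ⊥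

/-- Upper semicontinuous regularization (relative to `Ω`) of a function. -/
def uscReg (f : E → EReal) (Ω : Set E) : E → EReal :=
  fun z => Filter.limsup f (nhdsWithin z Ω)

/-- The psh envelope `P(h)` of a function `h` on `Ω`: the usc regularization of the
supremum of all psh minorants of `h` on `Ω`. -/
def PEnv (h : E → EReal) (Ω : Set E) : E → EReal :=
  uscReg (fun z =>
    ⨆ v ∈ {v : E → EReal | PlurisubharmonicOn v Ω ∧ ∀ x ∈ Ω, v x ≤ h x}, v z) Ω

/-- The rooftop envelope `P(u,v) = P(min{u,v})`. -/
def Rooftop (u v : E → EReal) (Ω : Set E) : E → EReal :=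
  PEnv (fun z => min (u z) (v z)) Ω

/-- The Green–Poisson residual function `g_φ`: usc regularization of the supremum of all
negative psh `w` with `w ≤ φ + C_w` on `Ω` for some constant `C_w`. -/
def gp (φ : E → EReal) (Ω : Set E) : E → EReal :=
  uscReg (fun z =>
    ⨆ w ∈ {w : E → EReal | PSHNeg w Ω ∧ ∃ C : ℝ, ∀ x ∈ Ω, w x ≤ φ x + (C : EReal)}, w z) Ω

/-- The residual Green function `g_φ^o`: usc regularization of the supremum of all
negative psh `w` with `w ≤ φ + O(1)` locally in `Ω`. -/
def gpO (φ : E → EReal) (Ω : Set E) : E → EReal :=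
  uscReg (fun z =>
    ⨆ w ∈ {w : E → EReal | PSHNeg w Ω ∧
      ∀ a ∈ Ω, ∃ U ∈ nhds a, ∃ C : ℝ, ∀ x ∈ U ∩ Ω, w x ≤ φ x + (C : EReal)}, w z) Ω

/-- The residual Poisson function `g_φ^b`: usc regularization of the supremum of all
negative psh `w` with `w ≤ φ + O(1)` in a neighborhood of `∂Ω`. -/
def gpB (φ : E → EReal) (Ω : Set E) : E → EReal :=
  uscReg (fun z =>
    ⨆ w ∈ {w : E → EReal | PSHNeg w Ω ∧
      ∃ U : Set E, IsOpen U ∧ frontier Ω ⊆ U ∧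
        ∃ C : ℝ, ∀ x ∈ U ∩ Ω, w x ≤ φ x + (C : EReal)}, w z) Ω

/-- The asymptotic rooftop `P[φ](ψ) = lim*_{C→∞} P(ψ, φ+C)`. -/
def asympRooftop (ψ φ : E → EReal) (Ω : Set E) : E → EReal :=
  uscReg (fun z => ⨆ C : ℝ, Rooftop ψ (fun x => φ x + (C : EReal)) Ω z) Ω

/-- The unbounded locus `L(φ)` of `φ` in `Ω`: points of `Ω` having no neighborhood on
which `φ` is bounded. -/
def Lset (φ : E → EReal) (Ω : Set E) : Set E :=
  {a | a ∈ Ω ∧ ∀ U ∈ nhds a, ¬ ∃ M : ℝ, ∀ x ∈ U ∩ Ω, -(M : EReal) ≤ φ x ∧ φ x ≤ (M : EReal)}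

/-- The boundary unbounded locus `BL(φ)`: boundary points near which `φ` is unbounded. -/
def BLset (φ : E → EReal) (Ω : Set E) : Set E :=
  {b | b ∈ frontier Ω ∧
    ∀ U ∈ nhds b, ¬ ∃ M : ℝ, ∀ x ∈ U ∩ Ω, -(M : EReal) ≤ φ x ∧ φ x ≤ (M : EReal)}

/-- `PSH_s⁻(Ω)` : negative psh functions with small unbounded locus (both `L(φ)` and
`BL(φ)` pluripolar). -/
def PSHs (φ : E → EReal) (Ω : Set E) : Prop :=
  PSHNeg φ Ω ∧ Pluripolar (Lset φ Ω) ∧ Pluripolar (BLset φ Ω)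

/-- `u` is a maximal psh function on the set `U`: it is psh there and for every `G ⋐ U`
and every psh `v` on a neighborhood of `closure G` with `v ≤ u` on `∂G`, one has `v ≤ u`
on `G`. -/
def MaximalOn (u : E → EReal) (U : Set E) : Prop :=
  PlurisubharmonicOn u U ∧
  ∀ G : Set E, IsOpen G → IsCompact (closure G) → closure G ⊆ U →
    ∀ W : Set E, IsOpen W → closure G ⊆ W →
      ∀ v : E → EReal, PlurisubharmonicOn v W →
        (∀ z ∈ frontier G, v z ≤ u z) → ∀ z ∈ G, v z ≤ u z

/-- B-regularity of a domain: every continuous function on the boundary is the boundary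
value of a psh function continuous up to the closure. -/
def BRegular (Ω : Set E) : Prop :=
  ∀ η : E → ℝ, ContinuousOn η (frontier Ω) →
    ∃ u : E → ℝ, PlurisubharmonicOn (fun z => ((u z : ℝ) : EReal)) Ω ∧
      ContinuousOn u (closure Ω) ∧ ∀ ζ ∈ frontier Ω, u ζ = η ζ

/-- Pseudoconvexity: existence of a continuous psh exhaustion function. -/
def Pseudoconvex (Ω : Set E) : Prop :=
  IsOpen Ω ∧ ∃ u : E → ℝ, ContinuousOn u Ω ∧
    PlurisubharmonicOn (fun z => ((u z : ℝ) : EReal)) Ω ∧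
    ∀ c : ℝ, IsCompact {z | z ∈ Ω ∧ u z ≤ c}

/-- Hyperconvexity: existence of a negative psh exhaustion function. -/
def Hyperconvex (Ω : Set E) : Prop :=
  ∃ ρ : E → EReal, PlurisubharmonicOn ρ Ω ∧ (∀ z ∈ Ω, ρ z < 0) ∧
    ∀ c : ℝ, c < 0 →
      IsCompact (closure {z | z ∈ Ω ∧ ρ z ≤ (c : EReal)}) ∧
      closure {z | z ∈ Ω ∧ ρ z ≤ (c : EReal)} ⊆ Ω

/-- `H` is the least maximal psh majorant (`fb φ`) of `φ` on `Ω` (within `PSH⁻(Ω)`). -/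
def IsLeastMaxMajorant (φ H : E → EReal) (Ω : Set E) : Prop :=
  MaximalOn H Ω ∧ (∀ z ∈ Ω, H z ≤ 0) ∧ (∀ z ∈ Ω, φ z ≤ H z) ∧
  ∀ H' : E → EReal, MaximalOn H' Ω → (∀ z ∈ Ω, H' z ≤ 0) → (∀ z ∈ Ω, φ z ≤ H' z) →
    ∀ z ∈ Ω, H z ≤ H' z

/-- Extended-real logarithm, with `log 0 = -∞`. -/
def elog (x : ℝ) : EReal := if x ≤ 0 then (⊥ : EReal) else ((Real.log x : ℝ) : EReal)

end Defs

section MA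

/-- Real second directional derivative `D²u(z)(v,w)`. -/
def reB (n : ℕ) (u : Cn n → ℝ) (z v w : Cn n) : ℝ :=
  fderiv ℝ (fun x => fderiv ℝ u x w) z v

/-- Entry `∂²u/∂z_j∂z̄_k` of the complex Hessian of a (C²) function `u`. -/
def cHessEntry (n : ℕ) (u : Cn n → ℝ) (z : Cn n) (j k : Fin n) : ℂ :=
  (1 / 4 : ℂ) *
    ( ((reB n u z ((Pi.single j (1 : ℂ) : Cn n)) ((Pi.single k (1 : ℂ) : Cn n)) : ℝ) : ℂ)
    + ((reB n u z ((Pi.single j Complex.I : Cn n)) ((Pi.single k Complex.I : Cn n)) : ℝ) : ℂ)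
    + Complex.I *
      ( ((reB n u z ((Pi.single j (1 : ℂ) : Cn n)) ((Pi.single k Complex.I : Cn n)) : ℝ) : ℂ)
      - ((reB n u z ((Pi.single j Complex.I : Cn n)) ((Pi.single k (1 : ℂ) : Cn n)) : ℝ) : ℂ)))

/-- Density of the Monge–Ampère measure `(dd^c u)ⁿ` of a smooth function `u`. -/
def maDensity (n : ℕ) (u : Cn n → ℝ) (z : Cn n) : ℝ :=
  (4 : ℝ) ^ n * (n.factorial : ℝ) * (Matrix.det (Matrix.of fun j k => cHessEntry n u z j k)).re

/-- `μ` is the Bedford–Taylor Monge–Ampère measure `(dd^c u)ⁿ` of `u` on `Ω`: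
it is locally finite on `Ω`, carried by `Ω`, and for every open `U ⊆ Ω` and every
decreasing sequence of smooth psh functions on `U` converging pointwise to `u`, the
corresponding smooth Monge–Ampère measures converge to `μ` against test functions
supported in `U`. -/
def IsMAMeasure (n : ℕ) (u : Cn n → EReal) (Ω : Set (Cn n)) (μ : Measure (Cn n)) : Prop :=
  μ Ωᶜ = 0 ∧ (∀ K : Set (Cn n), IsCompact K → K ⊆ Ω → μ K ≠ ⊤) ∧
  ∀ U : Set (Cn n), IsOpen U → U ⊆ Ω →
    ∀ v : ℕ → Cn n → ℝ,
      (∀ k, ContDiffOn ℝ (⊤ : ℕ∞) (v k) U) →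
      (∀ k, PlurisubharmonicOn (fun z => ((v k z : ℝ) : EReal)) U) →
      (∀ k, ∀ z ∈ U, v (k + 1) z ≤ v k z) →
      (∀ z ∈ U, (⨅ k, ((v k z : ℝ) : EReal)) = u z) →
      ∀ f : Cn n → ℝ, Continuous f → HasCompactSupport f → tsupport f ⊆ U →
        Filter.Tendsto (fun k => ∫ z, f z * maDensity n (v k) z) Filter.atTop
          (nhds (∫ z, f z ∂μ))

/-- The Cegrell class `E₀(Ω)`: bounded negative psh functions with zero boundary values
and finite total Monge–Ampère mass. -/
def ClassE0 (n : ℕ) (Ω : Set (Cn n)) (φ : Cn n → EReal) : Prop :=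
  PSHNeg φ Ω ∧ (∃ M : ℝ, ∀ z ∈ Ω, -(M : EReal) ≤ φ z) ∧
  (∀ ζ ∈ frontier Ω, Filter.Tendsto φ (nhdsWithin ζ Ω) (nhds (0 : EReal))) ∧
  ∃ μ : Measure (Cn n), IsMAMeasure n φ Ω μ ∧ μ Ω ≠ ⊤

/-- The Cegrell class `E(Ω)`: negative psh functions that are locally decreasing limits
of functions of `E₀(Ω)` with uniformly bounded total Monge–Ampère masses. -/
def ClassE (n : ℕ) (Ω : Set (Cn n)) (φ : Cn n → EReal) : Prop :=
  PSHNeg φ Ω ∧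
  ∀ z ∈ Ω, ∃ U : Set (Cn n), IsOpen U ∧ z ∈ U ∧ U ⊆ Ω ∧
    ∃ h : ℕ → Cn n → EReal, ∃ M : ℝ≥0∞, M ≠ ⊤ ∧
      (∀ j, ClassE0 n Ω (h j)) ∧
      (∀ j, ∀ x ∈ Ω, h (j + 1) x ≤ h j x) ∧
      (∀ x ∈ U, (⨅ j, h j x) = φ x) ∧
      (∀ j, ∀ μ : Measure (Cn n), IsMAMeasure n (h j) Ω μ → μ Ω ≤ M)

/-- The Cegrell class `N(Ω) = {w ∈ E(Ω) : fb w = 0}`. -/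
def ClassN (n : ℕ) (Ω : Set (Cn n)) : Set (Cn n → EReal) :=
  {w | ClassE n Ω w ∧ IsLeastMaxMajorant w 0 Ω}

/-- The Cegrell class `F(Ω) = {w ∈ E(Ω) : ∫ (dd^c w)ⁿ < ∞ and fb w = 0}`. -/
def ClassF (n : ℕ) (Ω : Set (Cn n)) : Set (Cn n → EReal) :=
  {w | ClassE n Ω w ∧ IsLeastMaxMajorant w 0 Ω ∧
    ∀ μ : Measure (Cn n), IsMAMeasure n w Ω μ → μ Ω ≠ ⊤}

/-- Membership `φ ∈ K(Ω, H)`: `φ ∈ E(Ω)` and `H + w ≤ φ ≤ H` for some `w ∈ K`. -/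
def InClassRel (n : ℕ) (Ω : Set (Cn n)) (K : Set (Cn n → EReal)) (H φ : Cn n → EReal) : Prop :=
  ClassE n Ω φ ∧ ∃ w ∈ K, ∀ z ∈ Ω, H z + w z ≤ φ z ∧ φ z ≤ H z

/-- The annulus `A = {1 < |ζ| < e}`. -/
def annA : Set ℂ := {ζ : ℂ | 1 < ‖ζ‖ ∧ ‖ζ‖ < Real.exp 1}

/-- The class `W(u₀,u₁)` of subgeodesics: negative psh functions on `Ω × A` with boundary
limsups dominated by `u₀` on `|ζ| = 1` and by `u₁` on `|ζ| = e`. -/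
def geodClass (n : ℕ) (Ω : Set (Cn n)) (u0 u1 : Cn n → EReal) : Set (Cn n × ℂ → EReal) :=
  {u | PSHNeg u (Ω ×ˢ annA) ∧
    (∀ z ∈ Ω, Filter.limsup (fun ζ : ℂ => u (z, ζ))
        ((nhds (1 : ℝ)).comap (fun ζ : ℂ => ‖ζ‖) ⊓ Filter.principal annA) ≤ u0 z) ∧
    (∀ z ∈ Ω, Filter.limsup (fun ζ : ℂ => u (z, ζ))
        ((nhds (Real.exp 1)).comap (fun ζ : ℂ => ‖ζ‖) ⊓ Filter.principal annA) ≤ u1 z)}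

/-- The geodesic `u_t(z) = P_W(z, e^t)`, the Perron envelope of the class `W(u₀,u₁)`. -/
def geodesic (n : ℕ) (Ω : Set (Cn n)) (u0 u1 : Cn n → EReal) (t : ℝ) (z : Cn n) : EReal :=
  ⨆ u ∈ geodClass n Ω u0 u1, u (z, ((Real.exp t : ℝ) : ℂ))

/-- The Monge–Ampère capacity `Cap(S) = sup {∫_S (dd^c u)ⁿ : u psh, -1 ≤ u ≤ 0}`. -/
def MACap (n : ℕ) (Ω : Set (Cn n)) (S : Set (Cn n)) : ℝ≥0∞ :=
  ⨆ u ∈ {u : Cn n → EReal | PlurisubharmonicOn u Ω ∧ ∀ z ∈ Ω, -1 ≤ u z ∧ u z ≤ 0},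
    ⨆ μ ∈ {μ : Measure (Cn n) | IsMAMeasure n u Ω μ}, μ S

/-- Convergence `u t → g` in capacity as `t → t₀` within `(0,1)`. -/
def TendstoInCap (n : ℕ) (Ω : Set (Cn n)) (u : ℝ → Cn n → EReal) (g : Cn n → EReal)
    (t0 : ℝ) : Prop :=
  ∀ ε : ℝ, 0 < ε → ∀ K : Set (Cn n), IsCompact K → K ⊆ Ω →
    Filter.Tendsto
      (fun t => MACap n Ω
        {z | z ∈ K ∧ ¬ (u t z ≤ g z + (ε : EReal) ∧ g z ≤ u t z + (ε : EReal))})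
      (nhdsWithin t0 (Set.Ioo (0 : ℝ) 1)) (nhds (0 : ℝ≥0∞))

/-- Convergence `u t → g` in `L¹_loc(Ω)` as `t → t₀` within `(0,1)`. -/
def TendstoL1loc (n : ℕ) (Ω : Set (Cn n)) (u : ℝ → Cn n → EReal) (g : Cn n → EReal)
    (t0 : ℝ) : Prop :=
  ∀ K : Set (Cn n), IsCompact K → K ⊆ Ω →
    Filter.Tendsto (fun t => ∫⁻ z in K, ENNReal.ofReal |(u t z).toReal - (g z).toReal|)
      (nhdsWithin t0 (Set.Ioo (0 : ℝ) 1)) (nhds (0 : ℝ≥0∞))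

end MA

/-- The unit circle, parametrised by `ℝ/ℤ`. -/
def circ (x : UnitAddCircle) : ℂ := fourier 1 x

/-- The normalized Haar measure of the circle. -/
def nuc : Measure UnitAddCircle := AddCircle.haarAddCircle

instance : IsProbabilityMeasure nuc := inferInstanceAs (IsProbabilityMeasure AddCircle.haarAddCircle)

lemma continuous_circ : Continuous circ := (fourier (T := 1) 1).continuous

lemma norm_circ (x : UnitAddCircle) : ‖circ x‖ = 1 := by
  rw [circ, fourier_apply]; exact Circle.norm_coe _

lemma circ_pow (x : UnitAddCircle) (m : ℕ) : circ x ^ m = fourier (m : ℤ) x := by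
  induction m with
  | zero => simp
  | succ m ih => rw [pow_succ, ih, circ, Nat.cast_succ, fourier_add]

lemma exists_circ {ζ : ℂ} (h : ‖ζ‖ = 1) : ∃ x, circ x = ζ := by
  obtain ⟨x, hx⟩ := (AddCircle.homeomorphCircle' ).surjective (⟨ζ, by simp [Submonoid.unitSphere, h]⟩ : Circle)
  obtain ⟨θ, rfl⟩ := QuotientAddGroup.mk_surjective x
  refine ⟨((θ / (2 * Real.pi) : ℝ) : UnitAddCircle), ?_⟩
  have h2 := congrArg (fun z : Circle => (z : ℂ)) hx
  simp only [] at h2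
  rw [← h2, circ, fourier_coe_apply]
  have : AddCircle.homeomorphCircle' ((θ : ℝ) : AddCircle (2 * Real.pi)) = Circle.exp θ := by
    rfl
  erw [this]
  rw [Circle.coe_exp]
  congr 1
  have := Real.pi_ne_zero
  push_cast
  field_simp

lemma integral_fourier (n : ℤ) : ∫ x, fourier n x ∂nuc = if n = 0 then (1 : ℂ) else 0 := by
  have h := congrFun (fourierCoeff_fourier (T := 1) n) 0
  simp only [fourierCoeff, neg_zero, fourier_zero, one_smul] at h
  rw [nuc, h, Pi.single_apply]
  simp [eq_comm]

lemma integrable_cont {F : Type*} [NormedAddCommGroup F] {f : UnitAddCircle → F} (hf : Continuous f) :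
    Integrable f nuc :=
  hf.integrable_of_hasCompactSupport (HasCompactSupport.of_compactSpace f)

lemma integral_poly_circ (p : Polynomial ℂ) : ∫ x, p.eval (circ x) ∂nuc = p.eval 0 := by
  simp_rw [Polynomial.eval_eq_sum_range, circ_pow]
  rw [integral_finsetSum _ fun i _ => integrable_cont (by fun_prop)]
  simp_rw [integral_const_mul, integral_fourier]
  refine Finset.sum_congr rfl fun i _ => ?_
  by_cases h : i = 0 <;> simp [h]

lemma integral_re_poly_circ (p : Polynomial ℂ) :
    ∫ x, (p.eval (circ x)).re ∂nuc = (p.eval 0).re := by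
  rw [← integral_poly_circ p]
  have : Continuous fun x => p.eval (circ x) := p.continuous.comp continuous_circ
  exact (integral_re (𝕜 := ℂ) (integrable_cont this))

lemma exists_poly_of_span {P : C(UnitAddCircle, ℂ)}
    (hP : P ∈ Submodule.span ℂ (Set.range (fourier (T := 1)))) :
    ∀ c : ℂ, ∃ p : Polynomial ℂ, ∀ x, (p.eval (circ x)).re = (c * P x).re := by
  induction hP using Submodule.span_induction with
  | mem f hf =>
    obtain ⟨n, rfl⟩ := hf
    intro c
    obtain ⟨m, rfl | rfl⟩ := n.eq_nat_or_neg
    · exact ⟨Polynomial.C c * Polynomial.X ^ m, fun x => by simp [circ_pow]⟩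
    · refine ⟨Polynomial.C (starRingEnd ℂ c) * Polynomial.X ^ m, fun x => ?_⟩
      rw [fourier_neg, ← Complex.conj_re]
      simp [circ_pow]
  | zero => exact fun c => ⟨0, by simp⟩
  | add f g _ _ hf hg =>
    intro c
    obtain ⟨p, hp⟩ := hf c
    obtain ⟨q, hq⟩ := hg c
    refine ⟨p + q, fun x => ?_⟩
    rw [Polynomial.eval_add, Complex.add_re, hp, hq, ContinuousMap.add_apply, mul_add, Complex.add_re]
  | smul a f _ hf =>
    intro c
    obtain ⟨p, hp⟩ := hf (c * a)
    refine ⟨p, fun x => ?_⟩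
    rw [hp, ContinuousMap.smul_apply, smul_eq_mul, mul_assoc]

/-- Trigonometric approximation: a continuous function on the circle is uniformly close to the real
part of a polynomial. -/
lemma exists_poly_near {g : UnitAddCircle → ℝ} (hg : Continuous g) {ε : ℝ} (hε : 0 < ε) :
    ∃ p : Polynomial ℂ, ∀ x, |(p.eval (circ x)).re - g x| < ε := by
  let G : C(UnitAddCircle, ℂ) := ⟨fun x => (g x : ℂ), by fun_prop⟩
  have hG : G ∈ (Submodule.span ℂ (Set.range (fourier (T := 1)))).topologicalClosure := by
    rw [span_fourier_closure_eq_top]; trivial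
  obtain ⟨P, hP, hd⟩ := Metric.mem_closure_iff.1 hG ε hε
  obtain ⟨p, hp⟩ := exists_poly_of_span hP 1
  refine ⟨p, fun x => ?_⟩
  have h1 := ContinuousMap.dist_apply_le_dist (f := G) (g := P) x
  rw [hp, one_mul, abs_sub_comm]
  have h2 : |(G x - P x).re| ≤ ‖G x - P x‖ := Complex.abs_re_le_norm _
  rw [dist_eq_norm] at h1
  have : (G x - P x).re = g x - (P x).re := by simp [G]
  rw [← this]
  linarith

/-- Lipschitz minorants of a lower semicontinuous function. -/
def lipMin {X : Type*} [PseudoMetricSpace X] (F : X → ℝ≥0∞) (k : ℕ) (x : X) : ℝ :=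
  ⨅ y, ((min (F y) k).toReal + k * dist x y)

section lip
variable {X : Type*} [PseudoMetricSpace X] (F : X → ℝ≥0∞) (k : ℕ)

lemma lipMin_bdd (x : X) : BddBelow (Set.range fun y => ((min (F y) k).toReal + k * dist x y)) :=
  ⟨0, by rintro _ ⟨y, rfl⟩; positivity⟩

lemma lipMin_nonneg (x : X) : 0 ≤ lipMin F k x := Real.iInf_nonneg fun y => by positivity

lemma lipMin_le (x : X) : ENNReal.ofReal (lipMin F k x) ≤ F x := by
  have h : lipMin F k x ≤ (min (F x) k).toReal := by
    refine (ciInf_le (lipMin_bdd F k x) x).trans (by simp)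
  refine (ENNReal.ofReal_le_ofReal h).trans ?_
  rw [ENNReal.ofReal_toReal (ne_top_of_le_ne_top (ENNReal.natCast_ne_top k) (min_le_right _ _))]
  exact min_le_left _ _

lemma lipMin_lipschitz : LipschitzWith k (lipMin F k) := by
  refine LipschitzWith.of_le_add_mul _ fun x z => ?_
  have : Nonempty X := ⟨x⟩
  rw [← sub_le_iff_le_add]
  refine le_ciInf fun y => ?_
  have := ciInf_le (lipMin_bdd F k x) y
  have h3 := dist_triangle x z y
  have hk : (0 : ℝ) ≤ k := by positivity
  simp only [lipMin] at *
  simp only [NNReal.coe_natCast]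
  nlinarith

lemma le_liminf_lipMin {x : X} (hF : LowerSemicontinuousAt F x) :
    F x ≤ liminf (fun k => ENNReal.ofReal (lipMin F k x)) atTop := by
  refine le_of_forall_lt fun c hc => ?_
  obtain ⟨c', hc', hcF⟩ := exists_between hc
  refine lt_of_lt_of_le hc' ?_
  have hctop : c' ≠ ⊤ := (lt_of_lt_of_le hcF le_top).ne
  obtain ⟨δ, hδ, hb⟩ := Metric.eventually_nhds_iff.1 (lowerSemicontinuousAt_iff.1 hF c' hcF)
  refine le_liminf_of_le (by isBoundedDefault) ?_
  obtain ⟨k0, hk0⟩ := exists_nat_ge (max c'.toReal (c'.toReal / δ))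
  filter_upwards [eventually_ge_atTop k0] with k hk
  have hkk : (k0 : ℝ) ≤ k := by exact_mod_cast hk
  have h1 : c'.toReal ≤ k := (le_max_left _ _).trans (hk0.trans hkk)
  have h2 : c'.toReal ≤ k * δ := by
    rw [← div_le_iff₀ hδ]; exact (le_max_right _ _).trans (hk0.trans hkk)
  rw [← ENNReal.ofReal_toReal hctop]
  refine ENNReal.ofReal_le_ofReal ?_
  have : Nonempty X := ⟨x⟩
  refine le_ciInf fun y => ?_
  by_cases hy : dist y x < δ
  · have h3 := hb hy
    have : c'.toReal ≤ (min (F y) k).toReal := by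
      refine ENNReal.toReal_mono (ne_top_of_le_ne_top (ENNReal.natCast_ne_top k) (min_le_right _ _)) ?_
      refine le_min h3.le ?_
      rw [← ENNReal.ofReal_toReal hctop, ← ENNReal.ofReal_natCast]
      exact ENNReal.ofReal_le_ofReal h1
    have : 0 ≤ k * dist x y := by positivity
    linarith
  · rw [dist_comm] at hy
    have : (k : ℝ) * δ ≤ k * dist x y := by
      have := not_lt.1 hy
      gcongr
    have : 0 ≤ (min (F y) k).toReal := by positivity
    linarith

end lip

/-! ### Negated plurisubharmonic functions as lower semicontinuous `[0,∞]`-valued functions -/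

section Spsh
variable {E : Type*} [NormedAddCommGroup E] [NormedSpace ℂ E]

/-- `U : E → [0,∞]` is such that `-U` is plurisubharmonic on `Ω`. -/
def Spsh (U : E → ℝ≥0∞) (Ω : Set E) : Prop :=
  (∀ z ∈ Ω, LowerSemicontinuousAt U z) ∧
  ∀ a b : E, (∀ ζ : ℂ, ‖ζ‖ ≤ 1 → a + ζ • b ∈ Ω) → ∫⁻ x, U (a + circ x • b) ∂nuc ≤ U a

/-- The negative of an extended real function. -/
def NegE (u : E → EReal) (z : E) : ℝ≥0∞ := (-u z).toENNReal

lemma neg_neg_eq {u : E → EReal} {z : E} (h : u z ≤ 0) : -((NegE u z : ℝ≥0∞) : EReal) = u z := by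
  rw [NegE, EReal.coe_toENNReal (by simpa using EReal.neg_le_neg_iff.2 h), neg_neg]

lemma NegE_coe (U : E → ℝ≥0∞) (z : E) : NegE (fun z => -(U z : EReal)) z = U z := by
  simp [NegE]

lemma le_real_iff {u : E → EReal} {z : E} (h : u z ≤ 0) (c : ℝ) :
    u z ≤ c ↔ ENNReal.ofReal (-c) ≤ NegE u z := by
  rw [← neg_neg_eq h]
  generalize NegE u z = U
  induction U with
  | top => simp
  | coe U =>
    rw [show (((U : NNReal) : ℝ≥0∞) : EReal) = ((U : ℝ) : EReal) from rfl, ← EReal.coe_neg, EReal.coe_le_coe_iff,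
      ENNReal.ofReal_le_iff_le_toReal (by simp)]
    simp [neg_le]

lemma negCoe_le_iff (U : ℝ≥0∞) (c : ℝ) : -(U : EReal) ≤ c ↔ ENNReal.ofReal (-c) ≤ U := by
  have := le_real_iff (E := ℂ) (u := fun _ => -(U : EReal)) (z := 0) (by simpa using EReal.coe_ennreal_nonneg U) c
  rwa [NegE_coe (fun _ => U)] at this

lemma lsc_circ {U : E → ℝ≥0∞} {Ω : Set E} (hU : ∀ z ∈ Ω, LowerSemicontinuousAt U z) {a b : E}
    (hab : ∀ ζ : ℂ, ‖ζ‖ ≤ 1 → a + ζ • b ∈ Ω) :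
    LowerSemicontinuous fun x => U (a + circ x • b) := by
  intro x
  have := hU _ (hab (circ x) (norm_circ x).le)
  refine LowerSemicontinuousAt.comp (f := U) this ?_
  exact (continuous_const.add (continuous_circ.smul continuous_const)).continuousAt

lemma lsc_of_usc {u : E → EReal} {Ω : Set E} (hΩ : IsOpen Ω) (hu0 : ∀ z ∈ Ω, u z ≤ 0)
    (hu : UpperSemicontinuousOn u Ω) : ∀ z ∈ Ω, LowerSemicontinuousAt (NegE u) z := by
  intro z hz
  rw [lowerSemicontinuousAt_iff]
  intro y hy
  have h1 : u z < -(y : EReal) := by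
    rw [← neg_neg_eq (hu0 z hz), EReal.neg_lt_neg_iff]
    exact_mod_cast hy
  have h2 := upperSemicontinuousWithinAt_iff.1 (hu z hz) _ h1
  rw [hΩ.nhdsWithin_eq hz] at h2
  filter_upwards [h2, hΩ.mem_nhds hz] with x hx hxΩ
  rw [← neg_neg_eq (hu0 x hxΩ), EReal.neg_lt_neg_iff] at hx
  exact_mod_cast hx

lemma usc_of_lsc {u : E → EReal} {Ω : Set E} (hΩ : IsOpen Ω) (hu0 : ∀ z ∈ Ω, u z ≤ 0)
    (hu : ∀ z ∈ Ω, LowerSemicontinuousAt (NegE u) z) : UpperSemicontinuousOn u Ω := by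
  intro z hz
  refine upperSemicontinuousWithinAt_iff.2 fun y hy => ?_
  rw [hΩ.nhdsWithin_eq hz]
  by_cases hy0 : 0 < y
  · filter_upwards [hΩ.mem_nhds hz] with x hx
    exact (hu0 x hx).trans_lt hy0
  have hy0 := not_lt.1 hy0
  have h1 : (-y).toENNReal < NegE u z :=
    EReal.toENNReal_lt_toENNReal (by simpa using EReal.neg_le_neg_iff.2 hy0) (EReal.neg_lt_neg_iff.2 hy)
  filter_upwards [lowerSemicontinuousAt_iff.1 (hu z hz) _ h1, hΩ.mem_nhds hz] with x hx hxΩ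
  rw [← neg_neg_eq (hu0 x hxΩ), ← neg_neg y, EReal.neg_lt_neg_iff,
    ← EReal.coe_toENNReal (x := -y) (by simpa using EReal.neg_le_neg_iff.2 hy0)]
  exact_mod_cast hx

/-- The sub-mean value property. -/
theorem PSHNeg.spsh {u : E → EReal} {Ω : Set E} (hΩ : IsOpen Ω) (hu : PSHNeg u Ω) :
    Spsh (NegE u) Ω := by
  obtain ⟨⟨husc, hp⟩, hu0⟩ := hu
  have hl := lsc_of_usc hΩ hu0 husc
  refine ⟨hl, fun a b hab => ?_⟩
  set F : UnitAddCircle → ℝ≥0∞ := fun x => NegE u (a + circ x • b) with hF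
  have hFl : LowerSemicontinuous F := lsc_circ hl hab
  have ha : a ∈ Ω := by simpa using hab 0 (by simp)
  have key : ∀ k, ∫⁻ x, ENNReal.ofReal (lipMin F k x) ∂nuc ≤ NegE u a := by
    intro k
    have hg : Continuous (lipMin F k) := (lipMin_lipschitz F k).continuous
    rw [← ofReal_integral_eq_lintegral_ofReal (integrable_cont hg)
      (Eventually.of_forall fun x => lipMin_nonneg F k x)]
    refine ENNReal.le_of_forall_pos_le_add fun ε hε _ => ?_
    have hε2 : (0 : ℝ) < ε / 2 := by positivity
    obtain ⟨p, hp'⟩ := exists_poly_near (g := fun x => - lipMin F k x + ε / 2)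
      (by fun_prop) hε2
    have h0 := hp a b 1 one_pos hab p (by
      intro ζ hζ
      obtain ⟨x, rfl⟩ := exists_circ hζ
      rw [le_real_iff (hu0 _ (hab _ hζ.le))]
      refine le_trans (ENNReal.ofReal_le_ofReal ?_) (lipMin_le F k x)
      have := (abs_lt.1 (hp' x)).1
      linarith) 0 (by simp)
    rw [zero_smul, add_zero, le_real_iff (hu0 _ ha)] at h0
    have h1 : (p.eval 0).re ≤ ∫ x, (- lipMin F k x + ε) ∂nuc := by
      rw [← integral_re_poly_circ]
      refine integral_mono (integrable_cont ?_) (integrable_cont (by fun_prop)) fun x => ?_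
      · exact Complex.continuous_re.comp (p.continuous.comp continuous_circ)
      · have := (abs_lt.1 (hp' x)).2
        simp only at this ⊢
        linarith
    rw [integral_add (integrable_cont (by fun_prop)) (integrable_cont (by fun_prop)), integral_neg] at h1
    simp only [integral_const, probReal_univ, smul_eq_mul, one_mul] at h1
    calc ENNReal.ofReal (∫ x, lipMin F k x ∂nuc) ≤ ENNReal.ofReal (-(p.eval 0).re + ε) :=
          ENNReal.ofReal_le_ofReal (by linarith)
      _ ≤ _ := ENNReal.ofReal_add_le.trans (by gcongr; simp)
  calc ∫⁻ x, F x ∂nuc ≤ ∫⁻ x, liminf (fun k => ENNReal.ofReal (lipMin F k x)) atTop ∂nuc :=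
        lintegral_mono fun x => le_liminf_lipMin F (hFl x)
    _ ≤ liminf (fun k => ∫⁻ x, ENNReal.ofReal (lipMin F k x) ∂nuc) atTop := by
        refine lintegral_liminf_le fun k => ?_
        exact (lipMin_lipschitz F k).continuous.measurable.ennreal_ofReal
    _ ≤ NegE u a := by
        refine liminf_le_of_le (by isBoundedDefault) fun b hb => ?_
        obtain ⟨k, hk⟩ := hb.exists
        exact hk.trans (key k)

/-- A lower semicontinuous function with the local super-mean value property is the negative of a
plurisubharmonic function. -/
theorem pshNeg_of_local {u : E → EReal} {Ω : Set E} (hΩ : IsOpen Ω) (hu0 : ∀ z ∈ Ω, u z ≤ 0)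
    (hl : ∀ z ∈ Ω, LowerSemicontinuousAt (NegE u) z)
    (hm : ∀ a ∈ Ω, ∀ b : E, ∃ r0 > 0, ∀ r : ℝ, 0 < r → r < r0 →
      ∫⁻ x, NegE u (a + circ x • ((r : ℂ) • b)) ∂nuc ≤ NegE u a) : PSHNeg u Ω := by
  have husc := usc_of_lsc hΩ hu0 hl
  refine ⟨⟨husc, fun a b r hr hab p hp ζ hζ => ?_⟩, hu0⟩
  by_contra hcon
  rw [not_le] at hcon
  -- choose a real value between
  obtain ⟨c, hc1, hc2⟩ := EReal.lt_iff_exists_real_btwn.1 hcon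
  have hc1' : (p.eval ζ).re < c := by exact_mod_cast hc1
  set ε : ℝ := (c - (p.eval ζ).re) / (2 * (r ^ 2 + 1)) with hε
  have hr2 : 0 < 2 * (r ^ 2 + 1) := by positivity
  have hεp : 0 < ε := div_pos (by linarith) hr2
  have hεr : ε * r ^ 2 < c - (p.eval ζ).re := by
    have : ε * (2 * (r ^ 2 + 1)) = c - (p.eval ζ).re := div_mul_cancel₀ _ hr2.ne'
    nlinarith [sq_nonneg r]
  let G : ℂ → ℝ := fun ζ => (p.eval ζ).re - ε * ‖ζ‖ ^ 2
  have hG : Continuous G := by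
    have : Continuous fun ζ => (p.eval ζ).re := Complex.continuous_re.comp p.continuous
    fun_prop
  let f : ℂ → EReal := fun ζ => u (a + ζ • b) - (G ζ : EReal)
  have hfusc : UpperSemicontinuousOn f (Metric.closedBall 0 r) := by
    intro w hw
    have hw' : ‖w‖ ≤ r := by simpa using hw
    refine upperSemicontinuousWithinAt_iff.2 fun y hy => ?_
    have hyw : u (a + w • b) < y + G w := by
      rwa [EReal.sub_lt_iff (by simp) (by simp)] at hy
    obtain ⟨d, hd1, hd2⟩ := EReal.lt_iff_exists_real_btwn.1 hyw
    have hyd : ((d - G w : ℝ) : EReal) < y := by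
      rw [EReal.coe_sub]; exact (EReal.sub_lt_iff (by simp) (by simp)).2 hd2
    obtain ⟨e, he1, he2⟩ := EReal.lt_iff_exists_real_btwn.1 hyd
    have he1 : d - G w < e := by exact_mod_cast he1
    have h1 : ∀ᶠ x in 𝓝 w, u (a + x • b) < d := by
      have h2 := upperSemicontinuousWithinAt_iff.1 (husc _ (hab w hw')) _ hd1
      rw [hΩ.nhdsWithin_eq (hab w hw')] at h2
      have : Tendsto (fun x : ℂ => a + x • b) (𝓝 w) (𝓝 (a + w • b)) := by
        apply Continuous.tendsto; fun_prop
      exact this.eventually h2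
    have h2 : ∀ᶠ x in 𝓝 w, d - G x < e := by
      have : Continuous fun x => d - G x := by fun_prop
      exact this.continuousAt.eventually_lt_const he1
    refine nhdsWithin_le_nhds ?_
    filter_upwards [h1, h2] with x hx1 hx2
    refine lt_of_le_of_lt ?_ he2
    have : f x ≤ ((d - G x : ℝ) : EReal) := by
      rw [EReal.coe_sub]; exact EReal.sub_le_sub hx1.le le_rfl
    exact this.trans (by exact_mod_cast hx2.le)
  obtain ⟨ζ1, hζ1, hmax⟩ := hfusc.exists_isMaxOn ⟨0, by simp [hr.le]⟩ (isCompact_closedBall 0 r)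
  have hζ1' : ‖ζ1‖ ≤ r := by simpa using hζ1
  have hfζ : ((c - (p.eval ζ).re : ℝ) : EReal) < f ζ1 := by
    have h1 : f ζ ≤ f ζ1 := hmax (by simpa using hζ)
    refine lt_of_lt_of_le ?_ h1
    have h2 : ((c - (p.eval ζ).re : ℝ) : EReal) ≤ ((c - G ζ : ℝ) : EReal) := by
      have : 0 ≤ ε * ‖ζ‖ ^ 2 := by positivity
      exact_mod_cast (by simp only [G]; linarith)
    refine lt_of_le_of_lt h2 ?_
    simp only [f]
    rw [EReal.coe_sub]
    exact EReal.sub_lt_sub_of_lt_of_le hc2 le_rfl (by simp) (by simp)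
  have hu1 : u (a + ζ1 • b) ≤ 0 := hu0 _ (hab _ hζ1')
  -- the maximum is a real number
  obtain ⟨m, hm'⟩ : ∃ m : ℝ, u (a + ζ1 • b) = m := by
    induction hh : u (a + ζ1 • b) with
    | bot => simp [f, hh] at hfζ
    | top => rw [hh] at hu1; simp at hu1
    | coe m => exact ⟨m, rfl⟩
  have hm0 : m ≤ 0 := by rw [hm'] at hu1; exact_mod_cast hu1
  have hfm : c - (p.eval ζ).re < m - G ζ1 := by
    simp only [f, hm', ← EReal.coe_sub] at hfζ
    exact_mod_cast hfζ
  have hlt : ‖ζ1‖ < r := by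
    refine lt_of_le_of_ne hζ1' fun h => ?_
    have := hp ζ1 h
    rw [hm'] at this
    have : m ≤ (p.eval ζ1).re := by exact_mod_cast this
    simp only [G, h] at hfm
    linarith
  obtain ⟨r0, hr0, hmean⟩ := hm _ (hab ζ1 hζ1') b
  obtain ⟨s, hs, hsr⟩ := exists_between (lt_min hr0 (sub_pos.2 hlt))
  have hsr0 := hsr.trans_le (min_le_left _ _)
  have hsr1 := hsr.trans_le (min_le_right _ _)
  have hmn := hmean s hs hsr0
  have hpt : ∀ x, ENNReal.ofReal (-(m - G ζ1 + G (ζ1 + s * circ x))) ≤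
      NegE u (a + ζ1 • b + circ x • ((s : ℂ) • b)) := by
    intro x
    have hn : ‖ζ1 + s * circ x‖ ≤ r := by
      refine (norm_add_le _ _).trans ?_
      rw [norm_mul, norm_circ, mul_one, Complex.norm_real, Real.norm_of_nonneg hs.le]
      linarith
    have h1 : f (ζ1 + s * circ x) ≤ f ζ1 := hmax (by simpa using hn)
    simp only [f, hm'] at h1
    rw [EReal.sub_le_iff_le_add (by simp) (by simp), ← EReal.coe_sub, ← EReal.coe_add] at h1
    rw [le_real_iff (hu0 _ (hab _ hn))] at h1
    convert h1 using 2
    rw [add_smul, smul_smul, ← add_assoc, mul_comm (circ x)]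
  have hIn : ∫ x, -(m - G ζ1 + G (ζ1 + s * circ x)) ∂nuc = -m + ε * s ^ 2 := by
    have hc := continuous_circ
    let q : Polynomial ℂ := p.comp (Polynomial.C ζ1 + Polynomial.C (s : ℂ) * Polynomial.X) -
      Polynomial.C (2 * ε : ℂ) * (Polynomial.C (starRingEnd ℂ ζ1) * (Polynomial.C (s : ℂ) * Polynomial.X))
    have hq : ∀ x, -(m - G ζ1 + G (ζ1 + s * circ x)) =
        (-m + G ζ1 + ε * ‖ζ1‖ ^ 2 + ε * s ^ 2) - (q.eval (circ x)).re := by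
      intro x
      have hcx : (circ x).re ^ 2 + (circ x).im ^ 2 = 1 := by
        have := norm_circ x
        rw [← Complex.sq_norm_sub_sq_re, this]; ring
      simp only [G, q, Polynomial.eval_sub, Polynomial.eval_comp, Polynomial.eval_add,
        Polynomial.eval_mul, Polynomial.eval_C, Polynomial.eval_X, Complex.sq_norm, Complex.normSq_apply,
        Complex.sub_re, Complex.add_re, Complex.add_im, Complex.mul_re, Complex.mul_im, Complex.ofReal_re,
        Complex.ofReal_im, Complex.conj_re, Complex.conj_im, Complex.re_ofNat, Complex.im_ofNat]
      linear_combination (ε * s ^ 2) * hcx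
    simp_rw [hq]
    have hqc : Continuous fun x => (q.eval (circ x)).re :=
      Complex.continuous_re.comp (q.continuous.comp continuous_circ)
    rw [integral_sub (integrable_cont continuous_const) (integrable_cont hqc), integral_re_poly_circ]
    simp [q, G]
    ring
  have hGc : Continuous fun x => -(m - G ζ1 + G (ζ1 + s * circ x)) := by
    have hc := continuous_circ
    fun_prop
  have hle : ENNReal.ofReal (-m + ε * s ^ 2) ≤ ENNReal.ofReal (-m) := by
    rw [← hIn]
    calc _ ≤ ∫⁻ x, ENNReal.ofReal (-(m - G ζ1 + G (ζ1 + s * circ x))) ∂nuc :=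
          by
            rw [integral_eq_lintegral_pos_part_sub_lintegral_neg_part (integrable_cont hGc)]
            refine (ENNReal.ofReal_le_ofReal (sub_le_self _ ENNReal.toReal_nonneg)).trans ?_
            exact ENNReal.ofReal_toReal_le
      _ ≤ ∫⁻ x, NegE u (a + ζ1 • b + circ x • ((s : ℂ) • b)) ∂nuc := lintegral_mono hpt
      _ ≤ NegE u (a + ζ1 • b) := hmn
      _ = ENNReal.ofReal (-m) := by rw [NegE, hm', ← EReal.coe_neg, EReal.real_coe_toENNReal]
  have := (ENNReal.ofReal_le_ofReal_iff (by linarith)).1 hle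
  have : 0 < ε * s ^ 2 := by positivity
  linarith

end Spsh

section SpshCalc
variable {E : Type*} [NormedAddCommGroup E] [NormedSpace ℂ E] {Ω : Set E}

lemma PSHNeg.congr {u v : E → EReal} (hu : PSHNeg u Ω) (h : ∀ z ∈ Ω, u z = v z) : PSHNeg v Ω := by
  obtain ⟨⟨h1, h2⟩, h3⟩ := hu
  refine ⟨⟨fun z hz => ?_, fun a b r hr hab p hp ζ hζ => ?_⟩, fun z hz => h z hz ▸ h3 z hz⟩
  · refine upperSemicontinuousWithinAt_iff.2 fun y hy => ?_
    rw [← h z hz] at hy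
    filter_upwards [upperSemicontinuousWithinAt_iff.1 (h1 z hz) y hy, self_mem_nhdsWithin] with x hx hxΩ
    rwa [← h x hxΩ]
  · rw [← h _ (hab ζ hζ)]
    exact h2 a b r hr hab p (fun ξ hξ => by rw [h _ (hab ξ hξ.le)]; exact hp ξ hξ) ζ hζ

lemma exists_disc (hΩ : IsOpen Ω) {a : E} (ha : a ∈ Ω) (b : E) :
    ∃ r0 > 0, ∀ r : ℝ, 0 < r → r < r0 → ∀ ζ : ℂ, ‖ζ‖ ≤ 1 → a + ζ • ((r : ℂ) • b) ∈ Ω := by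
  obtain ⟨δ, hδ, hb⟩ := Metric.isOpen_iff.1 hΩ a ha
  refine ⟨δ / (‖b‖ + 1), by positivity, fun r hr hr0 ζ hζ => hb ?_⟩
  rw [Metric.mem_ball, dist_eq_norm, add_sub_cancel_left, norm_smul, norm_smul, Complex.norm_real,
    Real.norm_of_nonneg hr.le]
  rw [lt_div_iff₀ (by positivity)] at hr0
  have : ‖ζ‖ * (r * ‖b‖) ≤ 1 * (r * ‖b‖) := by gcongr
  nlinarith [norm_nonneg b]

lemma spsh_of_local {U : E → ℝ≥0∞} (hΩ : IsOpen Ω)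
    (hl : ∀ z ∈ Ω, LowerSemicontinuousAt U z)
    (hm : ∀ a ∈ Ω, ∀ b : E, ∃ r0 > 0, ∀ r : ℝ, 0 < r → r < r0 →
      ∫⁻ x, U (a + circ x • ((r : ℂ) • b)) ∂nuc ≤ U a) :
    Spsh U Ω := by
  have h0 : NegE (fun z => -(U z : EReal)) = U := funext (NegE_coe U)
  have h := pshNeg_of_local (u := fun z => -(U z : EReal)) hΩ
    (fun z _ => by simpa using EReal.coe_ennreal_nonneg (U z)) (by rwa [h0]) (by rwa [h0])
  have := h.spsh hΩ
  rwa [h0] at this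

lemma Spsh.pshNeg {U : E → ℝ≥0∞} (hΩ : IsOpen Ω) (hU : Spsh U Ω) :
    PSHNeg (fun z => -(U z : EReal)) Ω := by
  have h0 : NegE (fun z => -(U z : EReal)) = U := funext (NegE_coe U)
  refine pshNeg_of_local hΩ (fun z _ => by simpa using EReal.coe_ennreal_nonneg (U z))
    (by rw [h0]; exact hU.1) fun a ha b => ?_
  rw [h0]
  obtain ⟨r0, hr0, h⟩ := exists_disc hΩ ha b
  exact ⟨r0, hr0, fun r hr hrr => hU.2 a _ (h r hr hrr)⟩

lemma pshNeg_of_spsh {u : E → EReal} (hΩ : IsOpen Ω) (h0 : ∀ z ∈ Ω, u z ≤ 0)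
    (hU : Spsh (NegE u) Ω) : PSHNeg u Ω :=
  (hU.pshNeg hΩ).congr fun z hz => neg_neg_eq (h0 z hz)

lemma Spsh.mono {U : E → ℝ≥0∞} {Ω' : Set E} (hU : Spsh U Ω) (h : Ω' ⊆ Ω) : Spsh U Ω' :=
  ⟨fun z hz => hU.1 z (h hz), fun a b hab => hU.2 a b fun ζ hζ => h (hab ζ hζ)⟩

lemma Spsh.congr {U V : E → ℝ≥0∞} (hΩ : IsOpen Ω) (hU : Spsh U Ω) (h : ∀ z ∈ Ω, U z = V z) :
    Spsh V Ω := by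
  refine ⟨fun z hz => ?_, fun a b hab => ?_⟩
  · rw [lowerSemicontinuousAt_iff]
    intro y hy
    rw [← h z hz] at hy
    filter_upwards [lowerSemicontinuousAt_iff.1 (hU.1 z hz) y hy, hΩ.mem_nhds hz] with x hx hxΩ
    rwa [← h x hxΩ]
  · have ha : a ∈ Ω := by simpa using hab 0 (by simp)
    rw [← h a ha]
    refine le_trans (le_of_eq (lintegral_congr fun x => ?_)) (hU.2 a b hab)
    exact (h _ (hab _ (norm_circ x).le)).symm

lemma Spsh.add {U V : E → ℝ≥0∞} (hU : Spsh U Ω) (hV : Spsh V Ω) : Spsh (fun z => U z + V z) Ω := by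
  refine ⟨fun z hz => (hU.1 z hz).add (hV.1 z hz), fun a b hab => ?_⟩
  rw [lintegral_add_left (lsc_circ hU.1 hab).measurable]
  exact add_le_add (hU.2 a b hab) (hV.2 a b hab)

lemma Spsh.min {U V : E → ℝ≥0∞} (hU : Spsh U Ω) (hV : Spsh V Ω) :
    Spsh (fun z => Min.min (U z) (V z)) Ω := by
  refine ⟨fun z hz => (hU.1 z hz).inf (hV.1 z hz), fun a b hab => le_min ?_ ?_⟩
  · exact (lintegral_mono fun x => min_le_left _ _).trans (hU.2 a b hab)
  · exact (lintegral_mono fun x => min_le_right _ _).trans (hV.2 a b hab)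

lemma Spsh.iSup {U : ℕ → E → ℝ≥0∞} (hU : ∀ k, Spsh (U k) Ω) (hm : ∀ k, ∀ z ∈ Ω, U k z ≤ U (k + 1) z) :
    Spsh (fun z => ⨆ k, U k z) Ω := by
  refine ⟨fun z hz => ?_, fun a b hab => ?_⟩
  · exact lowerSemicontinuousAt_iSup fun k => (hU k).1 z hz
  · rw [lintegral_iSup (fun k => (lsc_circ (hU k).1 hab).measurable)]
    · exact iSup_mono fun k => (hU k).2 a b hab
    · exact monotone_nat_of_le_succ fun k x => hm k _ (hab _ (norm_circ x).le)

lemma Spsh.tsum {U : ℕ → E → ℝ≥0∞} (hU : ∀ k, Spsh (U k) Ω) :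
    Spsh (fun z => ∑' k, U k z) Ω := by
  refine ⟨fun z hz => lowerSemicontinuousAt_tsum fun k => (hU k).1 z hz, fun a b hab => ?_⟩
  rw [lintegral_tsum fun k => (lsc_circ (hU k).1 hab).measurable.aemeasurable]
  exact ENNReal.tsum_le_tsum fun k => (hU k).2 a b hab

/-- Lower semicontinuous regularization relative to `Ω`. -/
def lreg (F : E → ℝ≥0∞) (Ω : Set E) (z : E) : ℝ≥0∞ := liminf F (𝓝[Ω] z)

lemma lreg_le {F : E → ℝ≥0∞} {z : E} (hz : z ∈ Ω) : lreg F Ω z ≤ F z := by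
  refine liminf_le_of_le (by isBoundedDefault) fun b hb => ?_
  exact hb.self_of_nhdsWithin hz

lemma lreg_mono {F G : E → ℝ≥0∞} (h : ∀ z ∈ Ω, F z ≤ G z) (z : E) : lreg F Ω z ≤ lreg G Ω z :=
  liminf_le_liminf (eventually_nhdsWithin_of_forall h)

lemma lsc_lreg (hΩ : IsOpen Ω) (F : E → ℝ≥0∞) {z : E} (hz : z ∈ Ω) :
    LowerSemicontinuousAt (lreg F Ω) z := by
  rw [lowerSemicontinuousAt_iff]
  intro y hy
  obtain ⟨c, hyc, hc⟩ := exists_between hy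
  have h1 : ∀ᶠ x in 𝓝 z, c < F x := by
    rw [← hΩ.nhdsWithin_eq hz]; exact eventually_lt_of_lt_liminf hc
  filter_upwards [h1.eventually_nhds, hΩ.mem_nhds hz] with x hx hxΩ
  refine hyc.trans_le (le_liminf_of_le (by isBoundedDefault) ?_)
  exact nhdsWithin_le_nhds (hx.mono fun _ h => h.le)

/-- A sequence realizing the regularization. -/
lemma exists_seq_lreg (F : E → ℝ≥0∞) {z : E} {c : ℝ≥0∞} (hc : lreg F Ω z < c) :
    ∃ x : ℕ → E, Tendsto x atTop (𝓝 z) ∧ ∀ k, x k ∈ Ω ∧ F (x k) < c := by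
  have h1 : ∃ᶠ x in 𝓝[Ω] z, F x < c := frequently_lt_of_liminf_lt (by isBoundedDefault) hc
  have h2 : ∃ᶠ x in 𝓝 z, x ∈ Ω ∧ F x < c := by
    rw [nhdsWithin, frequently_inf_principal] at h1
    exact h1
  exact exists_seq_forall_of_frequently h2

lemma eventually_disc (hΩ : IsOpen Ω) {a b : E} (hab : ∀ ζ : ℂ, ‖ζ‖ ≤ 1 → a + ζ • b ∈ Ω) :
    ∀ᶠ x in 𝓝 a, ∀ ζ : ℂ, ‖ζ‖ ≤ 1 → x + ζ • b ∈ Ω := by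
  have hK : IsCompact (Metric.closedBall (0 : ℂ) 1) := isCompact_closedBall _ _
  have := hK.eventually_forall_of_forall_eventually (x₀ := a) (P := fun x ζ => x + ζ • b ∈ Ω) (by
    intro ζ hζ
    have hc : Continuous fun p : E × ℂ => p.1 + p.2 • b := by fun_prop
    exact hc.continuousAt.eventually_mem (hΩ.mem_nhds (hab ζ (by simpa using hζ))))
  filter_upwards [this] with x hx ζ hζ
  exact hx ζ (by simpa using hζ)

lemma spsh_lreg (hΩ : IsOpen Ω) {ι : Sort*} {U : ι → E → ℝ≥0∞} (hU : ∀ i, Spsh (U i) Ω) :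
    Spsh (lreg (fun z => ⨅ i, U i z) Ω) Ω := by
  refine ⟨fun z hz => lsc_lreg hΩ _ hz, fun a b hab => ?_⟩
  have ha : a ∈ Ω := by simpa using hab 0 (by simp)
  set V := lreg (fun z => ⨅ i, U i z) Ω with hV
  refine le_of_forall_gt fun c hc => ?_
  obtain ⟨c', hc', hcc⟩ := exists_between hc
  obtain ⟨x, hx, hxk⟩ := exists_seq_lreg _ hc'
  have hVl : LowerSemicontinuous fun θ => V (a + circ θ • b) :=
    lsc_circ (Ω := Ω) (fun z hz => lsc_lreg hΩ _ hz) hab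
  have hev : ∀ᶠ k in atTop, ∫⁻ θ, V (x k + circ θ • b) ∂nuc ≤ c' := by
    filter_upwards [hx.eventually (eventually_disc hΩ hab)] with k hk
    obtain ⟨i, hi⟩ := iInf_lt_iff.1 (hxk k).2
    calc _ ≤ ∫⁻ θ, U i (x k + circ θ • b) ∂nuc := lintegral_mono fun θ =>
          (lreg_le (hk _ (norm_circ θ).le)).trans (iInf_le _ i)
      _ ≤ U i (x k) := (hU i).2 _ _ hk
      _ ≤ c' := hi.le
  refine lt_of_le_of_lt ?_ hcc
  obtain ⟨N, hN⟩ := eventually_atTop.1 (hev.and (hx.eventually (eventually_disc hΩ hab)))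
  calc ∫⁻ θ, V (a + circ θ • b) ∂nuc
      ≤ ∫⁻ θ, liminf (fun k => V (x (k + N) + circ θ • b)) atTop ∂nuc := by
        refine lintegral_mono fun θ => ?_
        refine le_of_forall_lt fun d hd => ?_
        obtain ⟨d', hd', hdd⟩ := exists_between hd
        refine hd'.trans_le (le_liminf_of_le (by isBoundedDefault) ?_)
        have h1 := lowerSemicontinuousAt_iff.1
          (lsc_lreg hΩ (fun z => ⨅ i, U i z) (hab (circ θ) (norm_circ θ).le)) d' hdd
        have h2 : Tendsto (fun k => x (k + N) + circ θ • b) atTop (𝓝 (a + circ θ • b)) :=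
          ((tendsto_add_atTop_iff_nat N).2 hx).add_const _
        exact (h2.eventually h1).mono fun _ h => h.le
    _ ≤ liminf (fun k => ∫⁻ θ, V (x (k + N) + circ θ • b) ∂nuc) atTop := by
        refine lintegral_liminf_le fun k => ?_
        exact (lsc_circ (Ω := Ω) (fun z hz => lsc_lreg hΩ _ hz) (hN (k + N) (by omega)).2).measurable
    _ ≤ c' := by
        refine liminf_le_of_le (by isBoundedDefault) fun b' hb => ?_
        obtain ⟨k, hk⟩ := hb.exists
        exact hk.trans (hN (k + N) (by omega)).1

/-- Gluing: modify `T` on a relatively compact open subset. -/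
lemma Spsh.glue {T V : E → ℝ≥0∞} {G : Set E} (hΩ : IsOpen Ω) (hG : IsOpen G) (hT : Spsh T Ω)
    (hV : Spsh V (G ∩ Ω)) {S : E → ℝ≥0∞} (hS : ∀ z ∈ Ω, z ∈ G → S z = Min.min (V z) (T z))
    (hS' : ∀ z ∈ Ω, z ∉ G → S z = T z)
    (hbd : ∀ z ∈ Ω, z ∈ frontier G → LowerSemicontinuousAt S z) : Spsh S Ω := by
  have hle : ∀ z ∈ Ω, S z ≤ T z := fun z hz => by
    by_cases h : z ∈ G
    · rw [hS z hz h]; exact min_le_right _ _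
    · rw [hS' z hz h]
  have hin : Spsh S (G ∩ Ω) :=
    (hV.min (hT.mono Set.inter_subset_right)).congr (hG.inter hΩ) fun z hz => (hS z hz.2 hz.1).symm
  refine spsh_of_local hΩ (fun z hz => ?_) fun a ha b => ?_
  · by_cases h : z ∈ G
    · exact hin.1 z ⟨h, hz⟩
    by_cases h' : z ∈ frontier G
    · exact hbd z hz h'
    have h2 : z ∈ (closure G)ᶜ := fun hc => h' ⟨hc, fun hi => h (interior_subset hi)⟩
    exact ((hT.mono (Ω' := Ω ∩ (closure G)ᶜ) Set.inter_subset_left).congr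
      (hΩ.inter isClosed_closure.isOpen_compl)
      (fun x hx => (hS' x hx.1 fun h => hx.2 (subset_closure h)).symm)).1 z ⟨hz, h2⟩
  · by_cases h : a ∈ G
    · obtain ⟨r0, hr0, hd⟩ := exists_disc (hG.inter hΩ) ⟨h, ha⟩ b
      exact ⟨r0, hr0, fun r hr hrr => hin.2 a _ (hd r hr hrr)⟩
    · obtain ⟨r0, hr0, hd⟩ := exists_disc hΩ ha b
      refine ⟨r0, hr0, fun r hr hrr => ?_⟩
      rw [hS' a ha h]
      exact (lintegral_mono fun x => hle _ (hd r hr hrr _ (norm_circ x).le)).trans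
        (hT.2 a _ (hd r hr hrr))

end SpshCalc

section Volume
variable {n : ℕ} {Ω : Set (Cn n)}

/-- Coordinatewise rotation. -/
lemma measurePreserving_circ_smul (c : ℂ) (hc : ‖c‖ = 1) :
    MeasurePreserving (fun y : Cn n => c • y) volume volume := by
  have h1 : MeasurePreserving (fun y : ℂ => c * y) volume volume := by
    let R : ℂ ≃ₗᵢ[ℝ] ℂ := rotation ⟨c, by simp [Submonoid.unitSphere, hc]⟩
    have := R.measurePreserving
    exact this
  exact volume_preserving_pi fun _ => h1

lemma measurable_indicator_of_lsc {F : Cn n → ℝ≥0∞} (hΩ : IsOpen Ω)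
    (hF : ∀ z ∈ Ω, LowerSemicontinuousAt F z) : Measurable (Ω.indicator F) := by
  have : LowerSemicontinuous (Ω.indicator F) := by
    intro z
    refine lowerSemicontinuousAt_iff.2 fun y hy => ?_
    by_cases hz : z ∈ Ω
    · rw [Set.indicator_of_mem hz] at hy
      filter_upwards [lowerSemicontinuousAt_iff.1 (hF z hz) y hy, hΩ.mem_nhds hz] with x hx hxΩ
      rwa [Set.indicator_of_mem hxΩ]
    · rw [Set.indicator_of_notMem hz] at hy
      exact absurd hy not_lt_zero
  exact this.measurable

/-- Super-mean value property over balls. -/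
lemma Spsh.ball_mean {U : Cn n → ℝ≥0∞} (hU : Spsh U Ω) {x : Cn n} {r : ℝ}
    (hx : Metric.ball x r ⊆ Ω) :
    ∫⁻ y in Metric.ball x r, U y ≤ volume (Metric.ball x r) * U x := by
  set B := Metric.ball x r
  set F : Cn n → ℝ≥0∞ := fun y => B.indicator U (x + y) with hF
  have hFm : Measurable F :=
    (measurable_indicator_of_lsc Metric.isOpen_ball fun z hz => hU.1 z (hx hz)).comp
      (measurable_const_add x)
  have h1 : ∫⁻ y in B, U y = ∫⁻ y, F y := by
    rw [← lintegral_indicator Metric.isOpen_ball.measurableSet]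
    exact (lintegral_add_left_eq_self _ x).symm
  have h2 : ∀ θ, ∫⁻ y, F y = ∫⁻ y, F (circ θ • y) := fun θ =>
    ((measurePreserving_circ_smul _ (norm_circ θ)).lintegral_comp hFm).symm
  have hmem : ∀ (c : ℂ), ‖c‖ ≤ 1 → ∀ y, x + y ∈ B → x + c • y ∈ B := by
    intro c hc y hy
    simp only [B, Metric.mem_ball, dist_eq_norm, add_sub_cancel_left, norm_smul] at hy ⊢
    exact (mul_le_of_le_one_left (norm_nonneg _) hc).trans_lt hy
  have h3 : ∫⁻ y, F y = ∫⁻ y : Cn n, (∫⁻ θ, F (circ θ • y) ∂nuc) := by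
    calc ∫⁻ y, F y = ∫⁻ _θ, (∫⁻ y, F y) ∂nuc := by simp
      _ = ∫⁻ θ, (∫⁻ y, F (circ θ • y)) ∂nuc := lintegral_congr fun θ => h2 θ
      _ = _ := by
        refine lintegral_lintegral_swap ?_
        refine (hFm.comp ?_).aemeasurable
        have : Continuous fun p : UnitAddCircle × Cn n => circ p.1 • p.2 :=
          (continuous_circ.comp continuous_fst).smul continuous_snd
        exact this.measurable
  rw [h1, h3]
  calc _ ≤ ∫⁻ y, B.indicator (fun _ => U x) (x + y) := by
        refine lintegral_mono fun y => ?_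
        by_cases hy : x + y ∈ B
        · rw [Set.indicator_of_mem hy]
          refine le_trans (le_of_eq (lintegral_congr fun θ => ?_))
            (hU.2 x y fun ζ hζ => hx (hmem ζ hζ y hy))
          simp only [hF]
          rw [Set.indicator_of_mem (hmem _ (norm_circ θ).le y hy)]
        · rw [Set.indicator_of_notMem hy]
          refine le_of_eq ?_
          rw [lintegral_eq_zero_iff']
          · refine Eventually.of_forall fun θ => ?_
            simp only [hF, Pi.zero_apply]
            refine Set.indicator_of_notMem (fun h => hy ?_) _
            have hne : circ θ ≠ 0 := by rw [← norm_ne_zero_iff, norm_circ]; simp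
            have := hmem (circ θ)⁻¹ (by rw [norm_inv, norm_circ]; simp) _ h
            rwa [inv_smul_smul₀ hne] at this
          · refine (hFm.comp ?_).aemeasurable
            exact (continuous_circ.smul continuous_const).measurable
    _ = ∫⁻ y, B.indicator (fun _ => U x) y := lintegral_add_left_eq_self _ x
    _ = _ := by
        rw [lintegral_indicator Metric.isOpen_ball.measurableSet, lintegral_const,
          Measure.restrict_apply_univ, mul_comm]

lemma volume_ball_ne_zero (x : Cn n) {r : ℝ} (hr : 0 < r) : volume (Metric.ball x r) ≠ 0 :=
  (Metric.measure_ball_pos volume x hr).ne'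

/-- Averaging principle behind the comparison of regularized functions. -/
lemma le_of_ball_means {G : Cn n → ℝ≥0∞} {z : Cn n} (hG : LowerSemicontinuousAt G z) {M : ℝ≥0∞}
    (h : ∀ᶠ r in 𝓝[>] (0 : ℝ), ∀ d > (0 : ℝ), d < r →
      ∫⁻ y in Metric.ball z (r - d), G y ≤ volume (Metric.ball z r) * M) : G z ≤ M := by
  refine le_of_forall_lt fun c hc => ?_
  obtain ⟨c', hcc', hc'⟩ := exists_between hc
  refine hcc'.trans_le ?_
  obtain ⟨δ, hδ, hb⟩ := Metric.eventually_nhds_iff.1 (lowerSemicontinuousAt_iff.1 hG c' hc')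
  obtain ⟨r, hr, hr0, hrδ⟩ := (h.and (Ioo_mem_nhdsGT hδ)).exists
  have h1 : ∀ k : ℕ, volume (Metric.ball z (r - r / (k + 2))) * c' ≤ volume (Metric.ball z r) * M := by
    intro k
    have hk : (0 : ℝ) < r / (k + 2) := by positivity
    refine le_trans ?_ (hr _ hk (div_lt_self hr0 (by linarith [Nat.cast_nonneg (α := ℝ) k])))
    rw [mul_comm, ← setLIntegral_const]
    refine setLIntegral_mono' Metric.isOpen_ball.measurableSet fun y hy => (hb ?_).le
    exact (Metric.mem_ball.1 hy).trans (by linarith)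
  have h2 : ⋃ k : ℕ, Metric.ball z (r - r / (k + 2)) = Metric.ball z r := by
    refine Set.Subset.antisymm (Set.iUnion_subset fun k => Metric.ball_subset_ball ?_) fun y hy => ?_
    · have : (0 : ℝ) ≤ r / (k + 2) := by positivity
      linarith
    · rw [Metric.mem_ball] at hy
      have ht : Tendsto (fun k : ℕ => r - r / ((k : ℝ) + 2)) atTop (𝓝 (r - 0)) := by
        refine tendsto_const_nhds.sub ?_
        exact tendsto_const_nhds.div_atTop
          (tendsto_atTop_add_const_right _ _ tendsto_natCast_atTop_atTop)
      rw [sub_zero] at ht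
      obtain ⟨k, hk⟩ := (ht.eventually_const_lt hy).exists
      exact Set.mem_iUnion.2 ⟨k, hk⟩
  have hmono : Monotone fun k : ℕ => Metric.ball z (r - r / ((k : ℝ) + 2)) := by
    intro a b hab
    refine Metric.ball_subset_ball ?_
    have : (a : ℝ) ≤ b := by exact_mod_cast hab
    have : r / ((b : ℝ) + 2) ≤ r / (a + 2) := by gcongr
    linarith
  have h3 := tendsto_measure_iUnion_atTop (μ := volume) hmono
  rw [h2] at h3
  have hc'top : c' ≠ ⊤ := (hc'.trans_le le_top).ne
  have h4 : volume (Metric.ball z r) * c' ≤ volume (Metric.ball z r) * M :=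
    le_of_tendsto' (ENNReal.Tendsto.mul_const h3 (Or.inr hc'top)) h1
  exact (ENNReal.mul_le_mul_iff_right (volume_ball_ne_zero z hr0) measure_ball_lt_top.ne).1 h4

lemma eventually_ball_two_mul_subset (hΩ : IsOpen Ω) {z : Cn n} (hz : z ∈ Ω) :
    ∀ᶠ r in 𝓝[>] (0 : ℝ), Metric.ball z (2 * r) ⊆ Ω := by
  obtain ⟨δ, hδ, hb⟩ := Metric.isOpen_iff.1 hΩ z hz
  filter_upwards [Ioo_mem_nhdsGT (half_pos hδ)] with r hr
  exact (Metric.ball_subset_ball (by linarith [hr.2])).trans hb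

/-- An inequality holding almost everywhere holds everywhere. -/
lemma Spsh.le_of_ae {U G : Cn n → ℝ≥0∞} (hΩ : IsOpen Ω) (hU : Spsh U Ω)
    (hG : ∀ z ∈ Ω, LowerSemicontinuousAt G z) (h : ∀ᵐ z ∂(volume.restrict Ω), G z ≤ U z) :
    ∀ z ∈ Ω, G z ≤ U z := by
  intro z hz
  refine le_of_ball_means (hG z hz) ?_
  filter_upwards [eventually_ball_two_mul_subset hΩ hz, self_mem_nhdsWithin] with r hr hr0 d hd hdr
  have hr0 : 0 < r := hr0
  have hs : Metric.ball z r ⊆ Ω := (Metric.ball_subset_ball (by linarith)).trans hr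
  calc ∫⁻ y in Metric.ball z (r - d), G y ≤ ∫⁻ y in Metric.ball z r, G y :=
        lintegral_mono_set (Metric.ball_subset_ball (by linarith))
    _ ≤ ∫⁻ y in Metric.ball z r, U y := lintegral_mono_ae (ae_restrict_of_ae_restrict_of_subset hs h)
    _ ≤ _ := hU.ball_mean hs

/-- Passing an inequality with a fixed summand through a regularized infimum. -/
lemma le_lreg_add {A G : Cn n → ℝ≥0∞} (hΩ : IsOpen Ω) {ι : Sort*} {U : ι → Cn n → ℝ≥0∞}
    (hU : ∀ i, Spsh (U i) Ω) (hA : Spsh A Ω) (hG : ∀ z ∈ Ω, LowerSemicontinuousAt G z)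
    (h : ∀ i, ∀ z ∈ Ω, G z ≤ U i z + A z) :
    ∀ z ∈ Ω, G z ≤ lreg (fun z => ⨅ i, U i z) Ω z + A z := by
  intro z hz
  refine le_of_ball_means (hG z hz) ?_
  filter_upwards [eventually_ball_two_mul_subset hΩ hz, self_mem_nhdsWithin] with r hr hr0 d hd hdr
  have hr0 : 0 < r := hr0
  have hs : Metric.ball z r ⊆ Ω := (Metric.ball_subset_ball (by linarith)).trans hr
  rw [mul_add]
  have hAi : ∫⁻ y in Metric.ball z (r - d), A y ≤ volume (Metric.ball z r) * A z :=
    (lintegral_mono_set (Metric.ball_subset_ball (by linarith))).trans (hA.ball_mean hs)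
  have hUi : ∀ c, lreg (fun z => ⨅ i, U i z) Ω z < c → ∃ i,
      ∫⁻ y in Metric.ball z (r - d), U i y ≤ volume (Metric.ball z r) * c := by
    intro c hc
    obtain ⟨x, hx, hxk⟩ := exists_seq_lreg _ hc
    obtain ⟨k, hk⟩ := (hx.eventually (Metric.ball_mem_nhds z hd)).exists
    obtain ⟨i, hi⟩ := iInf_lt_iff.1 (hxk k).2
    refine ⟨i, ?_⟩
    have hk' : dist (x k) z < d := hk
    have h1 : Metric.ball z (r - d) ⊆ Metric.ball (x k) r :=
      Metric.ball_subset_ball' (by rw [dist_comm]; linarith)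
    have h2 : Metric.ball (x k) r ⊆ Ω :=
      (Metric.ball_subset_ball' (by linarith)).trans hr
    calc _ ≤ ∫⁻ y in Metric.ball (x k) r, U i y := lintegral_mono_set h1
      _ ≤ volume (Metric.ball (x k) r) * U i (x k) := (hU i).ball_mean h2
      _ ≤ _ := by
        rw [Measure.addHaar_ball_center volume (x k), Measure.addHaar_ball_center volume z]
        exact mul_le_mul' le_rfl hi.le
  have hmeas : ∀ i, AEMeasurable (U i) (volume.restrict (Metric.ball z (r - d))) := fun i => by
    refine ⟨_, measurable_indicator_of_lsc hΩ (hU i).1, ?_⟩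
    filter_upwards [ae_restrict_mem Metric.isOpen_ball.measurableSet] with y hy
    rw [Set.indicator_of_mem (hs (Metric.ball_subset_ball (by linarith) hy))]
  have key : ∀ c, lreg (fun z => ⨅ i, U i z) Ω z < c → ∫⁻ y in Metric.ball z (r - d), G y ≤
      volume (Metric.ball z r) * c + volume (Metric.ball z r) * A z := by
    intro c hc
    obtain ⟨i, hi⟩ := hUi c hc
    calc ∫⁻ y in Metric.ball z (r - d), G y ≤ ∫⁻ y in Metric.ball z (r - d), (U i y + A y) :=
          setLIntegral_mono' Metric.isOpen_ball.measurableSet fun y hy =>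
            h i y (hs (Metric.ball_subset_ball (by linarith) hy))
      _ = _ := lintegral_add_left' (hmeas i) _
      _ ≤ _ := add_le_add hi hAi
  by_cases htop : lreg (fun z => ⨅ i, U i z) Ω z = ⊤
  · rw [htop, ENNReal.mul_top (volume_ball_ne_zero z hr0), top_add]
    exact le_top
  · refine ENNReal.le_of_forall_pos_le_add fun ε hε _ => ?_
    set v := volume (Metric.ball z r) with hv
    have hv0 : v ≠ 0 := volume_ball_ne_zero z hr0
    have hvt : v ≠ ⊤ := measure_ball_lt_top.ne
    have hε' : (ε : ℝ≥0∞) / v ≠ 0 := (ENNReal.div_pos (by exact_mod_cast hε.ne') hvt).ne'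
    refine (key _ (ENNReal.lt_add_right htop hε')).trans ?_
    rw [mul_add, ENNReal.mul_div_cancel hv0 hvt]
    exact le_of_eq (by ring)

end Volume

/-- The squared Euclidean norm on `ℂⁿ`. -/
def sqn {n : ℕ} (z : Cn n) : ℝ := ∑ i, ‖z i‖ ^ 2

section MaxPrinciple
variable {n : ℕ}

lemma continuous_sqn : Continuous (sqn (n := n)) := by unfold sqn; fun_prop

lemma sqn_nonneg (z : Cn n) : 0 ≤ sqn z := Finset.sum_nonneg fun _ _ => by positivity

lemma sqn_add (a b : Cn n) : sqn (a + b) = sqn a + 2 * (∑ i, starRingEnd ℂ (a i) * b i).re + sqn b := by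
  simp only [sqn, Pi.add_apply, Complex.re_sum, Finset.mul_sum, ← Finset.sum_add_distrib]
  refine Finset.sum_congr rfl fun i _ => ?_
  simp only [Complex.sq_norm, Complex.normSq_apply, Complex.add_re, Complex.add_im, Complex.mul_re,
    Complex.conj_re, Complex.conj_im]
  ring

lemma sqn_smul (ζ : ℂ) (b : Cn n) : sqn (ζ • b) = ‖ζ‖ ^ 2 * sqn b := by
  simp only [sqn, Pi.smul_apply, smul_eq_mul, norm_mul, mul_pow, Finset.mul_sum]

lemma sqn_line (a b : Cn n) (ζ : ℂ) :
    sqn (a + ζ • b) = sqn a + (ζ * (2 * ∑ i, starRingEnd ℂ (a i) * b i)).re + ‖ζ‖ ^ 2 * sqn b := by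
  rw [sqn_add, sqn_smul]
  congr 2
  have : ∑ i, starRingEnd ℂ (a i) * (ζ • b) i = ζ * ∑ i, starRingEnd ℂ (a i) * b i := by
    rw [Finset.mul_sum]
    exact Finset.sum_congr rfl fun i _ => by simp only [Pi.smul_apply, smul_eq_mul]; ring
  rw [this, show ζ * (2 * ∑ i, starRingEnd ℂ (a i) * b i) =
    ((2 : ℝ) : ℂ) * (ζ * ∑ i, starRingEnd ℂ (a i) * b i) by push_cast; ring, Complex.re_ofReal_mul]

lemma sqn_eq_zero {z : Cn n} : sqn z = 0 ↔ z = 0 := by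
  rw [sqn, Finset.sum_eq_zero_iff_of_nonneg fun _ _ => by positivity]
  simp [funext_iff]

lemma exists_disc' {E : Type*} [NormedAddCommGroup E] [NormedSpace ℂ E] {Ω : Set E} (hΩ : IsOpen Ω)
    {a : E} (ha : a ∈ Ω) (b : E) : ∃ r > 0, ∀ ζ : ℂ, ‖ζ‖ ≤ r → a + ζ • b ∈ Ω := by
  have hc : Continuous fun ζ : ℂ => a + ζ • b := by fun_prop
  have h1 : (fun ζ : ℂ => a + ζ • b) ⁻¹' Ω ∈ 𝓝 (0 : ℂ) :=
    (hΩ.preimage hc).mem_nhds (by simpa using ha)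
  obtain ⟨r, hr, hb⟩ := Metric.nhds_basis_closedBall.mem_iff.1 h1
  exact ⟨r, hr, fun ζ hζ => hb (by simpa using hζ)⟩

lemma ne_top_of_frontier (hn : 2 ≤ n) {W G : Set (Cn n)} (hG : IsOpen G)
    (hc : IsCompact (closure G)) (hGW : closure G ⊆ W) {v : Cn n → EReal}
    (hv : PlurisubharmonicOn v W) (hb : ∀ z ∈ frontier G, v z ≤ 0) : ∀ z ∈ closure G, v z ≠ ⊤ := by
  obtain ⟨m, rfl⟩ : ∃ m, n = m + 2 := ⟨n - 2, by omega⟩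
  by_contra! hcon
  obtain ⟨z0, hz0, hvz0⟩ := hcon
  have hvG : UpperSemicontinuousOn v (closure G) := hv.1.mono hGW
  have hA : IsCompact {z | z ∈ closure G ∧ v z = ⊤} := by
    refine hc.of_isClosed_subset ?_ fun z hz => hz.1
    rw [← isOpen_compl_iff, isOpen_iff_mem_nhds]
    intro z hz
    by_cases hzG : z ∈ closure G
    · have hzt : v z < ⊤ := lt_top_iff_ne_top.2 fun h => hz ⟨hzG, h⟩
      obtain ⟨y, hy1, hy2⟩ := exists_between hzt
      have := upperSemicontinuousWithinAt_iff.1 (hvG z hzG) y hy1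
      filter_upwards [eventually_nhdsWithin_iff.1 this] with x hx hxA
      have := hx hxA.1
      rw [hxA.2] at this
      exact absurd (this.trans hy2) (lt_irrefl _)
    · filter_upwards [isClosed_closure.isOpen_compl.mem_nhds hzG] with x hx hxA
      exact hx hxA.1
  obtain ⟨p, ⟨hpG, hpt⟩, hpmax⟩ := hA.exists_isMaxOn ⟨z0, hz0, hvz0⟩ continuous_sqn.continuousOn
  have hpG' : p ∈ G := by
    by_contra h
    have := hb p ⟨hpG, fun hi => h (interior_subset hi)⟩
    rw [hpt] at this
    exact absurd this (by simp)
  obtain ⟨b, hb0, hbp⟩ : ∃ b : Cn (m + 2), b ≠ 0 ∧ ∑ i, starRingEnd ℂ (p i) * b i = 0 := by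
    by_cases h : p 0 = 0 ∧ p 1 = 0
    · refine ⟨Pi.single 0 1, by simp, ?_⟩
      rw [Finset.sum_eq_single 0] <;> simp +contextual [h.1]
    · refine ⟨Function.update (Pi.single 0 (starRingEnd ℂ (p 1))) 1 (-starRingEnd ℂ (p 0)), ?_, ?_⟩
      · intro hz
        refine h ⟨?_, ?_⟩
        · have := congrFun hz 1
          simpa using this
        · have := congrFun hz 0
          simpa using this
      · rw [Fin.sum_univ_succ, Fin.sum_univ_succ, Finset.sum_eq_zero]
        · simp; ring
        · intro i _
          have h1 : (i.succ.succ : Fin (m + 2)) ≠ 1 := by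
            simp [Fin.ext_iff]
          simp [Function.update_of_ne h1]
  obtain ⟨r, hr, hd⟩ := exists_disc' hG hpG' b
  have hbpos : 0 < sqn b := lt_of_le_of_ne (sqn_nonneg b) fun h => hb0 (sqn_eq_zero.1 h.symm)
  have hcirc : ∀ ζ : ℂ, ‖ζ‖ = r → v (p + ζ • b) < ⊤ := by
    intro ζ hζ
    refine lt_top_iff_ne_top.2 fun h => ?_
    have := hpmax ⟨subset_closure (hd ζ hζ.le), h⟩
    simp only [Set.mem_ofPred_eq, sqn_line, hbp, mul_zero, Complex.zero_re, add_zero, hζ] at this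
    nlinarith [mul_pos (pow_pos hr 2) hbpos]
  obtain ⟨ζ0, hζ0, hmax⟩ : ∃ ζ0 ∈ Metric.sphere (0 : ℂ) r, ∀ ζ ∈ Metric.sphere (0 : ℂ) r,
      v (p + ζ • b) ≤ v (p + ζ0 • b) := by
    have hne : (Metric.sphere (0 : ℂ) r).Nonempty := NormedSpace.sphere_nonempty.2 hr.le
    have husc : UpperSemicontinuousOn (fun ζ : ℂ => v (p + ζ • b)) (Metric.sphere (0 : ℂ) r) := by
      have hcl : Continuous fun ζ : ℂ => p + ζ • b := by fun_prop
      refine UpperSemicontinuousOn.comp (f := v) (g := fun ζ : ℂ => p + ζ • b) (s := closure G)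
        (t := Metric.sphere (0 : ℂ) r) hvG hcl.continuousOn ?_
      intro ζ hζ
      exact subset_closure (hd ζ (by simpa using (mem_sphere_zero_iff_norm.1 hζ).le))
    obtain ⟨ζ0, h1, h2⟩ := husc.exists_isMaxOn hne (isCompact_sphere _ _)
    exact ⟨ζ0, h1, fun ζ hζ => h2 hζ⟩
  obtain ⟨M, hM1, _⟩ := EReal.lt_iff_exists_real_btwn.1 (hcirc ζ0 (by simpa using hζ0))
  have := hv.2 p b r hr (fun ζ hζ => hGW (subset_closure (hd ζ hζ))) (Polynomial.C (M : ℂ))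
    (fun ζ hζ => by
      simp only [Polynomial.eval_C, Complex.ofReal_re]
      exact (hmax ζ (by simpa using hζ)).trans hM1.le) 0 (by simpa using hr.le)
  rw [zero_smul, add_zero, hpt] at this
  simp at this

/-- Maximum principle. -/
lemma nonpos_of_frontier (hn : 2 ≤ n) {W G : Set (Cn n)} (hG : IsOpen G)
    (hc : IsCompact (closure G)) (hGW : closure G ⊆ W) {v : Cn n → EReal}
    (hv : PlurisubharmonicOn v W) (hb : ∀ z ∈ frontier G, v z ≤ 0) : ∀ z ∈ G, v z ≤ 0 := by
  have htop := ne_top_of_frontier hn hG hc hGW hv hb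
  intro z0 hz0
  by_contra! hcon
  obtain ⟨m0, hm0, hm0'⟩ := EReal.lt_iff_exists_real_btwn.1 hcon
  have hm0 : 0 < m0 := by exact_mod_cast hm0
  have hvG : UpperSemicontinuousOn v (closure G) := hv.1.mono hGW
  obtain ⟨R, hR⟩ := (hc.image continuous_sqn).bddAbove
  have hR' : ∀ z ∈ closure G, sqn z ≤ R := fun z hz => hR ⟨z, hz, rfl⟩
  have hR0 : 0 ≤ R := (sqn_nonneg z0).trans (hR' z0 (subset_closure hz0))
  set ε : ℝ := m0 / (2 * (R + 1)) with hε
  have hεp : 0 < ε := by positivity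
  have hεR : ε * R < m0 := by
    have : ε * (2 * (R + 1)) = m0 := div_mul_cancel₀ _ (by positivity)
    nlinarith
  have hfusc : UpperSemicontinuousOn (fun z => v z + ((ε * sqn z : ℝ) : EReal)) (closure G) := by
    refine UpperSemicontinuousOn.add' hvG ?_ ?_
    · refine ContinuousOn.upperSemicontinuousOn (Continuous.continuousOn ?_)
      exact continuous_coe_real_ereal.comp (continuous_const.mul continuous_sqn)
    · intro x _
      exact EReal.continuousAt_add (Or.inr (EReal.coe_ne_bot _)) (Or.inr (EReal.coe_ne_top _))
  obtain ⟨z1, hz1, hmax⟩ := hfusc.exists_isMaxOn ⟨z0, subset_closure hz0⟩ hc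
  have h01 : (m0 : EReal) < v z1 + ((ε * sqn z1 : ℝ) : EReal) := by
    refine lt_of_lt_of_le hm0' (le_trans ?_ (hmax (subset_closure hz0)))
    have : (0 : EReal) ≤ ((ε * sqn z0 : ℝ) : EReal) := by
      exact_mod_cast mul_nonneg hεp.le (sqn_nonneg z0)
    exact le_add_of_nonneg_right this
  obtain ⟨m, hm⟩ : ∃ m : ℝ, v z1 = m := by
    induction h : v z1 with
    | bot => rw [h, EReal.bot_add] at h01; simp at h01
    | top => exact absurd h (htop z1 hz1)
    | coe m => exact ⟨m, rfl⟩
  have hz1G : z1 ∈ G := by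
    by_contra h
    have h1 := hb z1 ⟨hz1, fun hi => h (interior_subset hi)⟩
    rw [hm] at h1 h01
    have h1 : m ≤ 0 := by exact_mod_cast h1
    have h01 : m0 < m + ε * sqn z1 := by exact_mod_cast h01
    nlinarith [hR' z1 hz1]
  have hnpos : 0 < n := by omega
  let b : Cn n := Pi.single ⟨0, hnpos⟩ 1
  have hbpos : 0 < sqn b := lt_of_le_of_ne (sqn_nonneg b) fun h => by
    have := sqn_eq_zero.1 h.symm
    simp [b] at this
  obtain ⟨r, hr, hd⟩ := exists_disc' hG hz1G b
  set s := ∑ i, starRingEnd ℂ (z1 i) * b i with hs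
  have := hv.2 z1 b r hr (fun ζ hζ => hGW (subset_closure (hd ζ hζ)))
    (Polynomial.C ((m - ε * (r ^ 2 * sqn b) : ℝ) : ℂ) -
      Polynomial.C (ε : ℂ) * (Polynomial.X * Polynomial.C (2 * s)))
    (fun ζ hζ => by
      have h1 := hmax (subset_closure (hd ζ hζ.le))
      simp only [Set.mem_ofPred_eq, hm] at h1
      rw [sqn_line, ← EReal.coe_add, ← EReal.le_sub_iff_add_le (Or.inl (EReal.coe_ne_bot _)) (Or.inl (EReal.coe_ne_top _)), ← EReal.coe_sub] at h1
      refine h1.trans (le_of_eq ?_)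
      congr 1
      simp only [Polynomial.eval_sub, Polynomial.eval_C, Polynomial.eval_mul, Polynomial.eval_X,
        Complex.sub_re, Complex.ofReal_re, Complex.re_ofReal_mul, hζ]
      ring) 0 (by simpa using hr.le)
  rw [zero_smul, add_zero, hm] at this
  have : m ≤ m - ε * (r ^ 2 * sqn b) := by
    have h := this
    simp only [Polynomial.eval_sub, Polynomial.eval_C, Polynomial.eval_mul, Polynomial.eval_X,
        Complex.ofReal_re, zero_mul, mul_zero, sub_zero] at h
    exact_mod_cast h
  nlinarith [mul_pos hεp (mul_pos (pow_pos hr 2) hbpos)]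

lemma two_le_of_maximalOn {Ω : Set (Cn n)} (hΩ : IsOpen Ω) (hne : Ω.Nonempty) {H : Cn n → EReal}
    (hH : MaximalOn H Ω) (h0 : ∀ z ∈ Ω, H z ≤ 0) : 2 ≤ n := by
  obtain ⟨z0, hz0⟩ := hne
  by_contra hlt
  have hn : n = 0 ∨ n = 1 := by omega
  rcases hn with rfl | rfl
  · have hΩu : Ω = Set.univ := Set.eq_univ_of_forall fun z => Subsingleton.elim z0 z ▸ hz0
    have := hH.2 Set.univ isOpen_univ (by rw [closure_univ]; exact Set.finite_univ.isCompact)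
      (by rw [hΩu]; simp) Set.univ isOpen_univ (by simp) (fun _ => ⊤)
      ⟨upperSemicontinuousOn_const, fun a b r hr _ p hp => by
        have := hp r (by simpa using hr.le)
        simp at this⟩ (by simp) z0 trivial
    have := this.trans (h0 z0 hz0)
    simp at this
  · obtain ⟨δ, hδ, hball⟩ := Metric.isOpen_iff.1 hΩ z0 hz0
    set s := δ / 4 with hs
    have hs0 : 0 < s := by positivity
    have hnorm : ∀ z : Cn 1, ‖z‖ = ‖z 0‖ := fun z => by
      rw [Pi.norm_def]; simp
    let v : Cn 1 → EReal := fun z => if ‖z - z0‖ = s then ⊤ else ⊥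
    let W : Set (Cn 1) := {z | s / 3 < ‖z - z0‖}
    let G : Set (Cn 1) := {z | s / 2 < ‖z - z0‖ ∧ ‖z - z0‖ < 2 * s}
    have hcn : Continuous fun z : Cn 1 => ‖z - z0‖ := by fun_prop
    have hclG : closure G ⊆ {z | s / 2 ≤ ‖z - z0‖ ∧ ‖z - z0‖ ≤ 2 * s} := by
      refine closure_minimal (fun z hz => ⟨hz.1.le, hz.2.le⟩) ?_
      exact (isClosed_le continuous_const hcn).inter (isClosed_le hcn continuous_const)
    have hGo : IsOpen G :=
      (isOpen_lt continuous_const hcn).inter (isOpen_lt hcn continuous_const)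
    have hvpsh : PlurisubharmonicOn v W := by
      refine ⟨fun z _ => upperSemicontinuousWithinAt_iff.2 fun y hy => ?_, ?_⟩
      · by_cases h : ‖z - z0‖ = s
        · simp [v, h] at hy
        · have : ∀ᶠ x in 𝓝 z, ‖x - z0‖ ≠ s := by
            have hc : Continuous fun x : Cn 1 => ‖x - z0‖ := by fun_prop
            exact hc.continuousAt.eventually_ne h
          refine nhdsWithin_le_nhds (this.mono fun x hx => ?_)
          simp only [v, h, hx, if_false] at hy ⊢
          exact hy
      · intro a b r hr hab p hp ζ hζ
        have hnot : ∀ ξ : ℂ, ‖ξ‖ = r → ‖a + ξ • b - z0‖ ≠ s := by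
          intro ξ hξ h
          have := hp ξ hξ
          simp [v, h] at this
        have : ‖a + ζ • b - z0‖ ≠ s := by
          intro hx
          by_cases hb : b 0 = 0
          · refine hnot r (by simp [hr.le]) ?_
            rw [hnorm] at hx ⊢
            simpa [hb] using hx
          -- rotate around the circle
          let x : ℂ := a 0 + ζ * b 0 - z0 0
          let ξ : ℝ → ℂ := fun θ => (z0 0 + Complex.exp (θ * Complex.I) * x - a 0) / b 0
          have hξc : Continuous fun θ => ‖ξ θ‖ := by
            have : Continuous fun θ : ℝ => Complex.exp (θ * Complex.I) := by fun_prop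
            exact ((continuous_const.add (this.mul continuous_const)).sub continuous_const).div_const _ |>.norm
          have hξ : ∀ θ, a + ξ θ • b - z0 = fun _ => Complex.exp (θ * Complex.I) * x := by
            intro θ
            ext i
            rw [Subsingleton.elim i 0]
            simp only [Pi.sub_apply, Pi.add_apply, Pi.smul_apply, smul_eq_mul, ξ]
            field_simp
            ring
          have hxs : ‖x‖ = s := by rw [hnorm] at hx; simpa [x] using hx
          have hnx : ∀ θ, ‖a + ξ θ • b - z0‖ = s := by
            intro θ
            rw [hξ, hnorm, norm_mul, Complex.norm_exp_ofReal_mul_I, one_mul, hxs]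
          have hξ0 : ξ 0 = ζ := by
            simp only [ξ, x]; field_simp; simp
          have hξπ : ξ Real.pi = (z0 0 - x - a 0) / b 0 := by
            simp only [ξ, Complex.exp_pi_mul_I]; ring
          by_cases hπ : ‖ξ Real.pi‖ ≤ r
          · have hmid : ‖(ζ + ξ Real.pi) / 2‖ ≤ r := by
              rw [norm_div, Complex.norm_ofNat]
              have := norm_add_le ζ (ξ Real.pi)
              linarith
            have hW := hab _ hmid
            have hz : a + ((ζ + ξ Real.pi) / 2) • b = z0 := by
              ext i
              rw [Subsingleton.elim i 0]
              simp only [Pi.add_apply, Pi.smul_apply, smul_eq_mul, hξπ, x]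
              field_simp
              ring
            rw [hz] at hW
            simp only [W, Set.mem_ofPred_eq, sub_self, norm_zero] at hW
            linarith
          · have hIVT := intermediate_value_Icc Real.pi_pos.le hξc.continuousOn
            obtain ⟨θ, -, hθ⟩ := hIVT ⟨by rw [hξ0]; exact hζ, (not_le.1 hπ).le⟩
            exact hnot (ξ θ) hθ (hnx θ)
        simp [v, this]
    have hmem : ‖(z0 + fun _ => (s : ℂ)) - z0‖ = s := by
      rw [add_sub_cancel_left, hnorm]; simp [hs0.le]
    have := hH.2 G hGo (Metric.isCompact_of_isClosed_isBounded isClosed_closure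
      ((Metric.isBounded_closedBall (x := z0) (r := 2 * s)).subset fun z hz => by
        rw [Metric.mem_closedBall, dist_eq_norm]; exact (hclG hz).2))
      (fun z hz => hball (by
        rw [Metric.mem_ball, dist_eq_norm]
        have := (hclG hz).2
        linarith)) W (isOpen_lt continuous_const hcn)
      (fun z hz => by
        have := (hclG hz).1
        simp only [W, Set.mem_ofPred_eq]; linarith) v hvpsh
      (fun z hz => by
        have : ‖z - z0‖ ≠ s := fun h => hz.2 (by
          rw [hGo.interior_eq]
          exact ⟨by linarith, by linarith⟩)
        simp [v, this]) (z0 + fun _ => (s : ℂ)) ⟨by rw [hmem]; linarith, by rw [hmem]; linarith⟩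
    have h2 := this.trans (h0 _ (hball (by rw [Metric.mem_ball, dist_eq_norm, hmem]; linarith)))
    simp only [v, hmem, if_true] at h2
    simp at h2

end MaxPrinciple

section Conversions
variable {E : Type*} [NormedAddCommGroup E] [NormedSpace ℂ E] {Ω : Set E}

lemma negCoe_le_add_iff (X Y : ℝ≥0∞) {C : ℝ} (hC : 0 ≤ C) :
    -(X : EReal) ≤ -(Y : EReal) + (C : EReal) ↔ Y ≤ X + ENNReal.ofReal C := by
  induction X with
  | top => simp
  | coe x =>
    induction Y with
    | top => simp
    | coe y =>
      lift C to NNReal using hC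
      rw [ENNReal.ofReal_coe_nnreal, ← ENNReal.coe_add, ENNReal.coe_le_coe]
      have e : ∀ a : NNReal, ((a : ℝ≥0∞) : EReal) = ((a : ℝ) : EReal) := fun _ => rfl
      rw [e, e, ← EReal.coe_neg, ← EReal.coe_neg, ← EReal.coe_add, EReal.coe_le_coe_iff,
        ← NNReal.coe_le_coe, NNReal.coe_add]
      constructor <;> intro h <;> linarith

lemma le_add_iff {u v : E → EReal} {z : E} (hu : u z ≤ 0) (hv : v z ≤ 0) {C : ℝ} (hC : 0 ≤ C) :
    u z ≤ v z + (C : EReal) ↔ NegE v z ≤ NegE u z + ENNReal.ofReal C := by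
  rw [← negCoe_le_add_iff _ _ hC, neg_neg_eq hu, neg_neg_eq hv]

lemma NegE_anti {u v : E → EReal} {z : E} (h : u z ≤ v z) : NegE v z ≤ NegE u z :=
  EReal.toENNReal_le_toENNReal (EReal.neg_le_neg_iff.2 h)

lemma le_of_NegE {u v : E → EReal} {z : E} (hu : u z ≤ 0) (hv : v z ≤ 0) (h : NegE v z ≤ NegE u z) :
    u z ≤ v z := by
  rw [← neg_neg_eq hu, ← neg_neg_eq hv, EReal.neg_le_neg_iff]
  exact_mod_cast h

lemma NegE_le_add {a b c : E → EReal} {z : E} (ha : a z ≤ 0) (hb : b z ≤ 0)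
    (h : a z + b z ≤ c z) : NegE c z ≤ NegE a z + NegE b z := by
  refine (EReal.toENNReal_le_toENNReal (EReal.neg_le_neg_iff.2 h)).trans ?_
  rw [EReal.neg_add (Or.inr (ne_top_of_le_ne_top (by simp) hb)) (Or.inl (ne_top_of_le_ne_top (by simp) ha)),
    sub_eq_add_neg]
  exact EReal.toENNReal_add_le

lemma antitone_negCoe : Antitone fun x : ℝ≥0∞ => -(x : EReal) :=
  fun _ _ h => EReal.neg_le_neg_iff.2 (by exact_mod_cast h)

lemma iSup_eq_neg_iInf {𝓕 : Set (E → EReal)} {z : E} (h0 : ∀ w ∈ 𝓕, w z ≤ 0) :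
    (⨆ w ∈ 𝓕, w z) = -((⨅ w : 𝓕, NegE (w : E → EReal) z : ℝ≥0∞) : EReal) := by
  refine le_antisymm (iSup₂_le fun w hw => ?_) ?_
  · rw [← neg_neg_eq (h0 w hw)]
    exact antitone_negCoe (iInf_le (fun w : 𝓕 => NegE (w : E → EReal) z) ⟨w, hw⟩)
  · have hS : (⨆ w ∈ 𝓕, w z) ≤ 0 := iSup₂_le h0
    rw [← neg_neg_eq (u := fun z => ⨆ w ∈ 𝓕, w z) hS]
    exact antitone_negCoe (le_iInf fun w => NegE_anti (le_iSup₂ (f := fun w (_ : w ∈ 𝓕) => w z) w.1 w.2))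

/-- Upper regularization of suprema becomes lower regularization of infima. -/
lemma uscReg_eq {𝓕 : Set (E → EReal)} (h0 : ∀ w ∈ 𝓕, ∀ z ∈ Ω, w z ≤ 0) {z : E} (hz : z ∈ Ω) :
    uscReg (fun z => ⨆ w ∈ 𝓕, w z) Ω z =
      -((lreg (fun z => ⨅ w : 𝓕, NegE (w : E → EReal) z) Ω z : ℝ≥0∞) : EReal) := by
  have : NeBot (𝓝[Ω] z) := mem_closure_iff_nhdsWithin_neBot.1 (subset_closure hz)
  unfold uscReg lreg
  rw [antitone_negCoe.map_liminf_of_continuousAt (F := 𝓝[Ω] z)]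
  · refine limsup_congr ?_
    filter_upwards [self_mem_nhdsWithin] with x hx
    exact iSup_eq_neg_iInf fun w hw => h0 w hw x hx
  · exact (continuous_neg.comp continuous_coe_ennreal_ereal).continuousAt

lemma NegE_uscReg {𝓕 : Set (E → EReal)} (h0 : ∀ w ∈ 𝓕, ∀ z ∈ Ω, w z ≤ 0) {z : E} (hz : z ∈ Ω) :
    NegE (uscReg (fun z => ⨆ w ∈ 𝓕, w z) Ω) z =
      lreg (fun z => ⨅ w : 𝓕, NegE (w : E → EReal) z) Ω z := by
  rw [NegE, uscReg_eq h0 hz]; simp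

lemma uscReg_nonpos {𝓕 : Set (E → EReal)} (h0 : ∀ w ∈ 𝓕, ∀ z ∈ Ω, w z ≤ 0) {z : E} (hz : z ∈ Ω) :
    uscReg (fun z => ⨆ w ∈ 𝓕, w z) Ω z ≤ 0 := by
  rw [uscReg_eq h0 hz, EReal.neg_le_zero]
  exact EReal.coe_ennreal_nonneg _

lemma le_uscReg {f : E → EReal} {z : E} (hz : z ∈ Ω) : f z ≤ uscReg f Ω z := by
  exact le_limsup_of_le (by isBoundedDefault) fun b hb => hb.self_of_nhdsWithin hz

lemma uscReg_le {f g : E → EReal} (hfg : ∀ z ∈ Ω, f z ≤ g z) (hg : UpperSemicontinuousOn g Ω)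
    {z : E} (hz : z ∈ Ω) : uscReg f Ω z ≤ g z := by
  refine le_of_forall_gt_imp_ge_of_dense fun y hy => ?_
  refine limsup_le_of_le (by isBoundedDefault) ?_
  filter_upwards [upperSemicontinuousWithinAt_iff.1 (hg z hz) y hy, self_mem_nhdsWithin] with x h1 h2
  exact (hfg x h2).trans h1.le

lemma PlurisubharmonicOn.mono {u : E → EReal} {V : Set E} (hu : PlurisubharmonicOn u Ω) (h : V ⊆ Ω) :
    PlurisubharmonicOn u V :=
  ⟨hu.1.mono h, fun a b r hr hab => hu.2 a b r hr fun ζ hζ => h (hab ζ hζ)⟩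

lemma PlurisubharmonicOn.add_const {u : E → EReal} (hu : PlurisubharmonicOn u Ω) (c : ℝ) :
    PlurisubharmonicOn (fun z => u z + (c : EReal)) Ω := by
  have key : ∀ (x : EReal) (p : ℝ), x + (c : EReal) ≤ p ↔ x ≤ ((p - c : ℝ) : EReal) := by
    intro x p
    rw [EReal.coe_sub, EReal.le_sub_iff_add_le (Or.inl (EReal.coe_ne_bot _)) (Or.inl (EReal.coe_ne_top _))]
  refine ⟨?_, fun a b r hr hab p hp ζ hζ => ?_⟩
  · refine UpperSemicontinuousOn.add' hu.1 upperSemicontinuousOn_const fun x _ => ?_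
    exact EReal.continuousAt_add (Or.inr (EReal.coe_ne_bot _)) (Or.inr (EReal.coe_ne_top _))
  · have := hu.2 a b r hr hab (p - Polynomial.C (c : ℂ)) (fun ξ hξ => by
      have := (key _ _).1 (hp ξ hξ)
      simpa using this) ζ hζ
    rw [key]
    simpa using this

end Conversions

section SoftPart
variable {n : ℕ} {Ω : Set (Cn n)}

lemma MaximalOn.le_add {H s : Cn n → EReal} (hH : MaximalOn H Ω) {G W : Set (Cn n)} (hG : IsOpen G)
    (hc : IsCompact (closure G)) (hGΩ : closure G ⊆ Ω) (hW : IsOpen W) (hGW : closure G ⊆ W)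
    (hs : PlurisubharmonicOn s W) {C : ℝ}
    (hb : ∀ z ∈ frontier G, s z ≤ H z + (C : EReal)) : ∀ z ∈ G, s z ≤ H z + (C : EReal) := by
  have key : ∀ x y : EReal, x + ((-C : ℝ) : EReal) ≤ y ↔ x ≤ y + (C : EReal) := by
    intro x y
    rw [EReal.coe_neg, ← sub_eq_add_neg, EReal.sub_le_iff_le_add (Or.inl (EReal.coe_ne_bot _))
      (Or.inl (EReal.coe_ne_top _))]
  intro z hz
  exact (key _ _).1 (hH.2 G hG hc hGΩ W hW hGW _ (hs.add_const (-C)) (fun z hz => (key _ _).2 (hb z hz)) z hz)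

lemma MaximalOn.le_add_of_boundary {H s : Cn n → EReal} (hH : MaximalOn H Ω) (hΩ : IsOpen Ω)
    (hΩb : Bornology.IsBounded Ω) (hs : PlurisubharmonicOn s Ω) {U : Set (Cn n)} (hU : IsOpen U)
    (hfU : frontier Ω ⊆ U) {C : ℝ} (hb : ∀ z ∈ U ∩ Ω, s z ≤ H z + (C : EReal)) :
    ∀ z ∈ Ω, s z ≤ H z + (C : EReal) := by
  have hK : Ω \ U = closure Ω \ U := by
    refine Set.Subset.antisymm (Set.sdiff_subset_sdiff_left subset_closure) fun z hz => ⟨?_, hz.2⟩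
    by_contra h
    exact hz.2 (hfU ⟨hz.1, fun hi => h (interior_subset hi)⟩)
  have hKc : IsCompact (Ω \ U) := by
    rw [hK]
    exact (hΩb.isCompact_closure).diff hU
  obtain ⟨G, hG, hKG, hGΩ, hGc⟩ := exists_open_between_and_isCompact_closure hKc hΩ Set.sdiff_subset
  intro z hz
  by_cases hzG : z ∈ G
  · refine hH.le_add hG hGc hGΩ hΩ hGΩ hs (fun x hx => hb x ⟨?_, hGΩ hx.1⟩) z hzG
    by_contra hxU
    exact hx.2 (hG.interior_eq.symm ▸ hKG ⟨hGΩ hx.1, hxU⟩)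
  · exact hb z ⟨by_contra fun hzU => hzG (hKG ⟨hz, hzU⟩), hz⟩

lemma lt_NegE {v : Cn n → EReal} {z : Cn n} {c : ℝ≥0∞} (h : v z < -(c : EReal)) : c < NegE v z := by
  by_contra! hcon
  have h1 : -v z ≤ (c : EReal) := ((le_max_right 0 _).trans_eq EReal.coe_toENNReal_eq_max.symm).trans
    (by exact_mod_cast hcon)
  exact absurd (EReal.neg_le.1 h1) (not_le.2 h)

/-- Perron-type improvement: a lower bound valid up to an additive `w` with vanishing least maximal
majorant holds without it. -/
lemma le_of_perron (hn : 2 ≤ n) (hΩ : IsOpen Ω) {w : Cn n → EReal} (hw : IsLeastMaxMajorant w 0 Ω)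
    (hwS : PSHNeg w Ω) {A G : Cn n → ℝ≥0∞} (hA : Spsh A Ω)
    (hG : ∀ z ∈ Ω, LowerSemicontinuousAt G z) (hGA : ∀ z ∈ Ω, G z ≤ A z + NegE w z)
    (himp : ∀ T : Cn n → ℝ≥0∞, Spsh T Ω → ∀ K, IsCompact K → K ⊆ Ω →
      (∀ z ∈ Ω, z ∉ K → G z ≤ A z + T z) → ∀ z ∈ Ω, G z ≤ A z + T z) :
    ∀ z ∈ Ω, G z ≤ A z := by
  classical
  let I := {T : Cn n → ℝ≥0∞ // Spsh T Ω ∧ ∀ z ∈ Ω, G z ≤ A z + T z}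
  let T := lreg (fun z => ⨅ i : I, i.1 z) Ω
  have hT : Spsh T Ω := spsh_lreg hΩ fun i : I => i.2.1
  have hGT : ∀ z ∈ Ω, G z ≤ T z + A z :=
    le_lreg_add hΩ (fun i : I => i.2.1) hA hG fun i z hz => (i.2.2 z hz).trans_eq (add_comm _ _)
  have hle : ∀ i : I, ∀ z ∈ Ω, T z ≤ i.1 z := fun i z hz =>
    (lreg_le hz).trans (iInf_le (fun i : I => i.1 z) i)
  have hmax : MaximalOn (fun z => -(T z : EReal)) Ω := by
    refine ⟨(hT.pshNeg hΩ).1, fun G0 hG0 hc hG0Ω W hW hGW v hv hb => ?_⟩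
    have hv0 : ∀ z ∈ G0, v z ≤ 0 := nonpos_of_frontier hn hG0 hc hGW hv fun z hz =>
      (hb z hz).trans (EReal.neg_le_zero.2 (EReal.coe_ennreal_nonneg _))
    have hV : Spsh (NegE v) (G0 ∩ Ω) :=
      (PSHNeg.spsh hG0 ⟨hv.mono (subset_closure.trans hGW), hv0⟩).mono Set.inter_subset_left
    let S : Cn n → ℝ≥0∞ := fun z => if z ∈ G0 then min (NegE v z) (T z) else T z
    have hS : Spsh S Ω := by
      refine Spsh.glue hΩ hG0 hT hV (S := S) (fun z _ hz => by simp [S, hz])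
        (fun z _ hz => by simp [S, hz]) fun z hz hzf => ?_
      have hzG : z ∉ G0 := fun h => hzf.2 (hG0.interior_eq.symm ▸ h)
      intro c hc'
      have hc2 : c < T z := by simpa [S, hzG] using hc'
      have hvz : v z < -(c : EReal) := (hb z hzf).trans_lt (EReal.neg_lt_neg_iff.2 (by exact_mod_cast hc2))
      have h1 : ∀ᶠ x in 𝓝 z, v x < -(c : EReal) := by
        have := hv.1 z (hGW hzf.1) (-(c : EReal)) hvz
        rwa [hW.nhdsWithin_eq (hGW hzf.1)] at this
      filter_upwards [h1, hT.1 z hz c hc2] with x hx1 hx2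
      by_cases hx : x ∈ G0
      · simpa [S, hx] using ⟨lt_NegE hx1, hx2⟩
      · simpa [S, hx] using hx2
    have hSG := himp S hS (closure G0) hc hG0Ω fun z hz hzG => by
      have : z ∉ G0 := fun h => hzG (subset_closure h)
      simpa [S, this, add_comm] using hGT z hz
    intro z hz
    have hz' := hG0Ω (subset_closure hz)
    have := hle ⟨S, hS, hSG⟩ z hz'
    simp only [S, hz, if_true] at this
    rw [← neg_neg_eq (hv0 z hz)]
    exact antitone_negCoe (this.trans (min_le_left _ _))
  intro z hz
  have h0 := hw.2.2.2 _ hmax (fun z _ => EReal.neg_le_zero.2 (EReal.coe_ennreal_nonneg _))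
    (fun z hz => by
      rw [← neg_neg_eq (hwS.2 z hz)]
      exact antitone_negCoe (hle ⟨NegE w, hwS.spsh hΩ, hGA⟩ z hz)) z hz
  have hT0 : T z = 0 := by
    have h1 : (T z : EReal) ≤ 0 := by simpa using EReal.neg_le_neg_iff.2 h0
    exact le_zero_iff.1 (by exact_mod_cast h1)
  simpa [hT0] using hGT z hz

end SoftPart

section Reduction
variable {n : ℕ} {Ω : Set (Cn n)}

lemma spsh_env (hΩ : IsOpen Ω) {𝓕 : Set (Cn n → EReal)} (h : ∀ w ∈ 𝓕, PSHNeg w Ω) :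
    Spsh (NegE (uscReg (fun z => ⨆ w ∈ 𝓕, w z) Ω)) Ω :=
  (spsh_lreg hΩ fun w : 𝓕 => (h w.1 w.2).spsh hΩ).congr hΩ fun _ hz =>
    (NegE_uscReg (fun w hw => (h w hw).2) hz).symm

lemma pshNeg_env (hΩ : IsOpen Ω) {𝓕 : Set (Cn n → EReal)} (h : ∀ w ∈ 𝓕, PSHNeg w Ω) :
    PSHNeg (uscReg (fun z => ⨆ w ∈ 𝓕, w z) Ω) Ω :=
  pshNeg_of_spsh hΩ (fun _ hz => uscReg_nonpos (fun w hw => (h w hw).2) hz) (spsh_env hΩ h)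

lemma NegE_env_le {𝓕 : Set (Cn n → EReal)} {w : Cn n → EReal} (hw : w ∈ 𝓕) {z : Cn n} (hz : z ∈ Ω) :
    NegE (uscReg (fun z => ⨆ w ∈ 𝓕, w z) Ω) z ≤ NegE w z :=
  NegE_anti ((le_iSup₂ (f := fun (w : Cn n → EReal) (_ : w ∈ 𝓕) => w z) w hw).trans
    (le_uscReg (f := fun z => ⨆ w ∈ 𝓕, w z) hz))

lemma le_env_add (hΩ : IsOpen Ω) {𝓕 : Set (Cn n → EReal)} (h : ∀ w ∈ 𝓕, PSHNeg w Ω)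
    {A G : Cn n → ℝ≥0∞} (hA : Spsh A Ω) (hG : ∀ z ∈ Ω, LowerSemicontinuousAt G z)
    (hle : ∀ w ∈ 𝓕, ∀ z ∈ Ω, G z ≤ NegE w z + A z) :
    ∀ z ∈ Ω, G z ≤ NegE (uscReg (fun z => ⨆ w ∈ 𝓕, w z) Ω) z + A z := by
  intro z hz
  rw [NegE_uscReg (fun w hw => (h w hw).2) hz]
  exact le_lreg_add hΩ (fun w : 𝓕 => (h w.1 w.2).spsh hΩ) hA hG (fun w => hle w.1 w.2) z hz

lemma NegE_gp_le (hΩ : IsOpen Ω) {φ : Cn n → EReal} (hφ0 : ∀ z ∈ Ω, φ z ≤ 0) {S : Cn n → ℝ≥0∞}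
    (hS : Spsh S Ω) {c : ℝ≥0∞} (hc : c ≠ ⊤) (h : ∀ z ∈ Ω, NegE φ z ≤ S z + c) :
    ∀ z ∈ Ω, NegE (gp φ Ω) z ≤ S z := by
  intro z hz
  have hmem : (fun z => -(S z : EReal)) ∈
      {w : Cn n → EReal | PSHNeg w Ω ∧ ∃ C : ℝ, ∀ x ∈ Ω, w x ≤ φ x + (C : EReal)} := by
    refine ⟨hS.pshNeg hΩ, c.toReal, fun x hx => ?_⟩
    rw [le_add_iff (u := fun z => -(S z : EReal)) ((hS.pshNeg hΩ).2 x hx) (hφ0 x hx) ENNReal.toReal_nonneg,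
      NegE_coe, ENNReal.ofReal_toReal hc]
    exact h x hx
  exact (NegE_env_le hmem hz).trans_eq (NegE_coe S z)

lemma Spsh.aemeasurable {U : Cn n → ℝ≥0∞} (hΩ : IsOpen Ω) (hU : Spsh U Ω) :
    AEMeasurable U (volume.restrict Ω) :=
  (aemeasurable_indicator_iff hΩ.measurableSet).1 (measurable_indicator_of_lsc hΩ hU.1).aemeasurable

lemma le_of_forall_small (hΩ : IsOpen Ω) {B G : Cn n → ℝ≥0∞} (hB : Spsh B Ω)
    (hG : ∀ z ∈ Ω, LowerSemicontinuousAt G z)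
    (h : ∀ ε : ℝ≥0∞, ε ≠ 0 → ∃ U, Spsh U Ω ∧ (∀ z ∈ Ω, G z ≤ B z + U z) ∧ ∫⁻ z in Ω, U z ≤ ε) :
    ∀ z ∈ Ω, G z ≤ B z := by
  choose U hU hGU hIn using fun k : ℕ => h ((k : ℝ≥0∞) + 1)⁻¹ (by simp)
  refine hB.le_of_ae hΩ hG ?_
  have h0 : ∫⁻ z in Ω, ⨅ k, U k z = 0 := by
    refine le_zero_iff.1 (le_of_forall_gt_imp_ge_of_dense fun ε hε => ?_)
    obtain ⟨k, hk⟩ := ENNReal.exists_inv_nat_lt hε.ne'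
    refine (lintegral_mono fun z => iInf_le (fun k => U k z) k).trans ((hIn k).trans (le_trans ?_ hk.le))
    exact ENNReal.inv_le_inv.2 le_self_add
  rw [lintegral_eq_zero_iff' (AEMeasurable.iInf fun k => (hU k).aemeasurable hΩ)] at h0
  filter_upwards [h0, ae_restrict_mem hΩ.measurableSet] with z hz hzΩ
  have h1 : G z ≤ ⨅ k, (B z + U k z) := le_iInf fun k => hGU k z hzΩ
  rw [← ENNReal.add_iInf] at h1
  simpa [hz] using h1

/-- The rooftop identity follows once the least maximal majorant `H` has, up to bounded terms on
compact sets, minorants of arbitrarily small total size. -/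
theorem gp_eq_rooftop_of_small (hΩ : IsOpen Ω) (hn : 2 ≤ n) (hΩb : Bornology.IsBounded Ω)
    {φ H : Cn n → EReal} (hH : IsLeastMaxMajorant φ H Ω) (hφ : InClassRel n Ω (ClassN n Ω) H φ)
    (hidem : Set.EqOn (gp (gp φ Ω) Ω) (gp φ Ω) Ω)
    (hsmall : ∀ ε : ℝ≥0∞, ε ≠ 0 → ∃ U, Spsh U Ω ∧ (∀ K, IsCompact K → K ⊆ Ω → ∃ C : ℝ≥0∞, C ≠ ⊤ ∧
      ∀ z ∈ K, NegE H z ≤ U z + C) ∧ ∫⁻ z in Ω, U z ≤ ε) :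
    Set.EqOn (gp φ Ω) (Rooftop (gpO φ Ω) (gpB φ Ω) Ω) Ω := by
  obtain ⟨⟨hφS, -⟩, w, ⟨⟨hwS, -⟩, hw0⟩, hwφ⟩ := hφ
  obtain ⟨hHmax, hH0, hφH, -⟩ := hH
  have hφ0 := hφS.2
  have hHS : PSHNeg H Ω := ⟨hHmax.1, hH0⟩
  have hsHH := hHS.spsh hΩ
  have hsW := hwS.spsh hΩ
  have hΦ : ∀ z ∈ Ω, NegE φ z ≤ NegE H z + NegE w z := fun z hz =>
    NegE_le_add (hH0 z hz) (hwS.2 z hz) (hwφ z hz).1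
  have hHΦ : ∀ z ∈ Ω, NegE H z ≤ NegE φ z := fun z hz => NegE_anti (hφH z hz)
  have hgS : PSHNeg (gp φ Ω) Ω := pshNeg_env hΩ fun w hw => hw.1
  have hgoS : PSHNeg (gpO φ Ω) Ω := pshNeg_env hΩ fun w hw => hw.1
  have hgbS : PSHNeg (gpB φ Ω) Ω := pshNeg_env hΩ fun w hw => hw.1
  have hsG := hgS.spsh hΩ
  have hgo : ∀ z ∈ Ω, gp φ Ω z ≤ gpO φ Ω z := fun z hz => by
    refine uscReg_le (fun x hx => iSup₂_le fun w hw => ?_) hgoS.1.1 hz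
    refine le_trans ?_ (le_uscReg hx)
    obtain ⟨h1, C, h2⟩ := hw
    exact le_iSup₂ (f := fun (w : Cn n → EReal) (_ : w ∈ {w : Cn n → EReal | PSHNeg w Ω ∧
      ∀ a ∈ Ω, ∃ U ∈ nhds a, ∃ C : ℝ, ∀ x ∈ U ∩ Ω, w x ≤ φ x + (C : EReal)}) => w x) w
      ⟨h1, fun a _ => ⟨Set.univ, univ_mem, C, fun x hx => h2 x hx.2⟩⟩
  have hgb : ∀ z ∈ Ω, gp φ Ω z ≤ gpB φ Ω z := fun z hz => by
    refine uscReg_le (fun x hx => iSup₂_le fun w hw => ?_) hgbS.1.1 hz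
    refine le_trans ?_ (le_uscReg hx)
    obtain ⟨h1, C, h2⟩ := hw
    exact le_iSup₂ (f := fun (w : Cn n → EReal) (_ : w ∈ {w : Cn n → EReal | PSHNeg w Ω ∧
      ∃ U : Set (Cn n), IsOpen U ∧ frontier Ω ⊆ U ∧
        ∃ C : ℝ, ∀ x ∈ U ∩ Ω, w x ≤ φ x + (C : EReal)}) => w x) w
      ⟨h1, Set.univ, isOpen_univ, Set.subset_univ _, C, fun x hx => h2 x hx.2⟩
  have hGΦ : ∀ z ∈ Ω, NegE (gp φ Ω) z ≤ NegE φ z :=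
    NegE_gp_le hΩ hφ0 (hφS.spsh hΩ) ENNReal.zero_ne_top fun z _ => by simp
  have hGG : ∀ S, Spsh S Ω → ∀ c : ℝ≥0∞, c ≠ ⊤ → (∀ z ∈ Ω, NegE (gp φ Ω) z ≤ S z + c) →
      ∀ z ∈ Ω, NegE (gp φ Ω) z ≤ S z := fun S hS c hc h z hz => by
    have := NegE_gp_le hΩ hgS.2 hS hc h z hz
    rwa [NegE, hidem hz] at this
  -- comparison with the boundary envelope
  have hGb : ∀ z ∈ Ω, NegE (gp φ Ω) z ≤ NegE (gpB φ Ω) z + NegE w z := by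
    refine le_env_add hΩ (fun w hw => hw.1) hsW hsG.1 fun s hs => ?_
    obtain ⟨hsS, U, hU, hfU, C, hC⟩ := hs
    have hsH : ∀ z ∈ Ω, s z ≤ H z + ((max C 0 : ℝ) : EReal) :=
      hHmax.le_add_of_boundary hΩ hΩb hsS.1 hU hfU fun z hz => (hC z hz).trans
        (add_le_add (hφH z hz.2) (by exact_mod_cast le_max_left C 0))
    refine hGG _ ((hsS.spsh hΩ).add hsW) (ENNReal.ofReal (max C 0)) ENNReal.ofReal_ne_top fun z hz => ?_
    have h1 := (le_add_iff (hsS.2 z hz) (hH0 z hz) (le_max_right C 0)).1 (hsH z hz)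
    calc _ ≤ NegE H z + NegE w z := (hGΦ z hz).trans (hΦ z hz)
      _ ≤ NegE s z + ENNReal.ofReal (max C 0) + NegE w z := by gcongr
      _ = _ := by ring
  -- comparison with the interior envelope
  have hGo : ∀ z ∈ Ω, NegE (gp φ Ω) z ≤ NegE (gpO φ Ω) z + NegE H z := by
    refine le_env_add hΩ (fun w hw => hw.1) hsHH hsG.1 fun s hs => ?_
    obtain ⟨hsS, hloc⟩ := hs
    have hsS' := hsS.spsh hΩ
    refine le_of_perron hn hΩ hw0 hwS (hsS'.add hsHH) hsG.1 (fun z hz => ?_) fun T hT K hK hKΩ hTK => ?_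
    · refine ((hGΦ z hz).trans (hΦ z hz)).trans ?_
      gcongr
      exact le_add_self
    have hKC : ∃ C : ℝ≥0∞, C ≠ ⊤ ∧ ∀ z ∈ K, NegE φ z ≤ NegE s z + C := by
      refine hK.induction_on (p := fun K => ∃ C : ℝ≥0∞, C ≠ ⊤ ∧ ∀ z ∈ K, NegE φ z ≤ NegE s z + C)
        ⟨0, by simp, by simp⟩ ?_ ?_ ?_
      · rintro A B hAB ⟨C, h1, h2⟩
        exact ⟨C, h1, fun z hz => h2 z (hAB hz)⟩
      · rintro A B ⟨C, h1, h2⟩ ⟨C', h1', h2'⟩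
        refine ⟨C + C', by simp [h1, h1'], fun z hz => ?_⟩
        rcases hz with hz | hz
        · exact (h2 z hz).trans (by gcongr; exact le_self_add)
        · exact (h2' z hz).trans (by gcongr; exact le_add_self)
      · intro a ha
        obtain ⟨U, hU, C, hC⟩ := hloc a (hKΩ ha)
        refine ⟨U ∩ K, inter_mem (mem_nhdsWithin_of_mem_nhds hU) self_mem_nhdsWithin,
          ENNReal.ofReal (max C 0), ENNReal.ofReal_ne_top, fun z hz => ?_⟩
        have hzΩ := hKΩ hz.2
        refine (le_add_iff (hsS.2 z hzΩ) (hφ0 z hzΩ) (le_max_right C 0)).1 ((hC z ⟨hz.1, hzΩ⟩).trans ?_)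
        exact add_le_add le_rfl (by exact_mod_cast le_max_left C 0)
    obtain ⟨C, hC, hKC⟩ := hKC
    refine hGG _ ((hsS'.add hsHH).add hT) C hC fun z hz => ?_
    by_cases hzK : z ∈ K
    · refine ((hGΦ z hz).trans (hKC z hzK)).trans ?_
      gcongr
      rw [add_assoc]
      exact le_self_add
    · exact (hTK z hz hzK).trans le_self_add
  intro z hz
  refine le_antisymm ?_ ?_
  · refine le_trans ?_ (le_uscReg hz)
    exact le_iSup₂ (f := fun (v : Cn n → EReal) (_ : v ∈ {v : Cn n → EReal | PlurisubharmonicOn v Ω ∧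
      ∀ x ∈ Ω, v x ≤ min (gpO φ Ω x) (gpB φ Ω x)}) => v z) (gp φ Ω)
      ⟨hgS.1, fun x hx => le_min (hgo x hx) (hgb x hx)⟩
  refine uscReg_le (fun x hx => iSup₂_le fun v hv => ?_) hgS.1.1 hz
  obtain ⟨hv, hvle⟩ := hv
  have hvS : PSHNeg v Ω := ⟨hv, fun y hy => (hvle y hy).trans ((min_le_left _ _).trans (hgoS.2 y hy))⟩
  have hvo : ∀ y ∈ Ω, NegE (gpO φ Ω) y ≤ NegE v y := fun y hy =>
    NegE_anti ((hvle y hy).trans (min_le_left _ _))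
  have hvb : ∀ y ∈ Ω, NegE (gpB φ Ω) y ≤ NegE v y := fun y hy =>
    NegE_anti ((hvle y hy).trans (min_le_right _ _))
  have hsv := hvS.spsh hΩ
  refine le_of_NegE (hvS.2 x hx) (hgS.2 x hx) ?_
  refine le_of_perron hn hΩ hw0 hwS hsv hsG.1 (fun y hy => (hGb y hy).trans (by gcongr; exact hvb y hy))
    (fun T hT K hK hKΩ hTK => ?_) x hx
  refine le_of_forall_small hΩ (hsv.add hT) hsG.1 fun ε hε => ?_
  obtain ⟨U, hU, hUK, hIn⟩ := hsmall ε hε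
  refine ⟨U, hU, ?_, hIn⟩
  obtain ⟨C, hC, hKC⟩ := hUK K hK hKΩ
  refine hGG _ ((hsv.add hT).add hU) C hC fun y hy => ?_
  by_cases hyK : y ∈ K
  · calc _ ≤ NegE v y + (U y + C) := (hGo y hy).trans (add_le_add (hvo y hy) (hKC y hyK))
      _ ≤ NegE v y + (U y + C) + T y := le_self_add
      _ = _ := by ring
  · refine (hTK y hy hyK).trans ?_
    rw [add_assoc _ (U y)]
    exact le_self_add

end Reduction

section Patching
variable {n : ℕ} {Ω : Set (Cn n)}

lemma small_of_local (hΩ : IsOpen Ω) (hne : Ω.Nonempty) {F : Cn n → ℝ≥0∞}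
    (hloc : ∀ z0 ∈ Ω, ∃ V, IsOpen V ∧ z0 ∈ V ∧ ∀ ε : ℝ≥0∞, ε ≠ 0 → ∃ T, Spsh T Ω ∧
      (∃ C : ℝ≥0∞, C ≠ ⊤ ∧ ∀ z ∈ V, F z ≤ T z + C) ∧ ∫⁻ z in Ω, T z ≤ ε) {ε : ℝ≥0∞} (hε : ε ≠ 0) :
    ∃ U, Spsh U Ω ∧ (∀ K, IsCompact K → K ⊆ Ω → ∃ C : ℝ≥0∞, C ≠ ⊤ ∧
      ∀ z ∈ K, F z ≤ U z + C) ∧ ∫⁻ z in Ω, U z ≤ ε := by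
  choose! V hV hzV hVT using hloc
  obtain ⟨S, hSc, hSu⟩ := TopologicalSpace.isOpen_iUnion_countable (fun z : Ω => V z) fun z => hV z z.2
  have hSne : S.Nonempty := by
    obtain ⟨z, hz⟩ := hne
    have : z ∈ ⋃ i ∈ S, V i := hSu ▸ Set.mem_iUnion.2 ⟨⟨z, hz⟩, hzV z hz⟩
    obtain ⟨i, hi, -⟩ := Set.mem_iUnion₂.1 this
    exact ⟨i, hi⟩
  obtain ⟨f, rfl⟩ := hSc.exists_eq_range hSne
  rw [Set.biUnion_range] at hSu
  obtain ⟨ε', hε', hsum⟩ := ENNReal.exists_pos_sum_of_countable' hε ℕ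
  choose T hT hTC hIn using fun k : ℕ => hVT (f k) (f k).2 (ε' k) (hε' k).ne'
  choose C hC hVF using hTC
  refine ⟨fun z => ∑' k, T k z, Spsh.tsum hT, fun K hK hKΩ => ?_, ?_⟩
  · obtain ⟨t, ht⟩ := hK.elim_finite_subcover (fun k => V (f k)) (fun k => hV _ (f k).2) (by
      rw [hSu]
      exact fun z hz => Set.mem_iUnion.2 ⟨⟨z, hKΩ hz⟩, hzV z (hKΩ hz)⟩)
    refine ⟨∑ k ∈ t, C k, by simp [hC], fun z hz => ?_⟩
    obtain ⟨k, hk, hzk⟩ := Set.mem_iUnion₂.1 (ht hz)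
    refine (hVF k z hzk).trans (add_le_add (ENNReal.le_tsum k) ?_)
    exact Finset.single_le_sum (f := C) (fun _ _ => zero_le) hk
  · rw [lintegral_tsum fun k => (hT k).aemeasurable hΩ]
    exact (ENNReal.tsum_le_tsum hIn).trans hsum.le

end Patching

section DetDeriv

variable {E : Type*} [NormedAddCommGroup E] [NormedSpace ℝ E] {n : ℕ}

theorem det_updateCol_eq_sum (A : Matrix (Fin n) (Fin n) ℂ) (i : Fin n) (c : Fin n → ℂ) :
    (A.updateCol i c).det = ∑ j, A.adjugate i j * c j := by
  rw [← Matrix.cramer_apply, Matrix.cramer_eq_adjugate_mulVec]; rfl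

theorem fderiv_det {M : E → Matrix (Fin n) (Fin n) ℂ} {z : E}
    (hM : ∀ a b, DifferentiableAt ℝ (fun x => M x a b) z) (v : E) :
    fderiv ℝ (fun x => (M x).det) z v
      = ∑ i, ((M z).updateCol i (fun a => fderiv ℝ (fun x => M x a i) z v)).det := by
  have h1 : HasFDerivAt (fun x => (M x).det)
      (∑ σ : Equiv.Perm (Fin n), ((Equiv.Perm.sign σ : ℤ) : ℂ) •
        ∑ i, (∏ j ∈ Finset.univ.erase i, M z (σ j) j) •
          fderiv ℝ (fun x => M x (σ i) i) z) z := by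
    simp only [Matrix.det_apply']
    refine HasFDerivAt.fun_sum fun σ _ => ?_
    refine HasFDerivAt.const_mul ?_ _
    exact HasFDerivAt.finsetProd fun i _ => (hM (σ i) i).hasFDerivAt
  rw [h1.fderiv]
  simp only [Matrix.det_apply', sum_apply, smul_apply,
    smul_eq_mul, Finset.mul_sum]
  rw [Finset.sum_comm]
  refine Finset.sum_congr rfl fun i _ => Finset.sum_congr rfl fun σ _ => ?_
  congr 1
  rw [← Finset.mul_prod_erase _ _ (Finset.mem_univ i), mul_comm]
  congr 1
  · simp
  · refine Finset.prod_congr rfl fun j hj => ?_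
    rw [Matrix.updateCol_ne (Finset.ne_of_mem_erase hj)]

theorem ContDiff.matrix_det {M : E → Matrix (Fin n) (Fin n) ℂ}
    (hM : ∀ a b, ContDiff ℝ (⊤ : ℕ∞) (fun x => M x a b)) :
    ContDiff ℝ (⊤ : ℕ∞) (fun x => (M x).det) := by
  simp only [Matrix.det_apply']
  exact ContDiff.sum fun σ _ => contDiff_const.mul (contDiff_prod fun i _ => hM _ _)

theorem contDiff_updateCol {M : E → Matrix (Fin n) (Fin n) ℂ}
    (hM : ∀ a b, ContDiff ℝ (⊤ : ℕ∞) (fun x => M x a b)) (i : Fin n) {c : E → Fin n → ℂ}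
    (hc : ∀ a, ContDiff ℝ (⊤ : ℕ∞) (fun x => c x a)) (a b : Fin n) :
    ContDiff ℝ (⊤ : ℕ∞) (fun x => (M x).updateCol i (c x) a b) := by
  by_cases h : b = i
  · subst h; simpa using hc a
  · simpa [Matrix.updateCol_ne h] using hM a b

theorem adjugate_eq_det_updateCol (A : Matrix (Fin n) (Fin n) ℂ) (i j : Fin n) :
    A.adjugate i j = (A.updateCol i (Pi.single j 1)).det := by
  rw [det_updateCol_eq_sum]; simp [Pi.single_apply]

theorem ContDiff.matrix_adjugate {M : E → Matrix (Fin n) (Fin n) ℂ}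
    (hM : ∀ a b, ContDiff ℝ (⊤ : ℕ∞) (fun x => M x a b)) (i j : Fin n) :
    ContDiff ℝ (⊤ : ℕ∞) (fun x => (M x).adjugate i j) := by
  simp only [adjugate_eq_det_updateCol]
  exact ContDiff.matrix_det (contDiff_updateCol hM i fun a => contDiff_const)

end DetDeriv

section Wirtinger

variable {n : ℕ}

/-- The operators `∂_j` (for `s = -1`) and `∂̄_j` (for `s = 1`). -/
def dop (s : ℂ) (j : Fin n) (F : Cn n → ℂ) (z : Cn n) : ℂ :=
  (1 / 2 : ℂ) * (fderiv ℝ F z (Pi.single j (1 : ℂ)) +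
    s * Complex.I * fderiv ℝ F z (Pi.single j Complex.I))

theorem ContDiff.fderiv_dir {F : Type*} [NormedAddCommGroup F] [NormedSpace ℝ F]
    {f : Cn n → F} (hf : ContDiff ℝ (⊤ : ℕ∞) f) (v : Cn n) :
    ContDiff ℝ (⊤ : ℕ∞) (fun z => fderiv ℝ f z v) :=
  (hf.fderiv_right (m := (⊤ : ℕ∞)) (by simp)).clm_apply contDiff_const

theorem ContDiff.dop {F : Cn n → ℂ} (hF : ContDiff ℝ (⊤ : ℕ∞) F) (s : ℂ) (j : Fin n) :
    ContDiff ℝ (⊤ : ℕ∞) (dop s j F) :=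
  contDiff_const.mul ((hF.fderiv_dir _).add (contDiff_const.mul (hF.fderiv_dir _)))

theorem fderiv_fderiv_comm {F : Type*} [NormedAddCommGroup F] [NormedSpace ℝ F]
    {f : Cn n → F} (hf : ContDiff ℝ (⊤ : ℕ∞) f) (z v w : Cn n) :
    fderiv ℝ (fun x => fderiv ℝ f x w) z v = fderiv ℝ (fun x => fderiv ℝ f x v) z w := by
  have hd : DifferentiableAt ℝ (fderiv ℝ f) z :=
    ((hf.fderiv_right (m := (⊤ : ℕ∞)) (by simp)).differentiable (by simp)) z
  have hs : IsSymmSndFDerivAt ℝ f z := by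
    refine ContDiffAt.isSymmSndFDerivAt (n := (⊤ : ℕ∞)) hf.contDiffAt ?_
    rw [minSmoothness_of_isRCLikeNormedField]; exact WithTop.coe_le_coe.2 (le_top : (2 : ℕ∞) ≤ ⊤)
  have e : ∀ a b : Cn n, fderiv ℝ (fun x => fderiv ℝ f x b) z a = fderiv ℝ (fderiv ℝ f) z a b := by
    intro a b
    rw [fderiv_clm_apply hd (by fun_prop)]; simp
  rw [e, e]; exact hs v w

theorem dop_comm {F : Cn n → ℂ} (hF : ContDiff ℝ (⊤ : ℕ∞) F) (s t : ℂ) (j k : Fin n) :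
    dop s j (dop t k F) = dop t k (dop s j F) := by
  have e : ∀ (s : ℂ) (j : Fin n) (v z : Cn n), fderiv ℝ (dop s j F) z v =
      (1 / 2 : ℂ) * (fderiv ℝ (fun x => fderiv ℝ F x (Pi.single j (1 : ℂ))) z v +
        s * Complex.I * fderiv ℝ (fun x => fderiv ℝ F x (Pi.single j Complex.I)) z v) := by
    intro s j v z
    have d1 := ((hF.fderiv_dir (Pi.single j (1 : ℂ))).differentiable (by simp)) z
    have d2 := ((hF.fderiv_dir (Pi.single j Complex.I)).differentiable (by simp)) z
    have : HasFDerivAt (dop s j F) _ z :=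
      (d1.hasFDerivAt.add (d2.hasFDerivAt.const_mul (s * Complex.I))).const_mul (1 / 2 : ℂ)
    rw [this.fderiv]
    simp [smul_eq_mul, mul_add]
  ext z
  rw [dop, dop]
  rw [e, e, e, e]
  rw [fderiv_fderiv_comm hF z (Pi.single k 1), fderiv_fderiv_comm hF z (Pi.single k Complex.I),
    fderiv_fderiv_comm hF z (Pi.single k 1) (Pi.single j Complex.I),
    fderiv_fderiv_comm hF z (Pi.single k Complex.I) (Pi.single j Complex.I)]
  ring

theorem dop_mul {F G : Cn n → ℂ} {z : Cn n} (hF : DifferentiableAt ℝ F z)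
    (hG : DifferentiableAt ℝ G z) (s : ℂ) (j : Fin n) :
    dop s j (fun x => F x * G x) z = dop s j F z * G z + F z * dop s j G z := by
  simp only [dop, fderiv_fun_mul hF hG]
  simp; ring

theorem dop_det {M : Cn n → Matrix (Fin n) (Fin n) ℂ} {z : Cn n}
    (hM : ∀ a b, DifferentiableAt ℝ (fun x => M x a b) z) (s : ℂ) (l : Fin n) :
    dop s l (fun x => (M x).det) z
      = ∑ i, ((M z).updateCol i (fun a => dop s l (fun x => M x a i) z)).det := by
  simp only [dop, fderiv_det hM, det_updateCol_eq_sum, Finset.mul_sum, ← Finset.sum_add_distrib]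
  refine Finset.sum_congr rfl fun i _ => Finset.sum_congr rfl fun j _ => ?_
  ring

theorem piola {M : Cn n → Matrix (Fin n) (Fin n) ℂ}
    (hM : ∀ a b, ContDiff ℝ (⊤ : ℕ∞) (fun x => M x a b)) (s : ℂ) (j : Fin n)
    (hsymm : ∀ a i l, dop s i (fun x => M x a l) = dop s l (fun x => M x a i)) (z : Cn n) :
    ∑ i, dop s i (fun x => (M x).adjugate i j) z = 0 := by
  simp only [adjugate_eq_det_updateCol]
  have hd : ∀ a b, DifferentiableAt ℝ (fun x => M x a b) z := fun a b =>
    ((hM a b).differentiable (by simp)) z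
  have hd' : ∀ i a b, DifferentiableAt ℝ
      (fun x => (M x).updateCol i (Pi.single j (1 : ℂ)) a b) z := fun i a b =>
    ((contDiff_updateCol hM i (c := fun _ => Pi.single j (1 : ℂ))
      (fun a => contDiff_const) a b).differentiable (by simp)) z
  have e : ∀ i, dop s i (fun x => ((M x).updateCol i (Pi.single j (1 : ℂ))).det) z
      = ∑ l, if l = i then 0 else
        (((M z).updateCol i (Pi.single j (1 : ℂ))).updateCol l
          (fun a => dop s i (fun x => M x a l) z)).det := by
    intro i
    rw [dop_det (hd' i)]
    refine Finset.sum_congr rfl fun l _ => ?_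
    split_ifs with h
    · subst h
      apply Matrix.det_eq_zero_of_column_eq_zero l
      intro a
      simp [dop]
    · simp [Matrix.updateCol_ne h]
  simp only [e]
  set T : Fin n → Fin n → ℂ := fun i l => if l = i then 0 else
        (((M z).updateCol i (Pi.single j (1 : ℂ))).updateCol l
          (fun a => dop s i (fun x => M x a l) z)).det with hT
  have anti : ∀ i l, T i l = - T l i := by
    intro i l
    simp only [hT]
    by_cases h : l = i
    · simp [h]
    rw [if_neg h, if_neg (Ne.symm h)]
    have hp := Matrix.det_permute' (Equiv.swap i l)
      (((M z).updateCol l (Pi.single j (1 : ℂ))).updateCol i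
          (fun a => dop s l (fun x => M x a i) z))
    rw [Equiv.Perm.sign_swap (Ne.symm h)] at hp
    have : (((M z).updateCol i (Pi.single j (1 : ℂ))).updateCol l
          (fun a => dop s i (fun x => M x a l) z)) =
        (((M z).updateCol l (Pi.single j (1 : ℂ))).updateCol i
          (fun a => dop s l (fun x => M x a i) z)).submatrix id (Equiv.swap i l) := by
      ext a b
      simp only [Matrix.submatrix_apply, id, Matrix.updateCol_apply, hsymm a i l]
      by_cases hb : b = l
      · subst hb; simp
      by_cases hb' : b = i
      · subst hb'; simp [h, hb]
      · rw [Equiv.swap_apply_of_ne_of_ne hb' hb]; simp [hb, hb']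
    rw [this, hp]; simp
  have hS : ∑ i, ∑ l, T i l = - ∑ i, ∑ l, T i l := by
    conv_lhs => rw [Finset.sum_comm]
    rw [← Finset.sum_neg_distrib]
    refine Finset.sum_congr rfl fun i _ => ?_
    rw [← Finset.sum_neg_distrib]
    exact Finset.sum_congr rfl fun l _ => anti l i
  have : (2 : ℂ) * ∑ i, ∑ l, T i l = 0 := by linear_combination hS
  simpa using this

theorem HasCompactSupport.fderiv_dir {f : Cn n → ℂ} (hf : HasCompactSupport f) (v : Cn n) :
    HasCompactSupport (fun z => fderiv ℝ f z v) :=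
  (hf.fderiv (𝕜 := ℝ)).comp_left (g := fun L : Cn n →L[ℝ] ℂ => L v) rfl

theorem HasCompactSupport.dop {f : Cn n → ℂ} (hf : HasCompactSupport f) (s : ℂ) (j : Fin n) :
    HasCompactSupport (dop s j f) :=
  HasCompactSupport.mul_left (((hf.fderiv_dir _).add ((hf.fderiv_dir _).mul_left)))

theorem integral_mul_dop {F G : Cn n → ℂ} (hF : ContDiff ℝ (⊤ : ℕ∞) F)
    (hG : ContDiff ℝ (⊤ : ℕ∞) G) (hc : HasCompactSupport G) (s : ℂ) (j : Fin n) :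
    ∫ z, F z * dop s j G z = - ∫ z, dop s j F z * G z := by
  have hv : ∀ v : Cn n, ∫ z, F z * fderiv ℝ G z v = - ∫ z, fderiv ℝ F z v * G z := by
    intro v
    refine integral_mul_fderiv_eq_neg_fderiv_mul_of_integrable ?_ ?_ ?_
      (fun x _ => (hF.differentiable (by simp)) x) (fun x _ => (hG.differentiable (by simp)) x)
    · exact ((hF.fderiv_dir v).continuous.mul hG.continuous).integrable_of_hasCompactSupport
        hc.mul_left
    · exact (hF.continuous.mul (hG.fderiv_dir v).continuous).integrable_of_hasCompactSupport
        (hc.fderiv_dir v).mul_left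
    · exact (hF.continuous.mul hG.continuous).integrable_of_hasCompactSupport hc.mul_left
  have hi : ∀ v : Cn n, Integrable (fun z => F z * fderiv ℝ G z v) := fun v =>
    (hF.continuous.mul (hG.fderiv_dir v).continuous).integrable_of_hasCompactSupport
        (hc.fderiv_dir v).mul_left
  have hi' : ∀ v : Cn n, Integrable (fun z => fderiv ℝ F z v * G z) := fun v =>
    ((hF.fderiv_dir v).continuous.mul hG.continuous).integrable_of_hasCompactSupport
        hc.mul_left
  have e1 : (fun z => F z * dop s j G z) = fun z => (1 / 2 : ℂ) *
      (F z * fderiv ℝ G z (Pi.single j 1)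
        + s * Complex.I * (F z * fderiv ℝ G z (Pi.single j Complex.I))) := by
    ext z; simp only [_root_.dop]; ring
  have e2 : (fun z => dop s j F z * G z) = fun z => (1 / 2 : ℂ) *
      (fderiv ℝ F z (Pi.single j 1) * G z
        + s * Complex.I * (fderiv ℝ F z (Pi.single j Complex.I) * G z)) := by
    ext z; simp only [_root_.dop]; ring
  rw [e1, e2, integral_const_mul, integral_const_mul,
    integral_add (hi _) ((hi _).const_mul _), integral_add (hi' _) ((hi' _).const_mul _),
    integral_const_mul, integral_const_mul, hv, hv]
  ring

theorem dop_fun_sum {ι : Type*} (S : Finset ι) {F : ι → Cn n → ℂ} {z : Cn n}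
    (hF : ∀ i ∈ S, DifferentiableAt ℝ (F i) z) (s : ℂ) (j : Fin n) :
    dop s j (fun x => ∑ i ∈ S, F i x) z = ∑ i ∈ S, dop s j (F i) z := by
  simp only [dop, fderiv_fun_sum hF]
  simp [Finset.sum_add_distrib, Finset.mul_sum, mul_add]

theorem integral_adjugate_symm {M : Cn n → Matrix (Fin n) (Fin n) ℂ}
    (hM : ∀ a b, ContDiff ℝ (⊤ : ℕ∞) (fun x => M x a b))
    (hcol : ∀ a i l, dop 1 i (fun x => M x a l) = dop 1 l (fun x => M x a i))
    (hrow : ∀ a i l, dop (-1) i (fun x => M x l a) = dop (-1) l (fun x => M x i a))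
    {T w : Cn n → ℂ} (hT : ContDiff ℝ (⊤ : ℕ∞) T) (hw : ContDiff ℝ (⊤ : ℕ∞) w)
    (hc : HasCompactSupport w) :
    ∫ z, T z * ∑ k, ∑ j, (M z).adjugate k j * dop (-1) j (dop 1 k w) z
      = ∫ z, w z * ∑ k, ∑ j, (M z).adjugate k j * dop (-1) j (dop 1 k T) z := by
  have ha : ∀ k j, ContDiff ℝ (⊤ : ℕ∞) (fun x => (M x).adjugate k j) := fun k j =>
    ContDiff.matrix_adjugate hM k j
  have hd : ∀ {F : Cn n → ℂ}, ContDiff ℝ (⊤ : ℕ∞) F → ∀ z, DifferentiableAt ℝ F z :=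
    fun h z => (h.differentiable (by simp)) z
  have pc : ∀ j z, ∑ k, dop 1 k (fun x => (M x).adjugate k j) z = 0 := fun j z =>
    piola hM 1 j hcol z
  have pr : ∀ k z, ∑ j, dop (-1) j (fun x => (M x).adjugate k j) z = 0 := fun k z => by
    have := piola (M := fun x => (M x).transpose) (fun a b => hM b a) (-1) k
      (fun a i l => hrow a i l) z
    simpa [← Matrix.adjugate_transpose] using this
  have step1 : ∀ k, ∫ z, ∑ j, (T z * (M z).adjugate k j) * dop (-1) j (dop 1 k w) z
      = - ∫ z, (∑ j, dop (-1) j T z * (M z).adjugate k j) * dop 1 k w z := by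
    intro k
    rw [integral_finsetSum]
    · have : ∀ j, ∫ z, (T z * (M z).adjugate k j) * dop (-1) j (dop 1 k w) z
        = - ∫ z, dop (-1) j (fun z => T z * (M z).adjugate k j) z * dop 1 k w z := fun j =>
        integral_mul_dop (hT.mul (ha k j)) (hw.dop 1 k) (hc.dop 1 k) _ _
      simp only [this, Finset.sum_neg_distrib]
      rw [← integral_finsetSum]
      · congr 2
        ext z
        rw [← Finset.sum_mul]
        congr 1
        have : ∀ j, dop (-1) j (fun z => T z * (M z).adjugate k j) z
          = dop (-1) j T z * (M z).adjugate k j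
            + T z * dop (-1) j (fun z => (M z).adjugate k j) z := fun j =>
          dop_mul (hd hT z) (hd (ha k j) z) _ _
        simp only [this, Finset.sum_add_distrib, ← Finset.mul_sum, pr k z, mul_zero, add_zero]
      · intro j _
        exact (((hT.mul (ha k j)).dop (-1) j).continuous.mul
          (hw.dop 1 k).continuous).integrable_of_hasCompactSupport (hc.dop 1 k).mul_left
    · intro j _
      exact ((hT.mul (ha k j)).continuous.mul
          ((hw.dop 1 k).dop (-1) j).continuous).integrable_of_hasCompactSupport
          ((hc.dop 1 k).dop (-1) j).mul_left
  have hS : ∀ k, ContDiff ℝ (⊤ : ℕ∞) (fun z => ∑ j, dop (-1) j T z * (M z).adjugate k j) :=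
    fun k => ContDiff.sum fun j _ => (hT.dop (-1) j).mul (ha k j)
  have step2 : ∀ k, ∫ z, (∑ j, dop (-1) j T z * (M z).adjugate k j) * dop 1 k w z
      = - ∫ z, dop 1 k (fun z => ∑ j, dop (-1) j T z * (M z).adjugate k j) z * w z := fun k =>
    integral_mul_dop (hS k) hw hc _ _
  have eL : (fun z => T z * ∑ k, ∑ j, (M z).adjugate k j * dop (-1) j (dop 1 k w) z)
      = fun z => ∑ k, ∑ j, (T z * (M z).adjugate k j) * dop (-1) j (dop 1 k w) z := by
    ext z; simp only [Finset.mul_sum, mul_assoc]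
  rw [eL, integral_finsetSum]
  · simp only [step1, step2, neg_neg]
    rw [← integral_finsetSum]
    · congr 1
      ext z
      rw [← Finset.sum_mul, mul_comm]
      congr 1
      have : ∀ k, dop 1 k (fun z => ∑ j, dop (-1) j T z * (M z).adjugate k j) z
          = ∑ j, (dop 1 k (dop (-1) j T) z * (M z).adjugate k j
            + dop (-1) j T z * dop 1 k (fun z => (M z).adjugate k j) z) := by
        intro k
        rw [dop_fun_sum _ (fun j _ => hd ((hT.dop (-1) j).mul (ha k j)) z)]
        exact Finset.sum_congr rfl fun j _ => dop_mul (hd (hT.dop (-1) j) z) (hd (ha k j) z) _ _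
      simp only [this, Finset.sum_add_distrib]
      have h0 : ∑ k, ∑ j, dop (-1) j T z * dop 1 k (fun z => (M z).adjugate k j) z = 0 := by
        rw [Finset.sum_comm]
        simp only [← Finset.mul_sum, pc, mul_zero, Finset.sum_const_zero]
      rw [h0, add_zero]
      refine Finset.sum_congr rfl fun k _ => Finset.sum_congr rfl fun j _ => ?_
      rw [dop_comm hT, mul_comm]
    · intro k _
      exact (((hS k).dop 1 k).continuous.mul hw.continuous).integrable_of_hasCompactSupport
        hc.mul_left
  · intro k _
    refine integrable_finsetSum _ fun j _ => ?_
    exact ((hT.mul (ha k j)).continuous.mul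
          ((hw.dop 1 k).dop (-1) j).continuous).integrable_of_hasCompactSupport
          ((hc.dop 1 k).dop (-1) j).mul_left

end Wirtinger

section Levi

open scoped ComplexOrder

variable {n : ℕ}

/-- The complex Hessian matrix of `u` at `z`. -/
def Lv (n : ℕ) (u : Cn n → ℝ) (z : Cn n) : Matrix (Fin n) (Fin n) ℂ :=
  Matrix.of fun j k => cHessEntry n u z j k

theorem maDensity_eq (u : Cn n → ℝ) (z : Cn n) :
    maDensity n u z = (4 : ℝ) ^ n * (n.factorial : ℝ) * (Lv n u z).det.re := rfl

theorem fderiv_ofReal {u : Cn n → ℝ} {z : Cn n} (hu : DifferentiableAt ℝ u z) (v : Cn n) :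
    fderiv ℝ (fun x => (u x : ℂ)) z v = (fderiv ℝ u z v : ℂ) := by
  have : HasFDerivAt (fun x => (u x : ℂ)) (Complex.ofRealCLM.comp (fderiv ℝ u z)) z :=
    Complex.ofRealCLM.hasFDerivAt.comp z hu.hasFDerivAt
  rw [this.fderiv]; rfl

theorem ContDiff.ofReal {u : Cn n → ℝ} (hu : ContDiff ℝ (⊤ : ℕ∞) u) :
    ContDiff ℝ (⊤ : ℕ∞) (fun x => (u x : ℂ)) := Complex.ofRealCLM.contDiff.comp hu

theorem cHessEntry_eq_dop {u : Cn n → ℝ} (hu : ContDiff ℝ (⊤ : ℕ∞) u) (z : Cn n) (j k : Fin n) :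
    cHessEntry n u z j k = dop (-1) j (dop 1 k (fun x => (u x : ℂ))) z := by
  have hd : ∀ v, Differentiable ℝ (fun x => fderiv ℝ u x v) := fun v =>
    (hu.fderiv_dir v).differentiable (by simp)
  have e1 : dop 1 k (fun x => (u x : ℂ)) = fun x => (1 / 2 : ℂ) *
      (((fderiv ℝ u x (Pi.single k 1) : ℝ) : ℂ)
        + Complex.I * ((fderiv ℝ u x (Pi.single k Complex.I) : ℝ) : ℂ)) := by
    ext x
    simp [dop, fderiv_ofReal (hu.differentiable (by simp) x)]
  have e2 : ∀ v, fderiv ℝ (dop 1 k (fun x => (u x : ℂ))) z v = (1 / 2 : ℂ) *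
      (((reB n u z v (Pi.single k 1) : ℝ) : ℂ)
        + Complex.I * ((reB n u z v (Pi.single k Complex.I) : ℝ) : ℂ)) := by
    intro v
    have d : ∀ w, HasFDerivAt (fun x => ((fderiv ℝ u x w : ℝ) : ℂ))
        (Complex.ofRealCLM.comp (fderiv ℝ (fun x => fderiv ℝ u x w) z)) z := fun w =>
      Complex.ofRealCLM.hasFDerivAt.comp z (hd w z).hasFDerivAt
    have h := ((d (Pi.single k 1)).add
      ((d (Pi.single k Complex.I)).const_mul Complex.I)).const_mul (1 / 2 : ℂ)
    have e3 := h.fderiv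
    simp only [Pi.add_def] at e3
    rw [e1, e3]
    simp [reB, mul_add]
  rw [dop, e2, e2, cHessEntry]
  linear_combination ((1 / 4 : ℂ) * reB n u z (Pi.single j Complex.I) (Pi.single k Complex.I)) * Complex.I_sq

theorem contDiff_cHessEntry {u : Cn n → ℝ} (hu : ContDiff ℝ (⊤ : ℕ∞) u) (j k : Fin n) :
    ContDiff ℝ (⊤ : ℕ∞) (fun z => Lv n u z j k) := by
  have : (fun z => Lv n u z j k) = dop (-1) j (dop 1 k (fun x => (u x : ℂ))) :=
    funext fun z => cHessEntry_eq_dop hu z j k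
  rw [this]
  exact (hu.ofReal.dop 1 k).dop (-1) j

theorem reB_add {u v : Cn n → ℝ} (hu : ContDiff ℝ (⊤ : ℕ∞) u) (hv : ContDiff ℝ (⊤ : ℕ∞) v)
    (z a b : Cn n) : reB n (fun x => u x + v x) z a b = reB n u z a b + reB n v z a b := by
  have e : (fun x => fderiv ℝ (fun x => u x + v x) x b) =
      fun x => fderiv ℝ u x b + fderiv ℝ v x b := by
    ext x
    rw [fderiv_fun_add (hu.differentiable (by simp) x) (hv.differentiable (by simp) x)]; rfl
  rw [reB, e, fderiv_fun_add ((hu.fderiv_dir b).differentiable (by simp) z)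
    ((hv.fderiv_dir b).differentiable (by simp) z)]
  rfl

theorem reB_const_mul {u : Cn n → ℝ} (hu : ContDiff ℝ (⊤ : ℕ∞) u) (c : ℝ)
    (z a b : Cn n) : reB n (fun x => c * u x) z a b = c * reB n u z a b := by
  have e : (fun x => fderiv ℝ (fun x => c * u x) x b) =
      fun x => c * fderiv ℝ u x b := by
    ext x
    rw [fderiv_const_mul (hu.differentiable (by simp) x)]; rfl
  rw [reB, e, fderiv_const_mul ((hu.fderiv_dir b).differentiable (by simp) z)]
  rfl

theorem Lv_add {u v : Cn n → ℝ} (hu : ContDiff ℝ (⊤ : ℕ∞) u) (hv : ContDiff ℝ (⊤ : ℕ∞) v)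
    (z : Cn n) : Lv n (fun x => u x + v x) z = Lv n u z + Lv n v z := by
  ext j k
  simp only [Lv, Matrix.of_apply, Matrix.add_apply, cHessEntry, reB_add hu hv]
  push_cast; ring

theorem Lv_const_mul {u : Cn n → ℝ} (hu : ContDiff ℝ (⊤ : ℕ∞) u) (c : ℝ)
    (z : Cn n) : Lv n (fun x => c * u x) z = (c : ℂ) • Lv n u z := by
  ext j k
  simp only [Lv, Matrix.of_apply, Matrix.smul_apply, smul_eq_mul, cHessEntry, reB_const_mul hu]
  push_cast; ring

theorem Lv_congr {u v : Cn n → ℝ} {z : Cn n} (h : u =ᶠ[𝓝 z] v) : Lv n u z = Lv n v z := by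
  have : ∀ a b, reB n u z a b = reB n v z a b := by
    intro a b
    have : (fun x => fderiv ℝ u x b) =ᶠ[𝓝 z] fun x => fderiv ℝ v x b :=
      h.fderiv.fun_comp (fun L => L b)
    rw [reB, reB, this.fderiv_eq]
  ext j k
  simp only [Lv, Matrix.of_apply, cHessEntry, this]

theorem maDensity_congr {u v : Cn n → ℝ} {z : Cn n} (h : u =ᶠ[𝓝 z] v) :
    maDensity n u z = maDensity n v z := by
  rw [maDensity_eq, maDensity_eq, Lv_congr h]

theorem Lv_zero (z : Cn n) (c : ℝ) : Lv n (fun _ => c) z = 0 := by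
  ext j k
  simp [Lv, cHessEntry, reB]

theorem continuous_maDensity {u : Cn n → ℝ} (hu : ContDiff ℝ (⊤ : ℕ∞) u) :
    Continuous (maDensity n u) :=
  continuous_const.mul (Complex.continuous_re.comp
    (ContDiff.matrix_det (contDiff_cHessEntry hu)).continuous)

open scoped MatrixOrder Matrix.Norms.L2Operator in
theorem PosSemidef.exists_conjTranspose_mul_self {P : Matrix (Fin n) (Fin n) ℂ}
    (hP : P.PosSemidef) : ∃ B : Matrix (Fin n) (Fin n) ℂ, P = B.conjTranspose * B :=
  CStarAlgebra.nonneg_iff_eq_star_mul_self.mp hP.nonneg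

/-- `Re tr(adj P · N) ≥ 0` for positive semidefinite matrices. -/
theorem re_sum_adjugate_nonneg {P N : Matrix (Fin n) (Fin n) ℂ} (hP : P.PosSemidef)
    (hN : N.PosSemidef) : 0 ≤ (∑ k, ∑ j, P.adjugate k j * N j k).re := by
  have hA : P.adjugate.PosSemidef := by
    obtain ⟨C, rfl⟩ := PosSemidef.exists_conjTranspose_mul_self hP
    rw [Matrix.adjugate_mul_distrib, ← Matrix.adjugate_conjTranspose]
    exact Matrix.posSemidef_self_mul_conjTranspose _
  obtain ⟨B, rfl⟩ := PosSemidef.exists_conjTranspose_mul_self hN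
  have e : ∑ k, ∑ j, P.adjugate k j * (B.conjTranspose * B) j k
      = (B * P.adjugate * B.conjTranspose).trace := by
    rw [Matrix.trace_mul_comm, ← mul_assoc, Matrix.trace_mul_comm]
    simp [Matrix.trace, Matrix.mul_apply]
  rw [e]
  have := (hA.mul_mul_conjTranspose_same B).trace_nonneg
  exact (Complex.le_def.1 this).1

theorem det_add_sub_det (P N : Matrix (Fin n) (Fin n) ℂ) :
    (P + N).det - P.det = ∫ s in (0 : ℝ)..1,
      ∑ k, ∑ j, (P + (s : ℂ) • N).adjugate k j * N j k := by
  have hd : ∀ s : ℝ, HasDerivAt (fun s : ℝ => (P + (s : ℂ) • N).det)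
      (∑ k, ∑ j, (P + (s : ℂ) • N).adjugate k j * N j k) s := by
    intro s
    have hM : ∀ a b (s : ℝ), HasDerivAt (fun s : ℝ => (P + (s : ℂ) • N) a b) (N a b) s := by
      intro a b s
      simp only [Matrix.add_apply, Matrix.smul_apply, smul_eq_mul]
      simpa using ((Complex.ofRealCLM.hasDerivAt (x := s)).mul_const (N a b)).const_add (P a b)
    have h1 := fderiv_det (M := fun s : ℝ => P + (s : ℂ) • N) (z := s)
      (fun a b => (hM a b s).differentiableAt) 1
    have h2 : DifferentiableAt ℝ (fun s : ℝ => (P + (s : ℂ) • N).det) s := by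
      refine ((ContDiff.matrix_det fun a b => ?_).differentiable (by simp)) s
      simp only [Matrix.add_apply, Matrix.smul_apply, smul_eq_mul]
      exact contDiff_const.add (Complex.ofRealCLM.contDiff.mul contDiff_const)
    have h3 := h2.hasDerivAt
    have e : deriv (fun s : ℝ => (P + (s : ℂ) • N).det) s
        = fderiv ℝ (fun s : ℝ => (P + (s : ℂ) • N).det) s 1 := by simp
    rw [e, h1] at h3
    have h4 : ∑ i, ((P + (s : ℂ) • N).updateCol i
        (fun a => fderiv ℝ (fun s : ℝ => (P + (s : ℂ) • N) a i) s 1)).det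
        = ∑ k, ∑ j, (P + (s : ℂ) • N).adjugate k j * N j k := by
      refine Finset.sum_congr rfl fun k _ => ?_
      rw [det_updateCol_eq_sum]
      refine Finset.sum_congr rfl fun j _ => ?_
      congr 1
      rw [← (hM j k s).deriv]; simp
    rw [← h4]; exact h3
  rw [intervalIntegral.integral_eq_sub_of_hasDerivAt (fun s _ => hd s)]
  · simp
  · apply Continuous.intervalIntegrable
    refine continuous_finsetSum _ fun k _ => continuous_finsetSum _ fun j _ => ?_
    refine Continuous.mul ?_ continuous_const
    exact Continuous.matrix_elem (Continuous.matrix_adjugate (by fun_prop)) _ _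

theorem mono {h w T : Cn n → ℝ} (hh : ContDiff ℝ (⊤ : ℕ∞) h) (hw : ContDiff ℝ (⊤ : ℕ∞) w)
    (hT : ContDiff ℝ (⊤ : ℕ∞) T) (hc : HasCompactSupport w) (hw0 : ∀ z, 0 ≤ w z)
    (h1 : ∀ z ∈ tsupport w, (Lv n h z).PosSemidef)
    (h2 : ∀ z ∈ tsupport w, (Lv n (fun x => h x + w x) z).PosSemidef)
    (h3 : ∀ z ∈ tsupport w, (- Lv n T z).PosSemidef) :
    ∫ z, T z * (maDensity n (fun x => h x + w x) z - maDensity n h z) ≤ 0 := by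
  have hMs : ∀ s : ℝ, ∀ z, Lv n h z + (s : ℂ) • Lv n w z = Lv n (fun x => h x + s * w x) z := by
    intro s z
    rw [Lv_add hh (contDiff_const.mul hw), Lv_const_mul hw]
  have hus : ∀ s : ℝ, ContDiff ℝ (⊤ : ℕ∞) (fun x => h x + s * w x) := fun s =>
    hh.add (contDiff_const.mul hw)
  have hpsd : ∀ s ∈ Set.Icc (0 : ℝ) 1, ∀ z ∈ tsupport w,
      (Lv n (fun x => h x + s * w x) z).PosSemidef := by
    intro s hs z hz
    have e : Lv n (fun x => h x + s * w x) z
        = ((1 - s : ℝ) : ℂ) • Lv n h z + (s : ℂ) • Lv n (fun x => h x + w x) z := by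
      rw [← hMs, Lv_add hh hw, smul_add, ← add_assoc, ← add_smul]; simp
    rw [e]
    refine ((h1 z hz).smul ?_).add ((h2 z hz).smul ?_)
    · exact_mod_cast sub_nonneg.2 hs.2
    · exact_mod_cast hs.1
  set F : Cn n → ℝ → ℂ := fun z s =>
    (T z : ℂ) * ∑ k, ∑ j, (Lv n h z + (s : ℂ) • Lv n w z).adjugate k j * Lv n w z j k with hF
  have hFc : Continuous (Function.uncurry F) := by
    have cL : ∀ {u : Cn n → ℝ}, ContDiff ℝ (⊤ : ℕ∞) u →
        Continuous fun p : Cn n × ℝ => Lv n u p.1 := fun hu =>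
      (continuous_matrix fun j k => (contDiff_cHessEntry hu j k).continuous).comp continuous_fst
    simp only [hF, Function.uncurry_def]
    refine ((Complex.continuous_ofReal.comp hT.continuous).comp continuous_fst).mul ?_
    refine continuous_finsetSum _ fun k _ => continuous_finsetSum _ fun j _ => ?_
    refine Continuous.mul ?_ (Continuous.matrix_elem (cL hw) _ _)
    refine Continuous.matrix_elem (Continuous.matrix_adjugate ?_) _ _
    exact (cL hh).add ((Complex.continuous_ofReal.comp continuous_snd).smul (cL hw))
  have hz0 : ∀ z, z ∉ tsupport w → Lv n w z = 0 := by
    intro z hz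
    rw [Lv_congr (notMem_tsupport_iff_eventuallyEq.1 hz)]
    exact Lv_zero z 0
  have hF0 : ∀ z s, z ∉ tsupport w → F z s = 0 := by
    intro z s hz
    simp [hF, hz0 z hz]
  have hIn : Integrable (Function.uncurry F)
      (volume.prod (volume.restrict (Set.Ioc (0 : ℝ) 1))) := by
    have e : (volume : Measure (Cn n)).prod (volume.restrict (Set.Ioc (0 : ℝ) 1))
        = (volume.prod volume).restrict (Set.univ ×ˢ Set.Ioc (0 : ℝ) 1) := by
      rw [← Measure.prod_restrict, Measure.restrict_univ]
    rw [e]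
    have hK : IntegrableOn (Function.uncurry F) (tsupport w ×ˢ Set.Icc (0 : ℝ) 1)
        (volume.prod volume) :=
      hFc.continuousOn.integrableOn_compact (hc.isCompact.prod isCompact_Icc)
    refine IntegrableOn.of_forall_sdiff_eq_zero hK
      (MeasurableSet.univ.prod measurableSet_Ioc) ?_
    rintro ⟨z, s⟩ ⟨⟨_, hs⟩, hns⟩
    refine hF0 z s fun hz => hns ⟨hz, Set.Ioc_subset_Icc_self hs⟩
  have e1 : ∀ z, ((T z * ((Lv n (fun x => h x + w x) z).det.re - (Lv n h z).det.re) : ℝ) : ℂ).re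
      = (∫ s in Set.Ioc (0 : ℝ) 1, F z s).re := by
    intro z
    have := det_add_sub_det (Lv n h z) (Lv n w z)
    rw [intervalIntegral.integral_of_le zero_le_one] at this
    simp only [hF]
    rw [integral_const_mul, ← this, ← Lv_add hh hw]
    simp
  have e2 : ∀ s ∈ Set.Ioc (0 : ℝ) 1, (∫ z, F z s).re ≤ 0 := by
    intro s hs
    have hsy := integral_adjugate_symm (M := fun z => Lv n h z + (s : ℂ) • Lv n w z)
      (fun a b => by simp only [hMs]; exact contDiff_cHessEntry (hus s) a b)
      (fun a i l => by
        have : ∀ l, (fun x => (Lv n h x + (s : ℂ) • Lv n w x) a l)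
          = dop (-1) a (dop 1 l (fun x => ((h x + s * w x : ℝ) : ℂ))) := fun l => by
            ext x; rw [hMs, ← cHessEntry_eq_dop (hus s)]; rfl
        rw [this, this, dop_comm ((hus s).ofReal.dop _ _), dop_comm ((hus s).ofReal),
          ← dop_comm ((hus s).ofReal.dop _ _)])
      (fun a i l => by
        have : ∀ l, (fun x => (Lv n h x + (s : ℂ) • Lv n w x) l a)
          = dop (-1) l (dop 1 a (fun x => ((h x + s * w x : ℝ) : ℂ))) := fun l => by
            ext x; rw [hMs, ← cHessEntry_eq_dop (hus s)]; rfl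
        rw [this, this, dop_comm ((hus s).ofReal.dop _ _)])
      hT.ofReal hw.ofReal (hc.comp_left (g := fun x : ℝ => (x : ℂ)) (by simp))
    have e3 : ∫ z, F z s = ∫ z, (w z : ℂ) *
        ∑ k, ∑ j, (Lv n (fun x => h x + s * w x) z).adjugate k j * Lv n T z j k := by
      simp only [hF]
      have q1 : ∀ z k j, Lv n w z j k = dop (-1) j (dop 1 k (fun x => (w x : ℂ))) z :=
        fun z k j => cHessEntry_eq_dop hw z j k
      have q2 : ∀ z k j, Lv n T z j k = dop (-1) j (dop 1 k (fun x => (T x : ℂ))) z :=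
        fun z k j => cHessEntry_eq_dop hT z j k
      simp only [q1, q2, ← hMs s]
      exact hsy
    have hre : (∫ z, F z s).re = ∫ z, (w z) *
        (∑ k, ∑ j, (Lv n (fun x => h x + s * w x) z).adjugate k j * Lv n T z j k).re := by
      rw [e3]
      have := integral_re (𝕜 := ℂ) (μ := (volume : Measure (Cn n))) (f := fun z => (w z : ℂ) *
        ∑ k, ∑ j, (Lv n (fun x => h x + s * w x) z).adjugate k j * Lv n T z j k) ?_
      · simp only [RCLike.re_eq_complex_re] at this
        rw [← this]
        simp
      · refine Continuous.integrable_of_hasCompactSupport ?_ ?_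
        · refine hw.ofReal.continuous.mul ?_
          refine continuous_finsetSum _ fun k _ => continuous_finsetSum _ fun j _ => ?_
          exact (ContDiff.matrix_adjugate (contDiff_cHessEntry (hus s)) k j).continuous.mul
            (contDiff_cHessEntry hT j k).continuous
        · exact HasCompactSupport.mul_right (hc.comp_left (g := fun x : ℝ => (x : ℂ)) (by simp))
    rw [hre]
    refine integral_nonpos fun z => ?_
    by_cases hz : z ∈ tsupport w
    · have := re_sum_adjugate_nonneg (hpsd s ⟨hs.1.le, hs.2⟩ z hz) (h3 z hz)
      simp only [Matrix.neg_apply, mul_neg, Finset.sum_neg_distrib, Complex.neg_re] at this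
      exact mul_nonpos_of_nonneg_of_nonpos (hw0 z) (by linarith)
    · simp [image_eq_zero_of_notMem_tsupport hz]
  have e4 : ∫ z, T z * (maDensity n (fun x => h x + w x) z - maDensity n h z)
      = (4 : ℝ) ^ n * (n.factorial : ℝ) * (∫ z, ∫ s in Set.Ioc (0 : ℝ) 1, F z s).re := by
    have hi : Integrable (fun z => ∫ s in Set.Ioc (0 : ℝ) 1, F z s) := hIn.integral_prod_left
    have := integral_re (𝕜 := ℂ) hi
    simp only [RCLike.re_eq_complex_re] at this
    rw [← this, ← integral_const_mul]
    congr 1; ext z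
    rw [← e1 z, maDensity_eq, maDensity_eq, Complex.ofReal_re]; ring
  rw [e4, integral_integral_swap hIn]
  have hi : Integrable (fun s => ∫ z, F z s) (volume.restrict (Set.Ioc (0 : ℝ) 1)) :=
    hIn.integral_prod_right
  have := integral_re (𝕜 := ℂ) hi
  simp only [RCLike.re_eq_complex_re] at this
  rw [← this]
  refine mul_nonpos_of_nonneg_of_nonpos (by positivity) ?_
  exact setIntegral_nonpos measurableSet_Ioc e2

end Levi

section LeviForm

open scoped ComplexOrder

variable {n : ℕ}

/-- Four times the Levi form of `u` at `z` in the direction `b`. -/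
def lapl (u : Cn n → ℝ) (z b : Cn n) : ℝ :=
  reB n u z b b + reB n u z (Complex.I • b) (Complex.I • b)

theorem reB_eq {u : Cn n → ℝ} {z : Cn n} (hu : DifferentiableAt ℝ (fderiv ℝ u) z) (a b : Cn n) :
    reB n u z a b = fderiv ℝ (fderiv ℝ u) z a b := by
  rw [reB, fderiv_clm_apply hu (by fun_prop)]; simp

theorem ContDiff.differentiable_fderiv {u : Cn n → ℝ} (hu : ContDiff ℝ (⊤ : ℕ∞) u) :
    Differentiable ℝ (fderiv ℝ u) :=
  (hu.fderiv_right (m := (⊤ : ℕ∞)) (by simp)).differentiable (by simp)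

theorem reB_symm {u : Cn n → ℝ} (hu : ContDiff ℝ (⊤ : ℕ∞) u) (z a b : Cn n) :
    reB n u z a b = reB n u z b a := fderiv_fderiv_comm hu z a b

theorem eq_sum_single (b : Cn n) :
    b = ∑ j, ((b j).re • (Pi.single j (1 : ℂ) : Cn n)
      + (b j).im • (Pi.single j Complex.I : Cn n)) := by
  ext i
  simp only [Finset.sum_apply, Pi.add_apply, Pi.smul_apply, Pi.single_apply]
  rw [Finset.sum_eq_single i]
  · simp
  · intro j _ hj; simp [Ne.symm hj]
  · simp

theorem bilin_expand (B : Cn n →L[ℝ] Cn n →L[ℝ] ℝ) (b : Cn n) :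
    B b b = ∑ j, ∑ k, ((b j).re * (b k).re * B (Pi.single j 1) (Pi.single k 1)
      + (b j).re * (b k).im * B (Pi.single j 1) (Pi.single k Complex.I)
      + (b j).im * (b k).re * B (Pi.single j Complex.I) (Pi.single k 1)
      + (b j).im * (b k).im * B (Pi.single j Complex.I) (Pi.single k Complex.I)) := by
  conv_lhs => rw [eq_sum_single b]
  simp only [map_sum, map_add, map_smul, sum_apply, add_apply, smul_apply, smul_eq_mul]
  rw [Finset.sum_comm]
  refine Finset.sum_congr rfl fun j _ => ?_
  rw [Finset.mul_sum, Finset.mul_sum, ← Finset.sum_add_distrib]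
  refine Finset.sum_congr rfl fun k _ => ?_
  ring

theorem Lv_isHermitian {u : Cn n → ℝ} (hu : ContDiff ℝ (⊤ : ℕ∞) u) (z : Cn n) :
    (Lv n u z).IsHermitian := by
  ext j k
  simp only [Matrix.conjTranspose_apply, Lv, Matrix.of_apply, cHessEntry]
  rw [reB_symm hu z (Pi.single k 1) (Pi.single j 1),
    reB_symm hu z (Pi.single k Complex.I) (Pi.single j Complex.I),
    reB_symm hu z (Pi.single k 1) (Pi.single j Complex.I),
    reB_symm hu z (Pi.single k Complex.I) (Pi.single j 1)]
  simp [Complex.ext_iff]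

theorem re_dotProduct_Lv {u : Cn n → ℝ} (hu : ContDiff ℝ (⊤ : ℕ∞) u) (z x : Cn n) :
    (star x ⬝ᵥ (Lv n u z).mulVec x).re = 1 / 4 * lapl u z (star x) := by
  have hd := hu.differentiable_fderiv z
  rw [lapl, reB_eq hd, reB_eq hd, bilin_expand, bilin_expand, ← Finset.sum_add_distrib,
    Finset.mul_sum]
  simp only [dotProduct, Matrix.mulVec, Complex.re_sum]
  refine Finset.sum_congr rfl fun j _ => ?_
  rw [← Finset.sum_add_distrib, Finset.mul_sum, Finset.mul_sum, Complex.re_sum]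
  refine Finset.sum_congr rfl fun k _ => ?_
  simp only [Lv, Matrix.of_apply, cHessEntry, reB_eq hd]
  simp
  ring

theorem Lv_posSemidef {u : Cn n → ℝ} (hu : ContDiff ℝ (⊤ : ℕ∞) u) {z : Cn n}
    (h : ∀ b, 0 ≤ lapl u z b) : (Lv n u z).PosSemidef := by
  refine Matrix.PosSemidef.of_dotProduct_mulVec_nonneg (Lv_isHermitian hu z) fun x => ?_
  rw [Complex.le_def]
  refine ⟨?_, ((Lv_isHermitian hu z).im_star_dotProduct_mulVec_self x).symm⟩
  rw [re_dotProduct_Lv hu]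
  exact mul_nonneg (by norm_num) (h (star x))

/-- A degenerate nonnegative Levi form has vanishing Monge–Ampère density. -/
theorem maDensity_eq_zero {u : Cn n → ℝ} (hu : ContDiff ℝ (⊤ : ℕ∞) u) {z b : Cn n}
    (h : ∀ b, 0 ≤ lapl u z b) (hb : b ≠ 0) (h0 : lapl u z b ≤ 0) : maDensity n u z = 0 := by
  have hP := Lv_posSemidef hu h
  have e : star (star b) ⬝ᵥ (Lv n u z).mulVec (star b) = 0 := by
    refine Complex.ext ?_ ((Lv_isHermitian hu z).im_star_dotProduct_mulVec_self _)
    rw [re_dotProduct_Lv hu, star_star, le_antisymm h0 (h b)]; simp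
  have h1 := (hP.dotProduct_mulVec_zero_iff _).1 e
  have h2 := Matrix.exists_mulVec_eq_zero_iff.1 ⟨star b, by simpa using hb, h1⟩
  rw [maDensity_eq, h2]; simp

theorem lapl_add {u v : Cn n → ℝ} (hu : ContDiff ℝ (⊤ : ℕ∞) u) (hv : ContDiff ℝ (⊤ : ℕ∞) v)
    (z b : Cn n) : lapl (fun x => u x + v x) z b = lapl u z b + lapl v z b := by
  simp only [lapl, reB_add hu hv]; ring

theorem lapl_const_mul {u : Cn n → ℝ} (hu : ContDiff ℝ (⊤ : ℕ∞) u) (c : ℝ)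
    (z b : Cn n) : lapl (fun x => c * u x) z b = c * lapl u z b := by
  simp only [lapl, reB_const_mul hu]; ring

theorem lapl_const (c : ℝ) (z b : Cn n) : lapl (fun _ => c) z b = 0 := by
  simp [lapl, reB]

theorem lapl_congr {u v : Cn n → ℝ} {z : Cn n} (h : u =ᶠ[𝓝 z] v) (b : Cn n) :
    lapl u z b = lapl v z b := by
  have : ∀ a b, reB n u z a b = reB n v z a b := by
    intro a b
    have : (fun x => fderiv ℝ u x b) =ᶠ[𝓝 z] fun x => fderiv ℝ v x b :=
      h.fderiv.fun_comp (fun L => L b)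
    rw [reB, reB, this.fderiv_eq]
  simp only [lapl, this]

theorem reB_comp {m : ℝ → ℝ} (hm : ContDiff ℝ (⊤ : ℕ∞) m) {d : Cn n → ℝ}
    (hd : ContDiff ℝ (⊤ : ℕ∞) d) (z b : Cn n) :
    reB n (fun x => m (d x)) z b b =
      deriv (deriv m) (d z) * (fderiv ℝ d z b) ^ 2 + deriv m (d z) * reB n d z b b := by
  have hm' : Differentiable ℝ (deriv m) := by
    have := (contDiff_infty_iff_deriv.1 hm).2
    exact this.differentiable (by simp)
  have e : (fun x => fderiv ℝ (fun x => m (d x)) x b) =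
      fun x => deriv m (d x) * fderiv ℝ d x b := by
    ext x
    have := ((hm.differentiable (by simp) (d x)).hasDerivAt).comp_hasFDerivAt x
      (hd.differentiable (by simp) x).hasFDerivAt
    have h2 := this.fderiv
    rw [Function.comp_def] at h2
    rw [h2]; simp
  have h3 : HasFDerivAt (fun x => deriv m (d x)) (deriv (deriv m) (d z) • fderiv ℝ d z) z :=
    ((hm' (d z)).hasDerivAt).comp_hasFDerivAt z (hd.differentiable (by simp) z).hasFDerivAt
  have h4 := ((hd.fderiv_dir b).differentiable (by simp) z).hasFDerivAt
  have h5 := (h3.mul h4).fderiv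
  simp only [Pi.mul_def] at h5
  rw [reB, e, h5]
  simp [reB]; ring

/-- A smooth convex function vanishing on `x ≤ 0` with slope `1` on `x ≥ κ`. -/
def softPos (κ x : ℝ) : ℝ := ∫ s in (0 : ℝ)..x, Real.smoothTransition (s / κ)

theorem hasDerivAt_softPos (κ x : ℝ) :
    HasDerivAt (softPos κ) (Real.smoothTransition (x / κ)) x := by
  have hc : Continuous fun s : ℝ => Real.smoothTransition (s / κ) :=
    Real.smoothTransition.continuous.comp (continuous_id.div_const κ)
  exact intervalIntegral.integral_hasDerivAt_right (hc.intervalIntegrable _ _)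
    (hc.stronglyMeasurableAtFilter _ _) hc.continuousAt

theorem deriv_softPos (κ : ℝ) : deriv (softPos κ) = fun x => Real.smoothTransition (x / κ) :=
  funext fun x => (hasDerivAt_softPos κ x).deriv

theorem contDiff_softPos (κ : ℝ) : ContDiff ℝ (⊤ : ℕ∞) (softPos κ) := by
  refine contDiff_infty_iff_deriv.2 ⟨fun x => (hasDerivAt_softPos κ x).differentiableAt, ?_⟩
  rw [deriv_softPos]
  exact Real.smoothTransition.contDiff.comp (contDiff_id.div_const κ)

theorem deriv_deriv_softPos_nonneg {κ : ℝ} (hκ : 0 < κ) (x : ℝ) :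
    0 ≤ deriv (deriv (softPos κ)) x := by
  rw [deriv_softPos]
  refine Monotone.deriv_nonneg (fun a b h => ?_)
  exact Real.smoothTransition.monotone (by gcongr)

theorem softPos_of_nonpos {κ : ℝ} (hκ : 0 < κ) {x : ℝ} (hx : x ≤ 0) : softPos κ x = 0 := by
  rw [softPos]
  refine intervalIntegral.integral_zero_ae (ae_of_all _ fun s hs => ?_)
  rw [Set.uIoc_of_ge hx] at hs
  exact Real.smoothTransition.zero_of_nonpos (div_nonpos_of_nonpos_of_nonneg hs.2 hκ.le)

theorem softPos_nonneg (κ : ℝ) {x : ℝ} (hx : 0 ≤ x) : 0 ≤ softPos κ x :=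
  intervalIntegral.integral_nonneg hx fun _ _ => Real.smoothTransition.nonneg _

theorem softPos_le {κ : ℝ} {x : ℝ} (hx : 0 ≤ x) : softPos κ x ≤ x := by
  have hc : Continuous fun s : ℝ => Real.smoothTransition (s / κ) :=
    Real.smoothTransition.continuous.comp (continuous_id.div_const κ)
  have := intervalIntegral.integral_mono_on (μ := volume) hx (hc.intervalIntegrable 0 x)
    (continuous_const.intervalIntegrable (0 : ℝ) x) (g := fun _ => (1 : ℝ))
    (fun s _ => Real.smoothTransition.le_one _)
  simpa [softPos] using this

theorem softPos_nonneg' {κ : ℝ} (hκ : 0 < κ) (x : ℝ) : 0 ≤ softPos κ x := by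
  rcases le_total x 0 with h | h
  · rw [softPos_of_nonpos hκ h]
  · exact softPos_nonneg κ h

theorem softPos_eq {κ : ℝ} (hκ : 0 < κ) {x : ℝ} (hx : κ ≤ x) :
    softPos κ x = x + (softPos κ κ - κ) := by
  have hc : Continuous fun s : ℝ => Real.smoothTransition (s / κ) :=
    Real.smoothTransition.continuous.comp (continuous_id.div_const κ)
  have h1 : softPos κ x = softPos κ κ + ∫ s in κ..x, Real.smoothTransition (s / κ) :=
    (intervalIntegral.integral_add_adjacent_intervals (hc.intervalIntegrable _ _)
      (hc.intervalIntegrable _ _)).symm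
  have h2 : ∫ s in κ..x, Real.smoothTransition (s / κ) = ∫ _ in κ..x, (1 : ℝ) := by
    refine intervalIntegral.integral_congr fun s hs => ?_
    rw [Set.uIcc_of_le hx] at hs
    exact Real.smoothTransition.one_of_one_le ((one_le_div hκ).2 hs.1)
  rw [h1, h2]; simp; ring

/-- The regularized maximum of `h` and `b`. -/
def regmax (κ : ℝ) (h b : Cn n → ℝ) (z : Cn n) : ℝ := h z + softPos κ (b z - h z)

theorem lapl_regmax_nonneg {κ : ℝ} (hκ : 0 < κ) {h b : Cn n → ℝ} (hh : ContDiff ℝ (⊤ : ℕ∞) h)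
    (hb : ContDiff ℝ (⊤ : ℕ∞) b) {z v : Cn n} (h1 : 0 ≤ lapl h z v) (h2 : 0 ≤ lapl b z v) :
    0 ≤ lapl (regmax κ h b) z v := by
  have hd : ContDiff ℝ (⊤ : ℕ∞) (fun x => b x + (-1) * h x) := hb.add (contDiff_const.mul hh)
  have e : regmax κ h b = fun x => h x + softPos κ (b x + (-1) * h x) := by
    ext x; simp [regmax, sub_eq_add_neg]
  have hl : lapl (fun x => b x + (-1) * h x) z v = lapl b z v - lapl h z v := by
    rw [lapl_add hb (contDiff_const.mul hh), lapl_const_mul hh]; ring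
  rw [e, lapl_add hh (v := fun x => softPos κ (b x + (-1) * h x)) ((contDiff_softPos κ).comp hd)]
  set d : Cn n → ℝ := fun x => b x + (-1) * h x
  have e2 : lapl (fun x => softPos κ (d x)) z v
      = deriv (deriv (softPos κ)) (d z)
        * ((fderiv ℝ d z v) ^ 2 + (fderiv ℝ d z (Complex.I • v)) ^ 2)
        + Real.smoothTransition (d z / κ) * lapl d z v := by
    simp only [lapl, reB_comp (contDiff_softPos κ) hd]
    rw [deriv_softPos]; ring
  rw [e2, hl]
  have p1 := deriv_deriv_softPos_nonneg hκ (d z)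
  have p2 := Real.smoothTransition.nonneg (d z / κ)
  have p3 := Real.smoothTransition.le_one (d z / κ)
  have p4 : 0 ≤ deriv (deriv (softPos κ)) (d z)
        * ((fderiv ℝ d z v) ^ 2 + (fderiv ℝ d z (Complex.I • v)) ^ 2) := by positivity
  nlinarith [mul_nonneg p2 h2, mul_nonneg (sub_nonneg.2 p3) h1]

theorem contDiff_regmax (κ : ℝ) {h b : Cn n → ℝ} (hh : ContDiff ℝ (⊤ : ℕ∞) h)
    (hb : ContDiff ℝ (⊤ : ℕ∞) b) : ContDiff ℝ (⊤ : ℕ∞) (regmax κ h b) :=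
  hh.add ((contDiff_softPos κ).comp (hb.sub hh))

end LeviForm

section Taylor

/-- Second order Taylor expansion at a point where the derivative is differentiable. -/
theorem taylor_two {E : Type*} [NormedAddCommGroup E] [NormedSpace ℝ E] {f : E → ℝ}
    {f' : E → E →L[ℝ] ℝ} {B : E →L[ℝ] E →L[ℝ] ℝ} {p : E} (hf : ∀ x, HasFDerivAt f (f' x) x)
    (hp : HasFDerivAt f' B p) {ε : ℝ} (hε : 0 < ε) :
    ∃ δ > 0, ∀ y, ‖y‖ < δ → |f (p + y) - f p - f' p y - 1 / 2 * B y y| ≤ ε * ‖y‖ ^ 2 := by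
  have h1 := (hasFDerivAt_iff_isLittleO_nhds_zero.1 hp).bound hε
  obtain ⟨δ, hδ, hb⟩ := Metric.eventually_nhds_iff.1 h1
  refine ⟨δ, hδ, fun y hy => ?_⟩
  have hder : ∀ s : ℝ, HasDerivAt (fun s : ℝ => f (p + s • y) - s * f' p y - s ^ 2 / 2 * B y y)
      (f' (p + s • y) y - f' p y - s * B y y) s := by
    intro s
    have h2 : HasDerivAt (fun s : ℝ => p + s • y) y s := by
      simpa using ((hasDerivAt_id s).smul_const y).const_add p
    have h3 := (hf (p + s • y)).comp_hasDerivAt s h2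
    have h4 : HasDerivAt (fun s : ℝ => s * f' p y) (f' p y) s := by
      simpa using (hasDerivAt_id s).mul_const (f' p y)
    have h5 : HasDerivAt (fun s : ℝ => s ^ 2 / 2 * B y y) (s * B y y) s := by
      have := (((hasDerivAt_id s).pow 2).div_const 2).mul_const (B y y)
      refine this.congr_deriv ?_
      simp
    exact (h3.sub h4).sub h5
  have := norm_image_sub_le_of_norm_deriv_le_segment_01' (C := ε * ‖y‖ ^ 2)
    (fun s _ => (hder s).hasDerivWithinAt) (fun s hs => ?_)
  · simp only [one_smul, zero_smul, add_zero, one_mul, Real.norm_eq_abs] at this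
    convert this using 2
    ring
  · have hs1 : |s| ≤ 1 := abs_le.2 ⟨by linarith [hs.1], hs.2.le⟩
    have hsy : ‖s • y‖ ≤ ‖y‖ := by
      rw [norm_smul]; exact mul_le_of_le_one_left (norm_nonneg _) hs1
    have h6 := hb (y := s • y) (by rw [dist_zero_right]; exact hsy.trans_lt hy)
    have e : f' (p + s • y) y - f' p y - s * B y y = (f' (p + s • y) - f' p - B (s • y)) y := by
      simp
    rw [e]
    refine (ContinuousLinearMap.le_opNorm _ _).trans ?_
    calc _ ≤ ε * ‖s • y‖ * ‖y‖ := by gcongr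
      _ ≤ ε * ‖y‖ * ‖y‖ := by gcongr
      _ = _ := by ring

end Taylor

section Submean

variable {n : ℕ}

theorem integral_circ_re : ∫ x, (circ x).re ∂nuc = 0 := by
  simpa using integral_re_poly_circ Polynomial.X

theorem integral_circ_im : ∫ x, (circ x).im ∂nuc = 0 := by
  have := integral_re_poly_circ (Polynomial.C (-Complex.I) * Polynomial.X)
  simpa using this

theorem sq_re_add_sq_im (x : UnitAddCircle) : (circ x).re ^ 2 + (circ x).im ^ 2 = 1 := by
  have := norm_circ x
  rw [← Complex.normSq_add_mul_I, Complex.re_add_im, Complex.normSq_eq_norm_sq, this]; norm_num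

theorem integral_circ_re_sq : ∫ x, (circ x).re ^ 2 ∂nuc = 1 / 2 := by
  have h := integral_re_poly_circ (Polynomial.X ^ 2)
  have e : ∀ x, (circ x).re ^ 2
      = 1 / 2 * (((Polynomial.X ^ 2 : Polynomial ℂ)).eval (circ x)).re + 1 / 2 := by
    intro x
    have := sq_re_add_sq_im x
    simp [pow_two] at this ⊢
    linarith
  have hc := continuous_circ
  simp_rw [e]
  rw [integral_add (integrable_cont (by simp; fun_prop)) (integrable_cont (by fun_prop)),
    integral_const_mul, h]
  simp

theorem integral_circ_im_sq : ∫ x, (circ x).im ^ 2 ∂nuc = 1 / 2 := by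
  have e : ∀ x, (circ x).im ^ 2 = 1 - (circ x).re ^ 2 := fun x => by
    linarith [sq_re_add_sq_im x]
  have hc := continuous_circ
  simp_rw [e]
  rw [integral_sub (integrable_cont (by fun_prop)) (integrable_cont (by fun_prop)),
    integral_circ_re_sq]
  simp; norm_num

theorem integral_circ_re_mul_im : ∫ x, (circ x).re * (circ x).im ∂nuc = 0 := by
  have h := integral_re_poly_circ (Polynomial.C (-Complex.I) * Polynomial.X ^ 2)
  have e : ∀ x, (circ x).re * (circ x).im = 1 / 2 *
      ((Polynomial.C (-Complex.I) * Polynomial.X ^ 2 : Polynomial ℂ).eval (circ x)).re := by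
    intro x; simp [pow_two]; ring
  simp_rw [e]
  rw [integral_const_mul, h]; simp

theorem circ_smul_eq (x : UnitAddCircle) (b : Cn n) :
    circ x • b = (circ x).re • b + (circ x).im • (Complex.I • b) := by
  ext i
  simp only [Pi.smul_apply, Pi.add_apply, smul_eq_mul, Complex.real_smul]
  conv_lhs => rw [← Complex.re_add_im (circ x)]
  ring

theorem integral_quadratic_circ (L : Cn n →L[ℝ] ℝ) (B : Cn n →L[ℝ] Cn n →L[ℝ] ℝ) (b : Cn n) :
    ∫ x, (L (circ x • b) + 1 / 2 * B (circ x • b) (circ x • b)) ∂nuc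
      = 1 / 4 * (B b b + B (Complex.I • b) (Complex.I • b)) := by
  have hc := continuous_circ
  have e : ∀ x, L (circ x • b) + 1 / 2 * B (circ x • b) (circ x • b)
      = (circ x).re * L b + (circ x).im * L (Complex.I • b)
        + (circ x).re ^ 2 * (1 / 2 * B b b)
        + (circ x).re * (circ x).im * (1 / 2 * (B b (Complex.I • b) + B (Complex.I • b) b))
        + (circ x).im ^ 2 * (1 / 2 * B (Complex.I • b) (Complex.I • b)) := by
    intro x
    rw [circ_smul_eq]
    simp only [map_add, map_smul, add_apply, smul_apply,
      smul_eq_mul]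
    ring
  simp_rw [e]
  rw [integral_add (integrable_cont (by fun_prop)) (integrable_cont (by fun_prop)),
    integral_add (integrable_cont (by fun_prop)) (integrable_cont (by fun_prop)),
    integral_add (integrable_cont (by fun_prop)) (integrable_cont (by fun_prop)),
    integral_add (integrable_cont (by fun_prop)) (integrable_cont (by fun_prop))]
  simp only [integral_mul_const, integral_circ_re, integral_circ_im, integral_circ_re_sq,
    integral_circ_im_sq, integral_circ_re_mul_im]
  ring

/-- The sub-mean value inequality of a real function on the discs contained in `S`. -/
def RSub (u : Cn n → ℝ) (S : Set (Cn n)) : Prop :=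
  ∀ a b : Cn n, (∀ ζ : ℂ, ‖ζ‖ ≤ 1 → a + ζ • b ∈ S) → u a ≤ ∫ x, u (a + circ x • b) ∂nuc

theorem RSub.mono {u : Cn n → ℝ} {S T : Set (Cn n)} (h : RSub u S) (hT : T ⊆ S) : RSub u T :=
  fun a b hab => h a b fun ζ hζ => hT (hab ζ hζ)

theorem lapl_nonneg_of_submean {u : Cn n → ℝ} (hu : ContDiff ℝ (⊤ : ℕ∞) u) {p b : Cn n}
    {r0 : ℝ} (hr0 : 0 < r0)
    (h : ∀ r : ℝ, 0 < r → r < r0 → u p ≤ ∫ x, u (p + circ x • ((r : ℂ) • b)) ∂nuc) :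
    0 ≤ lapl u p b := by
  have hd := hu.differentiable_fderiv p
  rw [lapl, reB_eq hd, reB_eq hd]
  set B := fderiv ℝ (fderiv ℝ u) p
  set L := fderiv ℝ u p
  refine le_of_forall_pos_le_add fun ε hε => ?_
  obtain ⟨δ, hδ, ht⟩ := taylor_two (fun x => (hu.differentiable (by simp) x).hasFDerivAt)
    hd.hasFDerivAt (ε := ε / (4 * (‖b‖ ^ 2 + 1))) (by positivity)
  set r := min (r0 / 2) (δ / (2 * (‖b‖ + 1))) with hr
  have hrp : 0 < r := by positivity
  have h1 := h r hrp ((min_le_left _ _).trans_lt (by linarith))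
  have hrb : ‖(r : ℂ) • b‖ < δ := by
    rw [norm_smul, Complex.norm_real, Real.norm_of_nonneg hrp.le]
    calc r * ‖b‖ ≤ δ / (2 * (‖b‖ + 1)) * ‖b‖ := by
          gcongr; exact min_le_right _ _
      _ < δ := by
          rw [div_mul_eq_mul_div, div_lt_iff₀ (by positivity)]
          nlinarith [norm_nonneg b]
  have hc := continuous_circ
  have huc := hu.continuous
  have h2 : ∫ x, u (p + circ x • ((r : ℂ) • b)) ∂nuc ≤
      ∫ x, ((u p + ε / (4 * (‖b‖ ^ 2 + 1)) * ‖(r : ℂ) • b‖ ^ 2) +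
        (L (circ x • ((r : ℂ) • b)) +
        1 / 2 * B (circ x • ((r : ℂ) • b)) (circ x • ((r : ℂ) • b)))) ∂nuc := by
    refine integral_mono (integrable_cont (by fun_prop)) (integrable_cont (by fun_prop)) fun x => ?_
    have hn : ‖circ x • ((r : ℂ) • b)‖ = ‖(r : ℂ) • b‖ := by rw [norm_smul, norm_circ, one_mul]
    have h3 := ht (circ x • ((r : ℂ) • b)) (by rw [hn]; exact hrb)
    rw [hn] at h3
    have := (abs_le.1 h3).2
    simp only [L, B]
    linarith
  rw [integral_add (integrable_cont (by fun_prop)) (integrable_cont (by fun_prop)),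
    integral_quadratic_circ] at h2
  have e1 : Complex.I • (r : ℂ) • b = r • (Complex.I • b) := by
    rw [smul_comm]; rfl
  have e2 : (r : ℂ) • b = r • b := rfl
  have e3 : ‖(r : ℂ) • b‖ = r * ‖b‖ := by
    rw [norm_smul, Complex.norm_real, Real.norm_of_nonneg hrp.le]
  rw [e1, e3, e2] at h2
  simp only [map_smul, smul_apply, smul_eq_mul, integral_const,
    probReal_univ, one_mul] at h2
  have h4 : 0 ≤ r ^ 2 * (ε / (4 * (‖b‖ ^ 2 + 1)) * ‖b‖ ^ 2 +
      1 / 4 * (B b b + B (Complex.I • b) (Complex.I • b))) := by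
    have := sub_nonneg.2 (h1.trans h2)
    ring_nf at this ⊢
    exact this
  have h5 := nonneg_of_mul_nonneg_right h4 (by positivity : 0 < r ^ 2)
  have h6 : ε / (4 * (‖b‖ ^ 2 + 1)) * ‖b‖ ^ 2 ≤ ε / 4 := by
    rw [div_mul_eq_mul_div, div_le_div_iff₀ (by positivity) (by norm_num)]
    nlinarith [sq_nonneg ‖b‖]
  linarith

theorem RSub.lapl_nonneg {u : Cn n → ℝ} {S : Set (Cn n)} (h : RSub u S)
    (hu : ContDiff ℝ (⊤ : ℕ∞) u) {p : Cn n} (hS : S ∈ 𝓝 p) (b : Cn n) : 0 ≤ lapl u p b := by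
  obtain ⟨r, hr, hb⟩ := Metric.mem_nhds_iff.1 hS
  refine lapl_nonneg_of_submean hu (r0 := r / (‖b‖ + 1)) (by positivity) fun s hs hs' => ?_
  refine h _ _ fun ζ hζ => hb ?_
  rw [Metric.mem_ball, dist_eq_norm, add_sub_cancel_left, norm_smul, norm_smul, Complex.norm_real,
    Real.norm_of_nonneg hs.le]
  have : s * (‖b‖ + 1) < r := (lt_div_iff₀ (by positivity)).1 hs'
  nlinarith [norm_nonneg b, norm_nonneg ζ, mul_nonneg hs.le (norm_nonneg b)]

end Submean

section Mollifier

variable {n : ℕ}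

/-- Measurable, locally bounded real functions. -/
def LBdd (H : Cn n → ℝ) : Prop := Measurable H ∧ ∀ R : ℝ, ∃ C, ∀ z, ‖z‖ ≤ R → |H z| ≤ C

theorem Continuous.lBdd {H : Cn n → ℝ} (h : Continuous H) : LBdd H := by
  refine ⟨h.measurable, fun R => ?_⟩
  obtain ⟨C, hC⟩ := (isCompact_closedBall (0 : Cn n) R).exists_bound_of_continuousOn h.continuousOn
  exact ⟨C, fun z hz => hC z (by simpa using hz)⟩

theorem LBdd.locallyIntegrable {H : Cn n → ℝ} (h : LBdd H) : LocallyIntegrable H volume := by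
  intro z
  refine ⟨Metric.closedBall z 1, Metric.closedBall_mem_nhds z one_pos, ?_⟩
  obtain ⟨C, hC⟩ := h.2 (‖z‖ + 1)
  refine IntegrableOn.of_bound measure_closedBall_lt_top
    h.1.aestronglyMeasurable C ((ae_restrict_iff' measurableSet_closedBall).2 (ae_of_all _ ?_))
  intro y hy
  refine hC y ?_
  have : ‖y - z‖ ≤ 1 := by simpa [dist_eq_norm] using hy
  linarith [norm_le_norm_add_norm_sub' y z]

/-- A smooth real kernel with support in the unit ball. -/
def Ker (k : Cn n → ℝ) : Prop := ContDiff ℝ (⊤ : ℕ∞) k ∧ tsupport k ⊆ Metric.closedBall 0 1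

theorem Ker.hasCompactSupport {k : Cn n → ℝ} (hk : Ker k) : HasCompactSupport k :=
  (isCompact_closedBall (0 : Cn n) 1).of_isClosed_subset (isClosed_tsupport k) hk.2

theorem Ker.eq_zero {k : Cn n → ℝ} (hk : Ker k) {y : Cn n} (hy : 1 < ‖y‖) : k y = 0 := by
  by_contra h
  have := hk.2 (subset_tsupport k h)
  simp at this; linarith

theorem Ker.integrable {k : Cn n → ℝ} (hk : Ker k) : Integrable k :=
  hk.1.continuous.integrable_of_hasCompactSupport hk.hasCompactSupport

theorem Ker.fderiv_dir {k : Cn n → ℝ} (hk : Ker k) (b : Cn n) : Ker fun y => fderiv ℝ k y b := by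
  refine ⟨hk.1.fderiv_dir b, ?_⟩
  refine (closure_mono ?_).trans ((tsupport_fderiv_subset ℝ (f := k)).trans hk.2)
  intro y hy h0
  exact hy (by simp only [h0]; rfl)

/-- The mollification of `H` with the kernel `k` at scale `ε`. -/
def cv (k : Cn n → ℝ) (ε : ℝ) (H : Cn n → ℝ) (z : Cn n) : ℝ := ∫ y, k y * H (z - ε • y)

theorem integrable_cv {k : Cn n → ℝ} (hk : Ker k) (ε : ℝ) {H : Cn n → ℝ} (hH : LBdd H)
    (z : Cn n) : Integrable fun y => k y * H (z - ε • y) := by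
  obtain ⟨C, hC⟩ := hH.2 (‖z‖ + |ε|)
  refine (hk.integrable.norm.mul_const C).mono'
    ((hk.1.continuous.measurable.mul (hH.1.comp (by fun_prop))).aestronglyMeasurable)
    (ae_of_all _ fun y => ?_)
  rw [norm_mul]
  by_cases hy : 1 < ‖y‖
  · rw [hk.eq_zero hy]; simp
  · refine mul_le_mul_of_nonneg_left (hC _ ?_) (norm_nonneg _)
    refine (norm_sub_le _ _).trans ?_
    rw [norm_smul, Real.norm_eq_abs]
    have := mul_le_mul_of_nonneg_left (not_lt.1 hy) (abs_nonneg ε)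
    linarith

theorem abs_cv_le {k : Cn n → ℝ} (hk : Ker k) (ε : ℝ) {H : Cn n → ℝ} {z : Cn n} {c : ℝ}
    (h : ∀ y, ‖y‖ ≤ 1 → |H (z - ε • y)| ≤ c) : |cv k ε H z| ≤ c * ∫ y, |k y| := by
  rw [← Real.norm_eq_abs, ← integral_const_mul]
  refine norm_integral_le_of_norm_le (hk.integrable.norm.const_mul c) (ae_of_all _ fun y => ?_)
  rw [norm_mul, mul_comm]
  by_cases hy : 1 < ‖y‖
  · rw [hk.eq_zero hy]; simp
  · exact mul_le_mul_of_nonneg_right (h y (not_lt.1 hy)) (norm_nonneg _)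

theorem cv_add {k : Cn n → ℝ} (hk : Ker k) (ε : ℝ) {F H : Cn n → ℝ} (hF : LBdd F) (hH : LBdd H)
    (z : Cn n) : cv k ε (fun x => F x + H x) z = cv k ε F z + cv k ε H z := by
  rw [cv, cv, cv, ← integral_add (integrable_cv hk ε hF z) (integrable_cv hk ε hH z)]
  simp_rw [mul_add]

/-- The rescaled kernel. -/
def rescale (k : Cn n → ℝ) (ε : ℝ) (x : Cn n) : ℝ :=
  (ε ^ Module.finrank ℝ (Cn n))⁻¹ * k (ε⁻¹ • x)

theorem cv_eq_convolution (k : Cn n → ℝ) {ε : ℝ} (hε : 0 < ε) (H : Cn n → ℝ) :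
    cv k ε H = convolution (rescale k ε) H (ContinuousLinearMap.mul ℝ ℝ) volume := by
  ext z
  rw [cv, convolution]
  have h := Measure.integral_comp_smul volume (fun y => k (ε⁻¹ • y) * H (z - y)) ε
  simp only [smul_smul, inv_mul_cancel₀ hε.ne', one_smul] at h
  rw [h, abs_of_nonneg (by positivity), smul_eq_mul, ← integral_const_mul]
  refine integral_congr_ae (ae_of_all _ fun y => ?_)
  simp [rescale, mul_assoc]

theorem contDiff_rescale {k : Cn n → ℝ} (hk : Ker k) (ε : ℝ) :
    ContDiff ℝ (⊤ : ℕ∞) (rescale k ε) :=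
  contDiff_const.mul (hk.1.comp (contDiff_const_smul ε⁻¹))

theorem hasCompactSupport_rescale {k : Cn n → ℝ} (hk : Ker k) {ε : ℝ} (hε : 0 < ε) :
    HasCompactSupport (rescale k ε) :=
  (hk.hasCompactSupport.comp_smul (inv_ne_zero hε.ne')).mul_left

theorem contDiff_cv {k : Cn n → ℝ} (hk : Ker k) {ε : ℝ} (hε : 0 < ε) {H : Cn n → ℝ}
    (hH : LBdd H) : ContDiff ℝ (⊤ : ℕ∞) (cv k ε H) := by
  rw [cv_eq_convolution k hε]
  exact (hasCompactSupport_rescale hk hε).contDiff_convolution_left _ (contDiff_rescale hk ε)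
    hH.locallyIntegrable

theorem fderiv_rescale {k : Cn n → ℝ} (hk : Ker k) (ε : ℝ) (x b : Cn n) :
    fderiv ℝ (rescale k ε) x b = ε⁻¹ * rescale (fun y => fderiv ℝ k y b) ε x := by
  have h1 := ((hk.1.differentiable (by simp)) (ε⁻¹ • x)).hasFDerivAt
  have h2 : HasFDerivAt (fun x : Cn n => ε⁻¹ • x) (ε⁻¹ • ContinuousLinearMap.id ℝ (Cn n)) x :=
    (hasFDerivAt_id x).const_smul ε⁻¹
  have h3 := (h1.comp x h2).const_mul (ε ^ Module.finrank ℝ (Cn n))⁻¹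
  have h4 : HasFDerivAt (rescale k ε) _ x := h3
  rw [h4.fderiv]
  simp [rescale]
  ring

theorem fderiv_cv {k : Cn n → ℝ} (hk : Ker k) {ε : ℝ} (hε : 0 < ε) {H : Cn n → ℝ}
    (hH : LBdd H) (z b : Cn n) :
    fderiv ℝ (cv k ε H) z b = ε⁻¹ * cv (fun y => fderiv ℝ k y b) ε H z := by
  have hcs := hasCompactSupport_rescale hk hε
  have hsm := contDiff_rescale hk ε
  have h := hcs.hasFDerivAt_convolution_left (ContinuousLinearMap.mul ℝ ℝ)
    (μ := (volume : Measure (Cn n))) (hsm.of_le (by simp)) hH.locallyIntegrable z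
  rw [cv_eq_convolution k hε, h.fderiv, cv_eq_convolution _ hε, convolution, convolution,
    ContinuousLinearMap.integral_apply, ← integral_const_mul]
  · refine integral_congr_ae (ae_of_all _ fun y => ?_)
    simp only [ContinuousLinearMap.precompL_apply, ContinuousLinearMap.mul_apply', fderiv_rescale hk]
    ring
  · exact (HasCompactSupport.convolutionExists_left
      (ContinuousLinearMap.precompL (Cn n) (ContinuousLinearMap.mul ℝ ℝ)) (hcs.fderiv (𝕜 := ℝ))
      (hsm.continuous_fderiv (by simp)) hH.locallyIntegrable z)

theorem reB_cv {k : Cn n → ℝ} (hk : Ker k) {ε : ℝ} (hε : 0 < ε) {H : Cn n → ℝ}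
    (hH : LBdd H) (z a b : Cn n) :
    reB n (cv k ε H) z a b = (ε⁻¹) ^ 2 * cv (fun y => reB n k y a b) ε H z := by
  have e : (fun x => fderiv ℝ (cv k ε H) x b)
      = fun x => ε⁻¹ * cv (fun y => fderiv ℝ k y b) ε H x := funext fun x => fderiv_cv hk hε hH x b
  rw [reB, e, fderiv_const_mul]
  · rw [smul_apply, fderiv_cv (hk.fderiv_dir b) hε hH, smul_eq_mul]
    simp only [reB]; ring
  · exact (contDiff_cv (hk.fderiv_dir b) hε hH).differentiable (by simp) z

theorem Ker.reB {k : Cn n → ℝ} (hk : Ker k) (a b : Cn n) : Ker fun y => reB n k y a b :=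
  (hk.fderiv_dir b).fderiv_dir a

/-- A smooth circled probability kernel. -/
def chi (y : Cn n) : ℝ :=
  (∫ x : Cn n, Real.smoothTransition (1 - sqn x))⁻¹ * Real.smoothTransition (1 - sqn y)

theorem contDiff_sqn : ContDiff ℝ (⊤ : ℕ∞) (sqn (n := n)) := by
  unfold sqn
  refine ContDiff.sum fun i _ => ?_
  exact (contDiff_norm_sq ℝ).comp (contDiff_apply ℝ ℂ i)

theorem contDiff_pre : ContDiff ℝ (⊤ : ℕ∞) fun y : Cn n => Real.smoothTransition (1 - sqn y) :=
  Real.smoothTransition.contDiff.comp (contDiff_const.sub contDiff_sqn)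

theorem norm_sq_le_sqn (y : Cn n) : ‖y‖ ^ 2 ≤ sqn y := by
  have : ‖y‖ ≤ √(sqn y) := by
    refine (pi_norm_le_iff_of_nonneg (Real.sqrt_nonneg _)).2 fun i => Real.le_sqrt_of_sq_le ?_
    exact Finset.single_le_sum (f := fun i => ‖y i‖ ^ 2) (fun _ _ => sq_nonneg _) (Finset.mem_univ i)
  calc ‖y‖ ^ 2 ≤ √(sqn y) ^ 2 := by gcongr
    _ = sqn y := Real.sq_sqrt (sqn_nonneg y)

theorem tsupport_pre : tsupport (fun y : Cn n => Real.smoothTransition (1 - sqn y))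
    ⊆ Metric.closedBall 0 1 := by
  refine closure_minimal (fun y hy => ?_) Metric.isClosed_closedBall
  have h1 : sqn y ≤ 1 := by
    by_contra h
    exact hy (Real.smoothTransition.zero_of_nonpos (by linarith))
  have h2 := norm_sq_le_sqn y
  rw [mem_closedBall_zero_iff]
  nlinarith [norm_nonneg y]

theorem integral_pre_pos : 0 < ∫ x : Cn n, Real.smoothTransition (1 - sqn x) := by
  have hk : Ker fun y : Cn n => Real.smoothTransition (1 - sqn y) := ⟨contDiff_pre, tsupport_pre⟩
  refine contDiff_pre.continuous.integral_pos_of_hasCompactSupport_nonneg_nonzero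
    hk.hasCompactSupport (fun _ => Real.smoothTransition.nonneg _) (x := 0) ?_
  rw [Real.smoothTransition.one_of_one_le (by simp [sqn])]
  exact one_ne_zero

theorem ker_chi : Ker (chi (n := n)) := by
  refine ⟨contDiff_const.mul contDiff_pre, ?_⟩
  exact (closure_mono (Function.support_mul_subset_right _ _)).trans tsupport_pre

theorem chi_nonneg (y : Cn n) : 0 ≤ chi y :=
  mul_nonneg (inv_nonneg.2 integral_pre_pos.le) (Real.smoothTransition.nonneg _)

theorem integral_chi : ∫ y : Cn n, chi y = 1 := by
  simp only [chi]
  rw [integral_const_mul, inv_mul_cancel₀ integral_pre_pos.ne']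

theorem chi_smul {ζ : ℂ} (hζ : ‖ζ‖ = 1) (y : Cn n) : chi (ζ • y) = chi y := by
  rw [chi, sqn_smul, hζ]; simp [chi]

theorem mol_le_of_le {ε : ℝ} {H : Cn n → ℝ} (hH : LBdd H) {z : Cn n} {c : ℝ}
    (h : ∀ y, ‖y‖ ≤ 1 → H (z - ε • y) ≤ c) : cv chi ε H z ≤ c := by
  have : cv chi ε H z ≤ ∫ y : Cn n, chi y * c := by
    refine integral_mono (integrable_cv ker_chi ε hH z) (ker_chi.integrable.mul_const c) fun y => ?_
    by_cases hy : 1 < ‖y‖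
    · simp [ker_chi.eq_zero hy]
    · exact mul_le_mul_of_nonneg_left (h y (not_lt.1 hy)) (chi_nonneg y)
  rwa [integral_mul_const, integral_chi, one_mul] at this

theorem le_mol_of_le {ε : ℝ} {H : Cn n → ℝ} (hH : LBdd H) {z : Cn n} {c : ℝ}
    (h : ∀ y, ‖y‖ ≤ 1 → c ≤ H (z - ε • y)) : c ≤ cv chi ε H z := by
  have : ∫ y : Cn n, chi y * c ≤ cv chi ε H z := by
    refine integral_mono (ker_chi.integrable.mul_const c) (integrable_cv ker_chi ε hH z) fun y => ?_
    by_cases hy : 1 < ‖y‖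
    · simp [ker_chi.eq_zero hy]
    · exact mul_le_mul_of_nonneg_left (h y (not_lt.1 hy)) (chi_nonneg y)
  rwa [integral_mul_const, integral_chi, one_mul] at this

theorem mol_mono {ε : ℝ} {F H : Cn n → ℝ} (hF : LBdd F) (hH : LBdd H) {z : Cn n}
    (h : ∀ y, ‖y‖ ≤ 1 → F (z - ε • y) ≤ H (z - ε • y)) : cv chi ε F z ≤ cv chi ε H z := by
  refine integral_mono (integrable_cv ker_chi ε hF z) (integrable_cv ker_chi ε hH z) fun y => ?_
  by_cases hy : 1 < ‖y‖
  · simp [ker_chi.eq_zero hy]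
  · exact mul_le_mul_of_nonneg_left (h y (not_lt.1 hy)) (chi_nonneg y)

end Mollifier

section CircleMeans

variable {n : ℕ} {Ω : Set (Cn n)} {U : Cn n → ℝ≥0∞}

theorem lintegral_circ_mul {ζ : ℂ} (hζ : ‖ζ‖ = 1) (f : ℂ → ℝ≥0∞) :
    ∫⁻ x, f (ζ * circ x) ∂nuc = ∫⁻ x, f (circ x) ∂nuc := by
  obtain ⟨t, rfl⟩ := exists_circ hζ
  have : ∀ x, circ t * circ x = circ (t + x) := by
    intro x
    simp [circ, fourier_apply, AddCircle.toCircle_add]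
  simp_rw [this]
  have : nuc.IsAddLeftInvariant :=
    inferInstanceAs (AddCircle.haarAddCircle (T := 1)).IsAddLeftInvariant
  exact lintegral_add_left_eq_self (fun x => f (circ x)) t

theorem Spsh.circ_mean_spsh (hU : Spsh U Ω) (hm : Measurable U) {a b : Cn n}
    {W : Set ℂ} (hW : ∀ ζ ∈ W, ∀ ξ : ℂ, ‖ξ‖ = 1 → a + (ζ * ξ) • b ∈ Ω) :
    Spsh (fun ζ : ℂ => ∫⁻ x, U (a + (ζ * circ x) • b) ∂nuc) W := by
  have hc := continuous_circ
  refine ⟨fun ζ hζ => ?_, fun c d hcd => ?_⟩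
  · rw [lowerSemicontinuousAt_iff_le_liminf]
    refine le_trans (lintegral_mono fun x => ?_) (lintegral_liminf_le (u := 𝓝 ζ)
      (f := fun (ζ : ℂ) x => U (a + (ζ * circ x) • b)) fun ζ => hm.comp (by fun_prop))
    have h1 := hU.1 _ (hW ζ hζ (circ x) (norm_circ x))
    have h2 : ContinuousAt (fun ζ : ℂ => a + (ζ * circ x) • b) ζ := by fun_prop
    refine le_of_forall_lt fun y hy => ?_
    obtain ⟨y', h3, h4⟩ := exists_between hy
    refine h3.trans_le (le_liminf_of_le (by isBoundedDefault) ?_)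
    exact (h2.eventually (h1 y' h4)).mono fun _ h => h.le
  · have e : ∀ x, ∫⁻ t, U (a + ((c + circ t • d) * circ x) • b) ∂nuc
        ≤ U (a + (c * circ x) • b) := by
      intro x
      have h := hU.2 (a + (c * circ x) • b) ((d * circ x) • b) fun ζ hζ => by
        have := hW _ (hcd ζ hζ) (circ x) (norm_circ x)
        convert this using 1
        simp only [smul_eq_mul, add_mul, add_smul, mul_smul, add_assoc]
      refine le_trans (le_of_eq (lintegral_congr fun t => ?_)) h
      simp only [smul_eq_mul, add_mul, add_smul, mul_smul, add_assoc]
    rw [lintegral_lintegral_swap]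
    · exact lintegral_mono e
    · refine (hm.comp ?_).aemeasurable
      fun_prop

/-- Circle means of a plurisuperharmonic function decrease with the radius. -/
theorem Spsh.circ_mean_anti (hΩ : IsOpen Ω) (hU : Spsh U Ω) {a b : Cn n}
    (hab : ∀ ζ : ℂ, ‖ζ‖ ≤ 1 → a + ζ • b ∈ Ω) {s : ℝ} (hs0 : 0 ≤ s) (hs : s ≤ 1) :
    ∫⁻ x, U (a + circ x • b) ∂nuc ≤ ∫⁻ x, U (a + circ x • ((s : ℂ) • b)) ∂nuc := by
  wlog hm : Measurable U generalizing U
  · have h := this (U := Ω.indicator U) (hU.congr hΩ fun z hz => by simp [hz])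
      (measurable_indicator_of_lsc hΩ hU.1)
    have e1 : ∀ x, Ω.indicator U (a + circ x • b) = U (a + circ x • b) := fun x =>
      Set.indicator_of_mem (hab _ (norm_circ x).le) _
    have e2 : ∀ x, Ω.indicator U (a + circ x • ((s : ℂ) • b)) = U (a + circ x • ((s : ℂ) • b)) := by
      intro x
      refine Set.indicator_of_mem ?_ _
      rw [smul_smul]
      refine hab _ ?_
      rw [norm_mul, norm_circ, Complex.norm_real, Real.norm_of_nonneg hs0, one_mul]; exact hs
    simpa only [e1, e2] using h
  have hO : IsOpen {ζ : ℂ | a + ζ • b ∈ Ω} := hΩ.preimage (by fun_prop)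
  obtain ⟨δ, hδ, hsub⟩ := (isCompact_closedBall (0 : ℂ) 1).exists_thickening_subset_open hO
    (fun ζ hζ => hab ζ (by simpa using hζ))
  rw [thickening_closedBall hδ zero_le_one] at hsub
  have hV := hU.circ_mean_spsh (a := a) (b := b) hm (W := Metric.ball (0 : ℂ) (δ + 1)) (by
    intro ζ hζ ξ hξ
    refine hsub ?_
    simpa [hξ] using hζ)
  set V : ℂ → ℝ≥0∞ := fun ζ : ℂ => ∫⁻ x, U (a + (ζ * circ x) • b) ∂nuc with hVd
  have hVr : ∀ ζ : ℂ, ‖ζ‖ = 1 → V ζ = V 1 := by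
    intro ζ hζ
    simp only [hVd, one_mul]
    exact lintegral_circ_mul hζ (fun w => U (a + w • b))
  have e1 : ∫⁻ x, U (a + circ x • b) ∂nuc = V 1 := by simp [hVd]
  have e2 : ∫⁻ x, U (a + circ x • ((s : ℂ) • b)) ∂nuc = V s := by
    simp only [hVd, smul_smul, mul_comm]
  rw [e1, e2]
  refine le_of_forall_lt fun c hc => ?_
  obtain ⟨c', hc1, hc2⟩ := exists_between hc
  have hct : c' ≠ ⊤ := hc2.ne_top
  refine hc1.trans_le ?_
  have hP := (hV.pshNeg Metric.isOpen_ball).1.2 0 1 1 one_pos (fun ζ hζ => by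
    rw [zero_add, smul_eq_mul, mul_one, mem_ball_zero_iff]; linarith)
    (Polynomial.C ((-c'.toReal : ℝ) : ℂ)) (fun ζ hζ => by
      rw [zero_add, smul_eq_mul, mul_one, Polynomial.eval_C, Complex.ofReal_re, negCoe_le_iff,
        neg_neg, ENNReal.ofReal_toReal hct, hVr ζ hζ]
      exact hc2.le) s (by rw [Complex.norm_real, Real.norm_of_nonneg hs0]; exact hs)
  rwa [zero_add, smul_eq_mul, mul_one, Polynomial.eval_C, Complex.ofReal_re, negCoe_le_iff,
        neg_neg, ENNReal.ofReal_toReal hct] at hP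

end CircleMeans

section MollifySubmean

variable {n : ℕ} {Ω S : Set (Cn n)} {H : Cn n → ℝ}

theorem integrable_prod_cv {k : Cn n → ℝ} (hk : Ker k) (hH : LBdd H) {g : UnitAddCircle → Cn n → Cn n}
    (hg : Measurable fun p : UnitAddCircle × Cn n => g p.1 p.2)
    {R : ℝ} (hR : ∀ x y, ‖y‖ ≤ 1 → ‖g x y‖ ≤ R) :
    Integrable (fun p : UnitAddCircle × Cn n => k p.2 * H (g p.1 p.2)) (nuc.prod volume) := by
  obtain ⟨C, hC⟩ := hH.2 R
  refine ((hk.integrable.norm.mul_const C).comp_snd nuc).mono'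
    (((hk.1.continuous.measurable.comp measurable_snd).mul (hH.1.comp hg)).aestronglyMeasurable)
    (ae_of_all _ fun p => ?_)
  rw [norm_mul]
  by_cases hy : 1 < ‖p.2‖
  · rw [hk.eq_zero hy]; simp
  · exact mul_le_mul_of_nonneg_left (hC _ (hR _ _ (not_lt.1 hy))) (norm_nonneg _)

theorem norm_circ_smul (x : UnitAddCircle) (b : Cn n) : ‖circ x • b‖ = ‖b‖ := by
  rw [norm_smul, norm_circ, one_mul]

theorem RSub.mol (h : RSub H Ω) (hH : LBdd H) {ε : ℝ}
    (hS : ∀ z ∈ S, ∀ y, ‖y‖ ≤ 1 → z - ε • y ∈ Ω) : RSub (cv chi ε H) S := by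
  intro a b hab
  have hc := continuous_circ
  have hi := integrable_prod_cv ker_chi hH (g := fun x y => a + circ x • b - ε • y)
    (by fun_prop) (R := ‖a‖ + ‖b‖ + |ε|) (fun x y hy => by
      refine (norm_sub_le _ _).trans (add_le_add ((norm_add_le _ _).trans ?_) ?_)
      · rw [norm_circ_smul]
      · rw [norm_smul, Real.norm_eq_abs]
        exact mul_le_of_le_one_right (abs_nonneg _) hy)
  simp only [cv]
  rw [integral_integral_swap hi]
  refine integral_mono (integrable_cv ker_chi ε hH a) hi.integral_prod_right fun y => ?_
  simp only
  rw [integral_const_mul]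
  by_cases hy : 1 < ‖y‖
  · simp [ker_chi.eq_zero hy]
  · refine mul_le_mul_of_nonneg_left ?_ (chi_nonneg y)
    have := h (a - ε • y) b fun ζ hζ => by
      have := hS _ (hab ζ hζ) y (not_lt.1 hy)
      rwa [sub_add_eq_add_sub]
    refine this.trans (le_of_eq (integral_congr_ae (ae_of_all _ fun x => ?_)))
    simp only [sub_add_eq_add_sub]

/-- Mollification with a circled kernel averages circle means. -/
theorem cv_chi_eq (hH : LBdd H) (ε : ℝ) (z : Cn n) :
    cv chi ε H z = ∫ y, chi y * ∫ x, H (z + circ x • (-ε • y)) ∂nuc := by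
  have hc := continuous_circ
  have hi := integrable_prod_cv ker_chi hH (g := fun x y => z + circ x • (-ε • y))
    (by fun_prop) (R := ‖z‖ + |ε|) (fun x y hy => by
      refine (norm_add_le _ _).trans (add_le_add le_rfl ?_)
      rw [norm_circ_smul, norm_smul, Real.norm_eq_abs, abs_neg]
      exact mul_le_of_le_one_right (abs_nonneg _) hy)
  have e : ∀ x, cv chi ε H z = ∫ y, chi y * H (z + circ x • (-ε • y)) := by
    intro x
    rw [cv, ← (measurePreserving_circ_smul (n := n) (circ x) (norm_circ x)).integral_comp
      (measurableEmbedding_const_smul₀ (by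
        intro h; have := norm_circ x; rw [h] at this; simp at this))]
    refine integral_congr_ae (ae_of_all _ fun y => ?_)
    simp only [chi_smul (norm_circ x)]
    rw [smul_comm, neg_smul, smul_neg, sub_eq_add_neg]
  calc cv chi ε H z = ∫ _, cv chi ε H z ∂nuc := by simp
    _ = ∫ x, (∫ y, chi y * H (z + circ x • (-ε • y))) ∂nuc := by simp_rw [← e]
    _ = _ := by
      rw [integral_integral_swap (f := fun x y => chi y * H (z + circ x • (-ε • y))) hi]
      simp_rw [integral_const_mul]

theorem RSub.le_mol (h : RSub H Ω) (hH : LBdd H) {ε : ℝ} {z : Cn n}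
    (hz : ∀ y, ‖y‖ ≤ 1 → z + ε • y ∈ Ω) : H z ≤ cv chi ε H z := by
  have hc := continuous_circ
  have hi := integrable_prod_cv ker_chi hH (g := fun x y => z + circ x • (-ε • y))
    (by fun_prop) (R := ‖z‖ + |ε|) (fun x y hy => by
      refine (norm_add_le _ _).trans (add_le_add le_rfl ?_)
      rw [norm_circ_smul, norm_smul, Real.norm_eq_abs, abs_neg]
      exact mul_le_of_le_one_right (abs_nonneg _) hy)
  rw [cv_chi_eq hH]
  have h1 : ∫ y : Cn n, chi y * H z = H z := by rw [integral_mul_const, integral_chi, one_mul]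
  rw [← h1]
  have hi2 := hi.integral_prod_right
  simp only [integral_const_mul] at hi2
  refine integral_mono (ker_chi.integrable.mul_const _) hi2 fun y => ?_
  by_cases hy : 1 < ‖y‖
  · simp [ker_chi.eq_zero hy]
  · refine mul_le_mul_of_nonneg_left (h _ _ fun ζ hζ => ?_) (chi_nonneg y)
    have := hz (ζ • -y) (by rw [norm_smul, norm_neg]; nlinarith [norm_nonneg y, norm_nonneg ζ])
    rwa [smul_comm, smul_neg, ← neg_smul] at this

/-- The real function associated with a plurisuperharmonic function on `Ω`. -/
def realOf (U : Cn n → ℝ≥0∞) (Ω : Set (Cn n)) (z : Cn n) : ℝ := -(Ω.indicator U z).toReal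

variable {U : Cn n → ℝ≥0∞}

theorem realOf_nonpos (U : Cn n → ℝ≥0∞) (Ω : Set (Cn n)) (z : Cn n) : realOf U Ω z ≤ 0 :=
  neg_nonpos.2 ENNReal.toReal_nonneg

theorem ofReal_neg_realOf {C : ℝ≥0∞} (hC : C ≠ ⊤) (hb : ∀ z ∈ Ω, U z ≤ C) {z : Cn n} (hz : z ∈ Ω) :
    ENNReal.ofReal (-realOf U Ω z) = U z := by
  rw [realOf, neg_neg, Set.indicator_of_mem hz,
    ENNReal.ofReal_toReal ((hb z hz).trans_lt hC.lt_top).ne]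

theorem neg_le_realOf {C : ℝ≥0∞} (hC : C ≠ ⊤) (hb : ∀ z ∈ Ω, U z ≤ C) (z : Cn n) :
    -C.toReal ≤ realOf U Ω z := by
  rw [realOf, neg_le_neg_iff]
  refine ENNReal.toReal_mono hC ?_
  by_cases hz : z ∈ Ω
  · simpa [hz] using hb z hz
  · simp [hz]

theorem lBdd_realOf (hΩ : IsOpen Ω) (hU : Spsh U Ω) {C : ℝ≥0∞} (hC : C ≠ ⊤)
    (hb : ∀ z ∈ Ω, U z ≤ C) : LBdd (realOf U Ω) := by
  refine ⟨(measurable_indicator_of_lsc hΩ hU.1).ennreal_toReal.neg, fun _ => ⟨C.toReal, ?_⟩⟩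
  intro z _
  rw [abs_of_nonpos (realOf_nonpos U Ω z)]
  linarith [neg_le_realOf hC hb z]

theorem integral_realOf_circ (hU : Spsh U Ω) {C : ℝ≥0∞} (hC : C ≠ ⊤)
    (hb : ∀ z ∈ Ω, U z ≤ C) {a b : Cn n} (hab : ∀ ζ : ℂ, ‖ζ‖ ≤ 1 → a + ζ • b ∈ Ω) :
    ∫ x, realOf U Ω (a + circ x • b) ∂nuc = -(∫⁻ x, U (a + circ x • b) ∂nuc).toReal := by
  have e : ∀ x, Ω.indicator U (a + circ x • b) = U (a + circ x • b) := fun x =>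
    Set.indicator_of_mem (hab _ (norm_circ x).le) _
  simp only [realOf, integral_neg, e]
  rw [integral_toReal (lsc_circ hU.1 hab).measurable.aemeasurable
    (ae_of_all _ fun x => (hb _ (hab _ (norm_circ x).le)).trans_lt hC.lt_top)]

theorem lintegral_circ_ne_top {C : ℝ≥0∞} (hC : C ≠ ⊤)
    (hb : ∀ z ∈ Ω, U z ≤ C) {a b : Cn n} (hab : ∀ ζ : ℂ, ‖ζ‖ ≤ 1 → a + ζ • b ∈ Ω) :
    ∫⁻ x, U (a + circ x • b) ∂nuc ≠ ⊤ := by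
  refine ((lintegral_mono fun x => hb _ (hab _ (norm_circ x).le)).trans_lt ?_).ne
  simpa using hC.lt_top

theorem rSub_realOf (hU : Spsh U Ω) {C : ℝ≥0∞} (hC : C ≠ ⊤)
    (hb : ∀ z ∈ Ω, U z ≤ C) : RSub (realOf U Ω) Ω := by
  intro a b hab
  have ha : a ∈ Ω := by simpa using hab 0 (by simp)
  rw [integral_realOf_circ hU hC hb hab, realOf, neg_le_neg_iff, Set.indicator_of_mem ha]
  exact ENNReal.toReal_mono ((hb a ha).trans_lt hC.lt_top).ne (hU.2 a b hab)

theorem mol_realOf_mono (hΩ : IsOpen Ω) (hU : Spsh U Ω) {C : ℝ≥0∞} (hC : C ≠ ⊤)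
    (hb : ∀ z ∈ Ω, U z ≤ C) {ε ε' : ℝ} (h0 : 0 ≤ ε) (hε' : 0 < ε') (hε : ε ≤ ε') {z : Cn n}
    (hz : ∀ y, ‖y‖ ≤ 1 → z + ε' • y ∈ Ω) :
    cv chi ε (realOf U Ω) z ≤ cv chi ε' (realOf U Ω) z := by
  have hH := lBdd_realOf hΩ hU hC hb
  have hc := continuous_circ
  have hi : ∀ ε : ℝ, Integrable fun y : Cn n => chi y * ∫ x, realOf U Ω (z + circ x • (-ε • y)) ∂nuc := by
    intro ε
    have hi := integrable_prod_cv ker_chi hH (g := fun x y => z + circ x • (-ε • y))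
      (by fun_prop) (R := ‖z‖ + |ε|) (fun x y hy => by
        refine (norm_add_le _ _).trans (add_le_add le_rfl ?_)
        rw [norm_circ_smul, norm_smul, Real.norm_eq_abs, abs_neg]
        exact mul_le_of_le_one_right (abs_nonneg _) hy)
    have hi2 := hi.integral_prod_right
    simpa only [integral_const_mul] using hi2
  rw [cv_chi_eq hH, cv_chi_eq hH]
  refine integral_mono (hi ε) (hi ε') fun y => ?_
  by_cases hy : 1 < ‖y‖
  · simp [ker_chi.eq_zero hy]
  · refine mul_le_mul_of_nonneg_left ?_ (chi_nonneg y)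
    have hy := not_lt.1 hy
    have hd : ∀ ζ : ℂ, ‖ζ‖ ≤ 1 → z + ζ • (-ε' • y) ∈ Ω := fun ζ hζ => by
      have := hz (ζ • -y) (by rw [norm_smul, norm_neg]; nlinarith [norm_nonneg y, norm_nonneg ζ])
      rwa [smul_comm, smul_neg, ← neg_smul] at this
    have hs0 : 0 ≤ ε / ε' := by positivity
    have hs1 : ε / ε' ≤ 1 := (div_le_one hε').2 hε
    have e : (-ε • y : Cn n) = ((ε / ε' : ℝ) : ℂ) • (-ε' • y) := by
      rw [Complex.coe_smul, smul_smul]; congr 1; field_simp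
    have hd2 : ∀ ζ : ℂ, ‖ζ‖ ≤ 1 → z + ζ • (-ε • y) ∈ Ω := fun ζ hζ => by
      rw [e, smul_smul]
      refine hd _ ?_
      rw [norm_mul, Complex.norm_real, Real.norm_of_nonneg hs0]
      nlinarith [norm_nonneg ζ]
    rw [integral_realOf_circ hU hC hb hd, integral_realOf_circ hU hC hb hd2,
      neg_le_neg_iff]
    refine ENNReal.toReal_mono (lintegral_circ_ne_top hC hb hd2) ?_
    rw [e]
    exact hU.circ_mean_anti hΩ hd hs0 hs1

/-- A continuous nonpositive function with the sub-mean value property is psh. -/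
theorem RSub.spsh {u : Cn n → ℝ} (hu : RSub u Ω) (hc : Continuous u) (h0 : ∀ z, u z ≤ 0) :
    Spsh (fun z => ENNReal.ofReal (-u z)) Ω := by
  have hci := continuous_circ
  refine ⟨fun z _ => (ENNReal.continuous_ofReal.comp hc.neg).lowerSemicontinuous z, ?_⟩
  intro a b hab
  rw [← ofReal_integral_eq_lintegral_ofReal (integrable_cont (by fun_prop))
    (ae_of_all _ fun x => by simpa using h0 _), integral_neg]
  exact ENNReal.ofReal_le_ofReal (neg_le_neg (hu a b hab))

theorem NegE_ofReal (u : Cn n → ℝ) : NegE (fun z => ((u z : ℝ) : EReal))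
    = fun z => ENNReal.ofReal (-u z) := by
  ext z
  rw [NegE, ← EReal.coe_neg, EReal.toENNReal_of_ne_top (EReal.coe_ne_top _), EReal.toReal_coe]

theorem RSub.pshNeg {u : Cn n → ℝ} (hΩ : IsOpen Ω) (hu : RSub u Ω) (hc : Continuous u)
    (h0 : ∀ z, u z ≤ 0) : PSHNeg (fun z => ((u z : ℝ) : EReal)) Ω := by
  refine pshNeg_of_spsh hΩ (fun z _ => by exact_mod_cast h0 z) ?_
  rw [NegE_ofReal]; exact hu.spsh hc h0

theorem tendsto_mol_of_usc (h : RSub H Ω) (hΩ : IsOpen Ω) (hH : LBdd H) {z : Cn n} (hz : z ∈ Ω)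
    (husc : UpperSemicontinuousAt H z) {ε : ℕ → ℝ} (hε : Tendsto ε atTop (𝓝 0)) :
    Tendsto (fun k => cv chi (ε k) H z) atTop (𝓝 (H z)) := by
  have hnear : ∀ V ∈ 𝓝 z, ∀ᶠ k in atTop, ∀ y : Cn n, ‖y‖ ≤ 1 → z + ε k • y ∈ V ∧ z - ε k • y ∈ V := by
    intro V hV
    obtain ⟨r, hr, hb⟩ := Metric.mem_nhds_iff.1 hV
    filter_upwards [hε.eventually (Metric.ball_mem_nhds 0 hr)] with k hk y hy
    have : ‖ε k • y‖ < r := by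
      rw [norm_smul]
      exact (mul_le_of_le_one_right (norm_nonneg _) hy).trans_lt (by simpa using hk)
    constructor <;> refine hb ?_ <;> simpa [dist_eq_norm] using this
  refine tendsto_order.2 ⟨fun c hc => ?_, fun c hc => ?_⟩
  · filter_upwards [hnear Ω (hΩ.mem_nhds hz)] with k hk
    exact hc.trans_le (h.le_mol hH fun y hy => (hk y hy).1)
  · obtain ⟨c', h1, h2⟩ := exists_between hc
    filter_upwards [hnear _ (husc c' h1)] with k hk
    exact (mol_le_of_le hH fun y hy => (hk y hy).2.le).trans_lt h2

end MollifySubmean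

section Potentials
variable {n : ℕ} {Ω : Set (Cn n)} {H : Cn n → ℝ} {μ : Measure (Cn n)}

/-- The `k`-th mollification. -/
def mol (H : Cn n → ℝ) (k : ℕ) : Cn n → ℝ := cv chi (1 / ((k : ℝ) + 1)) H

/-- A bounded psh function on `Ω` with zero boundary values, extended by zero, whose smooth
Monge–Ampère measures converge to the finite measure `μ`. -/
structure BPot (Ω : Set (Cn n)) (H : Cn n → ℝ) (μ : Measure (Cn n)) : Prop where
  bdd : ∃ C, ∀ z, -C ≤ H z
  nonpos : ∀ z, H z ≤ 0
  lBdd : LBdd H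
  rSub : RSub H Ω
  usc : ∀ z ∈ Ω, UpperSemicontinuousAt H z
  mono : ∀ ε ε' : ℝ, 0 ≤ ε → 0 < ε' → ε ≤ ε' → ∀ z : Cn n, (∀ y, ‖y‖ ≤ 1 → z + ε' • y ∈ Ω) →
    cv chi ε H z ≤ cv chi ε' H z
  bdry : ∀ c > 0, ∃ K ⊆ Ω, IsCompact K ∧ ∀ z ∉ K, -c < H z
  fin : IsFiniteMeasure μ
  compl : μ Ωᶜ = 0
  weak : ∀ f : Cn n → ℝ, Continuous f → HasCompactSupport f → tsupport f ⊆ Ω →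
    Tendsto (fun k => ∫ z, f z * maDensity n (mol H k) z) atTop (𝓝 (∫ z, f z ∂μ))

theorem tendsto_mol_scale : Tendsto (fun k : ℕ => 1 / ((k : ℝ) + 1)) atTop (𝓝 0) :=
  tendsto_one_div_add_atTop_nhds_zero_nat

theorem mol_scale_pos (k : ℕ) : 0 < 1 / ((k : ℝ) + 1) := by positivity

theorem contDiff_mol (hH : LBdd H) (k : ℕ) : ContDiff ℝ (⊤ : ℕ∞) (mol H k) :=
  contDiff_cv ker_chi (mol_scale_pos k) hH

/-- Near a compact subset of `Ω` all small discs stay in `Ω`. -/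
theorem exists_nhds_scale (hΩ : IsOpen Ω) {K : Set (Cn n)} (hK : IsCompact K) (hKΩ : K ⊆ Ω) :
    ∃ V, IsOpen V ∧ K ⊆ V ∧ V ⊆ Ω ∧ ∀ᶠ k : ℕ in atTop, ∀ z ∈ V, ∀ y : Cn n, ‖y‖ ≤ 1 →
      z + (1 / ((k : ℝ) + 1)) • y ∈ Ω ∧ z - (1 / ((k : ℝ) + 1)) • y ∈ Ω := by
  obtain ⟨δ, hδ, hs⟩ := hK.exists_thickening_subset_open hΩ hKΩ
  refine ⟨Metric.thickening (δ / 2) K, Metric.isOpen_thickening,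
    Metric.self_subset_thickening (half_pos hδ) K,
    (Metric.thickening_mono (by linarith) K).trans hs, ?_⟩
  filter_upwards [tendsto_mol_scale.eventually (gt_mem_nhds (half_pos hδ))] with k hk z hz y hy
  obtain ⟨x, hx, hzx⟩ := Metric.mem_thickening_iff.1 hz
  have h1 : ‖(1 / ((k : ℝ) + 1)) • y‖ < δ / 2 := by
    rw [norm_smul, Real.norm_of_nonneg (mol_scale_pos k).le]
    nlinarith [norm_nonneg y, mol_scale_pos k]
  constructor <;> refine hs (Metric.mem_thickening_iff.2 ⟨x, hx, ?_⟩)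
  · have := dist_triangle (z + (1 / ((k : ℝ) + 1)) • y) z x
    rw [dist_self_add_left] at this; linarith
  · have := dist_triangle (z - (1 / ((k : ℝ) + 1)) • y) z x
    rw [dist_eq_norm (z - _) z, sub_sub_cancel_left, norm_neg] at this; linarith

theorem classE0_bPot (hΩ : IsOpen Ω) (hb : Bornology.IsBounded Ω) {h : Cn n → EReal}
    (hh : ClassE0 n Ω h) (hμ : IsMAMeasure n h Ω μ) (hf : μ Ω ≠ ⊤) :
    BPot Ω (realOf (NegE h) Ω) μ := by
  obtain ⟨hp, ⟨M, hM⟩, hbd, -⟩ := hh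
  have hU : Spsh (NegE h) Ω := hp.spsh hΩ
  have hC : ENNReal.ofReal M ≠ ⊤ := ENNReal.ofReal_ne_top
  have hbC : ∀ z ∈ Ω, NegE h z ≤ ENNReal.ofReal M := by
    intro z hz
    have := hM z hz
    have h2 : -h z ≤ (M : EReal) := EReal.neg_le_of_neg_le this
    refine (EReal.toENNReal_le_toENNReal h2).trans (le_of_eq ?_)
    rw [EReal.toENNReal_of_ne_top (EReal.coe_ne_top _), EReal.toReal_coe]
  have hL : LBdd (realOf (NegE h) Ω) := lBdd_realOf hΩ hU hC hbC
  have hval : ∀ z ∈ Ω, ((realOf (NegE h) Ω z : ℝ) : EReal) = h z := by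
    intro z hz
    rw [← neg_neg_eq (hp.2 z hz), realOf, Set.indicator_of_mem hz]
    have := ((hbC z hz).trans_lt hC.lt_top).ne
    lift NegE h z to NNReal using this with u
    simp only [ENNReal.coe_toReal, EReal.coe_neg]
    rfl
  have husc : ∀ z ∈ Ω, UpperSemicontinuousAt (realOf (NegE h) Ω) z := by
    intro z hz y hy
    have h1 : h z < (y : EReal) := by rw [← hval z hz]; exact_mod_cast hy
    have := hp.1.1 z hz y h1
    rw [hΩ.nhdsWithin_eq hz] at this
    filter_upwards [this, hΩ.mem_nhds hz] with x hx hxΩ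
    rw [← hval x hxΩ] at hx; exact_mod_cast hx
  have hR := rSub_realOf hU hC hbC
  have hmono := fun ε ε' h0 h0' h1 z hz => mol_realOf_mono hΩ hU hC hbC (ε := ε) (ε' := ε') h0 h0' h1 (z := z) hz
  refine ⟨⟨_, neg_le_realOf hC hbC⟩, realOf_nonpos _ _, hL, hR, husc, hmono, ?_,
    ⟨?_⟩, hμ.1, ?_⟩
  · intro c hc
    have h1 : ∀ ζ ∈ frontier Ω, ∃ V, IsOpen V ∧ ζ ∈ V ∧ ∀ x ∈ V ∩ Ω, ((-c : ℝ) : EReal) < h x := by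
      intro ζ hζ
      have h2 := (hbd ζ hζ).eventually (lt_mem_nhds (show ((-c : ℝ) : EReal) < 0 by
        exact_mod_cast neg_lt_zero.2 hc))
      obtain ⟨V, hV, h3⟩ := (mem_nhdsWithin_iff_exists_mem_nhds_inter).1 h2
      obtain ⟨W, hWV, hW, hζW⟩ := mem_nhds_iff.1 hV
      exact ⟨W, hW, hζW, fun x hx => h3 ⟨hWV hx.1, hx.2⟩⟩
    choose! V hV hζV hVc using h1
    refine ⟨closure Ω \ ⋃ ζ ∈ frontier Ω, V ζ, ?_, ?_, ?_⟩
    · rintro z ⟨hz, hzV⟩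
      by_contra hcon
      exact hzV (Set.mem_biUnion (show z ∈ frontier Ω from
        ⟨hz, by rwa [hΩ.interior_eq]⟩) (hζV z ⟨hz, by rwa [hΩ.interior_eq]⟩))
    · exact hb.isCompact_closure.diff (isOpen_biUnion hV)
    · intro z hz
      by_cases hzΩ : z ∈ Ω
      · have : z ∈ ⋃ ζ ∈ frontier Ω, V ζ := by
          by_contra hcon; exact hz ⟨subset_closure hzΩ, hcon⟩
        obtain ⟨ζ, hζ, hzζ⟩ := Set.mem_iUnion₂.1 this
        have := hVc ζ hζ z ⟨hzζ, hzΩ⟩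
        rw [← hval z hzΩ] at this; exact_mod_cast this
      · simpa [realOf, hzΩ] using hc
  · rw [← Set.union_compl_self Ω]
    refine (measure_union_le _ _).trans_lt ?_
    rw [hμ.1, add_zero]; exact hf.lt_top
  · intro f hfc hfs hft
    obtain ⟨V, hV, hKV, hVΩ, hk⟩ := exists_nhds_scale hΩ hfs hft
    obtain ⟨N, hN⟩ := eventually_atTop.1 hk
    rw [← tendsto_add_atTop_iff_nat N]
    refine hμ.2.2 V hV hVΩ (fun k => mol (realOf (NegE h) Ω) (k + N))
      (fun k => (contDiff_mol hL _).contDiffOn) (fun k => ?_) (fun k z hz => ?_) (fun z hz => ?_)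
      f hfc hfs hKV
    · refine (RSub.pshNeg hV (hR.mol hL fun z hz y hy => ?_)
        (contDiff_mol hL _).continuous fun z => ?_).1
      · exact (hN (k + N) (by omega) z hz y hy).2
      · exact mol_le_of_le hL fun y _ => realOf_nonpos _ _ _
    · refine hmono _ _ (mol_scale_pos _).le (mol_scale_pos _) ?_ z fun y hy =>
        (hN (k + N) (by omega) z hz y hy).1
      apply one_div_le_one_div_of_le (by positivity)
      push_cast; linarith
    · have ht := tendsto_mol_of_usc hR hΩ hL (hVΩ hz) (husc z (hVΩ hz)) tendsto_mol_scale
      rw [← hval z (hVΩ hz)]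
      have h2 := (continuous_coe_real_ereal.tendsto _).comp ((tendsto_add_atTop_iff_nat N).2 ht)
      refine iInf_eq_of_tendsto (antitone_nat_of_succ_le fun k => ?_) h2
      refine EReal.coe_le_coe_iff.2 (hmono _ _ (mol_scale_pos _).le (mol_scale_pos _) ?_ z fun y hy =>
        (hN (k + N) (by omega) z hz y hy).1)
      apply one_div_le_one_div_of_le (by positivity)
      push_cast; linarith

end Potentials

section Energy
variable {n : ℕ} {Ω : Set (Cn n)} {H : Cn n → ℝ} {μ : Measure (Cn n)}

open scoped Manifold in
theorem exists_cutoff (hΩ : IsOpen Ω) {K : Set (Cn n)} (hK : IsCompact K) (hKΩ : K ⊆ Ω) :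
    ∃ g : Cn n → ℝ, ContDiff ℝ (⊤ : ℕ∞) g ∧ HasCompactSupport g ∧ tsupport g ⊆ Ω ∧
      (∀ z, 0 ≤ g z) ∧ (∀ z, g z ≤ 1) ∧ ∀ᶠ z in 𝓝ˢ K, g z = 1 := by
  obtain ⟨L, hL, hKL, hLΩ⟩ := exists_compact_between hK hΩ hKΩ
  obtain ⟨f, h0, h1, h2⟩ := exists_contMDiffMap_zero_one_nhds_of_isClosed 𝓘(ℝ, Cn n) (n := (⊤ : ℕ∞))
    (s := (interior L)ᶜ) (t := K) isOpen_interior.isClosed_compl hK.isClosed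
    (Set.disjoint_left.2 fun z hz hzK => hz (hKL hzK))
  have hs : tsupport f ⊆ L := by
    refine closure_minimal (fun z hz => ?_) hL.isClosed
    by_contra hcon
    exact hz (h0.self_of_nhdsSet z fun h => hcon (interior_subset h))
  exact ⟨f, contMDiff_iff_contDiff.1 f.contMDiff, hL.of_isClosed_subset (isClosed_tsupport _) hs,
    hs.trans hLΩ, fun z => (h2 z).1, fun z => (h2 z).2, h1⟩

theorem maDensity_affine {u : Cn n → ℝ} (hu : ContDiff ℝ (⊤ : ℕ∞) u) (c d : ℝ) (z : Cn n) :
    maDensity n (fun x => c * u x + d) z = c ^ n * maDensity n u z := by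
  rw [maDensity_eq, maDensity_eq, Lv_add (contDiff_const.mul hu) contDiff_const, Lv_zero, add_zero,
    Lv_const_mul hu, Matrix.det_smul, Fintype.card_fin, ← Complex.ofReal_pow, Complex.re_ofReal_mul]
  ring

theorem maDensity_nonneg {u : Cn n → ℝ} (hu : ContDiff ℝ (⊤ : ℕ∞) u) {z : Cn n}
    (h : ∀ b, 0 ≤ lapl u z b) : 0 ≤ maDensity n u z := by
  rw [maDensity_eq]
  have := (Lv_posSemidef hu h).det_nonneg
  rw [Complex.le_def] at this
  have h2 := this.1
  simp only [Complex.zero_re] at h2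
  positivity

theorem mono_lapl {h v T : Cn n → ℝ} (hh : ContDiff ℝ (⊤ : ℕ∞) h) (hv : ContDiff ℝ (⊤ : ℕ∞) v)
    (hT : ContDiff ℝ (⊤ : ℕ∞) T) {K : Set (Cn n)} (hK : IsCompact K) (hvh : ∀ z ∉ K, v z = h z)
    (hle : ∀ z, h z ≤ v z) (h1 : ∀ z ∈ K, ∀ b, 0 ≤ lapl h z b) (h2 : ∀ z ∈ K, ∀ b, 0 ≤ lapl v z b)
    (h3 : ∀ z ∈ K, ∀ b, lapl T z b ≤ 0) :
    ∫ z, T z * (maDensity n v z - maDensity n h z) ≤ 0 := by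
  have hsub : tsupport (fun x => v x - h x) ⊆ K := by
    refine closure_minimal (fun z hz => ?_) hK.isClosed
    by_contra hcon
    exact hz (by simp [hvh z hcon])
  have e : (fun x => h x + (v x - h x)) = v := by ext x; ring
  have := mono hh (hv.sub hh) hT (hK.of_isClosed_subset (isClosed_tsupport _) hsub)
    (fun z => sub_nonneg.2 (hle z)) (fun z hz => Lv_posSemidef hh (h1 z (hsub hz)))
    (fun z hz => by simp only [e]; exact Lv_posSemidef hv (h2 z (hsub hz)))
    (fun z hz => by
      have hT' : ContDiff ℝ (⊤ : ℕ∞) (fun x => (-1) * T x) := contDiff_const.mul hT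
      have := Lv_posSemidef (z := z) hT' fun b => by
        rw [lapl_const_mul hT]; linarith [h3 z (hsub hz) b]
      rw [Lv_const_mul hT] at this
      simpa using this)
  simpa only [e] using this

theorem exists_nhds_lapl (hΩ : IsOpen Ω) (hL : LBdd H) (hR : RSub H Ω) {K : Set (Cn n)}
    (hK : IsCompact K) (hKΩ : K ⊆ Ω) :
    ∃ V, IsOpen V ∧ K ⊆ V ∧ V ⊆ Ω ∧ ∀ᶠ k in atTop, ∀ z ∈ V,
      (∀ b, 0 ≤ lapl (mol H k) z b) ∧ H z ≤ mol H k z := by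
  obtain ⟨V, hV, hKV, hVΩ, hk⟩ := exists_nhds_scale hΩ hK hKΩ
  refine ⟨V, hV, hKV, hVΩ, hk.mono fun k hk z hz => ⟨fun b => ?_, ?_⟩⟩
  · exact (hR.mol hL fun z hz y hy => (hk z hz y hy).2).lapl_nonneg (contDiff_mol hL k)
      (hV.mem_nhds hz) b
  · exact hR.le_mol hL fun y hy => (hk z hz y hy).1

theorem BPot.mol_nonpos (h : BPot Ω H μ) (k : ℕ) (z : Cn n) : mol H k z ≤ 0 :=
  mol_le_of_le h.lBdd fun _ _ => h.nonpos _

theorem BPot.mol_bdry (h : BPot Ω H μ) (hΩ : IsOpen Ω) {c : ℝ} (hc : 0 < c) :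
    ∃ K ⊆ Ω, IsCompact K ∧ ∀ᶠ k in atTop, ∀ z ∉ K, -c ≤ mol H k z := by
  obtain ⟨K, hKΩ, hK, hb⟩ := h.bdry c hc
  obtain ⟨L, hL, hKL, hLΩ⟩ := exists_compact_between hK hΩ hKΩ
  obtain ⟨δ, hδ, hs⟩ := hK.exists_thickening_subset_open isOpen_interior hKL
  refine ⟨L, hLΩ, hL, ?_⟩
  filter_upwards [tendsto_mol_scale.eventually (gt_mem_nhds hδ)] with k hk z hz
  refine le_mol_of_le h.lBdd fun y hy => (hb _ fun hK' => hz ?_).le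
  refine interior_subset (hs (Metric.mem_thickening_iff.2 ⟨_, hK', ?_⟩))
  rw [dist_eq_norm, sub_sub_cancel, norm_smul, Real.norm_of_nonneg (mol_scale_pos k).le]
  nlinarith [norm_nonneg y, mol_scale_pos k]

/-- Dini: mollifications are eventually uniformly negative on compact sets. -/
theorem BPot.mol_neg (h : BPot Ω H μ) (hΩ : IsOpen Ω) (hneg : ∀ z ∈ Ω, H z < 0) {K : Set (Cn n)}
    (hK : IsCompact K) (hKΩ : K ⊆ Ω) : ∃ c > 0, ∀ᶠ k in atTop, ∀ z ∈ K, mol H k z < -c := by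
  obtain ⟨V, hV, hKV, hVΩ, hk⟩ := exists_nhds_scale hΩ hK hKΩ
  refine hK.induction_on (p := fun S => ∃ c > 0, ∀ᶠ k in atTop, ∀ z ∈ S, mol H k z < -c) ?_ ?_ ?_ ?_
  · exact ⟨1, one_pos, by simp⟩
  · rintro s t hst ⟨c, hc, h1⟩
    exact ⟨c, hc, h1.mono fun k hk z hz => hk z (hst hz)⟩
  · rintro s t ⟨c, hc, h1⟩ ⟨d, hd, h2⟩
    refine ⟨min c d, lt_min hc hd, ?_⟩
    filter_upwards [h1, h2] with k h1 h2 z hz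
    rcases hz with hz | hz
    · linarith [h1 z hz, min_le_left c d]
    · linarith [h2 z hz, min_le_right c d]
  · intro z hz
    have ht := tendsto_mol_of_usc h.rSub hΩ h.lBdd (hKΩ hz) (h.usc z (hKΩ hz)) tendsto_mol_scale
    have hz0 := hneg z (hKΩ hz)
    have h1 := ht.eventually (gt_mem_nhds (show H z < H z / 2 by linarith))
    obtain ⟨N, hN⟩ := eventually_atTop.1 hk
    obtain ⟨m, hm, hNm⟩ := (h1.and (eventually_ge_atTop N)).exists
    refine ⟨{x | mol H m x < H z / 2} ∩ V, mem_nhdsWithin_of_mem_nhds (inter_mem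
      ((contDiff_mol h.lBdd m).continuous.continuousAt.eventually (gt_mem_nhds hm))
      (hV.mem_nhds (hKV hz))), -(H z / 2), by linarith, ?_⟩
    filter_upwards [eventually_ge_atTop m] with k hkm x hx
    rw [neg_neg]
    refine lt_of_le_of_lt (h.mono _ _ (mol_scale_pos k).le (mol_scale_pos m) ?_ x fun y hy =>
      (hN m hNm x hx.2 y hy).1) hx.1
    apply one_div_le_one_div_of_le (by positivity)
    have : (m : ℝ) ≤ k := by exact_mod_cast hkm
    linarith

/-- A continuous cutoff capturing almost all of the weighted mass. -/
theorem exists_cutoff_mass [IsFiniteMeasure μ] (hΩ : IsOpen Ω) (hc : μ Ωᶜ = 0) {T : Cn n → ℝ}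
    (hT : Continuous T) {R : ℝ} (hT1 : ∀ z ∈ Ω, 0 ≤ T z ∧ T z ≤ R) {η : ℝ} (hη : 0 < η) :
    ∃ f : Cn n → ℝ, Continuous f ∧ HasCompactSupport f ∧ tsupport f ⊆ Ω ∧
      (∀ z, 0 ≤ f z) ∧ (∀ z, f z ≤ 1) ∧ ∫ z, T z ∂μ - η ≤ ∫ z, f z * T z ∂μ := by
  have hae : ∀ᵐ z ∂μ, z ∈ Ω := by
    rw [ae_iff]; exact hc
  have hTi : Integrable T μ := by
    refine Integrable.of_bound hT.aestronglyMeasurable R (hae.mono fun z hz => ?_)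
    rw [Real.norm_of_nonneg (hT1 z hz).1]; exact (hT1 z hz).2
  obtain ⟨K, hKΩ, hK, hμK⟩ := hΩ.measurableSet.exists_isCompact_lt_add (μ := μ)
    (measure_ne_top μ Ω) (ε := ENNReal.ofReal (η / (|R| + 1))) (by positivity)
  obtain ⟨g, hg, hgs, hgΩ, hg0, hg1, hgK⟩ := exists_cutoff hΩ hK hKΩ
  refine ⟨g, hg.continuous, hgs, hgΩ, hg0, hg1, ?_⟩
  have hgi : Integrable (fun z => g z * T z) μ := by
    refine Integrable.mono hTi (hg.continuous.mul hT).aestronglyMeasurable (ae_of_all _ fun z => ?_)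
    rw [norm_mul, Real.norm_of_nonneg (hg0 z)]
    exact mul_le_of_le_one_left (norm_nonneg _) (hg1 z)
  have hμ2 : μ.real Kᶜ ≤ η / (|R| + 1) := by
    have h1 : μ Kᶜ ≤ ENNReal.ofReal (η / (|R| + 1)) := by
      have : Kᶜ ⊆ (Ω \ K) ∪ Ωᶜ := fun z hz => by
        by_cases h : z ∈ Ω
        · exact Or.inl ⟨h, hz⟩
        · exact Or.inr h
      refine (measure_mono this).trans ((measure_union_le _ _).trans ?_)
      rw [hc, add_zero, measure_sdiff hKΩ hK.measurableSet.nullMeasurableSet (measure_ne_top _ _)]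
      exact tsub_le_iff_left.2 hμK.le
    exact ENNReal.toReal_le_of_le_ofReal (by positivity) h1
  have h3 : ∫ z, T z ∂μ - ∫ z, g z * T z ∂μ ≤ ∫ z, Kᶜ.indicator (fun _ => |R|) z ∂μ := by
    rw [← integral_sub hTi hgi]
    refine integral_mono_ae (hTi.sub hgi) ((integrable_const _).indicator
      hK.measurableSet.compl) (hae.mono fun z hz => ?_)
    by_cases hzK : z ∈ K
    · simp [hzK, hgK.self_of_nhdsSet z hzK]
    · simp only [Set.mem_compl_iff, hzK, not_false_eq_true, Set.indicator_of_mem]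
      nlinarith [hT1 z hz, hg0 z, hg1 z, le_abs_self R, mul_nonneg (hg0 z) (hT1 z hz).1]
  rw [integral_indicator_const _ hK.measurableSet.compl, smul_eq_mul] at h3
  have h4 : μ.real Kᶜ * |R| ≤ η := by
    have : η / (|R| + 1) * (|R| + 1) = η := by field_simp
    nlinarith [abs_nonneg R, show 0 ≤ η / (|R| + 1) by positivity]
  linarith

end Energy

section EnergyEstimate
variable {n : ℕ} {Ω : Set (Cn n)} {H H0 : Cn n → ℝ} {μ μ0 : Measure (Cn n)}

theorem fderiv_sqn (z b : Cn n) :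
    fderiv ℝ sqn z b = 2 * (∑ i, starRingEnd ℂ (z i) * b i).re := by
  have h1 := ((contDiff_sqn (n := n)).differentiable (by simp) z).hasFDerivAt.hasLineDerivAt b
  have h2 : HasDerivAt (fun t : ℝ => sqn z + 2 * (∑ i, starRingEnd ℂ (z i) * b i).re * t
      + t ^ 2 * sqn b) (2 * (∑ i, starRingEnd ℂ (z i) * b i).re) 0 := by
    have := (((hasDerivAt_id (0 : ℝ)).const_mul (2 * (∑ i, starRingEnd ℂ (z i) * b i).re)).const_add
      (sqn z)).add ((hasDerivAt_pow 2 (0 : ℝ)).mul_const (sqn b))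
    simp only [mul_one, Nat.cast_ofNat, Nat.add_one_sub_one, pow_one, mul_zero, zero_mul,
      add_zero] at this
    exact this
  refine HasDerivAt.unique h1 (h2.congr_of_eventuallyEq (Eventually.of_forall fun t => ?_))
  show sqn (z + t • b) = _
  have := sqn_line z b (t : ℂ)
  simp only [Complex.coe_smul] at this
  rw [this, Complex.norm_real, Real.norm_eq_abs, sq_abs, Complex.re_ofReal_mul]
  simp only [Complex.mul_re, Complex.re_ofNat, Complex.im_ofNat]; ring

theorem reB_sqn (z a b : Cn n) : reB n sqn z a b = 2 * (∑ i, starRingEnd ℂ (a i) * b i).re := by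
  have e : (fun x : Cn n => fderiv ℝ sqn x b) = fun x => 2 * (∑ i, starRingEnd ℂ (x i) * b i).re :=
    funext fun x => fderiv_sqn x b
  have hd : DifferentiableAt ℝ (fun x : Cn n => fderiv ℝ sqn x b) z :=
    (contDiff_sqn.fderiv_dir b).differentiable (by simp) z
  have h1 := hd.hasFDerivAt.hasLineDerivAt a
  rw [reB]
  refine HasDerivAt.unique h1 ?_
  have h2 : HasDerivAt (fun t : ℝ => 2 * (∑ i, starRingEnd ℂ (z i) * b i).re
      + t * (2 * (∑ i, starRingEnd ℂ (a i) * b i).re)) (2 * (∑ i, starRingEnd ℂ (a i) * b i).re)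
      0 := by
    have := ((hasDerivAt_id (0 : ℝ)).mul_const
      (2 * (∑ i, starRingEnd ℂ (a i) * b i).re)).const_add (2 * (∑ i, starRingEnd ℂ (z i) * b i).re)
    rw [one_mul] at this
    exact this
  refine h2.congr_of_eventuallyEq (Eventually.of_forall fun t => ?_)
  simp only [fderiv_sqn, Pi.add_apply, Pi.smul_apply, map_add, add_mul, Finset.sum_add_distrib,
    Complex.add_re, Complex.real_smul, map_mul, Complex.conj_ofReal, mul_assoc, ← Finset.mul_sum,
    Complex.re_ofReal_mul]
  ring

theorem lapl_sqn (z b : Cn n) : lapl sqn z b = 4 * sqn b := by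
  have h (c : Cn n) : reB n sqn z c c = 2 * sqn c := by
    rw [reB_sqn, sqn, Complex.re_sum]
    congr 1
    refine Finset.sum_congr rfl fun i _ => ?_
    rw [Complex.conj_mul', ← Complex.ofReal_pow, Complex.ofReal_re]
  rw [lapl, h, h, sqn_smul]; simp; ring

theorem lapl_sqn_nonneg (z b : Cn n) : 0 ≤ lapl sqn z b := by
  rw [lapl_sqn]; linarith [sqn_nonneg b]

theorem Lv_sqn (z : Cn n) : Lv n sqn z = 1 := by
  ext j k
  simp only [Lv, Matrix.of_apply, cHessEntry, reB_sqn]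
  by_cases h : j = k
  · subst h
    simp [Pi.single_apply, apply_ite (starRingEnd ℂ)]; norm_num
  · simp [Pi.single_apply, apply_ite (starRingEnd ℂ), Matrix.one_apply_ne h, Ne.symm h]

theorem maDensity_sqn (z : Cn n) : maDensity n sqn z = 4 ^ n * n.factorial := by
  rw [maDensity_eq, Lv_sqn]; simp

theorem lapl_quad_nonpos (R : ℝ) (z b : Cn n) : lapl (fun x => R - sqn x) z b ≤ 0 := by
  have : lapl (fun x : Cn n => R - sqn x) z b = - lapl sqn z b := by
    have := lapl_add (n := n) (u := fun _ => R) (v := fun x => (-1) * sqn x) contDiff_const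
      (contDiff_const.mul contDiff_sqn) z b
    rw [lapl_const, lapl_const_mul contDiff_sqn] at this
    simpa [sub_eq_add_neg] using this
  rw [this]; linarith [lapl_sqn_nonneg z b]

/-- Off a closed set where two functions agree the densities agree. -/
theorem maDensity_eq_off {K : Set (Cn n)} (hK : IsClosed K) {u v : Cn n → ℝ}
    (h : ∀ z ∉ K, v z = u z) {z : Cn n} (hz : z ∉ K) : maDensity n v z = maDensity n u z :=
  maDensity_congr (by filter_upwards [hK.isOpen_compl.mem_nhds hz] with x hx using h x hx)

theorem lapl_eq_off {K : Set (Cn n)} (hK : IsClosed K) {u v : Cn n → ℝ}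
    (h : ∀ z ∉ K, v z = u z) {z : Cn n} (hz : z ∉ K) (b : Cn n) : lapl v z b = lapl u z b :=
  lapl_congr (by filter_upwards [hK.isOpen_compl.mem_nhds hz] with x hx using h x hx) b

theorem BPot.energy (hΩ : IsOpen Ω) (B0 : BPot Ω H0 μ0) (B : BPot Ω H μ) (hle : ∀ z, H z ≤ H0 z)
    (hneg : ∀ z ∈ Ω, H0 z < 0) {R : ℝ} (hR : ∀ z ∈ Ω, sqn z ≤ R) {η : ℝ} (hη : 0 < η)
    {C0 : ℝ} (hC0 : ∀ z, -C0 ≤ H0 z)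
    (hE : ∫ z, (R - sqn z) ∂μ ≤ ∫ z, (R - sqn z) ∂μ0 + η) {K : Set (Cn n)} (hK : IsCompact K)
    (hKΩ : K ⊆ Ω) :
    ∀ᶠ k in atTop, ∀ v : Cn n → ℝ, ContDiff ℝ (⊤ : ℕ∞) v → (∀ z, v z ≤ max (mol H k z) (-C0)) →
      (∀ z ∉ K, v z = mol H k z) → (∀ z ∈ K, ∀ b, 0 ≤ lapl v z b) →
      ∫ z, (R - sqn z) * (maDensity n (mol H k) z - maDensity n v z) ≤ 5 * η := by
  have hTc : Continuous fun z : Cn n => R - sqn z := continuous_const.sub continuous_sqn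
  have hTs : ContDiff ℝ (⊤ : ℕ∞) fun z : Cn n => R - sqn z := contDiff_const.sub contDiff_sqn
  set T : Cn n → ℝ := fun z => R - sqn z with hTdef
  have hT0 : ∀ z ∈ Ω, 0 ≤ T z := fun z hz => sub_nonneg.2 (hR z hz)
  have hT1 : ∀ z ∈ Ω, 0 ≤ T z ∧ T z ≤ R := fun z hz =>
    ⟨hT0 z hz, by simp only [hTdef]; linarith [sqn_nonneg z]⟩
  have := B0.fin
  have := B.fin
  obtain ⟨f, hf, hfs, hfΩ, hf0, hf1, hfE⟩ := exists_cutoff_mass hΩ B0.compl hTc hT1 hη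
  obtain ⟨b, hb, hbk⟩ := B0.mol_neg hΩ hneg hfs hfΩ
  set E0 := ∫ z, T z ∂μ0
  obtain ⟨τ, hτ0, hτ1, hτ⟩ : ∃ τ : ℝ, 0 < τ ∧ τ < 1 ∧ E0 - 3 * η < (1 - τ) ^ n * (E0 - 2 * η) := by
    have h1 : Tendsto (fun τ : ℝ => (1 - τ) ^ n * (E0 - 2 * η)) (𝓝[>] 0) (𝓝 (E0 - 2 * η)) := by
      have : Continuous fun τ : ℝ => (1 - τ) ^ n * (E0 - 2 * η) := by fun_prop
      have := this.tendsto 0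
      simp only [sub_zero, one_pow, one_mul] at this
      exact this.mono_left nhdsWithin_le_nhds
    obtain ⟨τ, h2, h3, h4⟩ := ((h1.eventually (lt_mem_nhds (show E0 - 3 * η < E0 - 2 * η by
      linarith))).and (((eventually_mem_nhdsWithin (a := (0 : ℝ)) (s := Set.Ioi 0))).and
      ((gt_mem_nhds (show (0 : ℝ) < 1 by norm_num)).filter_mono nhdsWithin_le_nhds))).exists
    exact ⟨τ, h3, h4, h2⟩
  set κ := τ * b / 2 with hκdef
  have hκ : 0 < κ := by positivity
  obtain ⟨K1, hK1Ω, hK1, hK1b⟩ := B.mol_bdry hΩ hκ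
  have hK2 : IsCompact (K ∪ K1 ∪ tsupport f) := (hK.union hK1).union hfs
  have hK2Ω : K ∪ K1 ∪ tsupport f ⊆ Ω := Set.union_subset (Set.union_subset hKΩ hK1Ω) hfΩ
  obtain ⟨F, hF, hFs, hFΩ, hF0, hF1, hFK⟩ := exists_cutoff hΩ hK2 hK2Ω
  replace hFK := fun z hz => hFK.self_of_nhdsSet z hz
  obtain ⟨V, hV, hFV, hVΩ, hVk⟩ := exists_nhds_lapl hΩ B.lBdd B.rSub hFs hFΩ
  obtain ⟨V0, hV0, hFV0, hV0Ω, hVk0⟩ := exists_nhds_lapl hΩ B0.lBdd B0.rSub hFs hFΩ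
  have w1 := B.weak (fun z => F z * T z) (hF.continuous.mul hTc) hFs.mul_right
    ((closure_mono (Function.support_mul_subset_left _ _)).trans hFΩ)
  have w0 := B0.weak (fun z => f z * T z) (hf.mul hTc) hfs.mul_right
    ((closure_mono (Function.support_mul_subset_left _ _)).trans hfΩ)
  have hae : ∀ᵐ z ∂μ, z ∈ Ω := by
    rw [ae_iff]; exact B.compl
  have hTi : Integrable T μ := by
    refine Integrable.of_bound hTc.aestronglyMeasurable R (hae.mono fun z hz => ?_)
    rw [Real.norm_of_nonneg (hT1 z hz).1]; exact (hT1 z hz).2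
  have hE1 : ∫ z, F z * T z ∂μ ≤ E0 + η := by
    refine le_trans (integral_mono_ae ?_ hTi (hae.mono fun z hz => ?_)) hE
    · refine Integrable.mono hTi (hF.continuous.mul hTc).aestronglyMeasurable
        (ae_of_all _ fun z => ?_)
      rw [norm_mul, Real.norm_of_nonneg (hF0 z)]
      exact mul_le_of_le_one_left (norm_nonneg _) (hF1 z)
    · exact mul_le_of_le_one_left (hT0 z hz) (hF1 z)
  filter_upwards [hbk, hK1b, hVk, hVk0,
    w1.eventually (gt_mem_nhds (show _ < E0 + 2 * η by linarith)),
    w0.eventually (lt_mem_nhds (show E0 - 2 * η < _ by linarith))]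
    with k hbk hK1b hVk hVk0 hw1 hw0 v hv hvle hvK hvl
  set h := mol H k
  set h0 := mol H0 k
  have hh : ContDiff ℝ (⊤ : ℕ∞) h := contDiff_mol B.lBdd k
  have hh0 : ContDiff ℝ (⊤ : ℕ∞) h0 := contDiff_mol B0.lBdd k
  have hhle : ∀ z, h z ≤ h0 z := fun z => mol_mono B.lBdd B0.lBdd fun y _ => hle _
  have hh0C : ∀ z, -C0 ≤ h0 z := fun z => le_mol_of_le B0.lBdd fun y _ => hC0 _
  have hvle0 : ∀ z, v z ≤ h0 z := fun z => (hvle z).trans (max_le (hhle z) (hh0C z))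
  set β : Cn n → ℝ := fun z => (1 - τ) * h0 z + -κ with hβdef
  have hβ : ContDiff ℝ (⊤ : ℕ∞) β := (contDiff_const.mul hh0).add contDiff_const
  set v' := regmax κ v β with hv'def
  have hv' : ContDiff ℝ (⊤ : ℕ∞) v' := contDiff_regmax κ hv hβ
  have hvl' : ∀ z ∈ tsupport F, ∀ b, 0 ≤ lapl v z b := fun z hz b => by
    by_cases hzK : z ∈ K
    · exact hvl z hzK b
    · rw [lapl_eq_off hK.isClosed hvK hzK]; exact (hVk z (hFV hz)).1 b
  have hβl : ∀ z ∈ tsupport F, ∀ b, 0 ≤ lapl β z b := fun z hz b => by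
    rw [hβdef, lapl_add (contDiff_const.mul hh0) contDiff_const, lapl_const, add_zero,
      lapl_const_mul hh0]
    exact mul_nonneg (by linarith) ((hVk0 z (hFV0 hz)).1 b)
  have hv'l : ∀ z ∈ tsupport F, ∀ b, 0 ≤ lapl v' z b := fun z hz b =>
    lapl_regmax_nonneg hκ hv hβ (hvl' z hz b) (hβl z hz b)
  have hv'v : ∀ z ∉ K ∪ K1 ∪ tsupport f, v' z = v z := by
    intro z hz
    simp only [Set.mem_union, not_or] at hz
    have h1 : β z - v z ≤ 0 := by
      have := hK1b z hz.1.2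
      have h2 : h0 z ≤ 0 := B0.mol_nonpos k z
      rw [hvK z hz.1.1]
      simp only [hβdef]; nlinarith
    rw [hv'def, regmax, softPos_of_nonpos hκ h1, add_zero]
  have hsupp : K ∪ K1 ∪ tsupport f ⊆ tsupport F := fun z hz =>
    subset_tsupport _ (by rw [Function.mem_support, hFK z hz]; norm_num)
  have hmono := mono_lapl hv hv' hTs hK2 hv'v
    (fun z => le_add_of_nonneg_right (softPos_nonneg' hκ _)) (fun z hz => hvl' z (hsupp hz))
    (fun z hz => hv'l z (hsupp hz)) (fun z _ => lapl_quad_nonpos R z)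
  have e1 : ∀ z, T z * (maDensity n h z - maDensity n v z)
      = F z * T z * maDensity n h z - F z * T z * maDensity n v z := fun z => by
    by_cases hz : z ∈ K
    · rw [hFK z (Or.inl (Or.inl hz))]; ring
    · rw [maDensity_eq_off hK.isClosed hvK hz]; ring
  have e2 : ∀ z, T z * (maDensity n v' z - maDensity n v z)
      = F z * T z * maDensity n v' z - F z * T z * maDensity n v z := fun z => by
    by_cases hz : z ∈ K ∪ K1 ∪ tsupport f
    · rw [hFK z hz]; ring
    · rw [maDensity_eq_off hK2.isClosed hv'v hz]; ring
  have hIn : ∀ (g : Cn n → ℝ) (_ : Continuous g) (_ : HasCompactSupport g) {u : Cn n → ℝ}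
      (_ : ContDiff ℝ (⊤ : ℕ∞) u), Integrable fun z => g z * T z * maDensity n u z := by
    intro g hg hgs u hu
    exact ((hg.mul hTc).mul (continuous_maDensity hu)).integrable_of_hasCompactSupport
      hgs.mul_right.mul_right
  have i1 := hIn F hF.continuous hFs hh
  have i2 := hIn F hF.continuous hFs hv
  have i3 := hIn F hF.continuous hFs hv'
  have i4 := hIn f hf hfs hh0
  replace hmono := (integral_congr_ae (ae_of_all _ e2)).symm.trans_le hmono
  rw [integral_sub i3 i2] at hmono
  rw [integral_congr_ae (ae_of_all _ e1), integral_sub i1 i2]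
  have hlow : (1 - τ) ^ n * ∫ z, f z * T z * maDensity n h0 z
      ≤ ∫ z, F z * T z * maDensity n v' z := by
    rw [← integral_const_mul]
    refine integral_mono (i4.const_mul _) i3 fun z => ?_
    by_cases hz : z ∈ tsupport f
    · have e3 : maDensity n v' z = (1 - τ) ^ n * maDensity n h0 z := by
        rw [← maDensity_affine hh0 (1 - τ) (-κ + (softPos κ κ - κ))]
        refine maDensity_congr ?_
        filter_upwards [hh0.continuous.continuousAt.eventually (gt_mem_nhds (hbk z hz))] with x hx
        have hx : h0 x < -b := hx
        have h3 : κ ≤ β x - v x := by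
          have := hvle0 x
          simp only [hβdef, hκdef]; nlinarith
        rw [hv'def, regmax, softPos_eq hκ h3, hβdef]; ring
      have h4 := maDensity_nonneg hv' (hv'l z (hsupp (Or.inr hz)))
      simp only
      rw [hFK z (Or.inr hz), one_mul, e3]
      rw [e3] at h4
      have h5 := mul_nonneg (hT0 z (hfΩ hz)) h4
      nlinarith [hf0 z, hf1 z, mul_nonneg (sub_nonneg.2 (hf1 z)) h5]
    · simp only [image_eq_zero_of_notMem_tsupport hz, zero_mul, mul_zero]
      by_cases hz2 : z ∈ tsupport F
      · exact mul_nonneg (mul_nonneg (hF0 z) (hT0 z (hFΩ hz2))) (maDensity_nonneg hv' (hv'l z hz2))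
      · simp [image_eq_zero_of_notMem_tsupport hz2]
  have h6 : (1 - τ) ^ n * (E0 - 2 * η) ≤ (1 - τ) ^ n * ∫ z, f z * T z * maDensity n h0 z :=
    mul_le_mul_of_nonneg_left hw0.le (pow_nonneg (by linarith) _)
  linarith

end EnergyEstimate

section Envelope
variable {n : ℕ} {S : Set (Cn n)} {f u v : Cn n → ℝ} {δ L K B : ℝ}

theorem sqn_add_eq (z a : Cn n) : sqn (z + a) = sqn z + fderiv ℝ sqn a z + sqn a := by
  rw [add_comm, sqn_add, fderiv_sqn]; ring

theorem integrable_circ (hu : Continuous u) (a b : Cn n) :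
    Integrable (fun x => u (a + circ x • b)) nuc := by
  have := continuous_circ
  exact integrable_cont (by fun_prop)

theorem integral_clm_circ (l : Cn n →L[ℝ] ℝ) (a b : Cn n) : ∫ x, l (a + circ x • b) ∂nuc = l a := by
  have := integral_quadratic_circ l 0 b
  simp only [zero_apply, mul_zero, add_zero] at this
  simp only [map_add]
  have hc := continuous_circ
  rw [integral_add (integrable_const _) (integrable_cont (by fun_prop)), this]; simp

theorem RSub.add (hu : RSub u S) (hv : RSub v S) (hcu : Continuous u) (hcv : Continuous v) :
    RSub (fun z => u z + v z) S := by
  intro a b hab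
  rw [integral_add (integrable_circ hcu a b) (integrable_circ hcv a b)]
  exact add_le_add (hu a b hab) (hv a b hab)

theorem RSub.const_mul (hu : RSub u S) {c : ℝ} (hc : 0 ≤ c) : RSub (fun z => c * u z) S := by
  intro a b hab
  rw [integral_const_mul]
  exact mul_le_mul_of_nonneg_left (hu a b hab) hc

theorem rSub_affine (l : Cn n →L[ℝ] ℝ) (c : ℝ) : RSub (fun z => l z + c) S := by
  intro a b _
  have hc := continuous_circ
  rw [integral_add (integrable_circ l.continuous a b) (integrable_const _), integral_clm_circ]
  simp

theorem rSub_sqn : RSub (sqn (n := n)) S := by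
  intro a b _
  have e : ∀ x, sqn (a + circ x • b) = (sqn a + sqn b) + fderiv ℝ sqn a (circ x • b) := fun x => by
    rw [add_comm a, sqn_add_eq, sqn_smul, norm_circ]; ring
  have hc := continuous_circ
  simp only [e]
  have := integral_clm_circ (fderiv ℝ sqn a) 0 b
  simp only [zero_add, map_zero] at this
  rw [integral_add (integrable_const _) (integrable_cont (by fun_prop)), this]
  simpa using sqn_nonneg b

theorem RSub.translate (hu : RSub u Set.univ) (a : Cn n) :
    RSub (fun z => u (z + a)) Set.univ := by
  intro x b _
  have := hu (x + a) b (by simp)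
  simpa only [add_right_comm] using this

/-- Competitors for the quasi-psh envelope of `f`. -/
def comp (f : Cn n → ℝ) (δ : ℝ) : Set (Cn n → ℝ) :=
  {τ | Continuous τ ∧ RSub (fun z => τ z + δ * sqn z) Set.univ ∧ ∀ z, τ z ≤ f z}

/-- The largest function below `f` whose sum with `δ|z|²` is psh. -/
def env (f : Cn n → ℝ) (δ : ℝ) (z : Cn n) : ℝ := ⨆ τ : comp f δ, τ.1 z

theorem comp_bdd (f : Cn n → ℝ) (δ : ℝ) (z : Cn n) :
    BddAbove (Set.range fun τ : comp f δ => τ.1 z) :=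
  ⟨f z, by rintro _ ⟨τ, rfl⟩; exact τ.2.2.2 z⟩

theorem le_env {τ : Cn n → ℝ} (hτ : τ ∈ comp f δ) (z : Cn n) : τ z ≤ env f δ z :=
  le_ciSup (comp_bdd f δ z) (⟨τ, hτ⟩ : comp f δ)

theorem comp_nonempty (hδ : 0 ≤ δ) (hB : ∀ z, -B ≤ f z) : Nonempty (comp f δ) := by
  refine ⟨⟨fun _ => -B, continuous_const, ?_, hB⟩⟩
  have := (rSub_sqn.const_mul hδ).add (rSub_affine (n := n) (S := Set.univ) 0 (-B))
    (continuous_const.mul continuous_sqn) (by fun_prop)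
  simpa [add_comm] using this

theorem env_le (hδ : 0 ≤ δ) (hB : ∀ z, -B ≤ f z) (z : Cn n) : env f δ z ≤ f z := by
  have := comp_nonempty hδ hB
  exact ciSup_le fun τ => τ.2.2.2 z

theorem RSub.translate_quad {τ : Cn n → ℝ} (hc : Continuous τ)
    (h : RSub (fun z => τ z + δ * sqn z) Set.univ) (a : Cn n) :
    RSub (fun z => τ (z + a) + δ * sqn z) Set.univ := by
  have hq := continuous_sqn (n := n)
  have := (h.translate a).add (rSub_affine (-δ • fderiv ℝ sqn a) (-δ * sqn a)) (by fun_prop)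
    (by fun_prop)
  have e : (fun z => τ (z + a) + δ * sqn z) = fun z => (τ (z + a) + δ * sqn (z + a)) +
      ((-δ • fderiv ℝ sqn a) z + -δ * sqn a) := by
    ext z; rw [sqn_add_eq]; simp; ring
  rw [e]; exact this

theorem RSub.add_real (hc : Continuous u) (h : RSub u S) (c : ℝ) : RSub (fun z => u z + c) S := by
  simpa using h.add (rSub_affine 0 c) hc (by fun_prop)

theorem translate_comp {τ : Cn n → ℝ} (hτ : τ ∈ comp f δ) (a : Cn n) {c : ℝ}
    (h : ∀ z, f (z + a) ≤ f z + c) : (fun z => τ (z + a) - c) ∈ comp f δ := by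
  have hq := continuous_sqn (n := n)
  have h1 := hτ.1
  refine ⟨by fun_prop, ?_, fun z => by linarith [hτ.2.2 (z + a), h z]⟩
  have := (RSub.translate_quad hτ.1 hτ.2.1 a).add_real (by fun_prop) (-c)
  convert this using 2; ring

theorem env_translate_le (hδ : 0 ≤ δ) (hB : ∀ z, -B ≤ f z) (a : Cn n) {c : ℝ}
    (h : ∀ z, f (z + a) ≤ f z + c) (z : Cn n) : env f δ (z + a) ≤ env f δ z + c := by
  have := comp_nonempty hδ hB
  exact ciSup_le fun τ => by linarith [le_env (translate_comp τ.2 a h) z]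

theorem env_lipschitz (hδ : 0 ≤ δ) (hB : ∀ z, -B ≤ f z) (hL : ∀ x y, |f x - f y| ≤ L * ‖x - y‖)
    (x y : Cn n) : |env f δ x - env f δ y| ≤ L * ‖x - y‖ := by
  have key : ∀ x y : Cn n, env f δ x ≤ env f δ y + L * ‖x - y‖ := fun x y => by
    have := env_translate_le hδ hB (x - y) (c := L * ‖x - y‖) (fun z => by
      have := (abs_le.1 (hL (z + (x - y)) z)).2
      rw [add_sub_cancel_left] at this; linarith) y
    rwa [add_sub_cancel] at this
  rw [abs_le]
  have h1 := key x y
  have h2 := key y x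
  rw [norm_sub_rev] at h2
  constructor <;> linarith

theorem continuous_env (hδ : 0 ≤ δ) (hB : ∀ z, -B ≤ f z)
    (hL : ∀ x y, |f x - f y| ≤ L * ‖x - y‖) : Continuous (env f δ) := by
  refine LipschitzWith.continuous (K := L.toNNReal) (LipschitzWith.of_dist_le_mul fun x y => ?_)
  rw [Real.dist_eq, dist_eq_norm]
  exact (env_lipschitz hδ hB hL x y).trans
    (mul_le_mul_of_nonneg_right (Real.le_coe_toNNReal L) (norm_nonneg _))

theorem env_mem_comp (hδ : 0 ≤ δ) (hB : ∀ z, -B ≤ f z)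
    (hL : ∀ x y, |f x - f y| ≤ L * ‖x - y‖) : env f δ ∈ comp f δ := by
  have hc := continuous_env (δ := δ) hδ hB hL
  have hq := continuous_sqn (n := n)
  refine ⟨hc, fun a b _ => ?_, env_le hδ hB⟩
  have := comp_nonempty hδ hB
  rw [← le_sub_iff_add_le]
  refine ciSup_le fun τ => ?_
  rw [le_sub_iff_add_le]
  have hτ := τ.2.1
  refine (τ.2.2.1 a b (by simp)).trans (integral_mono (integrable_circ (u := fun z => τ.1 z + δ * sqn z)
    (by fun_prop) a b) (integrable_circ (u := fun z => env f δ z + δ * sqn z) (by fun_prop) a b)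
    fun x => ?_)
  simpa using le_env τ.2 _

theorem env_second_diff (hδ : 0 ≤ δ) (hB : ∀ z, -B ≤ f z)
    (hL : ∀ x y, |f x - f y| ≤ L * ‖x - y‖)
    (hK : ∀ x a, f (x + a) + f (x - a) - 2 * f x ≤ K * ‖a‖ ^ 2) (x a : Cn n) :
    env f δ (x + a) + env f δ (x - a) - 2 * env f δ x ≤ K * ‖a‖ ^ 2 := by
  have hc := continuous_env (δ := δ) hδ hB hL
  have hq := continuous_sqn (n := n)
  have hm := env_mem_comp (δ := δ) hδ hB hL
  have : (fun z => 1 / 2 * env f δ (z + a) + 1 / 2 * env f δ (z - a) - K * ‖a‖ ^ 2 / 2) ∈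
      comp f δ := by
    refine ⟨by fun_prop, ?_, fun z => by
      linarith [hm.2.2 (z + a), hm.2.2 (z - a), hK z a]⟩
    have h1 := (RSub.translate_quad hc hm.2.1 a).const_mul (by norm_num : (0 : ℝ) ≤ 1 / 2)
    have h2 := (RSub.translate_quad hc hm.2.1 (-a)).const_mul (by norm_num : (0 : ℝ) ≤ 1 / 2)
    have := (h1.add h2 (by fun_prop) (by fun_prop)).add_real (by fun_prop) (-(K * ‖a‖ ^ 2 / 2))
    convert this using 2
    rw [← sub_eq_add_neg]; ring
  linarith [le_env this x]

theorem env_eq_zero (hδ : 0 < δ) (hB : ∀ z, -B ≤ f z) (hf : ∀ z, f z ≤ 0) {ρ : ℝ}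
    (hρ : ∀ z, ρ ≤ ‖z‖ → f z = 0) : ∃ ρ', ∀ z, ρ' ≤ ‖z‖ → env f δ z = 0 := by
  obtain ⟨m, hm⟩ : ∃ m : ℝ, 0 ≤ m ∧ B ≤ δ * m ^ 2 := by
    have h1 : B ≤ δ * (|B| / δ) := by rw [mul_div_cancel₀ _ hδ.ne']; exact le_abs_self B
    refine ⟨Real.sqrt (|B| / δ), Real.sqrt_nonneg _, ?_⟩
    rwa [Real.sq_sqrt (by positivity)]
  refine ⟨ρ + m, fun p hp => le_antisymm ((env_le hδ.le hB p).trans (hf p)) ?_⟩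
  have hq := continuous_sqn (n := n)
  have : (fun z => -δ * sqn (z - p)) ∈ comp f δ := by
    refine ⟨by fun_prop, ?_, fun z => ?_⟩
    · have := rSub_affine (n := n) (S := Set.univ) (-δ • fderiv ℝ sqn (-p)) (-δ * sqn (-p))
      convert this using 2 with z
      simp only [sub_eq_add_neg, sqn_add_eq]; simp; ring
    · have h0 := sqn_nonneg (z - p)
      by_cases hz : ρ ≤ ‖z‖
      · rw [hρ z hz]; nlinarith
      · have h1 : m ≤ ‖z - p‖ := by
          have := norm_sub_norm_le p z
          rw [norm_sub_rev] at this
          push Not at hz; linarith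
        have h2 := norm_sq_le_sqn (z - p)
        have h3 : m ^ 2 ≤ ‖z - p‖ ^ 2 := pow_le_pow_left₀ hm.1 h1 2
        have := hB z
        nlinarith [mul_le_mul_of_nonneg_left (h3.trans h2) hδ.le]
  have h := le_env this p
  simp at h
  have h0 : sqn (0 : Cn n) = 0 := by simp [sqn]
  simpa [h0] using h

end Envelope

section Regularity
variable {n : ℕ} {ψ : Cn n → ℝ} {K M : ℝ}

theorem abs_bilin_le {E : Type*} [NormedAddCommGroup E] [NormedSpace ℝ E] (B : E →L[ℝ] E →L[ℝ] ℝ)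
    (hs : ∀ a b, B a b = B b a) (hM : 0 ≤ M) (h : ∀ b, |B b b| ≤ M * ‖b‖ ^ 2) :
    ‖B‖ ≤ 2 * M := by
  have key : ∀ a b : E, ‖a‖ = 1 → ‖b‖ = 1 → |B a b| ≤ 2 * M := fun a b ha hb => by
    have e : B a b = 1 / 4 * (B (a + b) (a + b) - B (a - b) (a - b)) := by
      simp only [map_add, map_sub, add_apply, sub_apply]
      linarith [hs a b]
    have h1 := h (a + b)
    have h2 := h (a - b)
    have h3 : ‖a + b‖ ^ 2 ≤ 2 ^ 2 :=
      pow_le_pow_left₀ (norm_nonneg _) ((norm_add_le a b).trans (by linarith)) 2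
    have h4 : ‖a - b‖ ^ 2 ≤ 2 ^ 2 :=
      pow_le_pow_left₀ (norm_nonneg _) ((norm_sub_le a b).trans (by linarith)) 2
    rw [abs_le] at *
    rw [e]
    constructor <;> nlinarith
  refine B.opNorm_le_bound₂ (by linarith) fun a b => ?_
  rcases eq_or_ne a 0 with rfl | ha
  · simp
  rcases eq_or_ne b 0 with rfl | hb
  · simp
  have := key (‖a‖⁻¹ • a) (‖b‖⁻¹ • b) (by simp [norm_smul, ha]) (by simp [norm_smul, hb])
  simp only [map_smul, smul_apply, smul_eq_mul, abs_mul, abs_inv, abs_norm] at this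
  rw [Real.norm_eq_abs]
  have h1 := norm_pos_iff.2 ha
  have h2 := norm_pos_iff.2 hb
  calc |B a b| = ‖a‖ * ‖b‖ * (‖b‖⁻¹ * (‖a‖⁻¹ * |B a b|)) := by field_simp
    _ ≤ ‖a‖ * ‖b‖ * (2 * M) := by
      refine mul_le_mul_of_nonneg_left ?_ (by positivity)
      linarith
    _ = _ := by ring

theorem cv_sub_const_mul {k : Cn n → ℝ} (ε c : ℝ) {H : Cn n → ℝ} (z : Cn n) :
    cv k ε (fun x => c * H x) z = c * cv k ε H z := by
  rw [cv, cv, ← integral_const_mul]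
  congr 1; ext y; ring

theorem mol_second_diff (hc : Continuous ψ)
    (hK : ∀ x a, ψ (x + a) + ψ (x - a) - 2 * ψ x ≤ K * ‖a‖ ^ 2) (k : ℕ) (x a : Cn n) :
    mol ψ k (x + a) + mol ψ k (x - a) - 2 * mol ψ k x ≤ K * ‖a‖ ^ 2 := by
  have h1 : LBdd fun z => ψ (z + a) := Continuous.lBdd (by fun_prop)
  have h2 : LBdd fun z => ψ (z - a) := Continuous.lBdd (by fun_prop)
  have h3 : LBdd fun z => -2 * ψ z := Continuous.lBdd (by fun_prop)
  have h12 : LBdd fun z => ψ (z + a) + ψ (z - a) := Continuous.lBdd (by fun_prop)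
  have := mol_le_of_le (ε := 1 / ((k : ℝ) + 1))
    (H := fun z => ψ (z + a) + ψ (z - a) + -2 * ψ z) (Continuous.lBdd (by fun_prop)) (z := x)
    (c := K * ‖a‖ ^ 2) fun y _ => by linarith [hK (x - (1 / ((k : ℝ) + 1)) • y) a]
  rw [cv_add ker_chi _ h12 h3, cv_add ker_chi _ h1 h2, cv_sub_const_mul] at this
  have e1 : cv chi (1 / ((k : ℝ) + 1)) (fun z => ψ (z + a)) x = mol ψ k (x + a) := by
    simp only [mol, cv]; congr 1; ext y; rw [sub_add_eq_add_sub]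
  have e2 : cv chi (1 / ((k : ℝ) + 1)) (fun z => ψ (z - a)) x = mol ψ k (x - a) := by
    simp only [mol, cv]; congr 1; ext y; rw [sub_right_comm]
  rw [e1, e2] at this
  simp only [mol] at *
  linarith

theorem second_le_of_second_diff {u : Cn n → ℝ} (hu : ContDiff ℝ (⊤ : ℕ∞) u)
    (hK : ∀ x a, u (x + a) + u (x - a) - 2 * u x ≤ K * ‖a‖ ^ 2) (p b : Cn n) :
    fderiv ℝ (fderiv ℝ u) p b b ≤ K * ‖b‖ ^ 2 := by
  set B := fderiv ℝ (fderiv ℝ u) p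
  refine le_of_forall_pos_le_add fun e he => ?_
  obtain ⟨d, hd, h⟩ := taylor_two (fun x => (hu.differentiable (by simp) x).hasFDerivAt)
    (hu.differentiable_fderiv p).hasFDerivAt (ε := e / (2 * (‖b‖ ^ 2 + 1))) (by positivity)
  set s := d / (2 * (‖b‖ + 1)) with hsdef
  have hb := norm_nonneg b
  have hs : 0 < s := by positivity
  have hsb : ‖s • b‖ < d := by
    rw [norm_smul, Real.norm_of_nonneg hs.le, hsdef, div_mul_eq_mul_div, div_lt_iff₀ (by positivity)]
    nlinarith
  have h1 := h (s • b) hsb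
  have h2 := h (-(s • b)) (by rwa [norm_neg])
  have h3 := hK p (s • b)
  simp only [map_neg, neg_apply, neg_neg, norm_neg, ← sub_eq_add_neg] at h2
  rw [abs_le] at h1 h2
  have e1 : B (s • b) (s • b) = s ^ 2 * B b b := by simp; ring
  have e2 : ‖s • b‖ ^ 2 = s ^ 2 * ‖b‖ ^ 2 := by rw [norm_smul, mul_pow, Real.norm_of_nonneg hs.le]
  have e3 : e / (2 * (‖b‖ ^ 2 + 1)) * ‖b‖ ^ 2 ≤ e / 2 := by
    rw [div_mul_eq_mul_div, div_le_div_iff₀ (by positivity) (by norm_num)]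
    nlinarith
  change _ ∧ _ - 1 / 2 * B _ _ ≤ _ at h1
  have h4 : B (s • b) (s • b) ≤ K * ‖s • b‖ ^ 2 + 2 * (e / (2 * (‖b‖ ^ 2 + 1)) * ‖s • b‖ ^ 2) := by
    change -_ ≤ _ - 1 / 2 * B _ _ ∧ _ at h1
    change -_ ≤ _ - 1 / 2 * B _ _ ∧ _ at h2
    linarith
  rw [e1, e2] at h4
  have hs2 : 0 < s ^ 2 := by positivity
  refine le_of_mul_le_mul_left ?_ hs2
  nlinarith [mul_le_mul_of_nonneg_left e3 hs2.le]

theorem norm_second_mol_le (hK0 : 0 ≤ K) (hc : Continuous ψ) (hr : RSub ψ Set.univ)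
    (hK : ∀ x a, ψ (x + a) + ψ (x - a) - 2 * ψ x ≤ K * ‖a‖ ^ 2) (k : ℕ) :
    (∀ p b, 0 ≤ lapl (mol ψ k) p b) ∧ ∀ p, ‖fderiv ℝ (fderiv ℝ (mol ψ k)) p‖ ≤ 2 * K := by
  have hsm := contDiff_mol hc.lBdd k
  have hl : ∀ p b, 0 ≤ lapl (mol ψ k) p b := fun p b =>
    RSub.lapl_nonneg (hr.mol (S := Set.univ) hc.lBdd (by simp)) hsm univ_mem b
  refine ⟨hl, fun p => ?_⟩
  have hu := second_le_of_second_diff hsm (mol_second_diff hc hK k) p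
  refine abs_bilin_le _ (fun a b => ?_) hK0 fun b => abs_le.2 ⟨?_, hu b⟩
  · have := reB_symm hsm p a b
    rwa [reB_eq (hsm.differentiable_fderiv p), reB_eq (hsm.differentiable_fderiv p)] at this
  · have h1 := hu (Complex.I • b)
    have h2 := hl p b
    rw [lapl, reB_eq (hsm.differentiable_fderiv p), reB_eq (hsm.differentiable_fderiv p)] at h2
    rw [norm_smul, Complex.norm_I, one_mul] at h1
    linarith

theorem tendsto_mol_of_continuous (hc : Continuous ψ) (z : Cn n) :
    Tendsto (fun k => mol ψ k z) atTop (𝓝 (ψ z)) := by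
  rw [Metric.tendsto_nhds]
  intro e he
  obtain ⟨d, hd, h⟩ := Metric.continuousAt_iff.1 (hc.continuousAt (x := z)) (e / 2) (half_pos he)
  filter_upwards [tendsto_mol_scale.eventually (gt_mem_nhds hd)] with k hk
  have key : ∀ y : Cn n, ‖y‖ ≤ 1 → |ψ (z - (1 / ((k : ℝ) + 1)) • y) - ψ z| < e / 2 := fun y hy => by
    refine h ?_
    rw [dist_eq_norm, sub_sub_cancel_left, norm_neg, norm_smul,
      Real.norm_of_nonneg (mol_scale_pos k).le]
    nlinarith [mol_scale_pos k]
  have h1 := mol_le_of_le (ε := 1 / ((k : ℝ) + 1)) hc.lBdd (z := z) (c := ψ z + e / 2)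
    fun y hy => by linarith [(abs_lt.1 (key y hy)).2]
  have h2 := le_mol_of_le (ε := 1 / ((k : ℝ) + 1)) hc.lBdd (z := z) (c := ψ z - e / 2)
    fun y hy => by linarith [(abs_lt.1 (key y hy)).1]
  rw [Real.dist_eq, abs_lt]
  simp only [mol]
  constructor <;> linarith

theorem taylor_one_of_norm_second {u : Cn n → ℝ} (hu : ContDiff ℝ (⊤ : ℕ∞) u) (hM : 0 ≤ M)
    (h : ∀ p, ‖fderiv ℝ (fderiv ℝ u) p‖ ≤ M) (x y : Cn n) :
    |u y - u x - fderiv ℝ u x (y - x)| ≤ M * ‖y - x‖ ^ 2 := by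
  have h1 : ∀ z ∈ Metric.closedBall x ‖y - x‖, ‖fderiv ℝ u z - fderiv ℝ u x‖ ≤ M * ‖y - x‖ :=
    fun z hz => by
      refine (convex_univ.norm_image_sub_le_of_norm_fderiv_le (𝕜 := ℝ)
        (fun p _ => hu.differentiable_fderiv p) (fun p _ => h p) (Set.mem_univ x)
        (Set.mem_univ z)).trans (mul_le_mul_of_nonneg_left ?_ hM)
      rwa [← dist_eq_norm]
  have := (convex_closedBall x ‖y - x‖).norm_image_sub_le_of_norm_fderiv_le' (𝕜 := ℝ)
    (fun p _ => hu.differentiable (by simp) p) h1 (x := x) (y := y)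
    (by simp) (by simp [dist_eq_norm])
  rw [Real.norm_eq_abs] at this
  linarith

theorem exists_taylor_one (hK0 : 0 ≤ K) (hc : Continuous ψ) (hr : RSub ψ Set.univ)
    (hK : ∀ x a, ψ (x + a) + ψ (x - a) - 2 * ψ x ≤ K * ‖a‖ ^ 2) (x : Cn n) :
    ∃ A : Cn n →L[ℝ] ℝ, ∀ y, |ψ y - ψ x - A (y - x)| ≤ 2 * K * ‖y - x‖ ^ 2 := by
  have h2 : (0 : ℝ) ≤ 2 * K := by positivity
  have hT := fun k => taylor_one_of_norm_second (contDiff_mol hc.lBdd k) h2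
    (norm_second_mol_le hK0 hc hr hK k).2 x
  obtain ⟨C, hC⟩ := hc.lBdd.2 (‖x‖ + 2)
  have hm : ∀ k y, ‖y - x‖ ≤ 1 → |mol ψ k y| ≤ C := fun k y hy => by
    have : ∀ w : Cn n, ‖w‖ ≤ 1 → |ψ (y - (1 / ((k : ℝ) + 1)) • w)| ≤ C := fun w hw => by
      refine hC _ ((norm_sub_le _ _).trans ?_)
      have h3 : ‖(1 / ((k : ℝ) + 1)) • w‖ ≤ 1 := by
        rw [norm_smul, Real.norm_of_nonneg (mol_scale_pos k).le]
        have : 1 / ((k : ℝ) + 1) ≤ 1 := by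
          rw [div_le_one (by positivity)]; linarith [k.cast_nonneg (α := ℝ)]
        nlinarith [mol_scale_pos k]
      have h4 := norm_add_le (y - x) x
      rw [sub_add_cancel] at h4
      linarith
    exact abs_le.2 ⟨le_mol_of_le hc.lBdd fun w hw => (abs_le.1 (this w hw)).1,
      mol_le_of_le hc.lBdd fun w hw => (abs_le.1 (this w hw)).2⟩
  have hb : ∀ k, fderiv ℝ (mol ψ k) x ∈ Metric.closedBall (0 : Cn n →L[ℝ] ℝ) (2 * C + 2 * K) := by
    intro k
    rw [mem_closedBall_zero_iff]
    have hC0 : 0 ≤ C := (abs_nonneg _).trans (hm k x (by simp))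
    refine ContinuousLinearMap.opNorm_le_of_unit_norm (𝕜 := ℝ) (by positivity) fun v hv => ?_
    have h3 := hT k (x + v)
    rw [add_sub_cancel_left, hv] at h3
    have h4 := hm k (x + v) (by simp [hv])
    have h5 := hm k x (by simp)
    rw [Real.norm_eq_abs]
    rw [abs_le] at *
    constructor <;> linarith
  obtain ⟨A, -, φ, hφ, hA⟩ := tendsto_subseq_of_bounded Metric.isBounded_closedBall hb
  refine ⟨A, fun y => ?_⟩
  have h1 := (tendsto_mol_of_continuous hc y).comp hφ.tendsto_atTop
  have h3 := (tendsto_mol_of_continuous hc x).comp hφ.tendsto_atTop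
  have h4 : Tendsto (fun k => fderiv ℝ (mol ψ (φ k)) x (y - x)) atTop (𝓝 (A (y - x))) :=
    ((ContinuousLinearMap.apply ℝ ℝ (y - x)).continuous.tendsto A).comp hA
  exact le_of_tendsto ((h1.sub h3).sub h4).abs (Eventually.of_forall fun k => hT (φ k) y)

theorem exists_lipschitz_deriv {E : Type*} [NormedAddCommGroup E] [NormedSpace ℝ E] {ψ : E → ℝ}
    (hM : 0 ≤ M)
    (h : ∀ x, ∃ A : E →L[ℝ] ℝ, ∀ y, |ψ y - ψ x - A (y - x)| ≤ M * ‖y - x‖ ^ 2) :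
    ∃ ψ' : E → E →L[ℝ] ℝ, (∀ x, HasFDerivAt ψ (ψ' x) x) ∧ ∃ C, LipschitzWith C ψ' := by
  choose ψ' hψ using h
  refine ⟨ψ', fun x => ?_, (6 * M).toNNReal, LipschitzWith.of_dist_le_mul fun x y => ?_⟩
  · refine HasFDerivAt.of_isLittleO ?_
    refine Asymptotics.IsBigO.trans_isLittleO (g := fun y => ‖y - x‖ ^ 2) ?_ ?_
    · exact Asymptotics.IsBigO.of_bound M (Eventually.of_forall fun y => by simpa using hψ x y)
    · have : Tendsto (fun y => y - x) (𝓝 x) (𝓝 0) := by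
        have : ContinuousAt (fun y => y - x) x := by fun_prop
        simpa [ContinuousAt] using this
      exact (Asymptotics.isLittleO_norm_pow_id one_lt_two).comp_tendsto this
  · rw [Real.coe_toNNReal _ (by positivity), dist_eq_norm, dist_eq_norm]
    rcases eq_or_ne x y with rfl | hxy
    · simp
    have hr : 0 < ‖x - y‖ := norm_pos_iff.2 (sub_ne_zero.2 hxy)
    set r := ‖x - y‖ with hrdef
    refine ContinuousLinearMap.opNorm_le_of_unit_norm (𝕜 := ℝ) (by positivity) fun v hv => ?_
    have h1 := hψ x (y + r • v)
    have h2 := hψ y (y + r • v)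
    have h3 := hψ x y
    have e0 : y + r • v - x = (y - x) + r • v := by abel
    have n1 : ‖r • v‖ = r := by rw [norm_smul, hv, mul_one, Real.norm_of_nonneg hr.le]
    have n2 : ‖y - x‖ = r := by rw [hrdef, norm_sub_rev]
    have n3 : ‖y - x + r • v‖ ^ 2 ≤ (2 * r) ^ 2 :=
      pow_le_pow_left₀ (norm_nonneg _) ((norm_add_le _ _).trans (by linarith)) 2
    rw [add_sub_cancel_left, n1] at h2
    rw [n2] at h3
    rw [e0, map_add] at h1
    have h1' := h1.trans (mul_le_mul_of_nonneg_left n3 hM)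
    rw [map_smul, smul_eq_mul] at h1' h2
    rw [Real.norm_eq_abs, sub_apply]
    have : |r * (ψ' x v - ψ' y v)| ≤ r * (6 * M * r) := by
      rw [abs_le] at *
      constructor <;> nlinarith
    rw [abs_mul, abs_of_pos hr] at this
    exact le_of_mul_le_mul_left this hr

theorem ae_second_order (hK0 : 0 ≤ K) (hc : Continuous ψ) (hr : RSub ψ Set.univ)
    (hK : ∀ x a, ψ (x + a) + ψ (x - a) - 2 * ψ x ≤ K * ‖a‖ ^ 2) :
    ∀ᵐ p, ∃ (A : Cn n →L[ℝ] ℝ) (B : Cn n →L[ℝ] Cn n →L[ℝ] ℝ), (∀ a b, B a b = B b a) ∧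
      ∀ ε > 0, ∃ δ > 0, ∀ y, ‖y‖ < δ → |ψ (p + y) - ψ p - A y - 1 / 2 * B y y| ≤ ε * ‖y‖ ^ 2 := by
  obtain ⟨ψ', h1, C, hC⟩ := exists_lipschitz_deriv (by positivity : (0 : ℝ) ≤ 2 * K)
    (exists_taylor_one hK0 hc hr hK)
  filter_upwards [hC.ae_differentiableAt (μ := volume)] with p hp
  exact ⟨ψ' p, fderiv ℝ ψ' p, second_derivative_symmetric h1 hp.hasFDerivAt,
    fun ε hε => taylor_two h1 hp.hasFDerivAt hε⟩

end Regularity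

section SecondOrder
variable {n : ℕ} {ψ : Cn n → ℝ} {K M : ℝ}

theorem tendsto_maDensity {u : ℕ → Cn n → ℝ} {v : Cn n → ℝ} {z : Cn n}
    (h : ∀ a b, Tendsto (fun k => reB n (u k) z a b) atTop (𝓝 (reB n v z a b))) :
    Tendsto (fun k => maDensity n (u k) z) atTop (𝓝 (maDensity n v z)) := by
  have hc : ∀ a b, Tendsto (fun k => ((reB n (u k) z a b : ℝ) : ℂ)) atTop
      (𝓝 ((reB n v z a b : ℝ) : ℂ)) := fun a b =>
    (Complex.continuous_ofReal.tendsto _).comp (h a b)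
  have hL : Tendsto (fun k => Lv n (u k) z) atTop (𝓝 (Lv n v z)) :=
    tendsto_pi_nhds.2 fun i => tendsto_pi_nhds.2 fun j =>
      (((hc _ _).add (hc _ _)).add (((hc _ _).sub (hc _ _)).const_mul _)).const_mul _
  have hd : Continuous fun X : Matrix (Fin n) (Fin n) ℂ => X.det := continuous_id.matrix_det
  simp only [maDensity_eq]
  exact ((Complex.continuous_re.tendsto _).comp ((hd.tendsto _).comp hL)).const_mul _

theorem abs_maDensity_le {u : Cn n → ℝ} {z : Cn n} (h : ∀ a b, ‖a‖ ≤ 1 → ‖b‖ ≤ 1 → |reB n u z a b| ≤ M) :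
    |maDensity n u z| ≤ (4 : ℝ) ^ n * n.factorial * (n.factorial * M ^ n) := by
  have h1 : ∀ j : Fin n, ‖(Pi.single j (1 : ℂ) : Cn n)‖ ≤ 1 := fun j => by
    rw [Pi.norm_single]; simp
  have h2 : ∀ j : Fin n, ‖(Pi.single j Complex.I : Cn n)‖ ≤ 1 := fun j => by
    rw [Pi.norm_single]; simp
  have h0 : ∀ a b, ‖a‖ ≤ 1 → ‖b‖ ≤ 1 → ‖((reB n u z a b : ℝ) : ℂ)‖ ≤ M := fun a b ha hb => by
    rw [Complex.norm_real]; exact h a b ha hb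
  have he : ∀ i j, ‖Lv n u z i j‖ ≤ M := fun i j => by
    change ‖cHessEntry n u z i j‖ ≤ M
    rw [cHessEntry, norm_mul]
    have e : ‖(1 / 4 : ℂ)‖ = 1 / 4 := by norm_num
    rw [e]
    have := h0 _ _ (h1 i) (h1 j)
    have := h0 _ _ (h2 i) (h2 j)
    have := h0 _ _ (h1 i) (h2 j)
    have := h0 _ _ (h2 i) (h1 j)
    have t1 := norm_add_le (((reB n u z (Pi.single i 1) (Pi.single j 1) : ℝ) : ℂ) +
      ((reB n u z (Pi.single i Complex.I) (Pi.single j Complex.I) : ℝ) : ℂ)) (Complex.I *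
      (((reB n u z (Pi.single i 1) (Pi.single j Complex.I) : ℝ) : ℂ) -
      ((reB n u z (Pi.single i Complex.I) (Pi.single j 1) : ℝ) : ℂ)))
    have t2 := norm_add_le ((reB n u z (Pi.single i 1) (Pi.single j 1) : ℝ) : ℂ)
      ((reB n u z (Pi.single i Complex.I) (Pi.single j Complex.I) : ℝ) : ℂ)
    have t3 := norm_sub_le ((reB n u z (Pi.single i 1) (Pi.single j Complex.I) : ℝ) : ℂ)
      ((reB n u z (Pi.single i Complex.I) (Pi.single j 1) : ℝ) : ℂ)
    rw [norm_mul, Complex.norm_I, one_mul] at t1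
    linarith
  rw [maDensity_eq, abs_mul, abs_of_nonneg (by positivity)]
  refine mul_le_mul_of_nonneg_left ((Complex.abs_re_le_norm _).trans ?_) (by positivity)
  have := Matrix.det_le (abv := NormedField.toAbsoluteValue ℂ) he
  rw [Fintype.card_fin, nsmul_eq_mul] at this
  exact this

/-- A quadratic polynomial centred at `p`. -/
def quad (p : Cn n) (c : ℝ) (A : Cn n →L[ℝ] ℝ) (B : Cn n →L[ℝ] Cn n →L[ℝ] ℝ) (z : Cn n) : ℝ :=
  c + A (z - p) + 1 / 2 * B (z - p) (z - p)

variable {p : Cn n} {c : ℝ} {A : Cn n →L[ℝ] ℝ} {B : Cn n →L[ℝ] Cn n →L[ℝ] ℝ}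

theorem contDiff_quad : ContDiff ℝ (⊤ : ℕ∞) (quad p c A B) := by
  unfold quad
  fun_prop

theorem fderiv_quad (hB : ∀ a b, B a b = B b a) (x w : Cn n) :
    fderiv ℝ (quad p c A B) x w = A w + B w (x - p) := by
  have h1 : HasFDerivAt (fun z : Cn n => z - p) (ContinuousLinearMap.id ℝ (Cn n)) x :=
    (hasFDerivAt_id x).sub_const p
  have h2 : HasFDerivAt (fun z => A (z - p)) (A.comp (ContinuousLinearMap.id ℝ (Cn n))) x :=
    A.hasFDerivAt.comp x h1
  have h3 : HasFDerivAt (fun z => B (z - p)) (B.comp (ContinuousLinearMap.id ℝ (Cn n))) x :=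
    B.hasFDerivAt.comp x h1
  have h4 := ((h2.const_add c).add ((h3.clm_apply h1).const_mul (1 / 2)))
  have h5 : HasFDerivAt (quad p c A B) _ x := h4
  rw [h5.fderiv]
  simp [hB x w, hB p w]
  ring

theorem reB_quad (hB : ∀ a b, B a b = B b a) (z a b : Cn n) :
    reB n (quad p c A B) z a b = B a b := by
  rw [reB, show (fun x => fderiv ℝ (quad p c A B) x b) = fun x => A b + B b (x - p) from
    funext fun x => fderiv_quad hB x b]
  have h1 : HasFDerivAt (fun z : Cn n => z - p) (ContinuousLinearMap.id ℝ (Cn n)) z :=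
    (hasFDerivAt_id z).sub_const p
  have := (((B b).hasFDerivAt (x := z - p)).comp z h1).const_add (A b)
  have h5 : HasFDerivAt (fun x => A b + B b (x - p)) _ z := this
  rw [h5.fderiv]
  simp [hB a b]

theorem integral_chi_mul_clm (l : Cn n →L[ℝ] ℝ) : ∫ y, chi y * l y = 0 := by
  have h := integral_neg_eq_self (fun y => chi y * l y) (volume : Measure (Cn n))
  have e : ∀ y : Cn n, chi (-y) * l (-y) = -(chi y * l y) := fun y => by
    have : chi (-y) = chi y := by simpa using chi_smul (ζ := -1) (by simp) y
    rw [this]; simp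
  simp only [e, integral_neg] at h
  linarith

theorem mol_quad (hB : ∀ a b, B a b = B b a) (k : ℕ) :
    ∃ d, mol (quad p c A B) k = fun z => quad p c A B z + d := by
  set ε := 1 / ((k : ℝ) + 1) with hε
  refine ⟨∫ y, chi y * (ε ^ 2 / 2 * B y y), funext fun z => ?_⟩
  have hcc : Continuous (chi (n := n)) := ker_chi.1.continuous
  have e : ∀ y, chi y * quad p c A B (z - ε • y) = chi y * quad p c A B z
      + -ε * (chi y * (A + B (z - p)) y) + chi y * (ε ^ 2 / 2 * B y y) := fun y => by
    have : z - ε • y - p = (z - p) - ε • y := by abel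
    rw [quad, quad, this]
    simp [hB y (z - p)]
    ring
  have hi : ∀ F : Cn n → ℝ, Continuous F → Integrable fun y => chi y * F y := fun F hF =>
    (hcc.mul hF).integrable_of_hasCompactSupport ker_chi.hasCompactSupport.mul_right
  rw [mol, cv, ← hε]
  simp only [e]
  rw [integral_add, integral_add, integral_mul_const, integral_chi, integral_const_mul,
    integral_chi_mul_clm]
  · ring
  · exact hi _ continuous_const
  · exact (hi _ (A + B (z - p)).continuous).const_mul _
  · exact (hi _ continuous_const).add ((hi _ (A + B (z - p)).continuous).const_mul _)
  · exact hi _ (by fun_prop)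

theorem reB_add_const (u : Cn n → ℝ) (d : ℝ) (z a b : Cn n) :
    reB n (fun x => u x + d) z a b = reB n u z a b := by
  simp [reB]

theorem tendsto_reB_mol (hc : Continuous ψ) (hB : ∀ a b, B a b = B b a)
    (h : ∀ ε > 0, ∃ δ > 0, ∀ y, ‖y‖ < δ →
      |ψ (p + y) - ψ p - A y - 1 / 2 * B y y| ≤ ε * ‖y‖ ^ 2) (a b : Cn n) :
    Tendsto (fun k => reB n (mol ψ k) p a b) atTop (𝓝 (B a b)) := by
  set P := quad p (ψ p) A B with hP
  have hPc : Continuous P := contDiff_quad.continuous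
  have hk := ker_chi.reB (n := n) a b
  set J := ∫ y, |reB n chi y a b| with hJ
  have hJ0 : 0 ≤ J := integral_nonneg fun _ => abs_nonneg _
  rw [Metric.tendsto_nhds]
  intro e he
  obtain ⟨d, hd, hT⟩ := h (e / (2 * (J + 1))) (by positivity)
  filter_upwards [tendsto_mol_scale.eventually (gt_mem_nhds hd)] with k hkd
  set ε := 1 / ((k : ℝ) + 1) with hε
  have hε0 : 0 < ε := mol_scale_pos k
  have hr : LBdd fun z => ψ z - P z := Continuous.lBdd (by fun_prop)
  have e1 : mol ψ k = fun z => mol P k z + cv chi ε (fun z => ψ z - P z) z := funext fun z => by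
    rw [mol, mol, ← cv_add ker_chi _ hPc.lBdd hr]; simp
  obtain ⟨d', hd'⟩ := mol_quad (p := p) (c := ψ p) (A := A) hB k
  have e2 : reB n (mol ψ k) p a b = B a b + reB n (cv chi ε fun z => ψ z - P z) p a b := by
    rw [e1, reB_add (contDiff_mol hPc.lBdd k) (contDiff_cv ker_chi hε0 hr), hd', reB_add_const,
      reB_quad hB]
  rw [e2, Real.dist_eq, add_sub_cancel_left, reB_cv ker_chi hε0 hr]
  have h3 := abs_cv_le hk ε (H := fun z => ψ z - P z) (z := p)
    (c := e / (2 * (J + 1)) * ε ^ 2) fun y hy => by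
      have n1 : ‖-(ε • y)‖ ≤ ε := by
        rw [norm_neg, norm_smul, Real.norm_of_nonneg hε0.le]; nlinarith
      have := hT (-(ε • y)) (n1.trans_lt hkd)
      rw [← sub_eq_add_neg] at this
      have e3 : ψ (p - ε • y) - P (p - ε • y) = ψ (p - ε • y) - ψ p - A (-(ε • y))
          - 1 / 2 * B (-(ε • y)) (-(ε • y)) := by
        rw [hP, quad, sub_sub_cancel_left]; ring
      rw [e3]
      exact this.trans (mul_le_mul_of_nonneg_left (pow_le_pow_left₀ (norm_nonneg _) n1 2)
        (by positivity))
  rw [abs_mul, abs_of_nonneg (by positivity)]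
  calc _ ≤ (ε⁻¹) ^ 2 * (e / (2 * (J + 1)) * ε ^ 2 * J) :=
        mul_le_mul_of_nonneg_left h3 (by positivity)
    _ = e * (J / (2 * (J + 1))) := by field_simp
    _ < e * 1 := by
      refine mul_lt_mul_of_pos_left ?_ he
      rw [div_lt_one (by positivity)]; linarith
    _ = e := mul_one e

end SecondOrder

section Bump
variable {n : ℕ} {W : Set (Cn n)} {f u ψ g : Cn n → ℝ} {δ L c : ℝ}

theorem sqn_le_norm_sq (b : Cn n) : sqn b ≤ n * ‖b‖ ^ 2 := by
  have : sqn b ≤ ∑ _i : Fin n, ‖b‖ ^ 2 := Finset.sum_le_sum fun i _ =>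
    pow_le_pow_left₀ (norm_nonneg _) (norm_le_pi_norm b i) 2
  simpa using this

theorem integral_const_sub_circ (hc : Continuous u) (a b : Cn n) :
    ∫ x, (c - u (a + circ x • b)) ∂nuc = c - ∫ x, u (a + circ x • b) ∂nuc := by
  rw [integral_sub (integrable_const _) (integrable_circ hc a b)]; simp

theorem RSub.spsh_sub (hu : RSub u W) (hc : Continuous u) (hb : ∀ z ∈ W, u z ≤ c) :
    Spsh (fun z => ENNReal.ofReal (c - u z)) W := by
  have hci := continuous_circ
  refine ⟨fun z _ => (ENNReal.continuous_ofReal.comp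
    (continuous_const.sub hc)).lowerSemicontinuous z, fun a b hab => ?_⟩
  rw [← ofReal_integral_eq_lintegral_ofReal (integrable_cont (by fun_prop))
    (ae_of_all _ fun x => by simpa using hb _ (hab _ (norm_circ x).le)), integral_const_sub_circ hc]
  exact ENNReal.ofReal_le_ofReal (sub_le_sub_left (hu a b hab) c)

theorem Spsh.rSub_sub (h : Spsh (fun z => ENNReal.ofReal (c - u z)) W) (hc : Continuous u)
    (hb : ∀ z ∈ W, u z ≤ c) : RSub u W := by
  intro a b hab
  have hci := continuous_circ
  have h1 := h.2 a b hab
  rw [← ofReal_integral_eq_lintegral_ofReal (integrable_cont (by fun_prop))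
    (ae_of_all _ fun x => by simpa using hb _ (hab _ (norm_circ x).le)), integral_const_sub_circ hc]
    at h1
  rw [ENNReal.ofReal_le_ofReal_iff (by simpa using hb a (by simpa using hab 0 (by simp)))] at h1
  linarith

theorem RSub.glue (hψ : RSub ψ Set.univ) (hψc : Continuous ψ) (hg : RSub g Set.univ)
    (hgc : Continuous g) {G : Set (Cn n)} (hG : IsOpen G) (huc : Continuous u)
    (hu1 : ∀ z ∈ G, u z = max (ψ z) (g z)) (hu2 : ∀ z ∉ G, u z = ψ z) : RSub u Set.univ := by
  intro a b _
  set W := Metric.ball a (‖b‖ + 1)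
  have hab : ∀ ζ : ℂ, ‖ζ‖ ≤ 1 → a + ζ • b ∈ W := fun ζ hζ => by
    rw [Metric.mem_ball, dist_eq_norm, add_sub_cancel_left, norm_smul]
    nlinarith [norm_nonneg b]
  have hb : ∀ v : Cn n → ℝ, Continuous v → ∃ C, ∀ z ∈ W, v z ≤ C := fun v hv => by
    obtain ⟨C, hC⟩ := ((isCompact_closedBall a (‖b‖ + 1)).image hv).bddAbove
    exact ⟨C, fun z hz => hC ⟨z, Metric.ball_subset_closedBall hz, rfl⟩⟩
  obtain ⟨C1, h1⟩ := hb ψ hψc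
  obtain ⟨C2, h2⟩ := hb g hgc
  set C := max C1 C2
  have h1' : ∀ z ∈ W, ψ z ≤ C := fun z hz => (h1 z hz).trans (le_max_left _ _)
  have h2' : ∀ z ∈ W, g z ≤ C := fun z hz => (h2 z hz).trans (le_max_right _ _)
  have h3 : ∀ z ∈ W, u z ≤ C := fun z hz => by
    by_cases h : z ∈ G
    · rw [hu1 z h]; exact max_le (h1' z hz) (h2' z hz)
    · rw [hu2 z h]; exact h1' z hz
  have hT := RSub.spsh_sub (W := W) (fun x y _ => hψ x y (by simp)) hψc h1'
  have hV := RSub.spsh_sub (W := G ∩ W) (fun x y _ => hg x y (by simp)) hgc fun z hz => h2' z hz.2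
  have hS : Spsh (fun z => ENNReal.ofReal (C - u z)) W := by
    refine Spsh.glue Metric.isOpen_ball hG hT hV (fun z _ hz => ?_) (fun z _ hz => ?_)
      fun z _ _ => (ENNReal.continuous_ofReal.comp (continuous_const.sub huc)).lowerSemicontinuous z
    · rw [hu1 z hz, ← ENNReal.ofReal_mono.map_min]
      congr 1
      rcases le_total (ψ z) (g z) with h | h
      · rw [max_eq_right h, min_eq_left (by linarith)]
      · rw [max_eq_left h, min_eq_right (by linarith)]
    · rw [hu2 z hz]
  exact hS.rSub_sub huc h3 a b hab

theorem rSub_quad {p : Cn n} {A : Cn n →L[ℝ] ℝ} {B : Cn n →L[ℝ] Cn n →L[ℝ] ℝ} {γ : ℝ}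
    (hB : ∀ a b, B a b = B b a)
    (h : ∀ b, 4 * γ * sqn b ≤ B b b + B (Complex.I • b) (Complex.I • b)) :
    RSub (fun z => quad p c A B z + -γ * sqn (z - p)) Set.univ := by
  intro a b _
  have hci := continuous_circ
  have e : ∀ x, quad p c A B (a + circ x • b) + -γ * sqn (a + circ x • b - p) =
      (quad p c A B a + -γ * sqn (a - p) + -γ * sqn b) + ((A + B (a - p) + -γ • fderiv ℝ sqn (a - p))
        (circ x • b) + 1 / 2 * B (circ x • b) (circ x • b)) := fun x => by
    have e1 : a + circ x • b - p = circ x • b + (a - p) := by abel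
    rw [quad, quad, e1, sqn_add_eq, sqn_smul, norm_circ]
    simp [hB (circ x • b) (a - p)]
    ring
  simp only [e]
  rw [integral_add (integrable_const _) (integrable_cont (by fun_prop)), integral_quadratic_circ]
  have := h b
  simp
  linarith

theorem exists_pos_lower {lam : Cn n → ℝ} (hc : Continuous lam)
    (hs : ∀ (s : ℝ) b, lam (s • b) = s ^ 2 * lam b) (h : ∀ b, b ≠ 0 → 0 < lam b) :
    ∃ c > 0, ∀ b, c * ‖b‖ ^ 2 ≤ lam b := by
  have h0 : lam 0 = 0 := by simpa using hs 0 0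
  have hK : IsCompact (Metric.sphere (0 : Cn n) 1) := isCompact_sphere 0 1
  rcases (Metric.sphere (0 : Cn n) 1).eq_empty_or_nonempty with he | hne
  · refine ⟨1, one_pos, fun b => ?_⟩
    rcases eq_or_ne b 0 with rfl | hb
    · simp [h0]
    · have : ‖b‖⁻¹ • b ∈ Metric.sphere (0 : Cn n) 1 := by simp [norm_smul, hb]
      rw [he] at this; exact this.elim
  · obtain ⟨m, hm, hmin⟩ := hK.exists_isMinOn hne hc.continuousOn
    refine ⟨lam m, h m (by rintro rfl; simp at hm), fun b => ?_⟩
    rcases eq_or_ne b 0 with rfl | hb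
    · simp [h0]
    · have hb' := norm_pos_iff.2 hb
      have h1 : lam m ≤ lam (‖b‖⁻¹ • b) := hmin (by simp [norm_smul, hb])
      rw [hs] at h1
      calc lam m * ‖b‖ ^ 2 ≤ (‖b‖⁻¹) ^ 2 * lam b * ‖b‖ ^ 2 :=
            mul_le_mul_of_nonneg_right h1 (by positivity)
        _ = lam b := by field_simp

theorem noncontact (hδ : 0 ≤ δ) {B0 : ℝ} (hB0 : ∀ z, -B0 ≤ f z)
    (hL : ∀ x y, |f x - f y| ≤ L * ‖x - y‖) (hfc : Continuous f) {p : Cn n} {A : Cn n →L[ℝ] ℝ}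
    {B : Cn n →L[ℝ] Cn n →L[ℝ] ℝ} (hB : ∀ a b, B a b = B b a) (hp : env f δ p < f p)
    (hT : ∀ ε > 0, ∃ d > 0, ∀ y, ‖y‖ < d → |(env f δ (p + y) + δ * sqn (p + y))
      - (env f δ p + δ * sqn p) - A y - 1 / 2 * B y y| ≤ ε * ‖y‖ ^ 2) :
    ∃ b ≠ 0, B b b + B (Complex.I • b) (Complex.I • b) ≤ 0 := by
  by_contra! hcon
  have hq := continuous_sqn (n := n)
  obtain ⟨c, hc0, hc⟩ := exists_pos_lower
    (lam := fun b => B b b + B (Complex.I • b) (Complex.I • b)) (by fun_prop)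
    (fun s b => by simp [smul_comm Complex.I s]; ring) hcon
  have htc := continuous_env (δ := δ) hδ hB0 hL
  have hm := env_mem_comp (δ := δ) hδ hB0 hL
  set t := env f δ with ht
  set γ := c / (4 * (n + 1)) with hγ
  have hγ0 : 0 < γ := by positivity
  have hγc : ∀ b : Cn n, 4 * γ * sqn b ≤ B b b + B (Complex.I • b) (Complex.I • b) := fun b => by
    refine le_trans ?_ (hc b)
    calc 4 * γ * sqn b ≤ 4 * γ * (n * ‖b‖ ^ 2) :=
          mul_le_mul_of_nonneg_left (sqn_le_norm_sq b) (by positivity)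
      _ = c * ‖b‖ ^ 2 * (n / (n + 1)) := by rw [hγ]; field_simp
      _ ≤ c * ‖b‖ ^ 2 * 1 := by
        refine mul_le_mul_of_nonneg_left ?_ (by positivity)
        rw [div_le_one (by positivity)]; linarith
      _ = _ := mul_one _
  obtain ⟨d, hd, hTd⟩ := hT (γ / 2) (by positivity)
  set e := (f p - t p) / 2 with he
  have he0 : 0 < e := by rw [he]; linarith
  obtain ⟨d2, hd2, hfd⟩ : ∃ d2 > 0, ∀ z, dist z p < d2 → e < f z - t z := by
    have : ∀ᶠ z in 𝓝 p, e < f z - t z :=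
      (hfc.sub htc).continuousAt.eventually (lt_mem_nhds (by change e < f p - t p; linarith))
    exact Metric.eventually_nhds_iff.1 this
  obtain ⟨r, hr0, hrd, hrd2⟩ : ∃ r > 0, r < d ∧ r < d2 :=
    ⟨min d d2 / 2, by positivity, by linarith [min_le_left d d2], by linarith [min_le_right d d2]⟩
  obtain ⟨s, hs0, hse, hsr⟩ : ∃ s > 0, s ≤ e ∧ s < γ * r ^ 2 / 8 :=
    ⟨min e (γ * r ^ 2 / 16), by positivity, min_le_left _ _,
      (min_le_right _ _).trans_lt (by linarith [show 0 < γ * r ^ 2 by positivity])⟩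
  set ψ : Cn n → ℝ := fun z => t z + δ * sqn z with hψ
  have hψc : Continuous ψ := by fun_prop
  set g : Cn n → ℝ := fun z => quad p (ψ p + s) A B z + -γ * sqn (z - p) with hg
  have hgc : Continuous g := by
    have := (contDiff_quad (p := p) (c := ψ p + s) (A := A) (B := B)).continuous
    fun_prop
  have hgψ : ∀ y, ‖y‖ < d → g (p + y) ≤ ψ (p + y) + s - γ / 2 * ‖y‖ ^ 2 := fun y hy => by
    have h1 := (abs_le.1 (hTd y hy)).1
    have h2 := mul_le_mul_of_nonneg_left (norm_sq_le_sqn y) hγ0.le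
    simp only [hg, quad, add_sub_cancel_left]
    simp only [hψ] at *
    linarith
  set G := Metric.ball p r with hGdef
  have hlt : ∀ z, r / 2 < dist z p → dist z p < d → g z < ψ z := fun z h1 h2 => by
    rw [dist_eq_norm] at h1 h2
    have := hgψ (z - p) h2
    rw [add_sub_cancel] at this
    have h3 : (r / 2) ^ 2 ≤ ‖z - p‖ ^ 2 := pow_le_pow_left₀ (by positivity) h1.le 2
    nlinarith
  have hinG : ∀ z ∈ G, g z ≤ ψ z + s := fun z hz => by
    have h2 : ‖z - p‖ < d := by rw [← dist_eq_norm]; exact (Metric.mem_ball.1 hz).trans hrd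
    have := hgψ (z - p) h2
    rw [add_sub_cancel] at this
    nlinarith [sq_nonneg ‖z - p‖]
  classical
  set u : Cn n → ℝ := fun z => if z ∈ G then max (ψ z) (g z) else ψ z with hu
  have hu1 : ∀ z ∈ G, u z = max (ψ z) (g z) := fun z hz => if_pos hz
  have hu2 : ∀ z ∉ G, u z = ψ z := fun z hz => if_neg hz
  have huc : Continuous u := by
    rw [continuous_iff_continuousAt]
    intro z
    by_cases hz : r / 2 < dist z p
    · have : ∀ᶠ w in 𝓝 z, r / 2 < dist w p :=
        (continuous_id.dist continuous_const).continuousAt.eventually (lt_mem_nhds hz)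
      refine hψc.continuousAt.congr ?_
      filter_upwards [this] with w hw
      by_cases hwG : w ∈ G
      · rw [hu1 w hwG, max_eq_left (hlt w hw ((Metric.mem_ball.1 hwG).trans hrd)).le]
      · rw [hu2 w hwG]
    · have hzG : z ∈ G := Metric.mem_ball.2 (by linarith [not_lt.1 hz])
      refine (hψc.max hgc).continuousAt.congr ?_
      filter_upwards [Metric.isOpen_ball.mem_nhds hzG] with w hw
      exact (hu1 w hw).symm
  have hur := RSub.glue hm.2.1 hψc (rSub_quad hB hγc) hgc Metric.isOpen_ball huc hu1 hu2
  have hcomp : (fun z => u z - δ * sqn z) ∈ comp f δ := by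
    refine ⟨by fun_prop, by simpa using hur, fun z => ?_⟩
    by_cases hz : z ∈ G
    · have h1 : u z ≤ ψ z + s := by
        rw [hu1 z hz]; exact max_le (by linarith) (hinG z hz)
      have h2 := hfd z ((Metric.mem_ball.1 hz).trans hrd2)
      simp only [hψ] at h1
      linarith
    · change u z - δ * sqn z ≤ f z
      rw [hu2 z hz]
      simpa [hψ] using hm.2.2 z
  have h1 := le_env hcomp p
  have h2 : g p ≤ u p := by
    rw [hu1 p (Metric.mem_ball_self hr0)]; exact le_max_right _ _
  have h3 : g p = ψ p + s := by
    have h0 : sqn (0 : Cn n) = 0 := by simp [sqn]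
    simp [hg, quad, h0]
  simp only [hψ] at h3
  simp only [← ht] at h1
  linarith

end Bump

section Obstacle
variable {n : ℕ} {f ψ : Cn n → ℝ} {K L B ρ δ σ : ℝ}

theorem lapl_sub_const {u : Cn n → ℝ} (c : ℝ) (z b : Cn n) :
    lapl (fun x => u x - c) z b = lapl u z b := by
  simp only [sub_eq_add_neg, lapl, reB_add_const]

theorem integral_chi_mul_neg (H : Cn n → ℝ) (ε : ℝ) (z : Cn n) :
    cv chi ε (fun w => H (z + z - w)) z = cv chi ε H z := by
  rw [cv, cv, ← integral_neg_eq_self]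
  refine integral_congr_ae (.of_forall fun y => ?_)
  have h1 : chi (-y) = chi y := by
    have := chi_smul (ζ := -1) (by simp) y
    simpa using this
  simp only [h1]
  congr 2
  rw [smul_neg]; abel

theorem mol_le_of_second_diff (hK0 : 0 ≤ K) (hc : Continuous ψ)
    (hK : ∀ x a, ψ (x + a) + ψ (x - a) - 2 * ψ x ≤ K * ‖a‖ ^ 2) (k : ℕ) (z : Cn n) :
    mol ψ k z ≤ ψ z + K * (1 / ((k : ℝ) + 1)) ^ 2 := by
  set ε : ℝ := 1 / ((k : ℝ) + 1) with hε
  have hε0 : 0 < ε := mol_scale_pos k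
  have hc' : Continuous fun w => ψ (z + z - w) := by fun_prop
  have h1 := cv_add ker_chi ε hc.lBdd hc'.lBdd z
  rw [integral_chi_mul_neg] at h1
  have h2 : cv chi ε (fun w => ψ w + ψ (z + z - w)) z ≤ 2 * ψ z + K * ε ^ 2 := by
    refine mol_le_of_le (hc.add hc').lBdd fun y hy => ?_
    have := hK z (ε • y)
    have e : z + z - (z - ε • y) = z + ε • y := by abel
    simp only [Pi.add_apply]
    rw [e]
    have hn : ‖ε • y‖ ≤ ε := by
      rw [norm_smul, Real.norm_of_nonneg hε0.le]
      exact mul_le_of_le_one_right hε0.le hy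
    have : K * ‖ε • y‖ ^ 2 ≤ K * ε ^ 2 := by gcongr
    linarith
  have h3 : 0 ≤ K * ε ^ 2 := by positivity
  rw [mol]
  linarith

/-- A continuous obstacle with bounded second differences, nonpositive and vanishing near
infinity. -/
structure Obst (f : Cn n → ℝ) (K B : ℝ) : Prop where
  lip : ∃ L, ∀ x y, |f x - f y| ≤ L * ‖x - y‖
  semi : ∀ x a, f (x + a) + f (x - a) - 2 * f x ≤ K * ‖a‖ ^ 2
  low : ∀ z, -B ≤ f z
  up : ∀ z, f z ≤ 0
  far : ∃ ρ, ∀ z, ρ ≤ ‖z‖ → f z = 0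
  nonneg : 0 ≤ K

/-- The envelope made plurisubharmonic by adding the quadratic. -/
def penv (f : Cn n → ℝ) (δ : ℝ) (z : Cn n) : ℝ := env f δ z + δ * sqn z

namespace Obst

theorem continuous (h : Obst f K B) : Continuous f := by
  obtain ⟨L, hL⟩ := h.lip
  have : LipschitzWith (Real.toNNReal L) f := LipschitzWith.of_dist_le_mul fun x y => by
    rw [Real.dist_eq, dist_eq_norm]
    refine (hL x y).trans ?_
    gcongr; exact Real.le_coe_toNNReal L
  exact this.continuous

theorem continuous_env (h : Obst f K B) (hδ : 0 ≤ δ) : Continuous (env f δ) :=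
  let ⟨_, hL⟩ := h.lip
  _root_.continuous_env hδ h.low hL

theorem continuous_penv (h : Obst f K B) (hδ : 0 ≤ δ) : Continuous (penv f δ) :=
  (h.continuous_env hδ).add (continuous_sqn.const_mul δ)

theorem rSub_penv (h : Obst f K B) (hδ : 0 ≤ δ) : RSub (penv f δ) Set.univ :=
  let ⟨_, hL⟩ := h.lip
  (env_mem_comp hδ h.low hL).2.1

theorem semi_penv (h : Obst f K B) (hδ : 0 ≤ δ) (x a : Cn n) :
    penv f δ (x + a) + penv f δ (x - a) - 2 * penv f δ x ≤ (K + 2 * n * δ) * ‖a‖ ^ 2 := by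
  obtain ⟨L, hL⟩ := h.lip
  have h1 := env_second_diff hδ h.low hL h.semi x a
  have h2 := sqn_add_eq x a
  have h3 := sqn_add_eq x (-a)
  have h4 := mul_le_mul_of_nonneg_left (sqn_le_norm_sq a) (by positivity : 0 ≤ 2 * δ)
  have h5 : sqn (-a) = sqn a := by simp [sqn]
  rw [← sub_eq_add_neg, h5, fderiv_sqn] at h3
  rw [fderiv_sqn] at h2
  simp only [Pi.neg_apply, map_neg, neg_mul, Finset.sum_neg_distrib, Complex.neg_re] at h3
  simp only [penv]
  rw [h2, h3]
  nlinarith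

theorem nonneg_penv (h : Obst f K B) (hδ : 0 ≤ δ) : 0 ≤ K + 2 * n * δ :=
  add_nonneg h.nonneg (by positivity)

theorem lapl_mol (h : Obst f K B) (hδ : 0 ≤ δ) (k : ℕ) (p b : Cn n) :
    0 ≤ lapl (mol (penv f δ) k) p b :=
  (norm_second_mol_le (h.nonneg_penv hδ) (h.continuous_penv hδ) (h.rSub_penv hδ)
    (h.semi_penv hδ) k).1 p b

theorem contDiff_mol (h : Obst f K B) (hδ : 0 ≤ δ) (k : ℕ) :
    ContDiff ℝ (⊤ : ℕ∞) (mol (penv f δ) k) := _root_.contDiff_mol (h.continuous_penv hδ).lBdd k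

theorem le_mol (h : Obst f K B) (hδ : 0 ≤ δ) (k : ℕ) (z : Cn n) :
    penv f δ z ≤ mol (penv f δ) k z :=
  (h.rSub_penv hδ).le_mol (h.continuous_penv hδ).lBdd fun _ _ => Set.mem_univ _

theorem exists_maDensity_le (h : Obst f K B) (hδ : 0 ≤ δ) :
    ∃ M, ∀ k z, |maDensity n (mol (penv f δ) k) z| ≤ M := by
  refine ⟨_, fun k z => abs_maDensity_le (M := 2 * (K + 2 * n * δ)) fun a b ha hb => ?_⟩
  rw [reB_eq ((h.contDiff_mol hδ k).differentiable_fderiv z)]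
  have h1 := (norm_second_mol_le (h.nonneg_penv hδ) (h.continuous_penv hδ) (h.rSub_penv hδ)
    (h.semi_penv hδ) k).2 z
  have h2 := (fderiv ℝ (fderiv ℝ (mol (penv f δ) k)) z).le_opNorm₂ a b
  rw [Real.norm_eq_abs] at h2
  have h0 := h.nonneg_penv hδ
  calc _ ≤ _ := h2
    _ ≤ 2 * (K + 2 * n * δ) * 1 * 1 := by gcongr
    _ = _ := by ring

theorem ae_tendsto_maDensity (h : Obst f K B) (hδ : 0 ≤ δ) :
    ∀ᵐ p, env f δ p < f p → Tendsto (fun k => maDensity n (mol (penv f δ) k) p) atTop (𝓝 0) := by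
  obtain ⟨L, hL⟩ := h.lip
  filter_upwards [ae_second_order (h.nonneg_penv hδ) (h.continuous_penv hδ) (h.rSub_penv hδ)
    (h.semi_penv hδ)] with p ⟨A, B', hB', hT⟩ hp
  obtain ⟨b, hb, hb0⟩ := noncontact hδ h.low hL h.continuous hB' hp hT
  have ht := tendsto_reB_mol (h.continuous_penv hδ) hB' hT
  have h1 := tendsto_maDensity (u := fun k => mol (penv f δ) k) (v := quad p 0 A B') (z := p)
    (fun a b => by rw [reB_quad hB']; exact ht a b)
  rwa [maDensity_eq_zero contDiff_quad (fun b => ?_) hb] at h1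
  · simpa only [lapl, reB_quad hB'] using hb0
  · simp only [lapl, reB_quad hB']
    exact ge_of_tendsto' ((ht b b).add (ht (Complex.I • b) (Complex.I • b)))
      fun k => h.lapl_mol hδ k p b

theorem isCompact_sublevel (h : Obst f K B) (hδ : 0 < δ) (hσ : 0 < σ) :
    IsCompact {z | env f δ z ≤ -σ} := by
  obtain ⟨ρ, hρ⟩ := h.far
  obtain ⟨ρ', hρ'⟩ := env_eq_zero hδ h.low h.up hρ
  refine (isCompact_closedBall (0 : Cn n) ρ').of_isClosed_subset
    (isClosed_le (h.continuous_env hδ.le) continuous_const) fun z hz => ?_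
  by_contra hc
  have := hρ' z (by simpa using (not_le.1 (by simpa using hc) : ρ' < ‖z‖).le)
  simp only [Set.mem_ofPred_eq] at hz
  linarith

theorem tendsto_noncontact (h : Obst f K B) (hδ : 0 < δ) {S : Set (Cn n)} (hS : IsCompact S) :
    Tendsto (fun k => ∫ z in S ∩ {z | env f δ z < f z}, maDensity n (mol (penv f δ) k) z) atTop
      (𝓝 0) := by
  obtain ⟨M, hM⟩ := h.exists_maDensity_le hδ.le
  have hm : MeasurableSet {z | env f δ z < f z} :=
    (isOpen_lt (h.continuous_env hδ.le) h.continuous).measurableSet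
  have hfin : volume (S ∩ {z | env f δ z < f z}) ≠ ⊤ :=
    ((measure_mono Set.inter_subset_left).trans_lt hS.measure_lt_top).ne
  have := tendsto_integral_of_dominated_convergence (fun _ => M)
    (μ := volume.restrict (S ∩ {z | env f δ z < f z}))
    (F := fun k => maDensity n (mol (penv f δ) k)) (f := fun _ => 0)
    (fun k => (continuous_maDensity (h.contDiff_mol hδ.le k)).aestronglyMeasurable)
    (integrableOn_const hfin) (fun k => .of_forall fun z => hM k z) ?_
  · simpa using this
  · rw [ae_restrict_iff' (hS.isClosed.measurableSet.inter hm)]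
    filter_upwards [h.ae_tendsto_maDensity hδ.le] with z hz hzS using hz hzS.2

/-- The volume of a sublevel set of the envelope is controlled by the Monge–Ampère mass on the
contact set. -/
theorem volume_le (h : Obst f K B) (hδ : 0 < δ) (hσ : 0 < σ) {η : ℝ} (hη : 0 < η) :
    ∀ᶠ k in atTop, (4 : ℝ) ^ n * n.factorial * δ ^ n * volume.real {z | env f δ z < -2 * σ} ≤
      (∫ z in {z | env f δ z ≤ -σ} ∩ {z | env f δ z = f z}, maDensity n (mol (penv f δ) k) z)
        + η := by
  set N := {z | env f δ z ≤ -σ} with hN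
  have hNc : IsCompact N := h.isCompact_sublevel hδ hσ
  have hct := h.continuous_env hδ.le
  have hlim : Tendsto (fun k : ℕ => (K + 2 * n * δ) * (1 / ((k : ℝ) + 1)) ^ 2) atTop (𝓝 0) := by
    simpa using (tendsto_one_div_add_atTop_nhds_zero_nat (𝕜 := ℝ)).pow 2 |>.const_mul
      (K + 2 * n * δ)
  filter_upwards [hlim.eventually (gt_mem_nhds (show (0 : ℝ) < σ / 8 by positivity)),
    (h.tendsto_noncontact hδ hNc).eventually (gt_mem_nhds hη)] with k hk1 hk2
  set u := mol (penv f δ) k with hu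
  set b : Cn n → ℝ := fun z => δ * sqn z - 3 / 2 * σ with hb
  have hus : ContDiff ℝ (⊤ : ℕ∞) u := h.contDiff_mol hδ.le k
  have hbs : ContDiff ℝ (⊤ : ℕ∞) b := (contDiff_sqn.const_smul δ).sub contDiff_const
  have hκ : 0 < σ / 8 := by positivity
  have hle : ∀ z, env f δ z + δ * sqn z ≤ u z := h.le_mol hδ.le k
  have hge : ∀ z, u z ≤ env f δ z + δ * sqn z + σ / 8 := fun z =>
    (mol_le_of_second_diff (h.nonneg_penv hδ.le) (h.continuous_penv hδ.le)
      (h.semi_penv hδ.le) k z).trans (by simp only [penv]; linarith)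
  set v := regmax (σ / 8) u b with hv
  have hvs : ContDiff ℝ (⊤ : ℕ∞) v := contDiff_regmax _ hus hbs
  have hoff : ∀ z ∉ N, v z = u z := fun z hz => by
    have : -σ < env f δ z := not_le.1 hz
    simp only [hv, regmax]
    rw [softPos_of_nonpos hκ (by simp only [hb]; linarith [hle z]), add_zero]
  have hlu : ∀ z b, 0 ≤ lapl u z b := h.lapl_mol hδ.le k
  have hlv : ∀ z w, 0 ≤ lapl v z w := fun z w => by
    refine lapl_regmax_nonneg hκ hus hbs (hlu z w) ?_
    rw [hb, lapl_sub_const (u := fun z => δ * sqn z),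
      lapl_const_mul contDiff_sqn]
    exact mul_nonneg hδ.le (lapl_sqn_nonneg z w)
  have hmono := mono_lapl hus hvs (contDiff_const (c := (1 : ℝ))) hNc hoff
    (fun z => le_add_of_nonneg_right (softPos_nonneg' hκ _)) (fun z _ => hlu z)
    (fun z _ => hlv z) (fun z _ w => (lapl_const 1 z w).le)
  simp only [one_mul] at hmono
  have hiu : ∀ S, IsCompact S → IntegrableOn (maDensity n u) S :=
    fun S hS => (continuous_maDensity hus).continuousOn.integrableOn_compact hS
  have hiv : ∀ S, IsCompact S → IntegrableOn (maDensity n v) S :=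
    fun S hS => (continuous_maDensity hvs).continuousOn.integrableOn_compact hS
  have h1 : ∫ z in N, maDensity n v z ≤ ∫ z in N, maDensity n u z := by
    rw [← setIntegral_eq_integral_of_forall_compl_eq_zero (s := N), integral_sub (hiv N hNc)
      (hiu N hNc)] at hmono
    · linarith
    · intro z hz
      rw [maDensity_eq_off hNc.isClosed hoff hz, sub_self]
  have hO : IsOpen {z | env f δ z < -2 * σ} := isOpen_lt hct continuous_const
  have hON : {z | env f δ z < -2 * σ} ⊆ N := fun z hz => by
    simp only [Set.mem_ofPred_eq] at hz; simp only [hN, Set.mem_ofPred_eq]; linarith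
  have h2 : (4 : ℝ) ^ n * n.factorial * δ ^ n * volume.real {z | env f δ z < -2 * σ} ≤
      ∫ z in N, maDensity n v z := by
    have e : ∫ z in {z | env f δ z < -2 * σ}, maDensity n v z =
        ∫ z in {z | env f δ z < -2 * σ}, (4 : ℝ) ^ n * n.factorial * δ ^ n := by
      refine setIntegral_congr_fun hO.measurableSet fun z hz => ?_
      have : v =ᶠ[𝓝 z] fun x => δ * sqn x + (softPos (σ / 8) (σ / 8) - σ / 8 - 3 / 2 * σ) := by
        filter_upwards [hO.mem_nhds hz] with x hx
        have hx : env f δ x < -2 * σ := hx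
        simp only [hv, regmax]
        rw [softPos_eq hκ (by simp only [hb]; linarith [hge x])]
        simp only [hb]; ring
      rw [maDensity_congr this]
      simp only [sub_eq_add_neg]
      rw [maDensity_affine contDiff_sqn, maDensity_sqn]; ring
    rw [setIntegral_const, smul_eq_mul] at e
    rw [mul_comm, ← e]
    exact setIntegral_mono_set (hiv N hNc)
      (.of_forall fun z => maDensity_nonneg hvs (hlv z)) hON.eventuallyLE
  have h3 : ∫ z in N, maDensity n u z = (∫ z in N ∩ {z | env f δ z = f z}, maDensity n u z)
      + ∫ z in N ∩ {z | env f δ z < f z}, maDensity n u z := by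
    obtain ⟨L, hL⟩ := h.lip
    rw [← setIntegral_union (f := maDensity n u) (s := N ∩ {z | env f δ z = f z})
      (t := N ∩ {z | env f δ z < f z})]
    · congr 2
      ext z
      have := env_le hδ.le h.low z
      simp only [Set.mem_union, Set.mem_inter_iff, Set.mem_ofPred_eq, ← and_or_left]
      simp [this.eq_or_lt]
    · refine Set.disjoint_left.2 fun z hz hz' => ?_
      exact (ne_of_lt hz'.2) hz.2
    · exact hNc.isClosed.measurableSet.inter (isOpen_lt hct h.continuous).measurableSet
    · exact (hiu N hNc).mono_set Set.inter_subset_left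
    · exact (hiu N hNc).mono_set Set.inter_subset_left
  linarith
end Obst
end Obstacle

section Contact
variable {n : ℕ}

theorem bdd_second {s : Cn n → ℝ} (hs : ContDiff ℝ (⊤ : ℕ∞) s) (hc : HasCompactSupport s) :
    ∃ M, 0 ≤ M ∧ ∀ p, ‖fderiv ℝ (fderiv ℝ s) p‖ ≤ M := by
  have h1 : ContDiff ℝ (⊤ : ℕ∞) (fderiv ℝ s) := hs.fderiv_right (by simp)
  obtain ⟨M, hM⟩ := (h1.continuous_fderiv (by simp)).bounded_above_of_compact_support
    ((hc.fderiv (𝕜 := ℝ)).fderiv (𝕜 := ℝ))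
  exact ⟨M, (norm_nonneg _).trans (hM 0), hM⟩

theorem exists_lapl_le {s : Cn n → ℝ} (hs : ContDiff ℝ (⊤ : ℕ∞) s) (hc : HasCompactSupport s) :
    ∃ c, 0 ≤ c ∧ ∀ z b, lapl s z b ≤ c * lapl sqn z b := by
  obtain ⟨M, hM0, hM⟩ := bdd_second hs hc
  refine ⟨M, hM0, fun z b => ?_⟩
  have hd := hs.differentiable_fderiv z
  have key : ∀ w : Cn n, ‖w‖ = ‖b‖ → reB n s z w w ≤ M * sqn b := fun w hw => by
    rw [reB_eq hd]
    have h1 := (fderiv ℝ (fderiv ℝ s) z).le_opNorm₂ w w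
    rw [Real.norm_eq_abs, hw] at h1
    calc _ ≤ _ := (le_abs_self _).trans h1
      _ ≤ M * ‖b‖ * ‖b‖ := by gcongr; exact hM z
      _ = M * ‖b‖ ^ 2 := by ring
      _ ≤ _ := by gcongr; exact norm_sq_le_sqn b
  rw [lapl_sqn, lapl]
  have h1 := key b rfl
  have h2 := key (Complex.I • b) (by rw [norm_smul]; simp)
  nlinarith [mul_nonneg hM0 (sqn_nonneg b)]

/-- Truncations of smooth functions that are a nonnegative constant near infinity are admissible
obstacles. -/
theorem obst_min {s : Cn n → ℝ} (hs : ContDiff ℝ (⊤ : ℕ∞) s) (hc : HasCompactSupport s) {a : ℝ}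
    (ha : 0 ≤ a) : ∃ K B, Obst (fun z => min (s z + a) 0) K B := by
  obtain ⟨M, hM0, hM⟩ := bdd_second hs hc
  obtain ⟨L, hL⟩ := hs.lipschitzWith_of_hasCompactSupport hc (by simp)
  obtain ⟨B, hB⟩ := hs.continuous.bounded_above_of_compact_support hc
  have hB0 : 0 ≤ B := (norm_nonneg _).trans (hB 0)
  refine ⟨2 * M, B, ⟨L, fun x y => ?_⟩, fun x b => ?_, fun z => ?_, fun z => min_le_right _ _, ?_,
    by positivity⟩
  · have h1 := hL.dist_le_mul x y
    rw [Real.dist_eq, dist_eq_norm] at h1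
    refine (abs_min_sub_min_le_max _ _ _ _).trans ?_
    simpa using h1
  · have h1 := taylor_one_of_norm_second hs hM0 hM x (x + b)
    have h2 := taylor_one_of_norm_second hs hM0 hM x (x - b)
    rw [add_sub_cancel_left] at h1
    rw [sub_sub_cancel_left, norm_neg, map_neg] at h2
    have h3 := (abs_le.1 h1).2
    have h4 := (abs_le.1 h2).2
    have : 0 ≤ M * ‖b‖ ^ 2 := by positivity
    rcases min_cases (s x + a) 0 with ⟨e, _⟩ | ⟨e, _⟩ <;> rw [e]
    · linarith [min_le_left (s (x + b) + a) 0, min_le_left (s (x - b) + a) 0]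
    · linarith [min_le_right (s (x + b) + a) 0, min_le_right (s (x - b) + a) 0]
  · have := (abs_le.1 (hB z)).1
    exact le_min (by linarith) (by linarith)
  · obtain ⟨ρ, hρ⟩ := hc.isCompact.isBounded.subset_closedBall 0
    refine ⟨ρ + 1, fun z hz => ?_⟩
    have : s z = 0 := image_eq_zero_of_notMem_tsupport fun h => by
      have := hρ h
      rw [mem_closedBall_zero_iff] at this
      linarith
    simp only [this, zero_add]
    exact min_eq_right ha

theorem BPot.eq_zero {Ω : Set (Cn n)} {H : Cn n → ℝ} {μ : Measure (Cn n)} (B : BPot Ω H μ)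
    {z : Cn n} (hz : z ∉ Ω) : H z = 0 := by
  refine le_antisymm (B.nonpos z) (le_of_forall_pos_le_add fun c hc => ?_)
  obtain ⟨K, hK, -, h⟩ := B.bdry c hc
  linarith [h z fun h => hz (hK h)]

theorem hasCompactSupport_mol {Ω : Set (Cn n)} (hΩ : Bornology.IsBounded Ω) {H : Cn n → ℝ}
    (h0 : ∀ z ∉ Ω, H z = 0) (k : ℕ) : HasCompactSupport (mol H k) := by
  obtain ⟨ρ, hρ⟩ := hΩ.subset_closedBall 0
  refine HasCompactSupport.intro (isCompact_closedBall (0 : Cn n) (ρ + 1)) fun z hz => ?_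
  have : ∀ y : Cn n, chi y * H (z - (1 / ((k : ℝ) + 1)) • y) = 0 := fun y => by
    by_cases hy : 1 < ‖y‖
    · simp [ker_chi.eq_zero hy]
    rw [h0, mul_zero]
    intro hz'
    have h1 := hρ hz'
    rw [mem_closedBall_zero_iff] at h1
    rw [mem_closedBall_zero_iff, not_le] at hz
    have h2 := norm_sub_norm_le z ((1 / ((k : ℝ) + 1)) • y)
    have h3 : ‖(1 / ((k : ℝ) + 1)) • y‖ ≤ 1 := by
      rw [norm_smul, Real.norm_of_nonneg (mol_scale_pos k).le]
      refine mul_le_one₀ ?_ (norm_nonneg _) (not_lt.1 hy)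
      rw [div_le_one (by positivity)]
      linarith [(Nat.cast_nonneg k : (0 : ℝ) ≤ k)]
    linarith
  simp only [mol, cv, this, integral_zero]

end Contact

section Contact
variable {n : ℕ} {Ω : Set (Cn n)} {H H0 : Cn n → ℝ} {μ μ0 : Measure (Cn n)}

theorem BPot.exists_obst (hΩ : IsOpen Ω) (hΩb : Bornology.IsBounded Ω) (B0 : BPot Ω H0 μ0)
    (B : BPot Ω H μ) (hle : ∀ z, H z ≤ H0 z) (hneg : ∀ z ∈ Ω, H0 z < 0) {R : ℝ}
    (hR : ∀ z ∈ Ω, sqn z ≤ R) {η : ℝ} (hη : 0 < η) {C0 : ℝ} (hC0 : ∀ z, -C0 ≤ H0 z)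
    (hE : ∫ z, (R - sqn z) ∂μ ≤ ∫ z, (R - sqn z) ∂μ0 + η) {C : ℝ} (hC : C0 ≤ C) (hCp : 0 < C)
    {A : Set (Cn n)} {χ θ : Cn n → ℝ} (hχ : ContDiff ℝ (⊤ : ℕ∞) χ) (hχc : HasCompactSupport χ)
    (hχΩ : tsupport χ ⊆ Ω) (hχ0 : ∀ z, 0 ≤ χ z) (hχA : ∀ z ∈ A, χ z = 1)
    (hθ : ContDiff ℝ (⊤ : ℕ∞) θ) (hθc : HasCompactSupport θ) (hθ1 : ∀ z, θ z ≤ 1)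
    (hθA : ∀ z ∉ A, θ z = 0) {c : ℝ} (hc0 : 0 ≤ c) (hc : ∀ z b, lapl χ z b ≤ c * lapl sqn z b)
    {σ δ : ℝ} (hσ : 0 < σ) (hδ : 0 < δ) (hδR : δ * R ≤ σ / 4) :
    ∀ᶠ k in atTop, ∃ f, (∃ K B, Obst f K B) ∧ (∀ z, θ z = 1 → f z ≤ mol H k z + C) ∧
      (4 : ℝ) ^ n * n.factorial * δ ^ n * volume.real {z | env f δ z < -2 * σ} ≤
        2 ^ n * ((∫ z, χ z * maDensity n (mol H k) z) + 5 * c * η) + η := by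
  obtain ⟨L, hL⟩ := B.bdd
  have hL0 : 0 ≤ L := by linarith [hL 0, B.nonpos 0]
  obtain ⟨K0, hK0Ω, hK0, hb0⟩ := B.mol_bdry hΩ hCp
  have hK1 : IsCompact (K0 ∪ tsupport χ) := hK0.union hχc
  obtain ⟨V, -, hKV, -, hV⟩ := exists_nhds_lapl hΩ B.lBdd B.rSub hK1
    (Set.union_subset hK0Ω hχΩ)
  obtain ⟨g, hg, hgc, hgΩ, hg0, hg1, hgK⟩ := exists_cutoff hΩ hK0 hK0Ω
  filter_upwards [hb0, hV, B0.energy hΩ B hle hneg hR hη hC0 hE hK0 hK0Ω] with k hk0 hkV hkE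
  set h := mol H k with hh
  have hs : ContDiff ℝ (⊤ : ℕ∞) h := contDiff_mol B.lBdd k
  have hhc : HasCompactSupport h := hasCompactSupport_mol hΩb (fun z => B.eq_zero) k
  have hhL : ∀ z, -L ≤ h z := fun z => le_mol_of_le B.lBdd fun y _ => hL _
  have hlh : ∀ z ∈ K0 ∪ tsupport χ, ∀ b, 0 ≤ lapl h z b := fun z hz => (hkV z (hKV hz)).1
  set s : Cn n → ℝ := fun z => h z - L * θ z with hsdef
  have hss : ContDiff ℝ (⊤ : ℕ∞) s := hs.sub (contDiff_const.mul hθ)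
  have hsc : HasCompactSupport s := hhc.sub (hθc.mul_left)
  set f : Cn n → ℝ := fun z => min (s z + (C + L)) 0 with hf
  obtain ⟨K, B', hO⟩ := obst_min hss hsc (by positivity : 0 ≤ C + L)
  refine ⟨f, ⟨K, B', hO⟩, fun z hz => (min_le_left _ _).trans (by simp only [hsdef, hz]; linarith),
    ?_⟩
  have hlim : Tendsto (fun k : ℕ => (K + 2 * n * δ) * (1 / ((k : ℝ) + 1)) ^ 2) atTop (𝓝 0) := by
    simpa using (tendsto_one_div_add_atTop_nhds_zero_nat (𝕜 := ℝ)).pow 2 |>.const_mul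
      (K + 2 * n * δ)
  obtain ⟨k', hk1, hk2⟩ := ((hlim.eventually (gt_mem_nhds (show (0 : ℝ) < σ / 8 by positivity))).and
    (hO.volume_le hδ hσ hη)).exists
  refine hk2.trans (add_le_add_left ?_ η)
  set t := env f δ with ht
  set u := mol (penv f δ) k' with hu
  have hus : ContDiff ℝ (⊤ : ℕ∞) u := hO.contDiff_mol hδ.le k'
  have hle1 : ∀ z, t z + δ * sqn z ≤ u z := hO.le_mol hδ.le k'
  have hge1 : ∀ z, u z ≤ t z + δ * sqn z + σ / 8 := fun z =>
    (mol_le_of_second_diff (hO.nonneg_penv hδ.le) (hO.continuous_penv hδ.le)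
      (hO.semi_penv hδ.le) k' z).trans (by simp only [penv]; linarith)
  have htf : ∀ z, t z ≤ f z := env_le hδ.le hO.low
  set b : Cn n → ℝ := fun z => 1 / 2 * u z - (δ * R / 2 + σ / 8 + C) with hb
  have hbs : ContDiff ℝ (⊤ : ℕ∞) b := (contDiff_const.mul hus).sub contDiff_const
  have hκ : 0 < σ / 8 := by positivity
  have hbΩ : ∀ z ∈ Ω, b z ≤ -C := fun z hz => by
    have h1 := mul_le_mul_of_nonneg_left (hR z hz) hδ.le
    have h2 : t z ≤ 0 := (htf z).trans (min_le_right _ _)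
    simp only [hb]
    linarith [hge1 z]
  set v : Cn n → ℝ := fun z => h z + g z * softPos (σ / 8) (b z - h z) with hv
  have hvs : ContDiff ℝ (⊤ : ℕ∞) v :=
    hs.add (hg.mul ((contDiff_softPos _).comp (hbs.sub hs)))
  have hoff : ∀ z ∉ K0, v z = h z := fun z hz => by
    by_cases hzΩ : z ∈ Ω
    · simp only [hv]
      rw [softPos_of_nonpos hκ (by linarith [hbΩ z hzΩ, hk0 z hz])]; ring
    · simp only [hv]
      rw [image_eq_zero_of_notMem_tsupport fun h' => hzΩ (hgΩ h')]; ring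
  have hon : ∀ z ∈ K0, v =ᶠ[𝓝 z] regmax (σ / 8) h b := fun z hz => by
    filter_upwards [(eventually_nhdsSet_iff_forall.1 hgK) z hz] with x hx
    simp only [hv, hx, regmax, one_mul]
  have hlb : ∀ z w, 0 ≤ lapl b z w := fun z w => by
    rw [hb, lapl_sub_const (u := fun z => 1 / 2 * u z),
      lapl_const_mul hus]
    exact mul_nonneg (by norm_num) (hO.lapl_mol hδ.le k' z w)
  have hlv : ∀ z ∈ K0, ∀ w, 0 ≤ lapl v z w := fun z hz w => by
    rw [lapl_congr (hon z hz)]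
    exact lapl_regmax_nonneg hκ hs hbs (hlh z (Or.inl hz) w) (hlb z w)
  have hhv : ∀ z, h z ≤ v z := fun z =>
    le_add_of_nonneg_right (mul_nonneg (hg0 z) (softPos_nonneg' hκ _))
  have hvmax : ∀ z, v z ≤ max (h z) (-C0) := fun z => by
    by_cases hz : z ∈ K0
    · rw [(hon z hz).self_of_nhds, regmax]
      have h1 := hbΩ z (hK0Ω hz)
      rcases le_total (b z - h z) 0 with h2 | h2
      · rw [softPos_of_nonpos hκ h2, add_zero]; exact le_max_left _ _
      · refine le_max_of_le_right ?_
        linarith [softPos_le (κ := σ / 8) h2]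
    · rw [hoff z hz]; exact le_max_left _ _
  have hen := hkE v hvs hvmax hoff hlv
  set D : Cn n → ℝ := fun z => maDensity n v z - maDensity n h z with hD
  have hDc : Continuous D := (continuous_maDensity hvs).sub (continuous_maDensity hs)
  have hD0 : HasCompactSupport D := HasCompactSupport.intro hK0 fun z hz => by
    simp only [hD]; rw [maDensity_eq_off hK0.isClosed hoff hz, sub_self]
  have hTs : ContDiff ℝ (⊤ : ℕ∞) fun z : Cn n => R - sqn z := contDiff_const.sub contDiff_sqn
  have hi1 : Integrable fun z => χ z * D z :=
    (hχ.continuous.mul hDc).integrable_of_hasCompactSupport hD0.mul_left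
  have hi2 : Integrable fun z => (R - sqn z) * D z :=
    (hTs.continuous.mul hDc).integrable_of_hasCompactSupport hD0.mul_left
  have hmono := mono_lapl hs hvs (T := fun z => χ z + c * (R - sqn z))
    (hχ.add (contDiff_const.mul hTs)) hK0 hoff hhv
    (fun z hz => hlh z (Or.inl hz)) hlv (fun z _ w => by
      rw [lapl_add hχ (contDiff_const.mul hTs), lapl_const_mul hTs]
      have : lapl (fun z => R - sqn z) z w = - lapl sqn z w := by
        have e : (fun z : Cn n => R - sqn z) = fun z => (-1) * sqn z - (-R) := by
          ext; ring
        rw [e, lapl_sub_const (u := fun z => (-1) * sqn z),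
          lapl_const_mul contDiff_sqn]; ring
      rw [this]; linarith [hc z w])
  have hmono' : ∫ z, χ z * D z ≤ 5 * c * η := by
    have e1 : ∫ z, (χ z + c * (R - sqn z)) * (maDensity n v z - maDensity n h z) =
        (∫ z, χ z * D z) + c * ∫ z, (R - sqn z) * D z := by
      rw [← integral_const_mul, ← integral_add hi1 (hi2.const_mul c)]
      refine integral_congr_ae (.of_forall fun z => ?_)
      simp only [hD]; ring
    have e2 : ∫ z, (R - sqn z) * (maDensity n h z - maDensity n v z) =
        - ∫ z, (R - sqn z) * D z := by
      rw [← integral_neg]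
      refine integral_congr_ae (.of_forall fun z => ?_)
      simp only [hD]; ring
    rw [e1] at hmono
    rw [e2] at hen
    nlinarith
  have hiχ : ∀ w : Cn n → ℝ, ContDiff ℝ (⊤ : ℕ∞) w → Integrable fun z => χ z * maDensity n w z :=
    fun w hw => (hχ.continuous.mul (continuous_maDensity hw)).integrable_of_hasCompactSupport
      hχc.mul_right
  have hsum : ∫ z, χ z * maDensity n v z ≤ (∫ z, χ z * maDensity n h z) + 5 * c * η := by
    have : ∫ z, χ z * D z = (∫ z, χ z * maDensity n v z) - ∫ z, χ z * maDensity n h z := by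
      rw [← integral_sub (hiχ v hvs) (hiχ h hs)]
      refine integral_congr_ae (.of_forall fun z => ?_)
      simp only [hD]; ring
    linarith
  set S := {z | t z ≤ -σ} ∩ {z | t z = f z} with hS
  have hSc : IsClosed S := (isClosed_le (hO.continuous_env hδ.le) continuous_const).inter
    (isClosed_eq (hO.continuous_env hδ.le) hO.continuous)
  have hAΩ : A ⊆ Ω := fun z hz => hχΩ (subset_tsupport _ (by simp [hχA z hz]))
  have hcontact : ∀ z ∈ S, z ∈ A ∧ z ∈ K0 ∧ σ / 8 < b z - h z := by
    rintro z ⟨h1, h2⟩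
    have h1 : t z ≤ -σ := h1
    have h2 : t z = f z := h2
    have h3 : f z = h z - L * θ z + (C + L) := min_eq_left (not_lt.1 fun h4 => by
      have : f z = 0 := min_eq_right h4.le
      linarith)
    have h4 : z ∈ A := by
      by_contra h4
      rw [hθA z h4] at h3
      linarith [hhL z]
    have h5 : σ / 8 < b z - h z := by
      have := mul_le_mul_of_nonneg_left (hθ1 z) hL0
      have h6 := mul_nonneg hδ.le (sqn_nonneg z)
      simp only [hb]
      linarith [hle1 z]
    refine ⟨h4, ?_, h5⟩
    by_contra h6
    linarith [hk0 z h6, hbΩ z (hAΩ h4)]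
  have hma : ∀ z ∈ S, maDensity n u z = 2 ^ n * (χ z * maDensity n v z) := fun z hz => by
    obtain ⟨h1, h2, h3⟩ := hcontact z hz
    have : v =ᶠ[𝓝 z] fun x => 1 / 2 * u x +
        (softPos (σ / 8) (σ / 8) - σ / 8 - (δ * R / 2 + σ / 8 + C)) := by
      filter_upwards [hon z h2, (hbs.continuous.sub hs.continuous).continuousAt.eventually
        (lt_mem_nhds h3)] with x hx1 hx2
      have hx2 : σ / 8 < b x - h x := hx2
      rw [hx1, regmax, softPos_eq hκ hx2.le]
      simp only [hb]; ring
    rw [hχA z h1, maDensity_congr this, maDensity_affine hus, one_mul, ← mul_assoc, ← mul_pow]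
    norm_num
  have hpos : ∀ z, 0 ≤ χ z * maDensity n v z := fun z => by
    by_cases hz : z ∈ tsupport χ
    · refine mul_nonneg (hχ0 z) (maDensity_nonneg hvs fun w => ?_)
      by_cases hz' : z ∈ K0
      · exact hlv z hz' w
      · rw [lapl_eq_off hK0.isClosed hoff hz']; exact hlh z (Or.inr hz) w
    · rw [image_eq_zero_of_notMem_tsupport hz, zero_mul]
  calc ∫ z in S, maDensity n u z = ∫ z in S, 2 ^ n * (χ z * maDensity n v z) :=
        setIntegral_congr_fun hSc.measurableSet hma
    _ = 2 ^ n * ∫ z in S, χ z * maDensity n v z := integral_const_mul _ _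
    _ ≤ 2 ^ n * ∫ z, χ z * maDensity n v z := by
        refine mul_le_mul_of_nonneg_left ?_ (by positivity)
        exact setIntegral_le_integral (hiχ v hvs) (.of_forall hpos)
    _ ≤ _ := by gcongr

end Contact

section Shells
variable {n : ℕ} {U : Set (Cn n)}

/-- Cutoff functions adapted to a thin spherical shell in `U` whose inner side contains `V`:
`χ = 1` on `A`, `θ` is supported in `A` and `θ = 1` on the neighbourhood `I` of the sphere
bounding `G`. -/
structure Shell (U V : Set (Cn n)) where
  (χ θ : Cn n → ℝ)
  (A G I : Set (Cn n))
  χ_smooth : ContDiff ℝ (⊤ : ℕ∞) χ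
  χ_compact : HasCompactSupport χ
  χ_supp : tsupport χ ⊆ U
  χ_nonneg : ∀ z, 0 ≤ χ z
  χ_one : ∀ z ∈ A, χ z = 1
  θ_smooth : ContDiff ℝ (⊤ : ℕ∞) θ
  θ_compact : HasCompactSupport θ
  θ_le : ∀ z, θ z ≤ 1
  θ_zero : ∀ z ∉ A, θ z = 0
  θ_one : ∀ z ∈ I, θ z = 1
  I_open : IsOpen I
  I_sub : I ⊆ U
  G_open : IsOpen G
  sub_G : V ⊆ G
  G_sub : closure G ⊆ U
  G_compact : IsCompact (closure G)
  frontier_sub : frontier G ⊆ I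

theorem exists_shells (hU : IsOpen U) {z0 : Cn n} (hz : z0 ∈ U) :
    ∃ V, IsOpen V ∧ z0 ∈ V ∧ V ⊆ U ∧ ∀ m : ℕ, 0 < m → ∃ sh : Fin m → Shell U V,
      ∀ z, ∑ l, (sh l).χ z ≤ 1 := by
  obtain ⟨ρ, hρ, hb⟩ := Metric.isOpen_iff.1 hU z0 hz
  set q : Cn n → ℝ := fun z => sqn (z - z0) with hq
  have hqc : Continuous q := continuous_sqn.comp (continuous_id.sub continuous_const)
  set r : ℝ := ρ ^ 2 / 2 with hr
  have hr0 : 0 < r := by positivity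
  have hsub : {z | q z ≤ r} ⊆ U := fun z hz => hb (by
    have h1 := norm_sq_le_sqn (z - z0)
    have h2 : q z ≤ r := hz
    rw [Metric.mem_ball, dist_eq_norm]
    refine lt_of_pow_lt_pow_left₀ 2 hρ.le ?_
    simp only [hq] at h2
    nlinarith [sq_pos_of_pos hρ])
  have hcomp : IsCompact {z | q z ≤ r} := by
    refine (isCompact_closedBall z0 ρ).of_isClosed_subset (isClosed_le hqc continuous_const)
      fun z hz => ?_
    have h1 := norm_sq_le_sqn (z - z0)
    have h2 : q z ≤ r := hz
    rw [Metric.mem_closedBall, dist_eq_norm]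
    refine le_of_sq_le_sq ?_ hρ.le
    simp only [hq] at h2
    nlinarith [sq_pos_of_pos hρ]
  refine ⟨{z | q z < r / 2}, isOpen_lt hqc continuous_const, ?_, fun z hz => hsub ?_, fun m hm => ?_⟩
  · simp only [Set.mem_ofPred_eq, hq, sub_self]
    have : sqn (0 : Cn n) = 0 := by simp [sqn]
    rw [this]; positivity
  · have : q z < r / 2 := hz
    exact (by linarith : q z ≤ r)
  have hm' : (0 : ℝ) < m := by exact_mod_cast hm
  set τ : ℝ := r / (2 * m) with hτ
  have hτ0 : 0 < τ := by positivity
  have hmτ : m * τ = r / 2 := by rw [hτ]; field_simp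
  set c : Fin m → ℝ := fun l => r / 2 + ((l : ℕ) + 1 / 2) * τ with hc
  have hc1 : ∀ l, r / 2 < c l := fun l => lt_add_of_pos_right _ (by positivity)
  have hc2 : ∀ l, c l + τ / 2 ≤ r := fun l => by
    have : ((l : ℕ) : ℝ) + 1 ≤ m := by exact_mod_cast l.2
    have := mul_le_mul_of_nonneg_right this hτ0.le
    simp only [hc]; linarith
  have key : ∀ l : Fin m, ∃ sh : Shell U {z | q z < r / 2},
      tsupport sh.χ ⊆ {z | |q z - c l| < τ / 2} ∧ ∀ z, sh.χ z ≤ 1 := fun l => by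
    have hcl := hc2 l
    have hO : ∀ s : ℝ, IsOpen {z | |q z - c l| < s} := fun s =>
      isOpen_lt (hqc.sub continuous_const).abs continuous_const
    have hC : ∀ s ≤ τ / 2, IsCompact {z | |q z - c l| ≤ s} := fun s hs =>
      hcomp.of_isClosed_subset (isClosed_le (hqc.sub continuous_const).abs continuous_const)
        fun z hz => by
          have h : |q z - c l| ≤ s := hz
          have := (abs_le.1 h).2
          exact (by linarith : q z ≤ r)
    have hUU : {z | |q z - c l| < τ / 2} ⊆ U := fun z hz => hsub (by
      have h : |q z - c l| < τ / 2 := hz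
      have := (abs_lt.1 h).2
      exact (by linarith : q z ≤ r))
    obtain ⟨χ, h1, h2, h3, h4, h5, h6⟩ := exists_cutoff (hO (τ / 2)) (hC (τ / 4) (by linarith))
      (fun z hz => (lt_of_le_of_lt hz (by linarith) : |q z - c l| < τ / 2))
    obtain ⟨θ, k1, k2, k3, k4, k5, k6⟩ := exists_cutoff (hO (τ / 4)) (hC 0 (by positivity))
      (fun z hz => (lt_of_le_of_lt hz (by linarith) : |q z - c l| < τ / 4))
    have hcl' : closure {z | q z < c l} ⊆ {z | q z ≤ c l} :=
      closure_lt_subset_le hqc continuous_const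
    have hIt : interior {z | θ z = 1} ⊆ tsupport θ := fun z hz =>
      subset_tsupport _ (by
        have h : z ∈ {z | θ z = 1} := interior_subset hz
        have : θ z = 1 := h
        simp [this])
    refine ⟨{ χ := χ, θ := θ, A := {z | |q z - c l| < τ / 4}, G := {z | q z < c l}
              I := interior {z | θ z = 1}
              χ_smooth := h1, χ_compact := h2, χ_supp := h3.trans hUU, χ_nonneg := h4
              χ_one := fun z hz => (eventually_nhdsSet_iff_forall.1 h6 z
                (show |q z - c l| ≤ τ / 4 from le_of_lt hz)).self_of_nhds
              θ_smooth := k1, θ_compact := k2, θ_le := k5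
              θ_zero := fun z hz => image_eq_zero_of_notMem_tsupport fun h => hz (k3 h)
              θ_one := fun z hz => (show z ∈ {z | θ z = 1} from interior_subset hz)
              I_open := isOpen_interior
              I_sub := (hIt.trans k3).trans (subset_trans (fun z hz =>
                ((hz : |q z - c l| < τ / 4).trans (by linarith) : |q z - c l| < τ / 2)) hUU)
              G_open := isOpen_lt hqc continuous_const
              sub_G := fun z hz => ((hz : q z < r / 2).trans (hc1 l) : q z < c l)
              G_sub := hcl'.trans fun z hz =>
                hsub ((hz : q z ≤ c l).trans (by linarith) : q z ≤ r)
              G_compact := hcomp.of_isClosed_subset isClosed_closure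
                (hcl'.trans fun z hz => ((hz : q z ≤ c l).trans (by linarith) : q z ≤ r))
              frontier_sub := fun z hz => ?_ }, h3, h5⟩
    have hz : q z = c l := frontier_lt_subset_eq hqc continuous_const hz
    rw [mem_interior_iff_mem_nhds]
    exact eventually_nhdsSet_iff_forall.1 k6 z (by simp [hz])
  choose sh hsh1 hsh2 using key
  refine ⟨sh, fun z => ?_⟩
  by_cases h : ∃ l, (sh l).χ z ≠ 0
  · obtain ⟨l, hl⟩ := h
    rw [Finset.sum_eq_single l]
    · exact hsh2 l z
    · intro l' _ hne
      by_contra h'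
      have a1 : |q z - c l| < τ / 2 := hsh1 l (subset_tsupport _ hl)
      have a2 : |q z - c l'| < τ / 2 := hsh1 l' (subset_tsupport _ h')
      rw [abs_lt] at a1 a2
      simp only [hc] at a1 a2
      have b1 : ((l : ℕ) : ℝ) < (l' : ℕ) + 1 := by nlinarith
      have b2 : ((l' : ℕ) : ℝ) < (l : ℕ) + 1 := by nlinarith
      have b1' : (l : ℕ) < (l' : ℕ) + 1 := by exact_mod_cast b1
      have b2' : (l' : ℕ) < (l : ℕ) + 1 := by exact_mod_cast b2
      exact hne (Fin.ext (by omega))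
    · simp
  · push Not at h
    simp [h]
end Shells

section Uniform
variable {n : ℕ} {Ω : Set (Cn n)}

/-- If the set where the envelope is very negative has less volume than the unit ball, then the
envelope yields a plurisubharmonic function of small mass. -/
theorem Obst.exists_spsh {f : Cn n → ℝ} {K B δ σ ρ R : ℝ} (h : Obst f K B) (hδ : 0 < δ)
    (hσ : 0 < σ) (hR : ∀ z ∈ Metric.ball (0 : Cn n) (ρ + 2), sqn z ≤ R)
    (hδR : δ * R ≤ σ / 4)
    (hv : volume.real {z | env f δ z < -2 * σ} < volume.real (Metric.ball (0 : Cn n) 1)) :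
    ∃ T, Spsh T (Metric.ball 0 (ρ + 2)) ∧
      (∀ z ∈ Metric.ball (0 : Cn n) (ρ + 2), ENNReal.ofReal (-f z) ≤ T z) ∧
      ∫⁻ z in Metric.ball (0 : Cn n) ρ, T z ≤
        ENNReal.ofReal (3 * σ) * volume (Metric.ball (0 : Cn n) (ρ + 1)) := by
  have hle : ∀ z, env f δ z ≤ f z := env_le hδ.le h.low
  have hsp := (h.rSub_penv hδ.le).mono (Set.subset_univ (Metric.ball (0 : Cn n) (ρ + 2)))
  refine ⟨fun z => ENNReal.ofReal (δ * R - penv f δ z), hsp.spsh_sub (h.continuous_penv hδ.le)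
    fun z hz => ?_, fun z hz => ENNReal.ofReal_le_ofReal ?_, ?_⟩
  · have h1 := mul_le_mul_of_nonneg_left (hR z hz) hδ.le
    simp only [penv]
    linarith [hle z, h.up z]
  · have h1 := mul_le_mul_of_nonneg_left (hR z hz) hδ.le
    simp only [penv]
    linarith [hle z]
  obtain ⟨p, hp1, hp2⟩ : ∃ p ∈ Metric.ball (0 : Cn n) 1, -2 * σ ≤ env f δ p := by
    by_contra! hc
    refine absurd (measureReal_mono (μ := volume) (fun z hz => hc z hz) ?_) hv.not_ge
    refine ((h.isCompact_sublevel hδ (by positivity : 0 < 2 * σ)).measure_lt_top.trans_le'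
      (measure_mono fun z hz => ?_)).ne
    have hz' : env f δ z < -2 * σ := hz
    exact (by linarith : env f δ z ≤ -(2 * σ))
  have hp : ‖p‖ < 1 := by simpa using hp1
  have hsub1 : Metric.ball (0 : Cn n) ρ ⊆ Metric.ball p (ρ + 1) :=
    Metric.ball_subset_ball' (by rw [dist_comm, dist_zero_right]; linarith)
  have hsub2 : Metric.ball p (ρ + 1) ⊆ Metric.ball (0 : Cn n) (ρ + 2) :=
    Metric.ball_subset_ball' (by rw [dist_zero_right]; linarith)
  have hS := hsp.spsh_sub (h.continuous_penv hδ.le) (c := δ * R) fun z hz => by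
    have h1 := mul_le_mul_of_nonneg_left (hR z hz) hδ.le
    simp only [penv]
    linarith [hle z, h.up z]
  refine (lintegral_mono_set hsub1).trans ((hS.ball_mean hsub2).trans ?_)
  rw [Measure.addHaar_ball_center, mul_comm]
  gcongr
  have h1 : 0 ≤ δ * sqn p := mul_nonneg hδ.le (sqn_nonneg p)
  simp only [penv]
  linarith

theorem BPot.ae_mem {H : Cn n → ℝ} {μ : Measure (Cn n)} (B : BPot Ω H μ) : ∀ᵐ z ∂μ, z ∈ Ω := by
  rw [ae_iff]
  exact B.compl

theorem exists_potentials (hΩ : IsOpen Ω) (hΩb : Bornology.IsBounded Ω) {Hs : ℕ → Cn n → ℝ}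
    {μs : ℕ → Measure (Cn n)} (B : ∀ i, BPot Ω (Hs i) (μs i))
    (anti : ∀ i j, i ≤ j → ∀ z, Hs j z ≤ Hs i z) (hneg : ∀ z ∈ Ω, Hs 0 z < 0) {M : ℝ}
    (hM : ∀ i, (μs i).real Set.univ ≤ M) {U : Set (Cn n)} (hU : IsOpen U) (hUΩ : U ⊆ Ω)
    {z0 : Cn n} (hz0 : z0 ∈ U) :
    ∃ V, IsOpen V ∧ z0 ∈ V ∧ V ⊆ U ∧ ∀ ε : ℝ≥0∞, ε ≠ 0 → ∃ (sh : Shell U V) (C : ℝ)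
      (ι κ : ℕ → ℕ) (T : ℕ → Cn n → ℝ≥0∞), 0 ≤ C ∧ ∀ j, j ≤ ι j ∧ j ≤ κ j ∧ Spsh (T j) Ω ∧
        (∀ z ∈ sh.I, ENNReal.ofReal (-mol (Hs (ι j)) (κ j) z) ≤ T j z + ENNReal.ofReal C) ∧
        ∫⁻ z in Ω, T j z ≤ ε := by
  obtain ⟨V, hV, hzV, hVU, hsh⟩ := exists_shells hU hz0
  refine ⟨V, hV, hzV, hVU, fun ε hε => ?_⟩
  obtain ⟨ρ, hρ, hΩρ⟩ := hΩb.subset_ball_lt 0 0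
  set R : ℝ := n * (ρ + 2) ^ 2 + 1 with hRdef
  have hR0 : 0 < R := by positivity
  have hR : ∀ z ∈ Metric.ball (0 : Cn n) (ρ + 2), sqn z ≤ R := fun z hz => by
    have h1 : ‖z‖ < ρ + 2 := by simpa using hz
    have h2 : (n : ℝ) * ‖z‖ ^ 2 ≤ n * (ρ + 2) ^ 2 := by gcongr
    linarith [sqn_le_norm_sq z]
  have hRΩ : ∀ z ∈ Ω, sqn z ≤ R := fun z hz =>
    hR z (Metric.ball_subset_ball (by linarith) (hΩρ hz))
  obtain ⟨s, hs, hsε⟩ := ENNReal.exists_nnreal_pos_mul_lt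
    (measure_ball_lt_top (μ := volume) (x := (0 : Cn n)) (r := ρ + 1)).ne hε
  set σ : ℝ := s / 3 with hσdef
  have hσ : 0 < σ := by positivity
  set δ : ℝ := σ / (4 * R) with hδdef
  have hδ : 0 < δ := by positivity
  have hδR : δ * R ≤ σ / 4 := le_of_eq (by rw [hδdef]; field_simp)
  have hM0 : 0 ≤ M := measureReal_nonneg.trans (hM 0)
  set P : ℝ := 4 ^ n * n.factorial * δ ^ n * volume.real (Metric.ball (0 : Cn n) 1) with hPdef
  have hvb : 0 < volume.real (Metric.ball (0 : Cn n) 1) :=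
    ENNReal.toReal_pos (Metric.measure_ball_pos _ _ one_pos).ne' measure_ball_lt_top.ne
  have hP : 0 < P := by positivity
  obtain ⟨m, hm⟩ := exists_nat_gt (2 ^ n * (M + 1) / (P / 2))
  have hm0 : 0 < m := by
    have : (0 : ℝ) < m := lt_of_le_of_lt (by positivity) hm
    exact_mod_cast this
  have hm0' : (0 : ℝ) < m := by exact_mod_cast hm0
  have hmP : 2 ^ n * ((M + 1) / m) < P / 2 := by
    rw [div_lt_iff₀ (by positivity)] at hm
    rw [← mul_div_assoc, div_lt_iff₀ hm0']
    linarith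
  obtain ⟨sh, hsum⟩ := hsh m hm0
  choose c hc0 hc using fun l => exists_lapl_le (sh l).χ_smooth (sh l).χ_compact
  set cs : ℝ := ∑ l, c l with hcs
  have hcs0 : 0 ≤ cs := Finset.sum_nonneg fun l _ => hc0 l
  have hccs : ∀ l, c l ≤ cs := fun l => Finset.single_le_sum (fun l _ => hc0 l) (Finset.mem_univ l)
  set η : ℝ := P / (4 * (2 ^ n * (5 * cs) + 1)) with hηdef
  have hη : 0 < η := by positivity
  have hηP : 2 ^ n * (5 * cs * η) + η < P / 2 := by
    have : (2 ^ n * (5 * cs) + 1) * η = P / 4 := by rw [hηdef]; field_simp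
    linarith
  -- Almost maximal energy.
  have hE : BddAbove (Set.range fun j => ∫ z, (R - sqn z) ∂(μs j)) := by
    refine ⟨R * M, ?_⟩
    rintro _ ⟨j, rfl⟩
    have := (B j).fin
    calc ∫ z, (R - sqn z) ∂(μs j) ≤ ∫ _, R ∂(μs j) := by
          refine integral_mono_ae ?_ (integrable_const R) (.of_forall fun z => ?_)
          · refine Integrable.of_bound (C := R)
              (continuous_const.sub continuous_sqn).aestronglyMeasurable ?_
            filter_upwards [(B j).ae_mem] with z hz
            rw [Real.norm_eq_abs, abs_le]
            constructor <;> linarith [hRΩ z hz, sqn_nonneg z]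
          · simp only
            linarith [sqn_nonneg z]
      _ = R * (μs j).real Set.univ := by rw [integral_const, smul_eq_mul, mul_comm]
      _ ≤ R * M := by gcongr; exact hM j
  obtain ⟨j0, hj0⟩ := exists_lt_of_lt_ciSup
    (show (⨆ j, ∫ z, (R - sqn z) ∂(μs j)) - η < ⨆ j, ∫ z, (R - sqn z) ∂(μs j) by linarith)
  obtain ⟨C0, hC0⟩ := (B j0).bdd
  set C : ℝ := max C0 1 with hC
  have hCp : 0 < C := lt_max_of_lt_right one_pos
  have key : ∀ i ≥ j0, ∃ l, ∃ k ≥ i, ∃ T, Spsh T Ω ∧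
      (∀ z ∈ (sh l).I, ENNReal.ofReal (-mol (Hs i) k z) ≤ T z + ENNReal.ofReal C) ∧
      ∫⁻ z in Ω, T z ≤ ε := fun i hi => by
    have := (B i).fin
    have hIn : ∀ l, Integrable (sh l).χ (μs i) := fun l =>
      (sh l).χ_smooth.continuous.integrable_of_hasCompactSupport (sh l).χ_compact
    obtain ⟨l, -, hl⟩ : ∃ l ∈ (Finset.univ : Finset (Fin m)), ∫ z, (sh l).χ z ∂(μs i) ≤ M / m := by
      refine Finset.exists_le_of_sum_le ⟨⟨0, hm0⟩, Finset.mem_univ _⟩ ?_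
      rw [← integral_finsetSum _ fun l _ => hIn l]
      simp only [Finset.sum_const, Finset.card_univ, Fintype.card_fin, nsmul_eq_mul]
      rw [mul_div_cancel₀ _ hm0'.ne']
      refine le_trans ?_ (hM i)
      calc ∫ z, ∑ l, (sh l).χ z ∂(μs i) ≤ ∫ _, 1 ∂(μs i) :=
            integral_mono (integrable_finsetSum _ fun l _ => hIn l) (integrable_const _) hsum
        _ = (μs i).real Set.univ := by simp
    have hEi : ∫ z, (R - sqn z) ∂(μs i) ≤ ∫ z, (R - sqn z) ∂(μs j0) + η := by
      linarith [le_ciSup hE i]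
    have hw := (B i).weak _ (sh l).χ_smooth.continuous (sh l).χ_compact ((sh l).χ_supp.trans hUΩ)
    have hlt : ∫ z, (sh l).χ z ∂(μs i) < (M + 1) / m :=
      hl.trans_lt (by gcongr; linarith)
    obtain ⟨k, ⟨hk1, f, ⟨K, B', hf⟩, hf1, hf2⟩, hk2⟩ := (((hw.eventually (gt_mem_nhds hlt)).and
      ((B j0).exists_obst hΩ hΩb (B i) (anti j0 i hi)
        (fun z hz => (anti 0 j0 (Nat.zero_le _) z).trans_lt (hneg z hz)) hRΩ hη hC0 hEi
        (le_max_left C0 1) hCp (sh l).χ_smooth (sh l).χ_compact ((sh l).χ_supp.trans hUΩ)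
        (sh l).χ_nonneg (sh l).χ_one (sh l).θ_smooth (sh l).θ_compact (sh l).θ_le (sh l).θ_zero
        (hc0 l) (hc l) hσ hδ hδR)).and (eventually_ge_atTop i)).exists
    have hv : volume.real {z | env f δ z < -2 * σ} < volume.real (Metric.ball (0 : Cn n) 1) := by
      have h2 : (2 : ℝ) ^ n * ((∫ z, (sh l).χ z * maDensity n (mol (Hs i) k) z) + 5 * c l * η) ≤
          2 ^ n * ((M + 1) / m + 5 * cs * η) := by
        gcongr
        exact hccs l
      refine lt_of_mul_lt_mul_left (lt_of_le_of_lt hf2 ?_)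
        (by positivity : (0 : ℝ) ≤ 4 ^ n * n.factorial * δ ^ n)
      linarith
    obtain ⟨T, hT1, hT2, hT3⟩ := hf.exists_spsh hδ hσ hR hδR hv
    have hΩ2 : Ω ⊆ Metric.ball 0 (ρ + 2) := hΩρ.trans (Metric.ball_subset_ball (by linarith))
    refine ⟨l, k, hk2, T, hT1.mono hΩ2, fun z hz => ?_, (lintegral_mono_set hΩρ).trans
      (hT3.trans ?_)⟩
    · refine le_trans ?_ (add_le_add_left (hT2 z (hΩ2 (hUΩ ((sh l).I_sub hz)))) _)
      refine le_trans (ENNReal.ofReal_le_ofReal ?_) ENNReal.ofReal_add_le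
      linarith [hf1 z ((sh l).θ_one z hz)]
    · rw [show 3 * σ = (s : ℝ) by rw [hσdef]; ring, ENNReal.ofReal_coe_nnreal]
      exact hsε.le
  obtain ⟨l, hl⟩ : ∃ l, ∃ᶠ i in atTop, ∃ k ≥ i, ∃ T, Spsh T Ω ∧
      (∀ z ∈ (sh l).I, ENNReal.ofReal (-mol (Hs i) k z) ≤ T z + ENNReal.ofReal C) ∧
      ∫⁻ z in Ω, T z ≤ ε := by
    by_contra! hcon
    have := Filter.eventually_all.2 hcon
    obtain ⟨i, hi, hij⟩ := (this.and (eventually_ge_atTop j0)).exists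
    obtain ⟨l, k, hk, T, h1, h2, h3⟩ := key i hij
    exact (hi l k hk T h1 h2).not_ge h3
  have hl' : ∀ j, ∃ i k T, j ≤ i ∧ j ≤ k ∧ Spsh T Ω ∧
      (∀ z ∈ (sh l).I, ENNReal.ofReal (-mol (Hs i) k z) ≤ T z + ENNReal.ofReal C) ∧
      ∫⁻ z in Ω, T z ≤ ε := fun j => by
    obtain ⟨i, hij, k, hk, T, h⟩ := frequently_atTop.1 hl j
    exact ⟨i, k, T, hij, hij.trans hk, h⟩
  choose ι κ T h using hl'
  exact ⟨sh l, C, ι, κ, T, hCp.le, h⟩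

end Uniform

section Limit
variable {n : ℕ} {Ω : Set (Cn n)}

/-- A sequence of plurisubharmonic functions of bounded mass has a regularized lower limit. -/
theorem exists_liminf_spsh (hΩ : IsOpen Ω) {T : ℕ → Cn n → ℝ≥0∞} (hT : ∀ j, Spsh (T j) Ω)
    {ε : ℝ≥0∞} (hε : ∀ j, ∫⁻ z in Ω, T j z ≤ ε) :
    ∃ S, Spsh S Ω ∧ ∫⁻ z in Ω, S z ≤ ε ∧ ∀ (a : Cn n → ℝ≥0∞), ∀ z ∈ Ω,
      LowerSemicontinuousAt a z → ∀ N, ∀ W ∈ 𝓝 z, (∀ i ≥ N, ∀ x ∈ W, a x ≤ T i x) → a z ≤ S z := by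
  set Q : ℕ → Cn n → ℝ≥0∞ := fun k => lreg (fun z => ⨅ i, T (k + i) z) Ω with hQ
  have hQs : ∀ k, Spsh (Q k) Ω := fun k => spsh_lreg hΩ fun i => hT (k + i)
  have hQm : ∀ k z, Q k z ≤ Q (k + 1) z := fun k z => lreg_mono (fun x _ => le_iInf fun i =>
    (iInf_le _ (i + 1)).trans_eq (by rw [← add_assoc, add_right_comm])) z
  refine ⟨fun z => ⨆ k, Q k z, Spsh.iSup hQs fun k z _ => hQm k z, ?_, fun a z hz ha N W hW h => ?_⟩
  · rw [lintegral_iSup' (fun k => (hQs k).aemeasurable hΩ)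
      (ae_of_all _ fun z => monotone_nat_of_le_succ fun k => hQm k z)]
    refine iSup_le fun k => le_trans ?_ (hε k)
    refine setLIntegral_mono_ae' hΩ.measurableSet (ae_of_all _ fun z hz => ?_)
    exact (lreg_le hz).trans (iInf_le _ 0)
  · refine le_trans ?_ (le_iSup _ N)
    refine le_of_forall_lt fun c hc => ?_
    obtain ⟨c', hc', hca⟩ := exists_between hc
    refine hc'.trans_le (le_liminf_of_le (by isBoundedDefault) ?_)
    rw [hΩ.nhdsWithin_eq hz]
    filter_upwards [lowerSemicontinuousAt_iff.1 ha c' hca, hW] with x hx hxW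
    exact hx.le.trans (le_iInf fun i => h _ (Nat.le_add_right N i) x hxW)

theorem exists_spsh_of_potentials (hΩ : IsOpen Ω) (hΩb : Bornology.IsBounded Ω)
    {Hs : ℕ → Cn n → ℝ} {μs : ℕ → Measure (Cn n)} (B : ∀ i, BPot Ω (Hs i) (μs i))
    (anti : ∀ i j, i ≤ j → ∀ z, Hs j z ≤ Hs i z) (hneg : ∀ z ∈ Ω, Hs 0 z < 0) {M : ℝ}
    (hM : ∀ i, (μs i).real Set.univ ≤ M) {U : Set (Cn n)} (hU : IsOpen U) (hUΩ : U ⊆ Ω)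
    {z0 : Cn n} (hz0 : z0 ∈ U) :
    ∃ V, IsOpen V ∧ z0 ∈ V ∧ V ⊆ U ∧ ∀ ε : ℝ≥0∞, ε ≠ 0 → ∃ (sh : Shell U V) (C : ℝ)
      (S : Cn n → ℝ≥0∞), 0 ≤ C ∧ Spsh S Ω ∧ ∫⁻ z in Ω, S z ≤ ε ∧
        ∀ z ∈ sh.I, ∀ j, ENNReal.ofReal (-Hs j z) ≤ S z + ENNReal.ofReal C := by
  obtain ⟨V, hV, hzV, hVU, h⟩ := exists_potentials hΩ hΩb B anti hneg hM hU hUΩ hz0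
  refine ⟨V, hV, hzV, hVU, fun ε hε => ?_⟩
  obtain ⟨sh, C, ι, κ, T, hC, hT⟩ := h ε hε
  obtain ⟨S, hS, hSε, hlow⟩ := exists_liminf_spsh hΩ (fun j => (hT j).2.2.1) fun j => (hT j).2.2.2.2
  refine ⟨sh, C, S, hC, hS, hSε, fun z hz j => ?_⟩
  have hzΩ : z ∈ Ω := hUΩ (sh.I_sub hz)
  rw [← tsub_le_iff_right, ← ENNReal.ofReal_sub _ hC]
  obtain ⟨W, hW, hzW, hWΩ, hsc⟩ := exists_nhds_scale hΩ (isCompact_singleton (x := z))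
    (Set.singleton_subset_iff.2 hzΩ)
  have hlim : Tendsto (fun k : ℕ => mol (Hs j) k z) atTop (𝓝 (Hs j z)) :=
    tendsto_mol_of_usc (B j).rSub hΩ (B j).lBdd hzΩ ((B j).usc z hzΩ) tendsto_mol_scale
  refine le_of_tendsto ((ENNReal.continuous_ofReal.tendsto _).comp (hlim.neg.sub_const C)) ?_
  filter_upwards [hsc] with k hk
  have hcont : Continuous fun x => ENNReal.ofReal (-mol (Hs j) k x - C) :=
    ENNReal.continuous_ofReal.comp
      ((contDiff_mol (B j).lBdd k).continuous.neg.sub continuous_const)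
  refine hlow (fun x => ENNReal.ofReal (-mol (Hs j) k x - C)) z hzΩ
    (hcont.lowerSemicontinuous z) (max j k) (W ∩ sh.I)
    (inter_mem (hW.mem_nhds (Set.singleton_subset_iff.1 hzW)) (sh.I_open.mem_nhds hz))
    fun i hi x hx => ?_
  obtain ⟨h1, h2, -, h3, -⟩ := hT i
  rw [ENNReal.ofReal_sub _ hC, tsub_le_iff_right]
  refine le_trans (ENNReal.ofReal_le_ofReal (neg_le_neg ?_)) (h3 x hx.2)
  calc mol (Hs (ι i)) (κ i) x ≤ mol (Hs j) (κ i) x :=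
        mol_mono (B _).lBdd (B _).lBdd fun y _ => anti _ _ (((le_max_left _ _).trans hi).trans h1) _
    _ ≤ mol (Hs j) k x := (B j).mono _ _ (mol_scale_pos _).le (mol_scale_pos k)
        (one_div_le_one_div_of_le (by positivity) (by
          have : k ≤ κ i := ((le_max_right _ _).trans hi).trans h2
          have : (k : ℝ) ≤ κ i := by exact_mod_cast this
          linarith)) x fun y hy => (hk x hx.1 y hy).1

end Limit

section Conclusion
variable {n : ℕ} {Ω : Set (Cn n)}

/-- The strong maximum principle. -/
theorem Spsh.ne_zero (hΩ : IsOpen Ω) (hc : IsPreconnected Ω) {U : Cn n → ℝ≥0∞} (hU : Spsh U Ω)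
    {x : Cn n} (hx : x ∈ Ω) (hUx : U x ≠ 0) {z : Cn n} (hz : z ∈ Ω) : U z ≠ 0 := by
  have hA : IsOpen {z | z ∈ Ω ∧ U z ≠ 0} := isOpen_iff_mem_nhds.2 fun z ⟨hz, hUz⟩ => by
    filter_upwards [hΩ.mem_nhds hz,
      lowerSemicontinuousAt_iff.1 (hU.1 z hz) 0 (pos_iff_ne_zero.2 hUz)] with y hy hUy
    exact ⟨hy, hUy.ne'⟩
  have hB : IsOpen {z | z ∈ Ω ∧ U z = 0} := isOpen_iff_mem_nhds.2 fun z ⟨hz, hUz⟩ => by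
    obtain ⟨r, hr, hb⟩ := Metric.isOpen_iff.1 hΩ z hz
    have h1 : ∫⁻ y in Metric.ball z r, U y = 0 := by
      have := hU.ball_mean hb
      rw [hUz, mul_zero] at this
      exact le_antisymm this zero_le
    have hUb := hU.mono hb
    rw [lintegral_eq_zero_iff' (hUb.aemeasurable Metric.isOpen_ball)] at h1
    have h2 := Spsh.le_of_ae (U := 0) Metric.isOpen_ball
      ⟨fun z _ => continuous_const.lowerSemicontinuous z, fun a b _ => by simp⟩ hUb.1
      (h1.mono fun y hy => hy.le)
    filter_upwards [Metric.ball_mem_nhds z hr] with y hy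
    exact ⟨hb hy, le_antisymm (h2 y hy) zero_le⟩
  have h := hc.subset_left_of_subset_union hA hB
    (Set.disjoint_left.2 fun y hy hy' => hy.2 hy'.2)
    (fun y hy => (em (U y = 0)).elim (fun h => Or.inr ⟨hy, h⟩) fun h => Or.inl ⟨hy, h⟩)
    ⟨x, hx, hx, hUx⟩
  exact (h hz).2

theorem neg_le_iff_NegE_le {u : Cn n → EReal} {z : Cn n} (hu : u z ≤ 0) {X : ℝ≥0∞} :
    -(X : EReal) ≤ u z ↔ NegE u z ≤ X := by
  rw [← neg_neg_eq hu, EReal.neg_le_neg_iff, EReal.coe_ennreal_le_coe_ennreal_iff]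

theorem exists_local_small (hΩ : IsOpen Ω) (hc : IsPreconnected Ω) (hΩb : Bornology.IsBounded Ω)
    {H φ : Cn n → EReal} (hH : MaximalOn H Ω) (hH0 : ∀ z ∈ Ω, H z ≤ 0)
    (hφH : ∀ z ∈ Ω, φ z ≤ H z) (hφ : ClassE n Ω φ) {z0 : Cn n} (hz0 : z0 ∈ Ω) :
    ∃ V, IsOpen V ∧ z0 ∈ V ∧ ∀ ε : ℝ≥0∞, ε ≠ 0 → ∃ T, Spsh T Ω ∧
      (∃ C : ℝ≥0∞, C ≠ ⊤ ∧ ∀ z ∈ V, NegE H z ≤ T z + C) ∧ ∫⁻ z in Ω, T z ≤ ε := by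
  obtain ⟨U, hU, hzU, hUΩ, h, M, hM, hE0, hdec, hlim, hmass⟩ := hφ.2 z0 hz0
  have h0 : ∀ j, ∀ z ∈ Ω, h j z ≤ 0 := fun j => (hE0 j).1.2
  have hsp : ∀ j, Spsh (NegE (h j)) Ω := fun j => (hE0 j).1.spsh hΩ
  have hanti : ∀ i j, i ≤ j → ∀ z ∈ Ω, h j z ≤ h i z := fun i j hij z hz => by
    induction hij with
    | refl => exact le_rfl
    | step _ ih => exact (hdec _ z hz).trans ih
  by_cases hpos : ∃ j, ∃ x ∈ Ω, NegE (h j) x ≠ 0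
  swap
  · push Not at hpos
    refine ⟨U, hU, hzU, fun ε _ => ⟨0, ⟨fun z _ => continuous_const.lowerSemicontinuous z,
      fun a b _ => by simp⟩, ⟨0, by simp, fun z hz => ?_⟩, by simp⟩⟩
    have hz' := hUΩ hz
    have : φ z = 0 := by
      rw [← hlim z hz]
      simp [fun j => ((neg_neg_eq (h0 j z hz')).symm.trans (by rw [hpos j z hz']; simp) : h j z = 0)]
    simpa [NegE, this] using NegE_anti (hφH z hz')
  obtain ⟨j0, x, hx, hjx⟩ := hpos
  have hbdd : ∀ j, ∃ C : ℝ≥0∞, C ≠ ⊤ ∧ ∀ z ∈ Ω, NegE (h j) z ≤ C := fun j => by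
    obtain ⟨C, hC⟩ := (hE0 j).2.1
    refine ⟨ENNReal.ofReal C, ENNReal.ofReal_ne_top, fun z hz => ?_⟩
    exact (EReal.toENNReal_le_toENNReal (EReal.neg_le_of_neg_le (hC z hz))).trans (by simp)
  choose Cb hCb hb using hbdd
  choose μ hμ hμf using fun j => (hE0 j).2.2.2
  set Hs : ℕ → Cn n → ℝ := fun i => realOf (NegE (h (j0 + i))) Ω with hHs
  have B : ∀ i, BPot Ω (Hs i) (μ (j0 + i)) := fun i =>
    classE0_bPot hΩ hΩb (hE0 _) (hμ _) (hμf _)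
  have hmono : ∀ i j, i ≤ j → ∀ z, Hs j z ≤ Hs i z := fun i j hij z => by
    simp only [hHs, realOf, neg_le_neg_iff]
    by_cases hz : z ∈ Ω
    · simp only [Set.indicator_of_mem hz]
      exact ENNReal.toReal_mono ((hb _ z hz).trans_lt (hCb _).lt_top).ne
        (NegE_anti (hanti _ _ (Nat.add_le_add_left hij j0) z hz))
    · simp [hz]
  have hneg : ∀ z ∈ Ω, Hs 0 z < 0 := fun z hz => by
    simp only [hHs, realOf, Set.indicator_of_mem hz, neg_lt_zero]
    exact ENNReal.toReal_pos ((hsp j0).ne_zero hΩ hc hx hjx hz)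
      ((hb _ z hz).trans_lt (hCb _).lt_top).ne
  have hmassM : ∀ i, (μ (j0 + i)).real Set.univ ≤ M.toReal := fun i => by
    refine ENNReal.toReal_mono hM ?_
    rw [← Set.union_compl_self Ω]
    refine (measure_union_le _ _).trans ?_
    rw [(hμ _).1, add_zero]
    exact hmass _ _ (hμ _)
  obtain ⟨V, hV, hzV, hVU, hS⟩ := exists_spsh_of_potentials hΩ hΩb B hmono hneg hmassM hU hUΩ hzU
  refine ⟨V, hV, hzV, fun ε hε => ?_⟩
  obtain ⟨sh, C, S, hC, hSs, hSε, hlow⟩ := hS ε hε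
  refine ⟨S, hSs, ⟨ENNReal.ofReal C, ENNReal.ofReal_ne_top, fun z hz => ?_⟩, hSε⟩
  have hfr : ∀ z ∈ frontier sh.G, -(S z : EReal) ≤ H z + (C : EReal) := fun z hz => by
    have hzI := sh.frontier_sub hz
    have hzU := sh.I_sub hzI
    have hzΩ := hUΩ hzU
    rw [← neg_neg_eq (hH0 z hzΩ), negCoe_le_add_iff _ _ hC]
    refine (NegE_anti (hφH z hzΩ)).trans ?_
    rw [← neg_le_iff_NegE_le (hφ.1.2 z hzΩ), ← hlim z hzU]
    refine le_iInf fun j => ?_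
    rw [neg_le_iff_NegE_le (h0 j z hzΩ)]
    refine (NegE_anti (hanti j (j0 + j) (Nat.le_add_left _ _) z hzΩ)).trans ?_
    rw [← ofReal_neg_realOf (hCb _) (hb (j0 + j)) hzΩ]
    exact hlow z hzI j
  have hzG := sh.sub_G hz
  have hzΩ := hUΩ (sh.G_sub (subset_closure hzG))
  have hfin := MaximalOn.le_add hH sh.G_open sh.G_compact (sh.G_sub.trans hUΩ) hΩ
    (sh.G_sub.trans hUΩ) (hSs.pshNeg hΩ).1 hfr z hzG
  rwa [← neg_neg_eq (hH0 z hzΩ), negCoe_le_add_iff _ _ hC] at hfin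

end Conclusion

/-- Corollary 6.11: for `φ ∈ N(D, fb φ)` with finite total residual Monge–Ampère mass
and idempotent `g_φ`, the Green–Poisson residual function is the rooftop envelope of the
residual Green and Poisson functions: `g_φ = P(g_φ^o, g_φ^b)`. -/
theorem statement14 {n : ℕ} (Ω : Set (Cn n)) (hΩconn : IsConnected Ω) (hΩopen : IsOpen Ω)
    (hΩbd : Bornology.IsBounded Ω) (hΩbr : BRegular Ω)
    (φ H : Cn n → EReal) (hH : IsLeastMaxMajorant φ H Ω)
    (hφ : InClassRel n Ω (ClassN n Ω) H φ)
    (hresid : ∀ μ : Measure (Cn n), IsMAMeasure n φ Ω μ → μ {z | z ∈ Ω ∧ φ z = ⊥} ≠ ⊤)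
    (hidem : Set.EqOn (gp (gp φ Ω) Ω) (gp φ Ω) Ω) :
    Set.EqOn (gp φ Ω) (Rooftop (gpO φ Ω) (gpB φ Ω) Ω) Ω :=
  gp_eq_rooftop_of_small hΩopen (two_le_of_maximalOn hΩopen hΩconn.nonempty hH.1 hH.2.1) hΩbd hH hφ
    hidem fun _ hε => small_of_local hΩopen hΩconn.nonempty
      (fun _ hz0 => exists_local_small hΩopen hΩconn.isPreconnected hΩbd hH.1 hH.2.1 hH.2.2.1 hφ.1
        hz0) hε
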